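/- For every positive integer q, the integral group homology of PSL_2(O_{-6}) with trivial ℤ-coefficients is given, as an abelian group, by: H_1 ≅ ℤ² ⊕ ℤ/3 ⊕ ℤ/2; H_2 ≅ ℤ ⊕ ℤ/4 ⊕ ℤ/3 ⊕ (ℤ/2)²; and for each integer k ≥ 0: H_{6k+3} ≅ ℤ/3 ⊕ (ℤ/2)^{2k+2}, H_{6k+4} ≅ ℤ/3 ⊕ (ℤ/2)^{2k+1}, H_{6k+5} ≅ ℤ/3 ⊕ (ℤ/2)^{2k+4}, H_{6k+6} ≅ ℤ/3 ⊕ (ℤ/2)^{2k+3}, H_{6k+7} ≅ ℤ/3 ⊕ (ℤ/2)^{2k+2}, and H_{6k+8} ≅ ℤ/3 ⊕ (ℤ/2)^{2k+5}. -/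

import Mathlib

/-!
Group homology via the inhomogeneous bar complex (trivial coefficients).
-/

namespace BarHomology

/-- The `n`-th term of the inhomogeneous bar complex of `G` with trivial coefficients in `A`. -/
abbrev chains (G : Type) (A : Type) [AddCommGroup A] (n : ℕ) : Type := (Fin n → G) →₀ A

/-- The differential of the inhomogeneous bar complex with trivial coefficients:
`d (g₁, …, g_{n+1}) = (g₂, …, g_{n+1}) + ∑_{j=1}^{n} (-1)^j (g₁, …, g_j g_{j+1}, …, g_{n+1})
  + (-1)^{n+1} (g₁, …, g_n)`. -/
noncomputable def d (k : Type) [CommRing k] (G : Type) [Group G] (A : Type) [AddCommGroup A]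
    [Module k A] (n : ℕ) : chains G A (n + 1) →ₗ[k] chains G A n :=
  Finsupp.lsum k fun g =>
    (Finsupp.lsingle (fun i => g i.succ) : A →ₗ[k] chains G A n)
      + ∑ j : Fin (n + 1),
          ((-1 : k) ^ ((j : ℕ) + 1)) • (Finsupp.lsingle (Fin.contractNth j (· * ·) g))

/-- The cycles: everything in degree `0`, the kernel of the differential in positive degrees. -/
noncomputable def cycles (k : Type) [CommRing k] (G : Type) [Group G] (A : Type) [AddCommGroup A]
    [Module k A] : (n : ℕ) → Submodule k (chains G A n)
  | 0 => ⊤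
  | (n + 1) => LinearMap.ker (d k G A n)

/-- The boundaries, viewed as a submodule of the cycles. -/
noncomputable def boundariesIn (k : Type) [CommRing k] (G : Type) [Group G] (A : Type)
    [AddCommGroup A] [Module k A] (n : ℕ) : Submodule k (cycles k G A n) :=
  (LinearMap.range (d k G A n)).comap (cycles k G A n).subtype

/-- Group homology of `G` in degree `n` with trivial coefficients in the `k`-module `A`,
defined as cycles modulo boundaries in the inhomogeneous bar complex. -/
abbrev GroupHomology (k : Type) [CommRing k] (G : Type) [Group G] (A : Type) [AddCommGroup A]
    [Module k A] (n : ℕ) : Type :=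
  ↥(cycles k G A n) ⧸ boundariesIn k G A n

section Maps

variable {k : Type} [CommRing k] {G G' : Type} [Group G] [Group G'] {A : Type} [AddCommGroup A]
  [Module k A]

/-- The chain map induced by a group homomorphism. -/
noncomputable def chainsMap (k : Type) [CommRing k] (A : Type) [AddCommGroup A] [Module k A]
    (φ : G →* G') (n : ℕ) : chains G A n →ₗ[k] chains G' A n :=
  Finsupp.lmapDomain A k (fun f => φ ∘ f)

lemma comp_contractNth (φ : G →* G') {n : ℕ} (j : Fin (n + 1)) (g : Fin (n + 1) → G) :
    φ ∘ Fin.contractNth j (· * ·) g = Fin.contractNth j (· * ·) (φ ∘ g) := by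
  funext i
  rcases lt_trichotomy (i : ℕ) (j : ℕ) with h | h | h
  · simp [Function.comp_apply, Fin.contractNth_apply_of_lt _ _ _ _ h]
  · simp [Function.comp_apply, Fin.contractNth_apply_of_eq _ _ _ _ h, map_mul]
  · simp [Function.comp_apply, Fin.contractNth_apply_of_gt _ _ _ _ h]

lemma chainsMap_comm (φ : G →* G') (n : ℕ) :
    (d k G' A n).comp (chainsMap k A φ (n + 1))
      = (chainsMap k A φ n).comp (d k G A n) := by
  apply Finsupp.lhom_ext
  intro g a
  simp only [LinearMap.comp_apply, chainsMap, Finsupp.lmapDomain_apply, Finsupp.mapDomain_single,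
    d, Finsupp.lsum_single, LinearMap.add_apply, LinearMap.sum_apply, LinearMap.smul_apply,
    Finsupp.lsingle_apply, map_add, map_sum, map_smul]
  congr 1
  refine Finset.sum_congr rfl fun j _ => ?_
  rw [comp_contractNth]

lemma chainsMap_mem_cycles (φ : G →* G') {n : ℕ} {x : chains G A n}
    (hx : x ∈ cycles k G A n) : chainsMap k A φ n x ∈ cycles k G' A n := by
  cases n with
  | zero => trivial
  | succ n =>
    simp only [cycles, LinearMap.mem_ker] at hx ⊢
    have := LinearMap.congr_fun (chainsMap_comm (k := k) (A := A) φ n) x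
    simp only [LinearMap.comp_apply] at this
    rw [this, hx, map_zero]

/-- The map induced by a group homomorphism on cycles. -/
noncomputable def cyclesMap (k : Type) [CommRing k] (A : Type) [AddCommGroup A] [Module k A]
    (φ : G →* G') (n : ℕ) : ↥(cycles k G A n) →ₗ[k] ↥(cycles k G' A n) :=
  (chainsMap k A φ n).restrict fun _ hx => chainsMap_mem_cycles φ hx

/-- The map induced by a group homomorphism on group homology with trivial coefficients. -/
noncomputable def inducedMap (k : Type) [CommRing k] (A : Type) [AddCommGroup A] [Module k A]
    (φ : G →* G') (n : ℕ) :
    GroupHomology k G A n →ₗ[k] GroupHomology k G' A n :=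
  Submodule.mapQ (boundariesIn k G A n) (boundariesIn k G' A n) (cyclesMap k A φ n) (by
    rintro ⟨x, hx⟩ hb
    simp only [boundariesIn, Submodule.mem_comap, Submodule.subtype_apply,
      LinearMap.mem_range] at hb ⊢
    obtain ⟨w, hw⟩ := hb
    refine ⟨chainsMap k A φ (n + 1) w, ?_⟩
    have := LinearMap.congr_fun (chainsMap_comm (k := k) (A := A) φ n) w
    simp only [LinearMap.comp_apply] at this
    rw [this, hw]
    rfl)

end Maps

end BarHomology

open BarHomology

/-- The projective special linear group `PSL₂(R)`, i.e. `SL₂(R)` modulo its center. -/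
abbrev PSL2 (R : Type) [CommRing R] : Type :=
  Matrix.ProjectiveSpecialLinearGroup (Fin 2) R

/-! ## Chain complexes of abelian groups and their homology -/

/-- A chain complex of abelian groups, concentrated in nonnegative degrees. -/
structure Cx where
  /-- The chain groups. -/
  X : ℕ → Type
  [ab : ∀ n, AddCommGroup (X n)]
  /-- The differential. -/
  d : ∀ n, X (n + 1) →+ X n
  dd : ∀ n x, d n (d (n + 1) x) = 0

namespace Cx

attribute [instance] Cx.ab

/-- The cycles of a chain complex. -/
def Z (C : Cx) : ∀ n, AddSubgroup (C.X n)
  | 0 => ⊤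
  | n + 1 => (C.d n).ker

/-- The boundaries of a chain complex, inside the cycles. -/
def B (C : Cx) (n : ℕ) : AddSubgroup (C.Z n) := (C.d n).range.addSubgroupOf (C.Z n)

/-- The homology of a chain complex. -/
def H (C : Cx) (n : ℕ) : Type := C.Z n ⧸ C.B n

instance (C : Cx) (n : ℕ) : AddCommGroup (C.H n) :=
  inferInstanceAs (AddCommGroup (C.Z n ⧸ C.B n))

/-- The homology class of a cycle. -/
def cls (C : Cx) (n : ℕ) : C.Z n →+ C.H n := QuotientAddGroup.mk' (C.B n)

variable {C D E : Cx} {n : ℕ}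

lemma mem_Z_succ {x : C.X (n + 1)} : x ∈ C.Z (n + 1) ↔ C.d n x = 0 := Iff.rfl

lemma cls_surj (y : C.H n) : ∃ z, C.cls n z = y := QuotientAddGroup.mk'_surjective _ y

lemma cls_eq_zero {z : C.Z n} : C.cls n z = 0 ↔ ∃ y, C.d n y = z := by
  change (QuotientAddGroup.mk' (C.B n)) z = 0 ↔ _
  rw [QuotientAddGroup.mk'_apply, QuotientAddGroup.eq_zero_iff]
  rfl

lemma cls_eq_cls {z w : C.Z n} : C.cls n z = C.cls n w ↔ ∃ y, C.d n y = (z : C.X n) - w := by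
  rw [← sub_eq_zero, ← map_sub, cls_eq_zero]
  rfl

/-- A chain map. -/
structure Hom (C D : Cx) where
  /-- The components. -/
  f : ∀ n, C.X n →+ D.X n
  comm : ∀ n x, f n (C.d n x) = D.d n (f (n + 1) x)

namespace Hom

lemma map_mem (f : Hom C D) {x : C.X n} (hx : x ∈ C.Z n) : f.f n x ∈ D.Z n := by
  cases n with
  | zero => trivial
  | succ n =>
    rw [mem_Z_succ] at *
    rw [← f.comm, hx, map_zero]

/-- The map on cycles. -/
def mapZ (f : Hom C D) (n : ℕ) : C.Z n →+ D.Z n :=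
  ((f.f n).comp (C.Z n).subtype).codRestrict _ fun x => f.map_mem x.2

@[simp] lemma mapZ_coe (f : Hom C D) (x : C.Z n) : (f.mapZ n x : D.X n) = f.f n x := rfl

/-- The map on homology. -/
def map (f : Hom C D) (n : ℕ) : C.H n →+ D.H n :=
  QuotientAddGroup.lift (C.B n) ((D.cls n).comp (f.mapZ n)) (by
    rintro ⟨x, hx⟩ ⟨y, hy⟩
    change C.d n y = x at hy
    change D.cls n _ = 0
    rw [cls_eq_zero]
    exact ⟨f.f (n + 1) y, by rw [← f.comm, hy]; rfl⟩)

lemma map_cls (f : Hom C D) (z : C.Z n) : f.map n (C.cls n z) = D.cls n (f.mapZ n z) := rfl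

/-- The identity chain map. -/
def id (C : Cx) : Hom C C := ⟨fun _ => AddMonoidHom.id _, fun _ _ => rfl⟩

/-- Composition of chain maps. -/
def comp (g : Hom D E) (f : Hom C D) : Hom C E :=
  ⟨fun n => (g.f n).comp (f.f n), fun n x => by simp [f.comm, g.comm]⟩

lemma map_comp (g : Hom D E) (f : Hom C D) (x : C.H n) :
    (g.comp f).map n x = g.map n (f.map n x) := by
  obtain ⟨z, rfl⟩ := cls_surj x
  rfl

lemma map_eq_of_homotopy (f g : Hom C D) (h : ∀ n, C.X n →+ D.X (n + 1))
    (h0 : ∀ x, D.d 0 (h 0 x) = f.f 0 x - g.f 0 x)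
    (hs : ∀ n x, D.d (n + 1) (h (n + 1) x) + h n (C.d n x) = f.f (n + 1) x - g.f (n + 1) x)
    (n : ℕ) : f.map n = g.map n := by
  ext x
  obtain ⟨z, rfl⟩ := cls_surj x
  rw [map_cls, map_cls, cls_eq_cls]
  refine ⟨h n z, ?_⟩
  cases n with
  | zero => exact h0 _
  | succ n =>
    have := hs n z
    rwa [mem_Z_succ.1 z.2, map_zero, add_zero] at this

lemma map_congr (f g : Hom C D) (h : ∀ n x, f.f n x = g.f n x) (n : ℕ) : f.map n = g.map n := by
  ext x
  obtain ⟨z, rfl⟩ := cls_surj x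
  rw [map_cls, map_cls]
  congr 1
  exact Subtype.ext (h n z)

lemma map_id_of (f : Hom C C) (h : ∀ n x, f.f n x = x) (x : C.H n) : f.map n x = x := by
  obtain ⟨z, rfl⟩ := cls_surj x
  rw [map_cls]
  congr 1
  exact Subtype.ext (h n z)

end Hom

/-- A short exact sequence of chain complexes. -/
structure SES (A B C : Cx) where
  /-- The injection. -/
  i : Hom A B
  /-- The surjection. -/
  p : Hom B C
  inj : ∀ n, Function.Injective (i.f n)
  surj : ∀ n, Function.Surjective (p.f n)
  exact : ∀ n, Function.Exact (i.f n) (p.f n)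

namespace SES

variable {A B C : Cx} (S : SES A B C)

lemma lift_exists (z : C.Z (n + 1)) :
    ∃ a : A.Z n, ∃ b : B.X (n + 1), S.p.f _ b = z ∧ S.i.f n a = B.d n b := by
  obtain ⟨b, hb⟩ := S.surj _ (z : C.X (n + 1))
  obtain ⟨a, ha⟩ := (S.exact n (B.d n b)).1 (by rw [S.p.comm, hb]; exact z.2)
  refine ⟨⟨a, ?_⟩, b, hb, ha⟩
  cases n with
  | zero => trivial
  | succ n =>
    apply S.inj n
    rw [S.i.comm, ha, B.dd, map_zero]

lemma lift_unique {z : C.Z (n + 1)} {a a' : A.Z n} {b b' : B.X (n + 1)} (hb : S.p.f _ b = z)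
    (ha : S.i.f n a = B.d n b) (hb' : S.p.f _ b' - z ∈ (C.d (n + 1)).range)
    (ha' : S.i.f n a' = B.d n b') :
    A.cls n a = A.cls n a' := by
  obtain ⟨w, hw⟩ := hb'
  obtain ⟨v, rfl⟩ := S.surj _ w
  obtain ⟨y, hy⟩ := (S.exact (n + 1) (b' - b - B.d _ v)).1
    (by rw [map_sub, map_sub, hb, S.p.comm, hw, sub_self])
  rw [cls_eq_cls]
  refine ⟨-y, S.inj n ?_⟩
  rw [S.i.comm, map_neg, hy, map_sub, ha, ha', map_neg, map_sub, map_sub, B.dd]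
  abel

/-- The connecting homomorphism on cycles. -/
noncomputable def δZ (n : ℕ) : C.Z (n + 1) →+ A.H n :=
  AddMonoidHom.mk' (fun z => A.cls n (S.lift_exists z).choose) (by
    intro z w
    obtain ⟨b, hb, ha⟩ := (S.lift_exists z).choose_spec
    obtain ⟨b', hb', ha'⟩ := (S.lift_exists w).choose_spec
    obtain ⟨b'', hb'', ha''⟩ := (S.lift_exists (z + w)).choose_spec
    rw [← map_add]
    refine S.lift_unique hb'' ha'' (b' := b + b') ⟨0, ?_⟩ ?_
    · rw [map_add, hb, hb', map_zero]; simp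
    · rw [map_add, ← ha, ← ha', ← map_add]; rfl)

/-- The connecting homomorphism. -/
noncomputable def δ (n : ℕ) : C.H (n + 1) →+ A.H n :=
  QuotientAddGroup.lift (C.B (n + 1)) (S.δZ n) (by
    intro z hz
    obtain ⟨y, hy⟩ := hz
    change C.d _ y = z at hy
    obtain ⟨b, hb, ha⟩ := (S.lift_exists z).choose_spec
    change A.cls n _ = 0
    rw [← map_zero (A.cls n)]
    refine S.lift_unique hb ha (b' := 0) ⟨-y, ?_⟩ (by simp)
    rw [map_neg, hy, map_zero, zero_sub])

lemma δ_cls {z : C.Z (n + 1)} {a : A.Z n} {b : B.X (n + 1)} (hb : S.p.f _ b = z)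
    (ha : S.i.f n a = B.d n b) : S.δ n (C.cls _ z) = A.cls n a := by
  obtain ⟨b', hb', ha'⟩ := (S.lift_exists z).choose_spec
  exact S.lift_unique hb' ha' ⟨0, by rw [hb]; simp⟩ ha

lemma exact_mid (n : ℕ) : Function.Exact (S.i.map n) (S.p.map n) := by
  intro x
  obtain ⟨z, rfl⟩ := cls_surj x
  constructor
  · intro h
    rw [Hom.map_cls, cls_eq_zero] at h
    obtain ⟨y, hy⟩ := h
    obtain ⟨v, rfl⟩ := S.surj _ y
    rw [Hom.mapZ_coe, ← S.p.comm] at hy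
    obtain ⟨a, ha⟩ := (S.exact n (z - B.d _ v)).1 (by rw [map_sub, hy, sub_self])
    refine ⟨A.cls n ⟨a, ?_⟩, ?_⟩
    · cases n with
      | zero => trivial
      | succ n =>
        apply S.inj n
        rw [S.i.comm, ha, map_sub, B.dd, map_zero, mem_Z_succ.1 z.2, sub_zero]
    · rw [Hom.map_cls, cls_eq_cls]
      exact ⟨-v, by rw [Hom.mapZ_coe, ha, map_neg]; abel⟩
  · rintro ⟨y, hy⟩
    obtain ⟨w, rfl⟩ := cls_surj y
    rw [← hy, Hom.map_cls, Hom.map_cls, cls_eq_zero]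
    refine ⟨0, ?_⟩
    rw [map_zero, Hom.mapZ_coe, Hom.mapZ_coe, (S.exact n).apply_apply_eq_zero]

lemma exact_right (n : ℕ) : Function.Exact (S.p.map (n + 1)) (S.δ n) := by
  intro x
  obtain ⟨z, rfl⟩ := cls_surj x
  constructor
  · intro h
    obtain ⟨a, b, hb, ha⟩ := S.lift_exists z
    rw [S.δ_cls hb ha, cls_eq_zero] at h
    obtain ⟨y, hy⟩ := h
    refine ⟨B.cls _ ⟨b - S.i.f _ y, ?_⟩, ?_⟩
    · rw [mem_Z_succ, map_sub, ← S.i.comm, hy, ha, sub_self]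
    · rw [Hom.map_cls]
      congr 1
      refine Subtype.ext ?_
      rw [Hom.mapZ_coe, map_sub, hb, (S.exact _).apply_apply_eq_zero, sub_zero]
  · rintro ⟨y, hy⟩
    obtain ⟨w, rfl⟩ := cls_surj y
    rw [← hy, Hom.map_cls, S.δ_cls (a := 0) (b := w) rfl, map_zero]
    rw [mem_Z_succ.1 w.2]
    simp

lemma exact_left (n : ℕ) : Function.Exact (S.δ n) (S.i.map n) := by
  intro x
  obtain ⟨a, rfl⟩ := cls_surj x
  constructor
  · intro h
    rw [Hom.map_cls, cls_eq_zero] at h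
    obtain ⟨b, hb⟩ := h
    refine ⟨C.cls _ ⟨S.p.f _ b, ?_⟩, ?_⟩
    · rw [mem_Z_succ, ← S.p.comm, hb, Hom.mapZ_coe, (S.exact _).apply_apply_eq_zero]
    · exact S.δ_cls rfl hb.symm
  · rintro ⟨y, hy⟩
    obtain ⟨z, rfl⟩ := cls_surj y
    obtain ⟨a', b, hb, ha⟩ := S.lift_exists z
    rw [← hy, S.δ_cls hb ha, Hom.map_cls, cls_eq_zero]
    exact ⟨b, ha.symm⟩

lemma map_zero_surjective : Function.Surjective (S.p.map 0) := by
  intro x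
  obtain ⟨z, rfl⟩ := cls_surj x
  obtain ⟨b, hb⟩ := S.surj _ (z : C.X 0)
  exact ⟨B.cls 0 ⟨b, trivial⟩, by rw [Hom.map_cls]; congr 1; exact Subtype.ext hb⟩

end SES

end Cx

/-! ## The bar complex with coefficients -/

/-- An abelian group with a multiplicative (not necessarily unital) action of a group. -/
structure GMod (G : Type) [Group G] where
  /-- The underlying abelian group. -/
  V : Type
  [ab : AddCommGroup V]
  /-- The action. -/
  R : G → V →+ V
  mul : ∀ g h v, R (g * h) v = R g (R h v)

namespace GMod

attribute [instance] GMod.ab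

variable {G G' G'' : Type} [Group G] [Group G'] [Group G'']

/-- The module of one-letter words with coefficients in `M`. -/
@[reducible] noncomputable def Ω (M : GMod G) : GMod G where
  V := G →₀ M.V
  R g := Finsupp.liftAddHom fun h =>
    Finsupp.singleAddHom (g * h) - (Finsupp.singleAddHom g).comp (M.R h)
  mul g h v := by
    induction v using Finsupp.induction_linear with
    | zero => simp
    | add a b ha hb => rw [map_add, map_add, map_add, ha, hb]
    | single k v =>
      simp only [Finsupp.liftAddHom_apply_single, AddMonoidHom.sub_apply, AddMonoidHom.comp_apply,
        Finsupp.singleAddHom_apply, map_sub, M.mul, mul_assoc]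
      abel

/-- The bar differential in lowest degree. -/
noncomputable def δ (M : GMod G) : (G →₀ M.V) →+ M.V :=
  Finsupp.liftAddHom fun g => AddMonoidHom.id _ - M.R g

@[simp] lemma δ_single (M : GMod G) (g : G) (v : M.V) :
    M.δ (Finsupp.single g v) = v - M.R g v := by simp [δ]

@[simp] lemma Ω_R_single (M : GMod G) (g h : G) (v : M.V) :
    M.Ω.R g (Finsupp.single h v) =
      Finsupp.single (g * h) v - Finsupp.single g (M.R h v) := by
  change Finsupp.liftAddHom _ _ = _
  simp

lemma δ_δ (M : GMod G) (x : G →₀ (G →₀ M.V)) : M.δ (M.Ω.δ x) = 0 := by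
  induction x using Finsupp.induction_linear with
  | zero => simp
  | add a b ha hb => rw [map_add, map_add, ha, hb, add_zero]
  | single g x =>
    induction x using Finsupp.induction_linear with
    | zero => simp
    | add a b ha hb => rw [Finsupp.single_add, map_add, map_add, ha, hb, add_zero]
    | single h v =>
      rw [δ_single, Ω_R_single]
      simp [M.mul]

/-- Words of length `n` with coefficients in `M`. -/
noncomputable def iter (M : GMod G) : ℕ → GMod G
  | 0 => M
  | n + 1 => (M.iter n).Ω

/-- Prepending a letter to words. -/
noncomputable def cons {M : GMod G} {n : ℕ} (g : G) : (M.iter n).V →+ (M.iter (n + 1)).V :=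
  Finsupp.singleAddHom (M := (M.iter n).V) g

lemma R_cons {M : GMod G} {n : ℕ} (g h : G) (v : (M.iter n).V) :
    (M.iter (n + 1)).R g (cons h v) = cons (g * h) v - cons g ((M.iter n).R h v) :=
  Ω_R_single _ _ _ _

/-- The bar complex of a group with coefficients in a module. -/
@[reducible] noncomputable def bar (M : GMod G) : Cx where
  X n := (M.iter n).V
  d n := (M.iter n).δ
  dd n x := (M.iter n).δ_δ x

/-- The homology of a group with coefficients in a module. -/
abbrev H (M : GMod G) (n : ℕ) : Type := M.bar.H n

/-- An additive map which is equivariant along a group homomorphism. -/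
structure Hom (φ : G →* G') (M : GMod G) (N : GMod G') where
  /-- The underlying additive map. -/
  f : M.V →+ N.V
  comm : ∀ g v, f (M.R g v) = N.R (φ g) (f v)

namespace Hom

variable {φ : G →* G'} {M : GMod G} {N : GMod G'}

/-- The map on one-letter words. -/
noncomputable def Ω (F : Hom φ M N) : Hom φ M.Ω N.Ω where
  f := Finsupp.liftAddHom fun g => (Finsupp.singleAddHom (φ g)).comp F.f
  comm g v := by
    induction v using Finsupp.induction_linear with
    | zero => simp
    | add a b ha hb => rw [map_add, map_add, map_add, map_add, ha, hb]
    | single k v =>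
      simp only [Finsupp.liftAddHom_apply_single, AddMonoidHom.sub_apply, AddMonoidHom.comp_apply,
        Finsupp.singleAddHom_apply, map_sub, F.comm, map_mul]

@[simp] lemma Ω_single (F : Hom φ M N) (g : G) (v : M.V) :
    F.Ω.f (Finsupp.single g v) = Finsupp.single (φ g) (F.f v) := by
  change Finsupp.liftAddHom _ _ = _
  simp

/-- The map on words of length `n`. -/
noncomputable def iter (F : Hom φ M N) : ∀ n, Hom φ (M.iter n) (N.iter n)
  | 0 => F
  | n + 1 => (F.iter n).Ω

lemma iter_cons (F : Hom φ M N) (n : ℕ) (g : G) (v : (M.iter n).V) :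
    (F.iter (n + 1)).f (cons g v) = cons (φ g) ((F.iter n).f v) := Ω_single _ _ _

lemma δ_comm (F : Hom φ M N) (x : G →₀ M.V) : F.f (M.δ x) = N.δ (F.Ω.f x) := by
  induction x using Finsupp.induction_linear with
  | zero => simp
  | add a b ha hb => rw [map_add, map_add, map_add, map_add, ha, hb]
  | single g v => rw [δ_single, _root_.map_sub, F.comm, Ω_single, δ_single]

/-- The chain map induced on bar complexes. -/
noncomputable def bar (F : Hom φ M N) : Cx.Hom M.bar N.bar where
  f n := (F.iter n).f
  comm n x := (F.iter n).δ_comm x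

/-- The map induced on homology. -/
noncomputable def map (F : Hom φ M N) (n : ℕ) : M.H n →+ N.H n := F.bar.map n

end Hom

lemma d_cons {M : GMod G} {n : ℕ} (g : G) (v : (M.iter n).V) :
    M.bar.d n (cons g v) = v - (M.iter n).R g v := δ_single _ _ _

/-- Additive maps out of words, defined letter by letter. -/
noncomputable def lift {M : GMod G} {n : ℕ} {A : Type} [AddCommGroup A]
    (f : G → (M.iter n).V →+ A) : (M.iter (n + 1)).V →+ A :=
  Finsupp.liftAddHom (M := (M.iter n).V) f

@[simp] lemma lift_cons {M : GMod G} {n : ℕ} {A : Type} [AddCommGroup A]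
    (f : G → (M.iter n).V →+ A) (g : G) (v : (M.iter n).V) : lift f (cons g v) = f g v :=
  Finsupp.liftAddHom_apply_single _ _ _

lemma iter_induction {M : GMod G} {n : ℕ} {p : (M.iter (n + 1)).V → Prop}
    (h0 : p 0) (ha : ∀ x y, p x → p y → p (x + y))
    (hs : ∀ (g : G) (v : (M.iter n).V), p (cons g v)) :
    ∀ x, p x := fun x =>
  Finsupp.induction_linear (motive := p) (x : G →₀ (M.iter n).V) h0 ha hs

lemma iter_hom_ext {M : GMod G} {n : ℕ} {A : Type} [AddCommGroup A]
    {f f' : (M.iter (n + 1)).V →+ A}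
    (h : ∀ (g : G) (v : (M.iter n).V), f (cons g v) = f' (cons g v)) (x : (M.iter (n + 1)).V) : f x = f' x := by
  induction x using iter_induction with
  | h0 => simp
  | ha x y hx hy => rw [map_add, map_add, hx, hy]
  | hs g v => exact h g v

namespace Hom

variable {φ : G →* G'} {ψ : G' →* G''} {χ : G →* G''} {M : GMod G} {N : GMod G'} {P : GMod G''}

lemma iter_comp (F : Hom φ M N) (E : Hom ψ N P) (K : Hom χ M P) (hχ : ∀ g, χ g = ψ (φ g))
    (hK : ∀ v, K.f v = E.f (F.f v)) (n : ℕ) (v : (M.iter n).V) :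
    (K.iter n).f v = (E.iter n).f ((F.iter n).f v) := by
  induction n with
  | zero => exact hK v
  | succ n ih =>
    refine iter_hom_ext (f' := (E.iter (n + 1)).f.comp (F.iter (n + 1)).f) (fun g v => ?_) v
    rw [AddMonoidHom.comp_apply, iter_cons, iter_cons, iter_cons, ih, hχ]

lemma map_comp (F : Hom φ M N) (E : Hom ψ N P) (K : Hom χ M P) (hχ : ∀ g, χ g = ψ (φ g))
    (hK : ∀ v, K.f v = E.f (F.f v)) (n : ℕ) (x : M.H n) :
    K.map n x = E.map n (F.map n x) := by
  rw [map, map, map, ← Cx.Hom.map_comp]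
  exact DFunLike.congr_fun (Cx.Hom.map_congr _ _ (fun n v => iter_comp F E K hχ hK n v) n) x

lemma iter_id (F : Hom (MonoidHom.id G) M M) (hF : ∀ v, F.f v = v) (n : ℕ) (v : (M.iter n).V) :
    (F.iter n).f v = v := by
  induction n with
  | zero => exact hF v
  | succ n ih =>
    refine iter_hom_ext (f' := AddMonoidHom.id _) (fun g v => ?_) v
    rw [iter_cons, ih]
    rfl

lemma map_id (F : Hom (MonoidHom.id G) M M) (hF : ∀ v, F.f v = v) (n : ℕ) (x : M.H n) :
    F.map n x = x :=
  Cx.Hom.map_id_of _ (fun n v => iter_id F hF n v) x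

lemma map_congr {φ' : G →* G'} (F : Hom φ M N) (F' : Hom φ' M N) (hφ : ∀ g, φ g = φ' g)
    (hF : ∀ v, F.f v = F'.f v) (n : ℕ) (x : M.H n) : F.map n x = F'.map n x := by
  obtain rfl : φ = φ' := MonoidHom.ext hφ
  obtain rfl : F = F' := by
    cases F; cases F'
    congr 1
    exact AddMonoidHom.ext hF
  rfl

lemma iter_add (F F' K : Hom φ M N) (hK : ∀ v, K.f v = F.f v + F'.f v) (n : ℕ)
    (v : (M.iter n).V) : (K.iter n).f v = (F.iter n).f v + (F'.iter n).f v := by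
  induction n with
  | zero => exact hK v
  | succ n ih =>
    refine iter_hom_ext (f' := (F.iter (n + 1)).f + (F'.iter (n + 1)).f) (fun g v => ?_) v
    rw [AddMonoidHom.add_apply, iter_cons, iter_cons, iter_cons, ih, _root_.map_add]

lemma map_add (F F' K : Hom φ M N) (hK : ∀ v, K.f v = F.f v + F'.f v) (n : ℕ) (x : M.H n) :
    K.map n x = F.map n x + F'.map n x := by
  obtain ⟨z, rfl⟩ := Cx.cls_surj x
  rw [map, map, map, Cx.Hom.map_cls, Cx.Hom.map_cls, Cx.Hom.map_cls, ← _root_.map_add]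
  congr 1
  exact Subtype.ext (iter_add F F' K hK n z)

lemma map_zero_of (F : Hom φ M N) (hF : ∀ v, F.f v = 0) (n : ℕ) (x : M.H n) : F.map n x = 0 := by
  have := map_add F F F (fun v => by rw [hF, add_zero]) n x
  simpa using this

/-- A bijective equivariant map along a bijective homomorphism is bijective on homology. -/
lemma map_bijective_of_inverse (F : Hom φ M N) {ψ : G' →* G} (E : Hom ψ N M)
    (h1 : ∀ g, ψ (φ g) = g) (h2 : ∀ g, φ (ψ g) = g) (h3 : ∀ v, E.f (F.f v) = v)
    (h4 : ∀ v, F.f (E.f v) = v) (n : ℕ) : Function.Bijective (F.map n) := by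
  refine Function.bijective_iff_has_inverse.2 ⟨E.map n, fun x => ?_, fun x => ?_⟩
  · rw [← map_comp F E (χ := MonoidHom.id G) ⟨AddMonoidHom.id _, fun _ _ => rfl⟩
      (fun g => (h1 g).symm) (fun v => (h3 v).symm)]
    exact map_id _ (fun _ => rfl) n x
  · rw [← map_comp E F (χ := MonoidHom.id G') ⟨AddMonoidHom.id _, fun _ _ => rfl⟩
      (fun g => (h2 g).symm) (fun v => (h4 v).symm)]
    exact map_id _ (fun _ => rfl) n x

end Hom

/-! ### Short exact sequences of coefficients -/

section ShortExact

variable {A B C : GMod G} (i : Hom (MonoidHom.id G) A B) (p : Hom (MonoidHom.id G) B C)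

lemma Hom.Ω_eq_mapRange (i : Hom (MonoidHom.id G) A B) (x : G →₀ A.V) :
    i.Ω.f x = Finsupp.mapRange.addMonoidHom i.f x := by
  induction x using Finsupp.induction_linear with
  | zero => simp
  | add a b ha hb => rw [_root_.map_add, _root_.map_add, ha, hb]
  | single g v => rw [Hom.Ω_single]; simp

lemma Hom.Ω_exact (hi : Function.Injective i.f) (hp : Function.Surjective p.f)
    (he : Function.Exact i.f p.f) : Function.Injective i.Ω.f ∧ Function.Surjective p.Ω.f ∧
      Function.Exact i.Ω.f p.Ω.f := by
  have h1 : (i.Ω.f : (G →₀ A.V) → (G →₀ B.V)) = Finsupp.mapRange i.f i.f.map_zero :=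
    funext fun x => i.Ω_eq_mapRange x
  have h2 : (p.Ω.f : (G →₀ B.V) → (G →₀ C.V)) = Finsupp.mapRange p.f p.f.map_zero :=
    funext fun x => p.Ω_eq_mapRange x
  refine ⟨?_, ?_, ?_⟩
  · rw [h1]; exact Finsupp.mapRange_injective _ _ hi
  · rw [h2]; exact Finsupp.mapRange_surjective _ _ hp
  · rw [h1, h2]
    intro x
    constructor
    · intro hx
      have hx' : ∀ g, ∃ a, i.f a = x g := fun g => (he _).1 (DFunLike.congr_fun hx g)
      choose a ha using hx'
      refine ⟨Finsupp.onFinset x.support a fun g hg => ?_, ?_⟩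
      · rw [Finsupp.mem_support_iff, ← ha]
        exact fun h => hg (hi (by rw [h, _root_.map_zero]))
      · ext g
        simp [ha]
    · rintro ⟨y, rfl⟩
      ext g
      simp [he.apply_apply_eq_zero]

/-- The short exact sequence of bar complexes attached to a short exact sequence of
coefficients. -/
noncomputable def ses (hi : Function.Injective i.f) (hp : Function.Surjective p.f)
    (he : Function.Exact i.f p.f) : Cx.SES A.bar B.bar C.bar :=
  have key : ∀ n, Function.Injective (i.iter n).f ∧ Function.Surjective (p.iter n).f ∧
      Function.Exact (i.iter n).f (p.iter n).f := fun n => by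
    induction n with
    | zero => exact ⟨hi, hp, he⟩
    | succ n ih => exact Hom.Ω_exact _ _ ih.1 ih.2.1 ih.2.2
  { i := i.bar, p := p.bar, inj := fun n => (key n).1, surj := fun n => (key n).2.1,
    exact := fun n => (key n).2.2 }

end ShortExact

end GMod

/-! ### Trivial and permutation coefficients -/

namespace GMod

/-- The trivial module `ℤ`. -/
@[reducible] def triv (G : Type) [Group G] : GMod G where
  V := ℤ
  R _ := AddMonoidHom.id ℤ
  mul _ _ _ := rfl

/-- The permutation module of a `G`-set. -/
@[reducible] noncomputable def perm (G : Type) [Group G] (X : Type) [MulAction G X] : GMod G where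
  V := X →₀ ℤ
  R g := Finsupp.mapDomain.addMonoidHom (g • ·)
  mul g h v := by
    induction v using Finsupp.induction_linear with
    | zero => simp
    | add a b ha hb => rw [map_add, map_add, map_add, ha, hb]
    | single k v => simp [mul_smul]

/-- Integral homology of a group. -/
abbrev h (G : Type) [Group G] (n : ℕ) : Type := (triv G).H n

variable {G G' A : Type} [Group G] [Group G'] [Group A]
variable {X Y : Type} [MulAction G X] [MulAction G Y] [MulAction G' Y]

/-- The map of trivial modules along a homomorphism. -/
def trivHom (φ : G →* G') : Hom φ (triv G) (triv G') := ⟨AddMonoidHom.id ℤ, fun _ _ => rfl⟩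

/-- The map on integral homology induced by a homomorphism. -/
noncomputable def hmap (φ : G →* G') (n : ℕ) : h G n →+ h G' n := (trivHom φ).map n

lemma hmap_comp {G'' : Type} [Group G''] (ψ : G' →* G'') (φ : G →* G') (χ : G →* G'')
    (hχ : ∀ g, χ g = ψ (φ g)) (n : ℕ) (x : h G n) : hmap χ n x = hmap ψ n (hmap φ n x) :=
  Hom.map_comp _ _ _ hχ (fun _ => rfl) n x

lemma hmap_bijective (e : G ≃* G') (n : ℕ) : Function.Bijective (hmap (e : G →* G') n) :=
  Hom.map_bijective_of_inverse _ (trivHom (e.symm : G' →* G)) (by simp) (by simp)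
    (fun _ => rfl) (fun _ => rfl) n

/-- The map of permutation modules induced by an equivariant map. -/
noncomputable def permHom (φ : G →* G') (f : X → Y) (hf : ∀ (g : G) (x : X), f (g • x) = φ g • f x) :
    Hom φ (perm G X) (perm G' Y) where
  f := Finsupp.mapDomain.addMonoidHom f
  comm g v := by
    induction v using Finsupp.induction_linear with
    | zero => simp
    | add a b ha hb => rw [map_add, map_add, map_add, map_add, ha, hb]
    | single k v => simp [hf]

/-- The augmentation of a permutation module. -/
noncomputable def aug (G X : Type) [Group G] [MulAction G X] :
    Hom (MonoidHom.id G) (perm G X) (triv G) where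
  f := Finsupp.liftAddHom fun _ => AddMonoidHom.id ℤ
  comm g v := by
    induction v using Finsupp.induction_linear with
    | zero => simp
    | add a b ha hb => rw [map_add, map_add, map_add, map_add, ha, hb]
    | single k v => simp

@[simp] lemma aug_single (x : X) (a : ℤ) : (aug G X).f (Finsupp.single x a) = a := by
  simp [aug]

/-- The inclusion of a fixed point. -/
noncomputable def pt (j : A →* G) (x : X) (hx : ∀ a, j a • x = x) :
    Hom j (triv A) (perm G X) where
  f := Finsupp.singleAddHom x
  comm g v := by simp [hx]

/-- Words ending in a point `x` of a `G`-set. -/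
noncomputable def θ : ∀ (n : ℕ) (_ : X), ((triv G).iter n).V →+ ((perm G X).iter n).V
  | 0, x => Finsupp.singleAddHom x
  | n + 1, x => lift fun g => (cons g).comp (θ n (g⁻¹ • x))

lemma θ_cons (n : ℕ) (x : X) (g : G) (c : ((triv G).iter n).V) :
    θ (n + 1) x (cons g c) = cons g (θ n (g⁻¹ • x) c) := by
  rw [θ, lift_cons]
  rfl

lemma R_θ (n : ℕ) (x : X) (g : G) (c : ((triv G).iter n).V) :
    ((perm G X).iter n).R g (θ n x c) = θ n (g • x) (((triv G).iter n).R g c) := by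
  induction n generalizing x g with
  | zero =>
    change Finsupp.mapDomain _ (Finsupp.single x c) = Finsupp.single _ c
    simp
  | succ n ih =>
    induction c using iter_induction with
    | h0 => simp
    | ha a b ha hb => rw [map_add, map_add, map_add, map_add, ha, hb]
    | hs h c =>
      rw [θ_cons, R_cons, R_cons, map_sub, θ_cons, θ_cons, ih]
      simp [mul_smul]

lemma d_θ (n : ℕ) (x : X) (g : G) (c : ((triv G).iter n).V) :
    (perm G X).bar.d n (θ (n + 1) x (cons g c)) =
      θ n (g⁻¹ • x) c - θ n x (((triv G).iter n).R g c) := by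
  rw [θ_cons, d_cons, R_θ, smul_inv_smul]

lemma aug_θ (n : ℕ) (x : X) (c : ((triv G).iter n).V) : ((aug G X).iter n).f (θ n x c) = c := by
  induction n generalizing x with
  | zero => exact aug_single _ _
  | succ n ih =>
    refine iter_hom_ext (f := ((aug G X).iter (n + 1)).f.comp (θ (n + 1) x))
      (f' := AddMonoidHom.id _) (fun g c => ?_) c
    rw [AddMonoidHom.comp_apply, θ_cons, Hom.iter_cons, ih]
    rfl

lemma θ_hom_ext {n : ℕ} {B : Type} [AddCommGroup B] {f f' : ((perm G X).iter n).V →+ B}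
    (h : ∀ x c, f (θ n x c) = f' (θ n x c)) (v : ((perm G X).iter n).V) : f v = f' v := by
  induction n with
  | zero =>
    refine DFunLike.congr_fun (?_ : f = f') v
    exact Finsupp.addHom_ext h
  | succ n ih =>
    refine iter_hom_ext (fun g v => ih (f := f.comp (cons g)) (f' := f'.comp (cons g)) ?_ v) v
    intro x c
    have := h (g • x) (cons g c)
    rwa [θ_cons, inv_smul_smul] at this

/-- The decomposition of words according to their end point. -/
noncomputable def Ψ : ∀ n : ℕ, ((perm G X).iter n).V →+ (X →₀ ((triv G).iter n).V)
  | 0 => AddMonoidHom.id (X →₀ ℤ)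
  | n + 1 => lift fun g =>
      (Finsupp.liftAddHom fun x => (Finsupp.singleAddHom (g • x)).comp (cons g)).comp (Ψ n)

lemma Ψ_θ (n : ℕ) (x : X) (c : ((triv G).iter n).V) :
    Ψ n (θ n x c) = Finsupp.single x c := by
  induction n generalizing x with
  | zero => rfl
  | succ n ih =>
    refine iter_hom_ext (f := (Ψ (n + 1)).comp (θ (n + 1) x))
      (f' := Finsupp.singleAddHom x) (fun g c => ?_) c
    rw [AddMonoidHom.comp_apply, θ_cons, Ψ, lift_cons, AddMonoidHom.comp_apply, ih]
    simp

/-- Additive maps out of words ending in a `G`-set, defined end point by end point. -/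
noncomputable def θlift {n : ℕ} {B : Type} [AddCommGroup B] (f : X → ((triv G).iter n).V →+ B) :
    ((perm G X).iter n).V →+ B := (Finsupp.liftAddHom f).comp (Ψ n)

@[simp] lemma θlift_θ {n : ℕ} {B : Type} [AddCommGroup B] (f : X → ((triv G).iter n).V →+ B)
    (x : X) (c : ((triv G).iter n).V) : θlift f (θ n x c) = f x c := by
  rw [θlift, AddMonoidHom.comp_apply, Ψ_θ, Finsupp.liftAddHom_apply_single]

/-! ### Functors between action groupoids and natural transformations -/

/-- The map on words given by a cocycle. -/
noncomputable def fam (φ : X → G → G') : ∀ (n : ℕ) (_ : X),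
    ((triv G).iter n).V →+ ((triv G').iter n).V
  | 0, _ => AddMonoidHom.id ℤ
  | n + 1, x => lift fun g => (cons (φ x g)).comp (fam φ n (g⁻¹ • x))

lemma fam_cons (φ : X → G → G') (n : ℕ) (x : X) (g : G) (c : ((triv G).iter n).V) :
    fam φ (n + 1) x (cons g c) = cons (φ x g) (fam φ n (g⁻¹ • x) c) := by
  rw [fam, lift_cons]
  rfl

lemma fam_R (φ : X → G → G') (hφ : ∀ x g h, φ x (g * h) = φ x g * φ (g⁻¹ • x) h)
    (n : ℕ) (x : X) (g : G) (c : ((triv G).iter n).V) :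
    fam φ n x (((triv G).iter n).R g c) =
      ((triv G').iter n).R (φ x g) (fam φ n (g⁻¹ • x) c) := by
  induction n generalizing x g with
  | zero => rfl
  | succ n ih =>
    induction c using iter_induction with
    | h0 => simp
    | ha a b ha hb => rw [map_add, map_add, map_add, map_add, ha, hb]
    | hs h c =>
      rw [fam_cons, R_cons, R_cons, map_sub, fam_cons, fam_cons, ih, hφ]
      simp [mul_smul]

/-- The prism operator of a natural transformation `c` from `φ` to `ψ`. -/
noncomputable def hty (φ ψ : X → G → G') (c : X → G') : ∀ (n : ℕ) (_ : X),
    ((triv G).iter n).V →+ ((triv G').iter (n + 1)).V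
  | 0, x => (cons (M := triv G') (n := 0) (c x)).comp (fam φ 0 x)
  | n + 1, x => lift fun g =>
      (cons (c x)).comp ((cons (φ x g)).comp (fam φ n (g⁻¹ • x))) -
        (cons (ψ x g)).comp (hty φ ψ c n (g⁻¹ • x))

lemma hty_cons (φ ψ : X → G → G') (c : X → G') (n : ℕ) (x : X) (g : G)
    (b : ((triv G).iter n).V) :
    hty φ ψ c (n + 1) x (cons g b) = cons (c x) (cons (φ x g) (fam φ n (g⁻¹ • x) b)) -
      cons (ψ x g) (hty φ ψ c n (g⁻¹ • x) b) := by
  rw [hty, lift_cons]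
  rfl

lemma hty_R (φ ψ : X → G → G') (c : X → G')
    (hφ : ∀ x g h, φ x (g * h) = φ x g * φ (g⁻¹ • x) h)
    (hψ : ∀ x g h, ψ x (g * h) = ψ x g * ψ (g⁻¹ • x) h)
    (hc : ∀ x g, ψ x g * c (g⁻¹ • x) = c x * φ x g) (n : ℕ) (x : X) (g : G)
    (b : ((triv G).iter n).V) :
    ((triv G').iter (n + 1)).R (ψ x g) (hty φ ψ c n (g⁻¹ • x) b) -
      hty φ ψ c n x (((triv G).iter n).R g b) =
    cons (c x * φ x g) (fam φ n (g⁻¹ • x) b) -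
      cons (c x) (((triv G').iter n).R (φ x g) (fam φ n (g⁻¹ • x) b)) -
      cons (ψ x g) (fam ψ n (g⁻¹ • x) b) := by
  induction n generalizing x g with
  | zero =>
    change ((triv G').iter 1).R (ψ x g) (cons (c (g⁻¹ • x)) (fam φ 0 x b)) -
      cons (c x) (fam φ 0 x b) = _
    rw [R_cons, hc]
    change _ = cons _ (fam φ 0 x b) - cons _ (fam φ 0 x b) - cons _ (fam φ 0 x b)
    rw [sub_right_comm]
    rfl
  | succ n ih =>
    induction b using iter_induction with
    | h0 => simp
    | ha a b ha hb =>
      simp only [map_add]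
      rw [add_sub_add_comm, ha, hb]
      abel
    | hs k y =>
      have key := ih (g⁻¹ • x) k y
      simp only [hty_cons, map_sub, R_cons, hc, fam_cons, fam_R φ hφ, hφ, hψ, mul_smul,
        mul_inv_rev]
      rw [sub_eq_iff_eq_add] at key
      rw [key]
      simp only [map_sub, map_add]
      abel

lemma d_hty_zero {X' : Type} [MulAction G' X'] (φ ψ : X → G → G') (c : X → G') (f f' : X → X')
    (hf : ∀ x, (c x)⁻¹ • f' x = f x) (x : X) (b : ((triv G).iter 0).V) :
    (perm G' X').bar.d 0 (θ 1 (f' x) (hty φ ψ c 0 x b)) =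
      θ 0 (f x) (fam φ 0 x b) - θ 0 (f' x) (fam ψ 0 x b) := by
  change (perm G' X').bar.d 0 (θ 1 (f' x) (cons (c x) (fam φ 0 x b))) = _
  rw [d_θ, hf]
  rfl

lemma d_hty_succ {X' : Type} [MulAction G' X'] (φ ψ : X → G → G') (c : X → G') (f f' : X → X')
    (hφ : ∀ x g h, φ x (g * h) = φ x g * φ (g⁻¹ • x) h)
    (hψ : ∀ x g h, ψ x (g * h) = ψ x g * ψ (g⁻¹ • x) h)
    (hc : ∀ x g, ψ x g * c (g⁻¹ • x) = c x * φ x g)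
    (hf : ∀ x, (c x)⁻¹ • f' x = f x) (hf' : ∀ x g, (ψ x g)⁻¹ • f' x = f' (g⁻¹ • x))
    (n : ℕ) (x : X) (g : G) (b : ((triv G).iter n).V) :
    (perm G' X').bar.d (n + 1) (θ (n + 2) (f' x) (hty φ ψ c (n + 1) x (cons g b))) +
      (θ (n + 1) (f' (g⁻¹ • x)) (hty φ ψ c n (g⁻¹ • x) b) -
        θ (n + 1) (f' x) (hty φ ψ c n x (((triv G).iter n).R g b))) =
      θ (n + 1) (f x) (fam φ (n + 1) x (cons g b)) -
        θ (n + 1) (f' x) (fam ψ (n + 1) x (cons g b)) := by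
  have key := hty_R φ ψ c hφ hψ hc n x g b
  rw [sub_eq_iff_eq_add] at key
  rw [hty_cons, map_sub, map_sub, d_θ, d_θ, hf, hf', R_cons, key, fam_cons, fam_cons]
  simp only [map_sub, map_add]
  abel

/-! ### Shapiro's lemma -/

section Shapiro

variable (j : A →* G) (x₀ : X)

lemma pt_iter (hx : ∀ a, j a • x₀ = x₀) (n : ℕ) (c : ((triv A).iter n).V) :
    ((pt j x₀ hx).iter n).f c = θ n x₀ (((trivHom j).iter n).f c) := by
  induction n with
  | zero => rfl
  | succ n ih =>
    refine iter_hom_ext (f' := (θ (n + 1) x₀).comp ((trivHom j).iter (n + 1)).f)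
      (fun g c => ?_) c
    have hx' : (j g)⁻¹ • x₀ = x₀ := by rw [inv_smul_eq_iff, hx]
    rw [AddMonoidHom.comp_apply, Hom.iter_cons, Hom.iter_cons, θ_cons, ih, hx']

lemma trivHom_iter_fam {φ : X → G → A} (n : ℕ) (x : X) (c : ((triv G).iter n).V) :
    ((trivHom j).iter n).f (fam φ n x c) = fam (fun x g => j (φ x g)) n x c := by
  induction n generalizing x with
  | zero => rfl
  | succ n ih =>
    refine iter_hom_ext (f := ((trivHom j).iter (n + 1)).f.comp (fam φ (n + 1) x))
      (fun g c => ?_) c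
    rw [AddMonoidHom.comp_apply, fam_cons, fam_cons, Hom.iter_cons, ih]

lemma fam_id (n : ℕ) (x : X) (c : ((triv G).iter n).V) : fam (fun _ g => g) n x c = c := by
  induction n generalizing x with
  | zero => rfl
  | succ n ih =>
    refine iter_hom_ext (f' := AddMonoidHom.id _) (fun g c => ?_) c
    rw [fam_cons, ih]
    rfl

/-- The chain map from words ending in a `G`-set given by a cocycle. -/
noncomputable def famHom (φ : X → G → A) (hφ : ∀ x g h, φ x (g * h) = φ x g * φ (g⁻¹ • x) h) :
    Cx.Hom (perm G X).bar (triv A).bar where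
  f n := θlift (fam φ n)
  comm n v := by
    refine θ_hom_ext (f := (θlift (fam φ n)).comp ((perm G X).bar.d n))
      (f' := ((triv A).bar.d n).comp (θlift (fam φ (n + 1)))) (fun x c => ?_) v
    induction c using iter_induction with
    | h0 => simp
    | ha a b ha hb => rw [map_add, map_add, map_add, ha, hb]
    | hs g c =>
      rw [AddMonoidHom.comp_apply, AddMonoidHom.comp_apply, d_θ, map_sub, θlift_θ, θlift_θ,
        θlift_θ, fam_cons, d_cons, fam_R φ hφ]

/-- Shapiro's lemma for a transitive `G`-set. -/
theorem pt_map_bijective (hj : Function.Injective j) (hx : ∀ a, j a • x₀ = x₀)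
    (hs : ∀ g : G, g • x₀ = x₀ → ∃ a, j a = g) (ht : ∀ x : X, ∃ g : G, g • x₀ = x) (n : ℕ) :
    Function.Bijective ((pt j x₀ hx).map n) := by
  classical
  obtain ⟨s, hs0, hsx⟩ : ∃ s : X → G, s x₀ = 1 ∧ ∀ x, s x • x₀ = x := by
    choose s hsx using ht
    refine ⟨Function.update s x₀ 1, by simp, fun x => ?_⟩
    by_cases h : x = x₀
    · subst h; simp
    · rw [Function.update_of_ne h, hsx]
  have hfix : ∀ x (g : G), ∃ a, j a = (s x)⁻¹ * g * s (g⁻¹ • x) := fun x g => hs _ (by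
    rw [mul_smul, hsx, mul_smul, smul_inv_smul, inv_smul_eq_iff, hsx])
  choose φ hφ using hfix
  have hφc : ∀ x g h, φ x (g * h) = φ x g * φ (g⁻¹ • x) h := fun x g h => hj (by
    rw [map_mul, hφ, hφ, hφ, mul_inv_rev, mul_smul]; group)
  have hφ0 : ∀ a, φ x₀ (j a) = a := fun a => hj (by
    have hx' : (j a)⁻¹ • x₀ = x₀ := by rw [inv_smul_eq_iff, hx]
    rw [hφ, hx', hs0]; group)
  have hfam0 : ∀ n c, fam φ n x₀ (((trivHom j).iter n).f c) = c := by
    intro n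
    induction n with
    | zero => exact fun c => rfl
    | succ n ih =>
      intro c
      refine iter_hom_ext (f := (fam φ (n + 1) x₀).comp ((trivHom j).iter (n + 1)).f)
        (f' := AddMonoidHom.id _) (fun a c => ?_) c
      have hx' : (j a)⁻¹ • x₀ = x₀ := by rw [inv_smul_eq_iff, hx]
      rw [AddMonoidHom.comp_apply, Hom.iter_cons, fam_cons, hx', ih, hφ0]
      rfl
  let T := famHom φ hφc
  have hleft : ∀ y : h A n, T.map n ((pt j x₀ hx).map n y) = y := fun y => by
    rw [Hom.map, ← Cx.Hom.map_comp]
    refine Cx.Hom.map_id_of _ (fun n c => ?_) y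
    change θlift (fam φ n) (((pt j x₀ hx).iter n).f c) = c
    rw [pt_iter, θlift_θ, hfam0]
  have hright : ∀ y : (perm G X).H n, (pt j x₀ hx).map n (T.map n y) = y := fun y => by
    rw [Hom.map, ← Cx.Hom.map_comp]
    have hval : ∀ n x c, ((pt j x₀ hx).bar.comp T).f n (θ n x c) =
        θ n x₀ (fam (fun x g => (s x)⁻¹ * g * s (g⁻¹ • x)) n x c) := fun n x c => by
      change ((pt j x₀ hx).iter n).f (θlift (fam φ n) (θ n x c)) = _
      rw [pt_iter, θlift_θ, trivHom_iter_fam]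
      simp only [hφ]
    let H : ∀ n, ((perm G X).iter n).V →+ ((perm G X).iter (n + 1)).V := fun n =>
      θlift fun x => (θ (n + 1) x).comp
        (hty (fun x g => (s x)⁻¹ * g * s (g⁻¹ • x)) (fun _ g => g) s n x)
    rw [Cx.Hom.map_eq_of_homotopy _ (Cx.Hom.id _) H]
    · exact Cx.Hom.map_id_of _ (fun _ _ => rfl) y
    · intro v
      refine θ_hom_ext (f := ((perm G X).bar.d 0).comp (H 0))
        (f' := ((pt j x₀ hx).bar.comp T).f 0 - (Cx.Hom.id _).f 0) (fun x c => ?_) v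
      rw [AddMonoidHom.comp_apply, AddMonoidHom.sub_apply, hval, θlift_θ, AddMonoidHom.comp_apply,
        d_hty_zero _ _ _ (fun _ => x₀) (fun x => x), fam_id]
      · rfl
      · exact fun x => by rw [inv_smul_eq_iff, hsx]
    · intro n v
      refine θ_hom_ext
        (f := ((perm G X).bar.d (n + 1)).comp (H (n + 1)) + (H n).comp ((perm G X).bar.d n))
        (f' := ((pt j x₀ hx).bar.comp T).f (n + 1) - (Cx.Hom.id _).f (n + 1)) (fun x c => ?_) v
      induction c using iter_induction with
      | h0 => simp
      | ha a b ha hb => rw [map_add, map_add, map_add, ha, hb]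
      | hs g c =>
        rw [AddMonoidHom.add_apply, AddMonoidHom.comp_apply, AddMonoidHom.comp_apply,
          AddMonoidHom.sub_apply, hval, θlift_θ, AddMonoidHom.comp_apply, d_θ, map_sub,
          θlift_θ, θlift_θ, AddMonoidHom.comp_apply, AddMonoidHom.comp_apply,
          d_hty_succ _ _ _ (fun _ => x₀) (fun x => x), fam_id]
        · rfl
        · intro x g h
          rw [mul_inv_rev, mul_smul]; group
        · exact fun _ _ _ => rfl
        · intro x g; group
        · exact fun x => by rw [inv_smul_eq_iff, hsx]
        · exact fun _ _ => rfl
  exact Function.bijective_iff_has_inverse.2 ⟨T.map n, hleft, hright⟩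

end Shapiro
end GMod

namespace GMod

variable {G G' A : Type} [Group G] [Group G'] [Group A]
variable {X Y : Type} [MulAction G X] [MulAction G Y]

/-! ### Conjugation and cross products with a centralizing element -/

section Prism

variable (j j' : A →* G) (g : G) (x : X)

/-- The prism between a homomorphism and a conjugate of it. -/
noncomputable def prism (n : ℕ) : ((triv A).iter n).V →+ ((perm G X).iter (n + 1)).V :=
  (θ (n + 1) (g • x)).comp
    (hty (X := Unit) (fun _ a => j a) (fun _ a => j' a) (fun _ => g) n ())

lemma fam_hom (n : ℕ) (c : ((triv A).iter n).V) :
    fam (X := Unit) (fun _ a => j a) n () c = ((trivHom j).iter n).f c := by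
  induction n with
  | zero => rfl
  | succ n ih =>
    refine iter_hom_ext (fun g c => ?_) c
    rw [fam_cons, Hom.iter_cons]
    exact congrArg _ (ih c)

lemma d_prism_zero (hx : ∀ a, j a • x = x) (hx' : ∀ a, j' a • g • x = g • x)
    (c : ((triv A).iter 0).V) :
    (perm G X).bar.d 0 (prism j j' g x 0 c) =
      ((pt j x hx).iter 0).f c - ((pt j' (g • x) hx').iter 0).f c := by
  rw [prism, AddMonoidHom.comp_apply,
    d_hty_zero _ _ _ (fun _ => x) (fun _ => g • x) (fun _ => inv_smul_smul _ _),
    fam_hom, fam_hom, pt_iter, pt_iter]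

lemma d_prism_succ (hg : ∀ a, j' a * g = g * j a) (hx : ∀ a, j a • x = x)
    (hx' : ∀ a, j' a • g • x = g • x) (n : ℕ) (c : ((triv A).iter (n + 1)).V) :
    (perm G X).bar.d (n + 1) (prism j j' g x (n + 1) c) + prism j j' g x n ((triv A).bar.d n c) =
      ((pt j x hx).iter (n + 1)).f c - ((pt j' (g • x) hx').iter (n + 1)).f c := by
  refine iter_hom_ext (f := ((perm G X).bar.d (n + 1)).comp (prism j j' g x (n + 1)) +
    (prism j j' g x n).comp ((triv A).bar.d n))
    (f' := ((pt j x hx).iter (n + 1)).f - ((pt j' (g • x) hx').iter (n + 1)).f)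
    (fun a c => ?_) c
  have := d_hty_succ (X := Unit) (fun _ a => j a) (fun _ a => j' a) (fun _ => g)
    (fun _ => x) (fun _ => g • x) (fun _ _ _ => map_mul _ _ _) (fun _ _ _ => map_mul _ _ _)
    (fun _ => hg) (fun _ => inv_smul_smul _ _)
    (fun _ a => by rw [inv_smul_eq_iff, hx']) n () a c
  rw [fam_hom, fam_hom] at this
  rw [AddMonoidHom.add_apply, AddMonoidHom.comp_apply, AddMonoidHom.comp_apply,
    AddMonoidHom.sub_apply, pt_iter, pt_iter, d_cons, map_sub]
  exact this

lemma pt_map_conj (hg : ∀ a, j' a * g = g * j a) (hx : ∀ a, j a • x = x)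
    (hx' : ∀ a, j' a • g • x = g • x) (n : ℕ) (y : h A n) :
    (pt j x hx).map n y = (pt j' (g • x) hx').map n y :=
  DFunLike.congr_fun (Cx.Hom.map_eq_of_homotopy (pt j x hx).bar (pt j' (g • x) hx').bar
    (prism j j' g x) (d_prism_zero j j' g x hx hx') (d_prism_succ j j' g x hg hx hx') n) y

lemma hmap_eq_aug_pt (hx : ∀ a, j a • x = x) (n : ℕ) (y : h A n) :
    hmap j n y = (aug G X).map n ((pt j x hx).map n y) :=
  Hom.map_comp _ _ _ (fun _ => rfl) (fun v => (aug_single x v).symm) n y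

lemma hmap_conj (hg : ∀ a, j' a * g = g * j a) (n : ℕ) (y : h A n) :
    hmap j n y = hmap j' n y := by
  rw [hmap_eq_aug_pt j (X := Unit) () (fun _ => rfl), hmap_eq_aug_pt j' (X := Unit) ()
    (fun _ => rfl), pt_map_conj j j' g () hg _ (fun _ => rfl)]

variable {g}

/-- The chain-level cross product with a centralizing element. -/
noncomputable def crossX (n : ℕ) : ((triv A).iter n).V →+ ((triv G).iter (n + 1)).V :=
  ((aug G Unit).iter (n + 1)).f.comp (prism j j g () n)

lemma crossX_eq (n : ℕ) (c : ((triv A).iter n).V) :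
    ((aug G X).iter (n + 1)).f (prism j j g x n c) = crossX (g := g) j n c := by
  rw [crossX, AddMonoidHom.comp_apply, prism, prism, AddMonoidHom.comp_apply,
    AddMonoidHom.comp_apply, aug_θ, aug_θ]

lemma d_crossX_zero (c : ((triv A).iter 0).V) :
    (triv G).bar.d 0 (crossX (g := g) j 0 c) = 0 := by
  change (triv G).bar.d 0 (((aug G Unit).bar).f 1 (prism j j g () 0 c)) = 0
  rw [← Cx.Hom.comm, d_prism_zero j j g () (fun _ => rfl) (fun _ => rfl)]
  change (aug G Unit).bar.f 0 (_ - _) = 0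
  rw [sub_eq_zero.2 rfl, map_zero]

lemma d_crossX_succ (hg : ∀ a, j a * g = g * j a) (n : ℕ) (c : ((triv A).iter (n + 1)).V) :
    (triv G).bar.d (n + 1) (crossX (g := g) j (n + 1) c) +
      crossX (g := g) j n ((triv A).bar.d n c) = 0 := by
  change (triv G).bar.d (n + 1) (((aug G Unit).bar).f (n + 2) (prism j j g () (n + 1) c)) +
    ((aug G Unit).bar).f (n + 1) (prism j j g () n ((triv A).bar.d n c)) = 0
  rw [← Cx.Hom.comm, ← map_add, d_prism_succ j j g () hg (fun _ => rfl) (fun _ => rfl)]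
  change (aug G Unit).bar.f (n + 1) (_ - _) = 0
  rw [sub_eq_zero.2 rfl, map_zero]

lemma crossX_mem (hg : ∀ a, j a * g = g * j a) (n : ℕ) (z : (triv A).bar.Z n) :
    crossX (g := g) j n z ∈ (triv G).bar.Z (n + 1) := by
  rw [Cx.mem_Z_succ]
  cases n with
  | zero => exact d_crossX_zero j _
  | succ n =>
    have := d_crossX_succ j hg n z
    rwa [Cx.mem_Z_succ.1 z.2, map_zero, add_zero] at this

/-- The cross product with a centralizing element. -/
noncomputable def cross (hg : ∀ a, j a * g = g * j a) (n : ℕ) : h A n →+ h G (n + 1) :=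
  QuotientAddGroup.lift ((triv A).bar.B n) (((triv G).bar.cls (n + 1)).comp
    (((crossX (g := g) j n).comp ((triv A).bar.Z n).subtype).codRestrict _ (crossX_mem j hg n))) (by
    rintro ⟨z, hz⟩ ⟨y, hy⟩
    change (triv A).bar.d n y = z at hy
    change (triv G).bar.cls (n + 1) _ = 0
    rw [Cx.cls_eq_zero]
    refine ⟨-crossX (g := g) j (n + 1) y, ?_⟩
    have := d_crossX_succ j hg n y
    rw [map_neg, neg_eq_iff_add_eq_zero, ← this, hy]
    rfl)

lemma cross_cls (hg : ∀ a, j a * g = g * j a) (n : ℕ) (z : (triv A).bar.Z n) :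
    cross j hg n ((triv A).bar.cls n z) =
      (triv G).bar.cls (n + 1) ⟨crossX (g := g) j n z, crossX_mem j hg n z⟩ := rfl

lemma δ_cross {E : GMod G} (i : Hom (MonoidHom.id G) E (perm G X))
    (hi : Function.Injective i.f) (hp : Function.Surjective (aug G X).f)
    (he : Function.Exact i.f (aug G X).f) (hg : ∀ a, j a * g = g * j a) (hx : ∀ a, j a • x = x)
    (e : Hom j (triv A) E)
    (hie : ∀ a, i.f (e.f a) + Finsupp.single (g • x) a = Finsupp.single x a)
    (n : ℕ) (y : h A n) :
    (ses i (aug G X) hi hp he).δ n (cross j hg n y) = e.map n y := by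
  obtain ⟨z, rfl⟩ := Cx.cls_surj y
  have hx' : ∀ a, j a • g • x = g • x := fun a => by rw [smul_smul, hg, mul_smul, hx]
  rw [cross_cls, Hom.map, Cx.Hom.map_cls]
  refine Cx.SES.δ_cls _ (b := prism j j g x n z) (crossX_eq j x n z) ?_
  let K : Hom j (triv A) (perm G X) := ⟨i.f.comp e.f, fun a v => by
    rw [AddMonoidHom.comp_apply, e.comm, i.comm]; rfl⟩
  have h1 : ∀ v, (K.iter n).f v = (i.iter n).f ((e.iter n).f v) :=
    fun v => Hom.iter_comp e i K (fun _ => rfl) (fun _ => rfl) n v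
  have h2 : ∀ v, ((pt j x hx).iter n).f v = (K.iter n).f v + ((pt j (g • x) hx').iter n).f v :=
    fun v => Hom.iter_add K _ _ (fun a => (hie a).symm) n v
  change (i.iter n).f ((e.iter n).f z) = (perm G X).bar.d n (prism j j g x n z)
  have h3 : (perm G X).bar.d n (prism j j g x n z) =
      ((pt j x hx).iter n).f z - ((pt j (g • x) hx').iter n).f z := by
    cases n with
    | zero => exact d_prism_zero j j g x hx hx' _
    | succ n =>
      rw [← d_prism_succ j j g x hg hx hx' n z, Cx.mem_Z_succ.1 z.2, map_zero, add_zero]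
  rw [h3, h2, h1, add_sub_cancel_right]

end Prism

/-! ### Degree zero and degree one -/

/-- The degree-zero homology class of an integer. -/
noncomputable def c0 (G : Type) [Group G] : ℤ →+ h G 0 :=
  ((triv G).bar.cls 0).comp
    (AddMonoidHom.codRestrict (AddMonoidHom.id ((triv G).iter 0).V) _ fun _ => trivial)

lemma c0_bijective : Function.Bijective (c0 G) := by
  constructor
  · rw [injective_iff_map_eq_zero]
    intro a ha
    obtain ⟨y, hy⟩ := Cx.cls_eq_zero.1 ha
    have hya : (triv G).bar.d 0 y = a := hy
    refine hya.symm.trans ?_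
    refine iter_hom_ext (M := triv G) (n := 0) (f := (triv G).bar.d 0) (f' := 0)
      (fun g v => ?_) y
    rw [d_cons]
    exact sub_self _
  · intro y
    obtain ⟨z, rfl⟩ := Cx.cls_surj y
    exact ⟨z.1, rfl⟩

lemma hmap_c0 (φ : G →* G') (a : ℤ) : hmap φ 0 (c0 G a) = c0 G' a := rfl

lemma hmap_zero_bijective (φ : G →* G') : Function.Bijective (hmap φ 0) := by
  have h1 : hmap φ 0 ∘ c0 G = c0 G' := rfl
  rw [← Function.Bijective.of_comp_iff _ (c0_bijective (G := G)), h1]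
  exact c0_bijective

/-- The generator of the chains of degree zero. -/
def one0 (G : Type) [Group G] : ((triv G).iter 0).V := (1 : ℤ)

lemma eq_zsmul_one0 (v : ((triv G).iter 0).V) : ∃ k : ℤ, v = k • one0 G := by
  refine ⟨v, ?_⟩
  exact (mul_one (M := ℤ) v).symm

/-- The degree-one class of a group element. -/
noncomputable def c1 (g : G) : h G 1 :=
  (triv G).bar.cls 1 ⟨cons g (one0 G), by
    rw [Cx.mem_Z_succ, d_cons]; exact sub_self _⟩

lemma c1_mul (a b : G) : c1 (a * b) = c1 a + c1 b := by
  rw [c1, c1, c1, ← sub_eq_zero, ← map_add, ← map_sub, Cx.cls_eq_zero]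
  refine ⟨-cons a (cons b (one0 G)), ?_⟩
  rw [map_neg, d_cons, R_cons]
  change -(cons b _ - (cons (a * b) _ - cons a _)) = cons (a * b) _ - (cons a _ + cons b _)
  abel_nf
  rfl

/-- The degree-one class as a homomorphism. -/
noncomputable def c1Hom (G : Type) [Group G] : G →* Multiplicative (h G 1) where
  toFun g := Multiplicative.ofAdd (c1 g)
  map_one' := by
    have := c1_mul (1 : G) 1
    rw [mul_one, left_eq_add] at this
    rw [this]; rfl
  map_mul' a b := by rw [c1_mul]; rfl

lemma hmap_c1 (φ : G →* G') (g : G) : hmap φ 1 (c1 g) = c1 (φ g) := by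
  rw [c1, hmap, Hom.map, Cx.Hom.map_cls]
  congr 1
  exact Subtype.ext (Hom.iter_cons (trivHom φ) 0 g (one0 G))

lemma h1_mem_of_c1 (K : AddSubgroup (h G 1)) (hK : ∀ g, c1 g ∈ K) (y : h G 1) : y ∈ K := by
  obtain ⟨⟨z, hz⟩, rfl⟩ := Cx.cls_surj y
  have hz1 : ∀ z, z ∈ (triv G).bar.Z 1 := fun z => by
    rw [Cx.mem_Z_succ]
    refine iter_hom_ext (M := triv G) (n := 0) (f := (triv G).bar.d 0) (f' := 0)
      (fun g v => ?_) z
    rw [d_cons]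
    exact sub_self _
  suffices hs : ∀ z : ((triv G).iter 1).V, (triv G).bar.cls 1 ⟨z, hz1 z⟩ ∈ K from hs z
  intro z
  induction z using iter_induction with
  | h0 => exact K.zero_mem
  | ha a b ha hb => exact K.add_mem ha hb
  | hs g v =>
    obtain ⟨k, rfl⟩ := eq_zsmul_one0 v
    have hv : (⟨cons g (k • one0 G), hz1 _⟩ : (triv G).bar.Z 1) =
        k • ⟨cons g (one0 G), hz1 _⟩ := Subtype.ext (map_zsmul _ _ _)
    rw [hv, map_zsmul]
    exact K.zsmul_mem (hK g) _

/-- The degree-one homology is generated by the classes of generators of the group. -/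
lemma h1_mem_of_closure (K : AddSubgroup (h G 1)) (s : Set G) (hs : Subgroup.closure s = ⊤)
    (hK : ∀ g ∈ s, c1 g ∈ K) (y : h G 1) : y ∈ K := by
  refine h1_mem_of_c1 K (fun g => ?_) y
  have hle : Subgroup.closure s ≤ (AddSubgroup.toSubgroup K).comap (c1Hom G) :=
    (Subgroup.closure_le _).2 hK
  exact hle (hs ▸ Subgroup.mem_top g)

/-! ### The trivial group and free coefficients -/

lemma h_subsingleton_of_trivial [Subsingleton G] (n : ℕ) (y : h G (n + 1)) : y = 0 := by
  obtain ⟨⟨z, hz⟩, rfl⟩ := Cx.cls_surj y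
  have hform : ∀ z : ((triv G).iter (n + 1)).V, ∃ v, z = cons 1 v := fun z => by
    induction z using iter_induction with
    | h0 => exact ⟨0, (map_zero _).symm⟩
    | ha a b ha hb =>
      obtain ⟨v, rfl⟩ := ha
      obtain ⟨w, rfl⟩ := hb
      exact ⟨v + w, (map_add _ _ _).symm⟩
    | hs g v => exact ⟨v, by rw [Subsingleton.elim g 1]⟩
  obtain ⟨v, rfl⟩ := hform z
  rw [Cx.mem_Z_succ, d_cons, sub_eq_zero] at hz
  rw [Cx.cls_eq_zero]
  refine ⟨cons 1 (cons 1 v), ?_⟩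
  rw [d_cons, R_cons, ← hz, mul_one, sub_self, sub_zero]

/-- The point `1` of the regular permutation module. -/
lemma pt_one_bijective (n : ℕ) : Function.Bijective
    ((pt (1 : Unit →* G) (1 : G) (fun _ => one_smul _ _)).map n) :=
  pt_map_bijective _ _ (fun _ _ _ => rfl) _ (fun g hg => ⟨(), by simpa using hg.symm⟩)
    (fun x => ⟨x, by simp⟩) n

lemma H_perm_self (n : ℕ) (y : (perm G G).H (n + 1)) : y = 0 := by
  obtain ⟨z, rfl⟩ := (pt_one_bijective (G := G) (n + 1)).2 y
  rw [h_subsingleton_of_trivial n z, map_zero]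

/-! ### Disjoint unions -/

/-- The projection of the permutation module of a disjoint union to the first summand. -/
noncomputable def permFst : Hom (MonoidHom.id G) (perm G (X ⊕ Y)) (perm G X) where
  f := Finsupp.liftAddHom (Sum.elim (fun x => Finsupp.singleAddHom x) fun _ => 0)
  comm g v := by
    induction v using Finsupp.induction_linear with
    | zero => simp
    | add a b ha hb => rw [map_add, map_add, map_add, map_add, ha, hb]
    | single k v => cases k <;> simp [-Finsupp.liftAddHom_apply, Finsupp.liftAddHom_apply_single]

/-- The projection of the permutation module of a disjoint union to the second summand. -/
noncomputable def permSnd : Hom (MonoidHom.id G) (perm G (X ⊕ Y)) (perm G Y) where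
  f := Finsupp.liftAddHom (Sum.elim (fun _ => 0) fun x => Finsupp.singleAddHom x)
  comm g v := by
    induction v using Finsupp.induction_linear with
    | zero => simp
    | add a b ha hb => rw [map_add, map_add, map_add, map_add, ha, hb]
    | single k v => cases k <;> simp [-Finsupp.liftAddHom_apply, Finsupp.liftAddHom_apply_single]

/-- The inclusion of the first summand. -/
noncomputable def permInl (G X Y : Type) [Group G] [MulAction G X] [MulAction G Y] :
    Hom (MonoidHom.id G) (perm G X) (perm G (X ⊕ Y)) :=
  permHom _ Sum.inl fun _ _ => rfl

/-- The inclusion of the second summand. -/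
noncomputable def permInr (G X Y : Type) [Group G] [MulAction G X] [MulAction G Y] :
    Hom (MonoidHom.id G) (perm G Y) (perm G (X ⊕ Y)) :=
  permHom _ Sum.inr fun _ _ => rfl

/-- An equivariant additive map which is a composite. -/
noncomputable def Hom.comp {M N P : GMod G} (E : Hom (MonoidHom.id G) N P)
    (F : Hom (MonoidHom.id G) M N) : Hom (MonoidHom.id G) M P :=
  ⟨E.f.comp F.f, fun g v => by
    rw [AddMonoidHom.comp_apply, F.comm, E.comm]; rfl⟩

lemma Hom.comp_map {M N P : GMod G} (E : Hom (MonoidHom.id G) N P)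
    (F : Hom (MonoidHom.id G) M N) (n : ℕ) (x : M.H n) :
    (E.comp F).map n x = E.map n (F.map n x) :=
  Hom.map_comp _ _ _ (fun _ => rfl) (fun _ => rfl) n x

lemma permFst_inl (x : X →₀ ℤ) : (permFst (G := G) (Y := Y)).f ((permInl G X Y).f x) = x := by
  induction x using Finsupp.induction_linear with
  | zero => simp
  | add a b ha hb => rw [map_add, map_add, ha, hb]
  | single k v => simp [-Finsupp.liftAddHom_apply, Finsupp.liftAddHom_apply_single, permFst, permInl, permHom]

lemma permFst_inr (x : Y →₀ ℤ) : (permFst (G := G) (X := X)).f ((permInr G X Y).f x) = 0 := by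
  induction x using Finsupp.induction_linear with
  | zero => simp
  | add a b ha hb => rw [map_add, map_add, ha, hb, add_zero]
  | single k v => simp [-Finsupp.liftAddHom_apply, Finsupp.liftAddHom_apply_single, permFst, permInr, permHom]

lemma permSnd_inl (x : X →₀ ℤ) : (permSnd (G := G) (Y := Y)).f ((permInl G X Y).f x) = 0 := by
  induction x using Finsupp.induction_linear with
  | zero => simp
  | add a b ha hb => rw [map_add, map_add, ha, hb, add_zero]
  | single k v => simp [-Finsupp.liftAddHom_apply, Finsupp.liftAddHom_apply_single, permSnd, permInl, permHom]

lemma permSnd_inr (x : Y →₀ ℤ) : (permSnd (G := G) (X := X)).f ((permInr G X Y).f x) = x := by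
  induction x using Finsupp.induction_linear with
  | zero => simp
  | add a b ha hb => rw [map_add, map_add, ha, hb]
  | single k v => simp [-Finsupp.liftAddHom_apply, Finsupp.liftAddHom_apply_single, permSnd, permInr, permHom]

lemma perm_sum_decomp (v : X ⊕ Y →₀ ℤ) :
    v = (permInl G X Y).f (permFst.f v) + (permInr G X Y).f (permSnd.f v) := by
  induction v using Finsupp.induction_linear with
  | zero => simp
  | add a b ha hb =>
    simp only [map_add]
    rw [add_add_add_comm, ← ha, ← hb]
  | single k v => cases k <;> simp [-Finsupp.liftAddHom_apply, Finsupp.liftAddHom_apply_single, permFst, permSnd, permInl, permInr, permHom]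

/-- The homology of a disjoint union is the product of the homologies. -/
lemma perm_sum_bijective (n : ℕ) : Function.Bijective
    (AddMonoidHom.coprod ((permInl G X Y).map n) ((permInr G X Y).map n)) := by
  have e1 : ∀ x, permFst.map n ((permInl G X Y).map n x) = x := fun x => by
    rw [← Hom.comp_map]; exact Hom.map_id _ permFst_inl n x
  have e2 : ∀ x, permFst.map n ((permInr G X Y).map n x) = 0 := fun x => by
    rw [← Hom.comp_map]; exact Hom.map_zero_of _ permFst_inr n x
  have e3 : ∀ x, permSnd.map n ((permInl G X Y).map n x) = 0 := fun x => by
    rw [← Hom.comp_map]; exact Hom.map_zero_of _ permSnd_inl n x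
  have e4 : ∀ x, permSnd.map n ((permInr G X Y).map n x) = x := fun x => by
    rw [← Hom.comp_map]; exact Hom.map_id _ permSnd_inr n x
  refine Function.bijective_iff_has_inverse.2
    ⟨fun v => (permFst.map n v, permSnd.map n v), fun x => ?_, fun v => ?_⟩
  · simp [e1, e2, e3, e4]
  · change (permInl G X Y).map n (permFst.map n v) + (permInr G X Y).map n (permSnd.map n v) = v
    rw [← Hom.comp_map, ← Hom.comp_map, ← Hom.map_add _ _
      (⟨AddMonoidHom.id _, fun _ _ => rfl⟩ : Hom (MonoidHom.id G) _ _) perm_sum_decomp]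
    exact Hom.map_id _ (fun _ => rfl) n v

end GMod

namespace GMod

section Tree

variable {G A : Type} [Group G] [Group A] {E V X Y : Type} [MulAction G E] [MulAction G V]
  [MulAction G X] [MulAction G Y]

/-! ### Graphs with a group action -/

/-- The boundary map of an equivariant graph. -/
noncomputable def bd (o t : E → V) (ho : ∀ (g : G) e, o (g • e) = g • o e)
    (ht : ∀ (g : G) e, t (g • e) = g • t e) :
    Hom (MonoidHom.id G) (perm G E) (perm G V) where
  f := Finsupp.mapDomain.addMonoidHom o - Finsupp.mapDomain.addMonoidHom t
  comm g v := by
    have h1 := (permHom (MonoidHom.id G) o ho).comm g v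
    have h2 := (permHom (MonoidHom.id G) t ht).comm g v
    rw [AddMonoidHom.sub_apply, AddMonoidHom.sub_apply, map_sub]
    exact congrArg₂ (· - ·) h1 h2

variable {o t : E → V} (ho : ∀ (g : G) e, o (g • e) = g • o e)
  (ht : ∀ (g : G) e, t (g • e) = g • t e)

lemma bd_single (e : E) (a : ℤ) : (bd o t ho ht).f (Finsupp.single e a) =
    Finsupp.single (o e) a - Finsupp.single (t e) a := by
  simp [bd, AddMonoidHom.sub_apply]

lemma bd_injective (hs : ∀ e, ∃ s : V → ℤ, s (o e) - s (t e) = 1 ∧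
    ∀ e', e' ≠ e → s (o e') = s (t e')) : Function.Injective (bd o t ho ht).f := by
  classical
  rw [injective_iff_map_eq_zero]
  intro x hx
  ext e
  obtain ⟨s, h1, h2⟩ := hs e
  let L : (V →₀ ℤ) →+ ℤ := Finsupp.liftAddHom fun v => AddMonoidHom.mulLeft (s v)
  have hL : L.comp (bd o t ho ht).f = Finsupp.applyAddHom e := by
    refine Finsupp.addHom_ext fun e' a => ?_
    rw [AddMonoidHom.comp_apply, bd_single, map_sub, Finsupp.liftAddHom_apply_single,
      Finsupp.liftAddHom_apply_single]
    simp only [AddMonoidHom.coe_mulLeft, Finsupp.applyAddHom_apply]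
    by_cases h : e' = e
    · subst h
      rw [Finsupp.single_eq_same, ← sub_mul, h1, one_mul]
    · rw [Finsupp.single_eq_of_ne (Ne.symm h), h2 e' h, sub_self]
  have := DFunLike.congr_fun hL x
  rw [AddMonoidHom.comp_apply, hx, map_zero] at this
  exact this.symm

/-- It suffices to separate the ends of representatives of the edges. -/
lemma bd_injective_of_rep (R : Set E) (hR : ∀ e, ∃ e₀ ∈ R, ∃ g : G, e = g • e₀)
    (hs : ∀ e ∈ R, ∃ s : V → ℤ, s (o e) - s (t e) = 1 ∧
      ∀ e', e' ≠ e → s (o e') = s (t e')) : Function.Injective (bd o t ho ht).f := by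
  refine bd_injective ho ht fun e => ?_
  obtain ⟨e₀, he₀, g, rfl⟩ := hR e
  obtain ⟨s, h1, h2⟩ := hs e₀ he₀
  refine ⟨fun v => s (g⁻¹ • v), ?_, fun e' he' => ?_⟩
  · simp only [ho, ht, inv_smul_smul, h1]
  · have := h2 (g⁻¹ • e') (fun h => he' (by rw [← h, smul_inv_smul]))
    rwa [ho, ht] at this

/-- Two vertices are linked if their difference bounds. -/
def Linked (o t : E → V) (v w : V) : Prop :=
  ∃ x : E →₀ ℤ, Finsupp.mapDomain o x - Finsupp.mapDomain t x =
    Finsupp.single v 1 - Finsupp.single w 1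

lemma Linked.refl (v : V) : Linked o t v v := ⟨0, by simp⟩

lemma Linked.symm {v w : V} (h : Linked o t v w) : Linked o t w v := by
  obtain ⟨x, hx⟩ := h
  refine ⟨-x, ?_⟩
  rw [← Finsupp.mapDomain.addMonoidHom_apply, ← Finsupp.mapDomain.addMonoidHom_apply] at hx ⊢
  rw [map_neg, map_neg, ← neg_sub (Finsupp.single v 1), ← hx]
  abel

lemma Linked.trans {u v w : V} (h : Linked o t u v) (h' : Linked o t v w) : Linked o t u w := by
  obtain ⟨x, hx⟩ := h
  obtain ⟨y, hy⟩ := h'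
  refine ⟨x + y, ?_⟩
  rw [Finsupp.mapDomain_add, Finsupp.mapDomain_add, add_sub_add_comm, hx, hy]
  abel

lemma linked_edge (e : E) : Linked o t (o e) (t e) := ⟨Finsupp.single e 1, by simp⟩

lemma Linked.smul {v w : V} (h : Linked o t v w) (g : G)
    (ho : ∀ (g : G) e, o (g • e) = g • o e) (ht : ∀ (g : G) e, t (g • e) = g • t e) :
    Linked o t (g • v) (g • w) := by
  obtain ⟨x, hx⟩ := h
  refine ⟨((perm G E).R g x), ?_⟩
  have h1 := (bd o t ho ht).comm g x
  have h2 : (bd o t ho ht).f x = Finsupp.single v 1 - Finsupp.single w 1 := hx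
  rw [h2, map_sub] at h1
  refine h1.trans ?_
  simp

/-- The elements moving a vertex to a linked vertex form a subgroup. -/
lemma linked_of_closure (S : Set G) (hS : Subgroup.closure S = ⊤) (v₀ : V)
    (ho : ∀ (g : G) e, o (g • e) = g • o e) (ht : ∀ (g : G) e, t (g • e) = g • t e)
    (h : ∀ g ∈ S, Linked o t (g • v₀) v₀) (g : G) : Linked o t (g • v₀) v₀ := by
  have hg : g ∈ Subgroup.closure S := hS ▸ Subgroup.mem_top g
  induction hg using Subgroup.closure_induction with
  | mem x hx => exact h x hx
  | one => rw [one_smul]; exact Linked.refl _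
  | mul x y _ _ hx hy => rw [mul_smul]; exact (hy.smul x ho ht).trans hx
  | inv x _ hx =>
    have := (hx.smul x⁻¹ ho ht).symm
    rwa [inv_smul_smul] at this

lemma bd_exact (v₀ : V) (hc : ∀ v, Linked o t v v₀) :
    Function.Exact (bd o t ho ht).f (aug G V).f := by
  have key : ∀ w : V →₀ ℤ, ∃ x, (bd o t ho ht).f x = w - Finsupp.single v₀ ((aug G V).f w) := by
    intro w
    induction w using Finsupp.induction_linear with
    | zero => exact ⟨0, by simp⟩
    | add a b ha hb =>
      obtain ⟨x, hx⟩ := ha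
      obtain ⟨y, hy⟩ := hb
      refine ⟨x + y, ?_⟩
      rw [map_add, map_add, hx, hy, Finsupp.single_add]
      abel
    | single v a =>
      obtain ⟨x, hx⟩ := hc v
      refine ⟨a • x, ?_⟩
      have h2 : (bd o t ho ht).f x = Finsupp.single v 1 - Finsupp.single v₀ 1 := hx
      rw [map_zsmul, h2, aug_single, smul_sub, Finsupp.smul_single, Finsupp.smul_single,
        smul_eq_mul, mul_one]
  intro w
  constructor
  · intro hw
    obtain ⟨x, hx⟩ := key w
    exact ⟨x, by rw [hx, hw]; simp⟩
  · rintro ⟨x, rfl⟩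
    induction x using Finsupp.induction_linear with
    | zero => simp
    | add a b ha hb => rw [map_add, map_add, ha, hb, add_zero]
    | single e a => rw [bd_single, map_sub, aug_single, aug_single, sub_self]

lemma aug_surjective (v₀ : V) : Function.Surjective (aug G V).f :=
  fun a => ⟨Finsupp.single v₀ a, aug_single _ _⟩

/-! ### Coset spaces -/

/-- The equivariant map from a coset space determined by a fixed point. -/
def qmap (H : Subgroup G) (y : Y) (hy : ∀ h ∈ H, h • y = y) : G ⧸ H → Y :=
  Quotient.lift (fun g : G => g • y) (by
    intro a b hab
    have := hy _ (QuotientGroup.leftRel_apply.1 hab)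
    change a • y = b • y
    rw [← this, smul_smul, mul_inv_cancel_left, this])

/-- A function on a coset space determined by a right-invariant function. -/
def qfun (H : Subgroup G) (f : G → ℤ) (hf : ∀ g, ∀ h ∈ H, f (g * h) = f g) : G ⧸ H → ℤ :=
  Quotient.lift f (by
    intro a b hab
    rw [← hf a _ (QuotientGroup.leftRel_apply.1 hab), mul_inv_cancel_left])

lemma range_smul_mk_one (j : A →* G) (a : A) :
    j a • ((1 : G) : G ⧸ j.range) = ((1 : G) : G ⧸ j.range) := by
  rw [MulAction.Quotient.smul_coe, smul_eq_mul, mul_one, eq_comm, QuotientGroup.eq]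
  simp

/-- Shapiro's lemma for a coset space. -/
lemma pt_quot_bijective (j : A →* G) (hj : Function.Injective j) (n : ℕ) : Function.Bijective
    ((pt j ((1 : G) : G ⧸ j.range) (range_smul_mk_one j)).map n) := by
  refine pt_map_bijective _ _ hj _ (fun g hg => ?_) (fun x => ?_) n
  · rw [MulAction.Quotient.smul_coe, smul_eq_mul, mul_one, eq_comm, QuotientGroup.eq, inv_one,
      one_mul] at hg
    exact hg
  · induction x using QuotientGroup.induction_on with
    | H a => exact ⟨a, by rw [MulAction.Quotient.smul_coe, smul_eq_mul, mul_one]⟩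

lemma coprod_bijective {P Q : Type} [AddCommGroup P] [AddCommGroup Q] (n : ℕ)
    (a : P →+ (perm G X).H n) (b : Q →+ (perm G Y).H n) (ha : Function.Bijective a)
    (hb : Function.Bijective b) : Function.Bijective
    (AddMonoidHom.coprod (((permInl G X Y).map n).comp a) (((permInr G X Y).map n).comp b)) := by
  have := (perm_sum_bijective (G := G) (X := X) (Y := Y) n).comp (ha.prodMap hb)
  exact this

/-- The composite of a fixed point and an equivariant map is a fixed point. -/
lemma permHom_pt (f : X → Y) (hf : ∀ (g : G) x, f (g • x) = MonoidHom.id G g • f x) (j : A →* G)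
    (x : X) (hx : ∀ a, j a • x = x) (hy : ∀ a, j a • f x = f x) (n : ℕ) (y : h A n) :
    (permHom (MonoidHom.id G) f hf).map n ((pt j x hx).map n y) = (pt j (f x) hy).map n y := by
  refine (Hom.map_comp _ _ _ (fun _ => rfl) (fun v => ?_) n y).symm
  simp [permHom, pt]

lemma bd_pt (j : A →* G) (e : E) (he : ∀ a, j a • e = e) (hoe : ∀ a, j a • o e = o e)
    (hte : ∀ a, j a • t e = t e) (n : ℕ) (y : h A n) :
    (bd o t ho ht).map n ((pt j e he).map n y) =
      (pt j (o e) hoe).map n y - (pt j (t e) hte).map n y := by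
  let K : Hom j (triv A) (perm G V) := ⟨(bd o t ho ht).f.comp (pt j e he).f, fun a v => by
    rw [AddMonoidHom.comp_apply, (pt j e he).comm, (bd o t ho ht).comm]; rfl⟩
  have h1 := Hom.map_comp (pt j e he) (bd o t ho ht) K (fun _ => rfl) (fun _ => rfl) n y
  have h2 := Hom.map_add K (pt j (t e) hte) (pt j (o e) hoe) (fun v => by
    change _ = (bd o t ho ht).f (Finsupp.single e v) + Finsupp.single (t e) v
    rw [bd_single]
    change Finsupp.single (o e) v = _
    abel) n y
  rw [← h1, h2, add_sub_cancel_right]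

/-- The boundary is trivial on the degree-zero classes of edges with ends in one orbit. -/
lemma pt_zero_smul (j : A →* G) (hj : ∀ a, j a = 1) (x : X) (g : G) (n : ℕ) (y : h A n) :
    (pt j x (fun a => by rw [hj, one_smul])).map n y =
      (pt j (g • x) (fun a => by rw [hj, one_smul])).map n y :=
  pt_map_conj j j g x (fun a => by rw [hj, one_mul, mul_one]) _ _ n y

end Tree

/-! ### Free products -/

section FreeProduct

variable {P A B : Type} [Group P] [Group A] [Group B] (a : A →* P) (b : B →* P)

/-- The homology of a free product, recognized through its action on a tree. -/
theorem freeProduct_bijective (ha : Function.Injective a) (hb : Function.Injective b)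
    (hgen : Subgroup.closure (Set.range a ∪ Set.range b) = ⊤) (fA fB : P → ℤ)
    (hfA : ∀ w x, fA (w * a x) = fA w) (hfB : ∀ w x, fB (w * b x) = fB w)
    (h1 : fA 1 - fB 1 = 1) (h2 : ∀ w, w ≠ 1 → fA w = fB w) (n : ℕ) :
    Function.Bijective (AddMonoidHom.coprod (hmap a (n + 1)) (hmap b (n + 1))) := by
  let V := (P ⧸ a.range) ⊕ (P ⧸ b.range)
  let o : P → V := fun w => Sum.inl (w : P ⧸ a.range)
  let t : P → V := fun w => Sum.inr (w : P ⧸ b.range)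
  have ho : ∀ (g : P) e, o (g • e) = g • o e := fun _ _ => rfl
  have ht : ∀ (g : P) e, t (g • e) = g • t e := fun _ _ => rfl
  have hi : Function.Injective (bd o t ho ht).f := by
    refine bd_injective_of_rep ho ht {1} (fun e => ⟨1, rfl, e, by simp⟩) ?_
    rintro e rfl
    refine ⟨Sum.elim (qfun _ fA ?_) (qfun _ fB ?_), h1, fun e he => h2 e he⟩
    · rintro g _ ⟨x, rfl⟩; exact hfA g x
    · rintro g _ ⟨x, rfl⟩; exact hfB g x
  have hla : ∀ x : A, a x • o 1 = o 1 := fun x => congrArg Sum.inl (range_smul_mk_one a x)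
  have hlb : ∀ x : B, b x • t 1 = t 1 := fun x => congrArg Sum.inr (range_smul_mk_one b x)
  have hc0 : ∀ g : P, Linked o t (g • o 1) (o 1) := by
    refine linked_of_closure _ hgen _ ho ht ?_
    rintro g (⟨x, rfl⟩ | ⟨x, rfl⟩)
    · rw [hla]; exact Linked.refl _
    · have h3 := (linked_edge (o := o) (t := t) 1).smul (b x) ho ht
      rw [hlb] at h3
      exact h3.trans (linked_edge _).symm
  have hc : ∀ v, Linked o t v (o 1) := by
    rintro (q | q)
    · induction q using QuotientGroup.induction_on with
      | H g =>
        have := hc0 g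
        rwa [← ho, smul_eq_mul, mul_one] at this
    · induction q using QuotientGroup.induction_on with
      | H g =>
        have h3 := hc0 g
        rw [← ho, smul_eq_mul, mul_one] at h3
        exact (linked_edge (o := o) (t := t) g).symm.trans h3
  let S := ses (bd o t ho ht) (aug P V) hi (aug_surjective (o 1)) (bd_exact ho ht _ hc)
  have hbij := coprod_bijective (G := P) (n + 1) _ _ (pt_quot_bijective a ha (n + 1))
    (pt_quot_bijective b hb (n + 1))
  have hsurj : Function.Surjective (S.p.map (n + 1)) := by
    intro y
    refine (S.exact_right n y).1 ?_
    cases n with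
    | succ n => exact H_perm_self n _
    | zero =>
      let η : Hom (MonoidHom.id P) (perm P V) (triv P) := (aug P (P ⧸ a.range)).comp permFst
      have hη : ∀ v, ((η.comp (bd o t ho ht)).f) v = (aug P P).f v := fun v => by
        induction v using Finsupp.induction_linear with
        | zero => simp
        | add a b ha hb => rw [map_add, map_add, ha, hb]
        | single k v =>
          change (aug P _).f (permFst.f ((bd o t ho ht).f (Finsupp.single k v))) = _
          rw [bd_single, map_sub, aug_single]
          simp [-Finsupp.liftAddHom_apply, Finsupp.liftAddHom_apply_single, permFst, o, t]
          exact aug_single _ _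
      have hinj : Function.Injective ((aug P P).map 0) := by
        have h4 := hmap_zero_bijective (1 : Unit →* P)
        have h5 : ⇑(hmap (1 : Unit →* P) 0) = (aug P P).map 0 ∘
            (pt (1 : Unit →* P) (1 : P) (fun _ => one_smul _ _)).map 0 :=
          funext fun y => hmap_eq_aug_pt _ _ _ 0 y
        rw [h5] at h4
        exact ((Function.Bijective.of_comp_iff _ (pt_one_bijective 0)).1 h4).1
      apply hinj
      have h6 := Hom.map_congr (η.comp (bd o t ho ht)) (aug P P)
        (fun _ => rfl) hη 0 (S.δ 0 y)
      rw [map_zero, ← h6, Hom.comp_map]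
      have h7 : (bd o t ho ht).map 0 (S.δ 0 y) = 0 :=
        (S.exact_left 0).apply_apply_eq_zero y
      rw [h7, map_zero]
  have hinj : Function.Injective (S.p.map (n + 1)) := by
    rw [injective_iff_map_eq_zero]
    intro y hy
    obtain ⟨z, rfl⟩ := (S.exact_mid (n + 1) y).1 hy
    rw [H_perm_self n z, map_zero]
  convert Function.Bijective.comp (⟨hinj, hsurj⟩ : Function.Bijective (S.p.map (n + 1))) hbij
    using 1
  · funext z
    have e1 := hmap_eq_aug_pt a (o 1) hla (n + 1) z.1
    have e2 := hmap_eq_aug_pt b (t 1) hlb (n + 1) z.2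
    rw [← permHom_pt Sum.inl (fun _ _ => rfl) a _ (range_smul_mk_one a)] at e1
    rw [← permHom_pt Sum.inr (fun _ _ => rfl) b _ (range_smul_mk_one b)] at e2
    rw [AddMonoidHom.coprod_apply, e1, e2, ← map_add]
    rfl

end FreeProduct

/-! ### HNN extensions over the trivial group -/

section HNN

variable {P A : Type} [Group P] [Group A] (a : A →* P) (s : P)

/-- The homology of the free product with an infinite cyclic group, recognized through its action
on a tree. -/
theorem hnn_homology (ha : Function.Injective a)
    (hgen : Subgroup.closure (Set.range a ∪ {s}) = ⊤) (f : P → ℤ)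
    (hf : ∀ w x, f (w * a x) = f w) (h1 : f 1 - f s = 1)
    (h2 : ∀ w, w ≠ 1 → f w = f (w * s)) :
    (∀ n, Function.Bijective (hmap a (n + 2))) ∧ Function.Injective (hmap a 1) ∧
      ∃ δ : h P 1 →+ ℤ, Function.Surjective δ ∧ Function.Exact (hmap a 1) δ := by
  let o : P → P ⧸ a.range := fun w => w
  let t : P → P ⧸ a.range := fun w => (w * s : P)
  have ho : ∀ (g : P) e, o (g • e) = g • o e := fun _ _ => rfl
  have ht : ∀ (g : P) e, t (g • e) = g • t e := fun g e => by
    change ((g * e * s : P) : P ⧸ a.range) = ((g * (e * s) : P) : P ⧸ a.range)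
    rw [mul_assoc]
  have hi : Function.Injective (bd o t ho ht).f := by
    refine bd_injective_of_rep ho ht {1} (fun e => ⟨1, rfl, e, by simp⟩) ?_
    rintro e rfl
    refine ⟨qfun _ f ?_, ?_, fun e he => h2 e he⟩
    · rintro g _ ⟨x, rfl⟩; exact hf g x
    · change f 1 - f (1 * s) = 1
      rwa [one_mul]
  have hla : ∀ x : A, a x • o 1 = o 1 := fun x => range_smul_mk_one a x
  have hst : s • o 1 = t 1 := by
    change ((s * 1 : P) : P ⧸ a.range) = ((1 * s : P) : P ⧸ a.range)
    rw [mul_one, one_mul]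
  have hc : ∀ v, Linked o t v (o 1) := by
    intro q
    induction q using QuotientGroup.induction_on with
    | H g =>
      have : Linked o t (g • o 1) (o 1) := by
        refine linked_of_closure _ hgen _ ho ht ?_ g
        rintro g (⟨x, rfl⟩ | rfl)
        · rw [hla]; exact Linked.refl _
        · rw [hst]
          exact (linked_edge (o := o) (t := t) 1).symm
      rwa [← ho, smul_eq_mul, mul_one] at this
  let S := ses (bd o t ho ht) (aug P _) hi (aug_surjective (o 1)) (bd_exact ho ht _ hc)
  have hinj : ∀ n, Function.Injective (S.p.map (n + 1)) := by
    intro n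
    rw [injective_iff_map_eq_zero]
    intro y hy
    obtain ⟨z, rfl⟩ := (S.exact_mid (n + 1) y).1 hy
    rw [H_perm_self n z, map_zero]
  have hsurj : ∀ n, Function.Surjective (S.p.map (n + 2)) := fun n y =>
    (S.exact_right (n + 1) y).1 (H_perm_self n _)
  have hpt := fun n => pt_quot_bijective a ha n
  have hcomp : ∀ n, ⇑(hmap a n) = S.p.map n ∘ (pt a (o 1) hla).map n :=
    fun n => funext fun y => hmap_eq_aug_pt _ _ _ n y
  refine ⟨fun n => ?_, ?_, ?_⟩
  · rw [hcomp]
    exact Function.Bijective.comp ⟨hinj _, hsurj n⟩ (hpt _)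
  · rw [hcomp]
    exact (hinj 0).comp (hpt 1).1
  · let e0 := (AddEquiv.ofBijective (c0 Unit) c0_bijective).trans
      (AddEquiv.ofBijective _ (pt_one_bijective (G := P) 0))
    have hzero : ∀ y, S.i.map 0 y = 0 := by
      intro y
      obtain ⟨z, rfl⟩ := (pt_one_bijective (G := P) 0).2 y
      refine (bd_pt ho ht (1 : Unit →* P) 1 _ (fun _ => one_smul _ _) (fun _ => one_smul _ _)
        0 z).trans ?_
      rw [sub_eq_zero]
      refine (pt_zero_smul (1 : Unit →* P) (fun _ => rfl) (o 1) s 0 z).trans ?_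
      simp only [hst]
    refine ⟨(e0.symm : (perm P P).H 0 →+ ℤ).comp (S.δ 0), ?_, ?_⟩
    · refine e0.symm.surjective.comp (fun y => ?_)
      exact (S.exact_left 0 y).1 (hzero y)
    · intro y
      have h3 : (e0.symm : (perm P P).H 0 →+ ℤ).comp (S.δ 0) y = 0 ↔ S.δ 0 y = 0 :=
        e0.symm.map_eq_zero_iff
      rw [h3, S.exact_right 0 y, hcomp, (hpt 1).2.range_comp]

end HNN

end GMod

namespace GMod

/-- An action on a tree with two orbits of vertices, whose stabilizers are two images of one group,
and three orbits of edges. -/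
structure TreeAction (G C E₁ E₂ E₃ : Type) [Group G] [Group C] [Group E₁] [Group E₂]
    [Group E₃] where
  /-- The first vertex group. -/
  j : C →* G
  /-- The second vertex group. -/
  j' : C →* G
  /-- The first edge group. -/
  φ₁ : E₁ →* C
  /-- The second edge group. -/
  φ₂ : E₂ →* C
  /-- The third edge group. -/
  φ₃ : E₃ →* C
  /-- The element moving the end of the second edge to the base vertex. -/
  g₂ : G
  /-- The element moving the end of the third edge to the base vertex. -/
  g₃ : G
  j_inj : Function.Injective j
  j'_inj : Function.Injective j'
  φ₁_inj : Function.Injective φ₁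
  φ₂_inj : Function.Injective φ₂
  φ₃_inj : Function.Injective φ₃
  conj₁ : ∀ x, j' (φ₁ x) = j (φ₁ x)
  conj₂ : ∀ x, j' (φ₂ x) * g₂ = g₂ * j (φ₂ x)
  conj₃ : ∀ x, j' (φ₃ x) * g₃ = g₃ * j (φ₃ x)
  gen : Subgroup.closure ((Set.range j ∪ Set.range j') ∪ {g₂, g₃}) = ⊤
  sep₁ : ∃ f f' : G → ℤ, (∀ w x, f (w * j x) = f w) ∧ (∀ w x, f' (w * j' x) = f' w) ∧
    f 1 - f' 1 = 1 ∧ (∀ w, (∀ x, j (φ₁ x) ≠ w) → f w = f' w) ∧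
    (∀ w, f w = f' (w * g₂⁻¹)) ∧ ∀ w, f w = f' (w * g₃⁻¹)
  sep₂ : ∃ f f' : G → ℤ, (∀ w x, f (w * j x) = f w) ∧ (∀ w x, f' (w * j' x) = f' w) ∧
    f 1 - f' g₂⁻¹ = 1 ∧ (∀ w, (∀ x, j (φ₂ x) ≠ w) → f w = f' (w * g₂⁻¹)) ∧
    (∀ w, f w = f' w) ∧ ∀ w, f w = f' (w * g₃⁻¹)
  sep₃ : ∃ f f' : G → ℤ, (∀ w x, f (w * j x) = f w) ∧ (∀ w x, f' (w * j' x) = f' w) ∧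
    f 1 - f' g₃⁻¹ = 1 ∧ (∀ w, (∀ x, j (φ₃ x) ≠ w) → f w = f' (w * g₃⁻¹)) ∧
    (∀ w, f w = f' w) ∧ ∀ w, f w = f' (w * g₂⁻¹)

namespace TreeAction

variable {G C E₁ E₂ E₃ : Type} [Group G] [Group C] [Group E₁] [Group E₂] [Group E₃]
  (T : TreeAction G C E₁ E₂ E₃)

/-- The vertices. -/
abbrev Vert : Type := (G ⧸ T.j.range) ⊕ (G ⧸ T.j'.range)

/-- The edges. -/
abbrev Edge : Type := (G ⧸ (T.j.comp T.φ₁).range) ⊕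
  ((G ⧸ (T.j.comp T.φ₂).range) ⊕ (G ⧸ (T.j.comp T.φ₃).range))

/-- The first base vertex. -/
abbrev x₀ : T.Vert := Sum.inl ((1 : G) : G ⧸ T.j.range)

/-- The second base vertex. -/
abbrev x₁ : T.Vert := Sum.inr ((1 : G) : G ⧸ T.j'.range)

/-- The first base edge. -/
abbrev e₁ : T.Edge := Sum.inl ((1 : G) : G ⧸ (T.j.comp T.φ₁).range)

/-- The second base edge. -/
abbrev e₂ : T.Edge := Sum.inr (Sum.inl ((1 : G) : G ⧸ (T.j.comp T.φ₂).range))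

/-- The third base edge. -/
abbrev e₃ : T.Edge := Sum.inr (Sum.inr ((1 : G) : G ⧸ (T.j.comp T.φ₃).range))

lemma j_smul (x : C) : T.j x • T.x₀ = T.x₀ := congrArg Sum.inl (range_smul_mk_one T.j x)

lemma j'_smul (x : C) : T.j' x • T.x₁ = T.x₁ := congrArg Sum.inr (range_smul_mk_one T.j' x)

lemma φ₁_smul (x : E₁) : T.j (T.φ₁ x) • T.x₁ = T.x₁ := by rw [← T.conj₁, j'_smul]

lemma φ₂_smul (x : E₂) : T.j (T.φ₂ x) • T.g₂⁻¹ • T.x₁ = T.g₂⁻¹ • T.x₁ := by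
  rw [eq_inv_smul_iff, smul_smul, smul_smul, ← T.conj₂, mul_inv_cancel_right, j'_smul]

lemma φ₃_smul (x : E₃) : T.j (T.φ₃ x) • T.g₃⁻¹ • T.x₁ = T.g₃⁻¹ • T.x₁ := by
  rw [eq_inv_smul_iff, smul_smul, smul_smul, ← T.conj₃, mul_inv_cancel_right, j'_smul]

/-- The first end of an edge. -/
def o : T.Edge → T.Vert :=
  Sum.elim (qmap _ T.x₀ (by rintro _ ⟨x, rfl⟩; exact T.j_smul _))
    (Sum.elim (qmap _ T.x₀ (by rintro _ ⟨x, rfl⟩; exact T.j_smul _))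
      (qmap _ T.x₀ (by rintro _ ⟨x, rfl⟩; exact T.j_smul _)))

/-- The second end of an edge. -/
def t : T.Edge → T.Vert :=
  Sum.elim (qmap _ T.x₁ (by rintro _ ⟨x, rfl⟩; exact T.φ₁_smul _))
    (Sum.elim (qmap _ (T.g₂⁻¹ • T.x₁) (by rintro _ ⟨x, rfl⟩; exact T.φ₂_smul _))
      (qmap _ (T.g₃⁻¹ • T.x₁) (by rintro _ ⟨x, rfl⟩; exact T.φ₃_smul _)))

lemma ho (g : G) (e : T.Edge) : T.o (g • e) = g • T.o e := by
  rcases e with e | e | e <;> induction e using QuotientGroup.induction_on with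
  | H a => exact mul_smul g a _

lemma ht (g : G) (e : T.Edge) : T.t (g • e) = g • T.t e := by
  rcases e with e | e | e <;> induction e using QuotientGroup.induction_on with
  | H a => exact mul_smul g a _

lemma o_e₁ : T.o T.e₁ = T.x₀ := one_smul _ _
lemma o_e₂ : T.o T.e₂ = T.x₀ := one_smul _ _
lemma o_e₃ : T.o T.e₃ = T.x₀ := one_smul _ _
lemma t_e₁ : T.t T.e₁ = T.x₁ := one_smul _ _
lemma t_e₂ : T.t T.e₂ = T.g₂⁻¹ • T.x₁ := one_smul _ _
lemma t_e₃ : T.t T.e₃ = T.g₃⁻¹ • T.x₁ := one_smul _ _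

lemma edge_cases (e : T.Edge) : ∃ g : G, e = g • T.e₁ ∨ e = g • T.e₂ ∨ e = g • T.e₃ := by
  rcases e with e | e | e <;> induction e using QuotientGroup.induction_on with
  | H g => exact ⟨g, by simp [Sum.smul_inl, Sum.smul_inr]⟩

/-- A vertex function from two right-invariant functions. -/
def vfun (f f' : G → ℤ) (hf : ∀ w x, f (w * T.j x) = f w) (hf' : ∀ w x, f' (w * T.j' x) = f' w) :
    T.Vert → ℤ :=
  Sum.elim (qfun _ f (by rintro g _ ⟨x, rfl⟩; exact hf g x))
    (qfun _ f' (by rintro g _ ⟨x, rfl⟩; exact hf' g x))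

variable {f f' : G → ℤ} (hf : ∀ w x, f (w * T.j x) = f w) (hf' : ∀ w x, f' (w * T.j' x) = f' w)

lemma vfun_x₀ (g : G) : T.vfun f f' hf hf' (g • T.x₀) = f g := by
  change f (g * 1) = f g
  rw [mul_one]

lemma vfun_x₁ (g : G) : T.vfun f f' hf hf' (g • T.x₁) = f' g := by
  change f' (g * 1) = f' g
  rw [mul_one]

lemma mem_of_smul_ne {A : Type} [Group A] (i : A →* G) {g : G}
    (hg : g • ((1 : G) : G ⧸ i.range) ≠ ((1 : G) : G ⧸ i.range)) (x : A) : i x ≠ g := by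
  rintro rfl
  exact hg (range_smul_mk_one i x)

lemma bd_inj : Function.Injective (bd T.o T.t T.ho T.ht).f := by
  refine bd_injective_of_rep T.ho T.ht {T.e₁, T.e₂, T.e₃} (fun e => ?_) ?_
  · obtain ⟨g, h | h | h⟩ := T.edge_cases e
    · exact ⟨_, Or.inl rfl, g, h⟩
    · exact ⟨_, Or.inr (Or.inl rfl), g, h⟩
    · exact ⟨_, Or.inr (Or.inr rfl), g, h⟩
  rintro e (rfl | rfl | rfl)
  · obtain ⟨f, f', hf, hf', h1, h2, h3, h4⟩ := T.sep₁
    have v0 := T.vfun_x₀ hf hf'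
    have v1 := T.vfun_x₁ hf hf'
    refine ⟨T.vfun f f' hf hf', ?_, fun e he => ?_⟩
    · have a0 := v0 1
      have a1 := v1 1
      rw [one_smul] at a0 a1
      rw [o_e₁, t_e₁, a0, a1, h1]
    · obtain ⟨g, rfl | rfl | rfl⟩ := T.edge_cases e
      · rw [ho, ht, o_e₁, t_e₁, v0, v1]
        exact h2 g (mem_of_smul_ne (T.j.comp T.φ₁) fun h => he (congrArg Sum.inl h))
      · rw [ho, ht, o_e₂, t_e₂, v0, smul_smul, v1]; exact h3 g
      · rw [ho, ht, o_e₃, t_e₃, v0, smul_smul, v1]; exact h4 g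
  · obtain ⟨f, f', hf, hf', h1, h2, h3, h4⟩ := T.sep₂
    have v0 := T.vfun_x₀ hf hf'
    have v1 := T.vfun_x₁ hf hf'
    refine ⟨T.vfun f f' hf hf', ?_, fun e he => ?_⟩
    · have a0 := v0 1
      rw [one_smul] at a0
      rw [o_e₂, t_e₂, a0, v1, h1]
    · obtain ⟨g, rfl | rfl | rfl⟩ := T.edge_cases e
      · rw [ho, ht, o_e₁, t_e₁, v0, v1]; exact h3 g
      · rw [ho, ht, o_e₂, t_e₂, v0, smul_smul, v1]
        exact h2 g (mem_of_smul_ne (T.j.comp T.φ₂) fun h =>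
          he (congrArg (Sum.inr ∘ Sum.inl) h))
      · rw [ho, ht, o_e₃, t_e₃, v0, smul_smul, v1]; exact h4 g
  · obtain ⟨f, f', hf, hf', h1, h2, h3, h4⟩ := T.sep₃
    have v0 := T.vfun_x₀ hf hf'
    have v1 := T.vfun_x₁ hf hf'
    refine ⟨T.vfun f f' hf hf', ?_, fun e he => ?_⟩
    · have a0 := v0 1
      rw [one_smul] at a0
      rw [o_e₃, t_e₃, a0, v1, h1]
    · obtain ⟨g, rfl | rfl | rfl⟩ := T.edge_cases e
      · rw [ho, ht, o_e₁, t_e₁, v0, v1]; exact h3 g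
      · rw [ho, ht, o_e₂, t_e₂, v0, smul_smul, v1]; exact h4 g
      · rw [ho, ht, o_e₃, t_e₃, v0, smul_smul, v1]
        exact h2 g (mem_of_smul_ne (T.j.comp T.φ₃) fun h =>
          he (congrArg (Sum.inr ∘ Sum.inr) h))

lemma linked (v : T.Vert) : Linked T.o T.t v T.x₀ := by
  have l1 : Linked T.o T.t T.x₀ T.x₁ := by
    have := linked_edge (o := T.o) (t := T.t) T.e₁
    rwa [o_e₁, t_e₁] at this
  have l2 : Linked T.o T.t T.x₀ (T.g₂⁻¹ • T.x₁) := by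
    have := linked_edge (o := T.o) (t := T.t) T.e₂
    rwa [o_e₂, t_e₂] at this
  have l3 : Linked T.o T.t T.x₀ (T.g₃⁻¹ • T.x₁) := by
    have := linked_edge (o := T.o) (t := T.t) T.e₃
    rwa [o_e₃, t_e₃] at this
  have key : ∀ g : G, Linked T.o T.t (g • T.x₀) T.x₀ := by
    refine linked_of_closure _ T.gen _ T.ho T.ht ?_
    rintro g ((⟨x, rfl⟩ | ⟨x, rfl⟩) | rfl | rfl)
    · rw [j_smul]; exact Linked.refl _
    · have := l1.smul (T.j' x) T.ho T.ht
      rw [j'_smul] at this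
      exact this.trans l1.symm
    · have := l2.smul T.g₂ T.ho T.ht
      rw [smul_inv_smul] at this
      exact this.trans l1.symm
    · have := l3.smul T.g₃ T.ho T.ht
      rw [smul_inv_smul] at this
      exact this.trans l1.symm
  rcases v with v | v <;> induction v using QuotientGroup.induction_on with
  | H g =>
    first
    | have h0 := key g
      rwa [Sum.smul_inl, MulAction.Quotient.smul_coe, smul_eq_mul, mul_one] at h0
    | have h0 := (l1.smul g T.ho T.ht).symm.trans (key g)
      rwa [Sum.smul_inr, MulAction.Quotient.smul_coe, smul_eq_mul, mul_one] at h0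

/-- The short exact sequence of the tree. -/
noncomputable def S := ses (bd T.o T.t T.ho T.ht) (aug G T.Vert) T.bd_inj (aug_surjective T.x₀)
  (bd_exact T.ho T.ht _ T.linked)

lemma e₁_smul (x : E₁) : (T.j.comp T.φ₁) x • T.e₁ = T.e₁ :=
  congrArg Sum.inl (range_smul_mk_one (T.j.comp T.φ₁) x)

lemma e₂_smul (x : E₂) : (T.j.comp T.φ₂) x • T.e₂ = T.e₂ :=
  congrArg (Sum.inr ∘ Sum.inl) (range_smul_mk_one (T.j.comp T.φ₂) x)

lemma e₃_smul (x : E₃) : (T.j.comp T.φ₃) x • T.e₃ = T.e₃ :=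
  congrArg (Sum.inr ∘ Sum.inr) (range_smul_mk_one (T.j.comp T.φ₃) x)

/-- The homology of the edges. -/
noncomputable def edgeMap (n : ℕ) : h E₁ n × h E₂ n × h E₃ n →+ (perm G T.Edge).H n :=
  AddMonoidHom.coprod ((pt _ T.e₁ T.e₁_smul).map n)
    (AddMonoidHom.coprod ((pt _ T.e₂ T.e₂_smul).map n) ((pt _ T.e₃ T.e₃_smul).map n))

/-- The homology of the vertices. -/
noncomputable def vertMap (n : ℕ) : h C n × h C n →+ (perm G T.Vert).H n :=
  AddMonoidHom.coprod ((pt _ T.x₀ T.j_smul).map n) ((pt _ T.x₁ T.j'_smul).map n)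

lemma vertMap_bijective (n : ℕ) : Function.Bijective (T.vertMap n) := by
  convert coprod_bijective (G := G) n _ _ (pt_quot_bijective T.j T.j_inj n)
    (pt_quot_bijective T.j' T.j'_inj n) using 1
  refine congrArg _ (congrArg₂ _ ?_ ?_)
  · ext y
    exact (permHom_pt Sum.inl (fun _ _ => rfl) T.j _ (range_smul_mk_one T.j) T.j_smul n y).symm
  · ext y
    exact (permHom_pt Sum.inr (fun _ _ => rfl) T.j' _ (range_smul_mk_one T.j') T.j'_smul n y).symm

lemma edgeMap_bijective (n : ℕ) : Function.Bijective (T.edgeMap n) := by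
  have b1 := pt_quot_bijective (T.j.comp T.φ₁) (T.j_inj.comp T.φ₁_inj) n
  have b2 := pt_quot_bijective (T.j.comp T.φ₂) (T.j_inj.comp T.φ₂_inj) n
  have b3 := pt_quot_bijective (T.j.comp T.φ₃) (T.j_inj.comp T.φ₃_inj) n
  convert coprod_bijective (G := G) n _ _ b1 (coprod_bijective (G := G) n _ _ b2 b3) using 1
  funext y
  obtain ⟨y1, y2, y3⟩ := y
  change (pt _ T.e₁ T.e₁_smul).map n y1 + ((pt _ T.e₂ T.e₂_smul).map n y2 +
    (pt _ T.e₃ T.e₃_smul).map n y3) = (permInl _ _ _).map n ((pt _ _ _).map n y1) +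
      (permInr _ _ _).map n ((permInl _ _ _).map n ((pt _ _ _).map n y2) +
        (permInr _ _ _).map n ((pt _ _ _).map n y3))
  rw [map_add]
  refine congrArg₂ _ ?_ (congrArg₂ _ ?_ ?_)
  · exact (permHom_pt Sum.inl (fun _ _ => rfl) _ _ (range_smul_mk_one _) T.e₁_smul n y1).symm
  · refine Eq.symm ((congrArg _ (permHom_pt Sum.inl (fun _ _ => rfl) _ _ (range_smul_mk_one _)
      (fun x => congrArg Sum.inl (range_smul_mk_one (T.j.comp T.φ₂) x)) n y2)).trans ?_)
    exact permHom_pt Sum.inr (fun _ _ => rfl) _ _ _ T.e₂_smul n y2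
  · refine Eq.symm ((congrArg _ (permHom_pt Sum.inr (fun _ _ => rfl) _ _ (range_smul_mk_one _)
      (fun x => congrArg Sum.inr (range_smul_mk_one (T.j.comp T.φ₃) x)) n y3)).trans ?_)
    exact permHom_pt Sum.inr (fun _ _ => rfl) _ _ _ T.e₃_smul n y3

/-- The sum of the maps from the edge groups to the vertex group. -/
noncomputable def φ (n : ℕ) : h E₁ n × h E₂ n × h E₃ n →+ h C n :=
  AddMonoidHom.coprod (hmap T.φ₁ n) (AddMonoidHom.coprod (hmap T.φ₂ n) (hmap T.φ₃ n))

/-- The map from the vertex groups. -/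
noncomputable def b (n : ℕ) : h C n × h C n →+ h G n :=
  AddMonoidHom.coprod (hmap T.j n) (hmap T.j' n)

lemma bd_edgeMap (n : ℕ) (y : h E₁ n × h E₂ n × h E₃ n) :
    T.S.i.map n (T.edgeMap n y) = T.vertMap n (T.φ n y, - T.φ n y) := by
  obtain ⟨y1, y2, y3⟩ := y
  have hpt : ∀ {A : Type} [Group A] (φ : A →* C) (y : h A n),
      (pt (T.j.comp φ) T.x₀ (fun _ => T.j_smul _)).map n y =
        (pt _ T.x₀ T.j_smul).map n (hmap φ n y) := fun φ y =>
    Hom.map_comp _ _ _ (fun _ => rfl) (fun _ => rfl) n y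
  have hpt' : ∀ {A : Type} [Group A] (φ : A →* C) (y : h A n),
      (pt (T.j'.comp φ) T.x₁ (fun _ => T.j'_smul _)).map n y =
        (pt _ T.x₁ T.j'_smul).map n (hmap φ n y) := fun φ y =>
    Hom.map_comp _ _ _ (fun _ => rfl) (fun _ => rfl) n y
  have key : ∀ {A : Type} [Group A] (φ : A →* C) (g : G) (e : T.Edge)
      (he : ∀ a, T.j.comp φ a • e = e) (_ : T.o e = T.x₀) (_ : T.t e = g⁻¹ • T.x₁)
      (_ : ∀ a, T.j' (φ a) * g = g * T.j (φ a)) (y : h A n),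
      T.S.i.map n ((pt _ e he).map n y) = (pt _ T.x₀ T.j_smul).map n (hmap φ n y) -
        (pt _ T.x₁ T.j'_smul).map n (hmap φ n y) := by
    intro A _ φ g e he h1 h2 h3 y
    have hoe : ∀ a, T.j.comp φ a • T.o e = T.o e := fun a => by rw [← ho, he]
    have hte : ∀ a, T.j.comp φ a • T.t e = T.t e := fun a => by rw [← ht, he]
    refine (bd_pt T.ho T.ht (T.j.comp φ) e he hoe hte n y).trans ?_
    rw [← hpt, ← hpt']
    have hgt : g • T.t e = T.x₁ := by rw [h2, smul_inv_smul]
    rw [pt_map_conj (T.j.comp φ) (T.j'.comp φ) g (T.t e) h3 hte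
      (fun a => by rw [hgt]; exact T.j'_smul _)]
    simp only [h1, hgt]
  have k1 := key T.φ₁ 1 T.e₁ T.e₁_smul T.o_e₁ (by rw [t_e₁, inv_one, one_smul])
    (fun a => by rw [mul_one, one_mul, T.conj₁]) y1
  have k2 := key T.φ₂ T.g₂ T.e₂ T.e₂_smul T.o_e₂ T.t_e₂ T.conj₂ y2
  have k3 := key T.φ₃ T.g₃ T.e₃ T.e₃_smul T.o_e₃ T.t_e₃ T.conj₃ y3
  simp only [edgeMap, vertMap, φ, AddMonoidHom.coprod_apply, map_add, map_neg, k1, k2, k3]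
  abel

lemma aug_vertMap (n : ℕ) (y : h C n × h C n) : T.S.p.map n (T.vertMap n y) = T.b n y := by
  rw [vertMap, AddMonoidHom.coprod_apply, map_add, b, AddMonoidHom.coprod_apply,
    hmap_eq_aug_pt T.j T.x₀ T.j_smul, hmap_eq_aug_pt T.j' T.x₁ T.j'_smul]
  rfl

/-- The connecting homomorphism. -/
noncomputable def D (n : ℕ) : h G (n + 1) →+ h E₁ n × h E₂ n × h E₃ n :=
  ((AddEquiv.ofBijective _ (T.edgeMap_bijective n)).symm : _ →+ _).comp (T.S.δ n)

lemma edgeMap_D (n : ℕ) (y : h G (n + 1)) : T.edgeMap n (T.D n y) = T.S.δ n y :=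
  (AddEquiv.ofBijective _ (T.edgeMap_bijective n)).apply_symm_apply _

lemma b_eq_zero (n : ℕ) (y : h C n × h C n) :
    T.b n y = 0 ↔ ∃ e, y = (T.φ n e, - T.φ n e) := by
  rw [← aug_vertMap, T.S.exact_mid n]
  constructor
  · rintro ⟨x, hx⟩
    obtain ⟨e, rfl⟩ := (T.edgeMap_bijective n).2 x
    rw [bd_edgeMap] at hx
    exact ⟨e, ((T.vertMap_bijective n).1 hx).symm⟩
  · rintro ⟨e, rfl⟩
    exact ⟨T.edgeMap n e, T.bd_edgeMap n e⟩

lemma D_eq_zero (n : ℕ) (y : h G (n + 1)) : T.D n y = 0 ↔ ∃ x, T.b (n + 1) x = y := by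
  have h1 : T.D n y = 0 ↔ T.S.δ n y = 0 := by
    rw [← edgeMap_D]
    exact ((injective_iff_map_eq_zero' _).1 (T.edgeMap_bijective n).1 _).symm
  rw [h1, T.S.exact_right n]
  constructor
  · rintro ⟨x, rfl⟩
    obtain ⟨z, rfl⟩ := (T.vertMap_bijective (n + 1)).2 x
    exact ⟨z, (T.aug_vertMap _ z).symm⟩
  · rintro ⟨x, rfl⟩
    exact ⟨_, T.aug_vertMap _ x⟩

lemma φ_eq_zero (n : ℕ) (e : h E₁ n × h E₂ n × h E₃ n) :
    T.φ n e = 0 ↔ ∃ y, T.D n y = e := by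
  have h1 : T.φ n e = 0 ↔ T.S.i.map n (T.edgeMap n e) = 0 := by
    rw [bd_edgeMap, (injective_iff_map_eq_zero' _).1 (T.vertMap_bijective n).1, Prod.mk_eq_zero,
      neg_eq_zero, and_self]
  rw [h1, T.S.exact_left n]
  constructor
  · rintro ⟨y, hy⟩
    exact ⟨y, (T.edgeMap_bijective n).1 (by rw [edgeMap_D, hy])⟩
  · rintro ⟨y, rfl⟩
    exact ⟨y, (T.edgeMap_D n y).symm⟩

/-- A subgroup of the second and third edge groups gives classes through the cross product with
the loop of these edges. -/
lemma D_cross {A : Type} [Group A] (a₂ : A →* E₂) (a₃ : A →* E₃)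
    (ha : ∀ x, T.φ₂ (a₂ x) = T.φ₃ (a₃ x)) (i : A →* G) (hi : ∀ x, i x = T.j (T.φ₂ (a₂ x)))
    (hg : ∀ x, i x * (T.g₂⁻¹ * T.g₃) = (T.g₂⁻¹ * T.g₃) * i x) (n : ℕ) (y : h A n) :
    T.D n (cross i hg n y) = (0, hmap a₂ n y, - hmap a₃ n y) := by
  have hi2 : ∀ x, i x = (T.j.comp T.φ₂) (a₂ x) := hi
  have hi3 : ∀ x, i x = (T.j.comp T.φ₃) (a₃ x) := fun x => by rw [hi, ha]; rfl
  have he2 : ∀ x, i x • T.e₂ = T.e₂ := fun x => by rw [hi2]; exact T.e₂_smul _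
  have he3 : ∀ x, i x • T.e₃ = T.e₃ := fun x => by rw [hi3]; exact T.e₃_smul _
  let ε : Hom i (triv A) (perm G T.Edge) := ⟨(pt i T.e₂ he2).f - (pt i T.e₃ he3).f, fun a v => by
    rw [AddMonoidHom.sub_apply, (pt i T.e₂ he2).comm, (pt i T.e₃ he3).comm, ← map_sub]; rfl⟩
  have h1 := δ_cross i (T.g₃⁻¹ • T.x₁) (bd T.o T.t T.ho T.ht) T.bd_inj (aug_surjective T.x₀)
    (bd_exact T.ho T.ht _ T.linked) hg (fun x => by rw [hi3]; exact T.φ₃_smul _) ε (fun a => by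
      change (bd T.o T.t T.ho T.ht).f (Finsupp.single T.e₂ a - Finsupp.single T.e₃ a) + _ = _
      rw [map_sub, bd_single, bd_single, o_e₂, t_e₂, o_e₃, t_e₃, mul_smul, smul_inv_smul]
      abel) n y
  apply (T.edgeMap_bijective n).1
  rw [edgeMap_D]
  refine h1.trans ?_
  have h2 := Hom.map_add ε (pt i T.e₃ he3) (pt i T.e₂ he2) (fun v => by
    change _ = (pt i T.e₂ he2).f v - (pt i T.e₃ he3).f v + _
    rw [sub_add_cancel]) n y
  have h3 : (pt i T.e₂ he2).map n y = (pt _ T.e₂ T.e₂_smul).map n (hmap a₂ n y) :=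
    Hom.map_comp _ _ _ hi2 (fun _ => rfl) n y
  have h4 : (pt i T.e₃ he3).map n y = (pt _ T.e₃ T.e₃_smul).map n (hmap a₃ n y) :=
    Hom.map_comp _ _ _ hi3 (fun _ => rfl) n y
  rw [edgeMap, AddMonoidHom.coprod_apply, AddMonoidHom.coprod_apply, map_zero, zero_add, map_neg,
    ← h3, ← h4, h2, add_neg_cancel_right]

/-- A chain in the vertex group bounding a cycle of the first edge group gives a class. -/
lemma D_of_chain (n : ℕ) (z : (triv E₁).bar.Z n) (c : ((triv C).iter (n + 1)).V)
    (hc : (triv C).bar.d n c = (trivHom T.φ₁).bar.f n z) :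
    ∃ hz : (trivHom T.j).bar.f (n + 1) c - (trivHom T.j').bar.f (n + 1) c ∈ (triv G).bar.Z (n + 1),
      T.D n ((triv G).bar.cls (n + 1) ⟨_, hz⟩) = ((triv E₁).bar.cls n z, 0, 0) := by
  have hjj : (trivHom T.j).bar.f n ((trivHom T.φ₁).bar.f n z) =
      (trivHom T.j').bar.f n ((trivHom T.φ₁).bar.f n z) := by
    have e1 := Hom.iter_comp (trivHom T.φ₁) (trivHom T.j) (trivHom (T.j.comp T.φ₁)) (fun _ => rfl)
      (fun _ => rfl) n z
    have e2 := Hom.iter_comp (trivHom T.φ₁) (trivHom T.j') (trivHom (T.j.comp T.φ₁))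
      (fun x => (T.conj₁ x).symm) (fun _ => rfl) n z
    exact e1.symm.trans e2
  have hz : (trivHom T.j).bar.f (n + 1) c - (trivHom T.j').bar.f (n + 1) c ∈
      (triv G).bar.Z (n + 1) := by
    rw [Cx.mem_Z_succ, map_sub, ← Cx.Hom.comm, ← Cx.Hom.comm, hc, hjj, sub_self]
  refine ⟨hz, ?_⟩
  apply (T.edgeMap_bijective n).1
  rw [edgeMap_D]
  have h1 : T.edgeMap n ((triv E₁).bar.cls n z, 0, 0) =
      (perm G T.Edge).bar.cls n ((pt _ T.e₁ T.e₁_smul).bar.mapZ n z) := by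
    rw [edgeMap, AddMonoidHom.coprod_apply, Prod.mk_zero_zero, map_zero, add_zero]
    rfl
  rw [h1]
  refine Cx.SES.δ_cls _ (b := (pt _ T.x₀ T.j_smul).bar.f (n + 1) c -
    (pt _ T.x₁ T.j'_smul).bar.f (n + 1) c) ?_ ?_
  · have a0 := Hom.iter_comp (pt _ T.x₀ T.j_smul) (aug G T.Vert) (trivHom T.j) (fun _ => rfl)
      (fun v => (aug_single (G := G) T.x₀ v).symm) (n + 1) c
    have a1 := Hom.iter_comp (pt _ T.x₁ T.j'_smul) (aug G T.Vert) (trivHom T.j') (fun _ => rfl)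
      (fun v => (aug_single (G := G) T.x₁ v).symm) (n + 1) c
    rw [map_sub]
    exact congrArg₂ _ a0.symm a1.symm
  · rw [map_sub, ← Cx.Hom.comm, ← Cx.Hom.comm, hc]
    have k0 : ∀ a, (T.j.comp T.φ₁) a • T.x₀ = T.x₀ := fun a => T.j_smul _
    have k1 : ∀ a, (T.j.comp T.φ₁) a • T.x₁ = T.x₁ := fun a => T.φ₁_smul _
    have a0 := Hom.iter_comp (trivHom T.φ₁) (pt _ T.x₀ T.j_smul) (pt _ T.x₀ k0) (fun _ => rfl)
      (fun _ => rfl) n z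
    have a1 := Hom.iter_comp (trivHom T.φ₁) (pt _ T.x₁ T.j'_smul) (pt _ T.x₁ k1)
      (fun x => (T.conj₁ x).symm) (fun _ => rfl) n z
    let K : Hom (T.j.comp T.φ₁) (triv E₁) (perm G T.Vert) :=
      ⟨(bd T.o T.t T.ho T.ht).f.comp (pt _ T.e₁ T.e₁_smul).f, fun a v => by
        rw [AddMonoidHom.comp_apply, (pt _ T.e₁ T.e₁_smul).comm, (bd T.o T.t T.ho T.ht).comm]; rfl⟩
    have a2 := Hom.iter_comp (pt _ T.e₁ T.e₁_smul) (bd T.o T.t T.ho T.ht) K (fun _ => rfl)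
      (fun _ => rfl) n z
    have a3 := Hom.iter_add K (pt _ T.x₁ k1) (pt _ T.x₀ k0) (fun v => by
      change _ = (bd T.o T.t T.ho T.ht).f (Finsupp.single T.e₁ v) + _
      rw [bd_single, o_e₁, t_e₁]
      change Finsupp.single T.x₀ v = _ - _ + Finsupp.single T.x₁ v
      abel) n z
    refine a2.symm.trans ?_
    refine Eq.trans ?_ (congrArg₂ _ a0 a1)
    rw [a3, add_sub_cancel_right]

end TreeAction

end GMod

/-! ### Dimension shifting -/

lemma Cx.SES.δ_bijective {A B C : Cx} (S : Cx.SES A B C) (n : ℕ) (h1 : ∀ y : B.H (n + 1), y = 0)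
    (h0 : ∀ y : B.H n, y = 0) : Function.Bijective (S.δ n) := by
  constructor
  · rw [injective_iff_map_eq_zero]
    intro y hy
    obtain ⟨x, rfl⟩ := (S.exact_right n y).1 hy
    rw [h1 x, map_zero]
  · intro y
    exact (S.exact_left n y).1 (h0 _)

lemma Cx.SES.δ_injective {A B C : Cx} (S : Cx.SES A B C) (n : ℕ)
    (h1 : ∀ y : B.H (n + 1), y = 0) : Function.Injective (S.δ n) := by
  rw [injective_iff_map_eq_zero]
  intro y hy
  obtain ⟨x, rfl⟩ := (S.exact_right n y).1 hy
  rw [h1 x, map_zero]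

lemma card_eq_mul_of_exact {A B C : Type} [AddCommGroup A] [AddCommGroup B] [AddCommGroup C]
    (f : A →+ B) (g : B →+ C) (hf : Function.Injective f) (hg : Function.Surjective g)
    (he : Function.Exact f g) : Nat.card B = Nat.card A * Nat.card C := by
  rw [AddSubgroup.card_eq_card_quotient_mul_card_addSubgroup g.ker,
    Nat.card_congr (QuotientAddGroup.quotientKerEquivOfSurjective g hg).toEquiv, mul_comm]
  congr 1
  rw [AddMonoidHom.exact_iff.1 he]
  exact (Nat.card_congr (AddMonoidHom.ofInjective hf).toEquiv).symm

namespace GMod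

section Kernel

variable {G : Type} [Group G] {M N : GMod G}

/-- The kernel of an equivariant map. -/
@[reducible] def kerMod (p : Hom (MonoidHom.id G) M N) : GMod G where
  V := p.f.ker
  R g := AddMonoidHom.codRestrict ((M.R g).comp p.f.ker.subtype) p.f.ker fun x => by
    rw [AddMonoidHom.mem_ker, AddMonoidHom.comp_apply, p.comm, AddSubgroup.subtype_apply,
      x.2, map_zero]
  mul g h v := Subtype.ext (M.mul g h v)

/-- The inclusion of the kernel. -/
def kerIncl (p : Hom (MonoidHom.id G) M N) : Hom (MonoidHom.id G) (kerMod p) M :=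
  ⟨p.f.ker.subtype, fun _ _ => rfl⟩

/-- The corestriction of a map to the kernel of another one. -/
def kerLift {L : GMod G} (p : Hom (MonoidHom.id G) M N) (q : Hom (MonoidHom.id G) L M)
    (h : ∀ x, p.f (q.f x) = 0) : Hom (MonoidHom.id G) L (kerMod p) :=
  ⟨AddMonoidHom.codRestrict q.f p.f.ker h, fun g v => Subtype.ext (q.comm g v)⟩

/-- The short exact sequence of bar complexes of a kernel. -/
noncomputable def kerSes (p : Hom (MonoidHom.id G) M N) (hp : Function.Surjective p.f) :
    Cx.SES (kerMod p).bar M.bar N.bar :=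
  ses (i := kerIncl p) (p := p) Subtype.val_injective hp (fun x => by
    constructor
    · intro hx; exact ⟨⟨x, hx⟩, rfl⟩
    · rintro ⟨y, rfl⟩; exact y.2)

/-- A three-term exact sequence of modules as a short exact sequence ending in a kernel. -/
noncomputable def kerLiftSes {K L : GMod G} (p : Hom (MonoidHom.id G) M N)
    (q : Hom (MonoidHom.id G) L M) (i : Hom (MonoidHom.id G) K L)
    (he : Function.Exact q.f p.f) (hi : Function.Injective i.f) (he' : Function.Exact i.f q.f) :
    Cx.SES K.bar L.bar (kerMod p).bar :=
  ses (i := i) (p := kerLift p q he.apply_apply_eq_zero) hi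
    (fun x => by
      obtain ⟨y, hy⟩ := (he x).1 x.2
      exact ⟨y, Subtype.ext hy⟩)
    (fun x => by
      rw [← he' x]
      exact Subtype.ext_iff)

end Kernel

section Aug

variable {G A X : Type} [Group G] [Group A] [MulAction G X]

lemma aug_pt_zero (j : A →* G) (x : X) (hx : ∀ a, j a • x = x) (a : ℤ) :
    (aug G X).map 0 ((pt j x hx).map 0 (c0 A a)) = c0 G a := by
  rw [← hmap_eq_aug_pt, hmap_c0]

lemma aug_zero_injective_of_pt (j : A →* G) (x : X) (hx : ∀ a, j a • x = x)
    (hs : Function.Surjective ((pt j x hx).map 0)) : Function.Injective ((aug G X).map 0) := by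
  rw [injective_iff_map_eq_zero]
  intro y hy
  obtain ⟨z, rfl⟩ := hs y
  obtain ⟨a, rfl⟩ := (c0_bijective (G := A)).2 z
  rw [aug_pt_zero] at hy
  rw [(injective_iff_map_eq_zero _).1 (c0_bijective (G := G)).1 a hy, map_zero, map_zero]

lemma aug_perm_self_zero_injective : Function.Injective ((aug G G).map 0) :=
  aug_zero_injective_of_pt _ _ _ (pt_one_bijective 0).2

lemma map_c0 (F : Hom (MonoidHom.id G) (triv G) (triv G)) (a : ℤ) :
    F.map 0 (c0 G a) = c0 G (F.f a) := rfl

/-- The invariant element of a finite permutation module. -/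
noncomputable def norm (G X : Type) [Group G] [MulAction G X] [Fintype X] :
    Hom (MonoidHom.id G) (triv G) (perm G X) where
  f := ∑ x : X, (Finsupp.singleAddHom x : ℤ →+ (X →₀ ℤ))
  comm g v := by
    change (∑ x : X, (Finsupp.singleAddHom x : ℤ →+ (X →₀ ℤ))) v =
      Finsupp.mapDomain.addMonoidHom (g • ·) ((∑ x : X, (Finsupp.singleAddHom x : ℤ →+ (X →₀ ℤ))) v)
    simp only [AddMonoidHom.finsetSum_apply, map_sum, Finsupp.singleAddHom_apply,
      Finsupp.mapDomain.addMonoidHom_apply, Finsupp.mapDomain_single]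
    exact (Equiv.sum_comp (MulAction.toPerm g) fun x : X => Finsupp.single x v).symm

lemma norm_apply [Fintype X] (a : ℤ) (x : X) : ((norm G X).f a : X →₀ ℤ) x = a := by
  change ((∑ x : X, (Finsupp.singleAddHom x : ℤ →+ (X →₀ ℤ))) a : X →₀ ℤ) x = a
  simp [Finsupp.finsetSum_apply]

lemma norm_zero_injective [Fintype X] [Nonempty X] :
    Function.Injective ((norm G X).map 0) := by
  let F : Hom (MonoidHom.id G) (triv G) (triv G) :=
    ⟨(aug G X).f.comp (norm G X).f, fun _ _ => by
      rw [AddMonoidHom.comp_apply, (norm G X).comm, (aug G X).comm]; rfl⟩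
  have hF : ∀ a : ℤ, F.f a = Fintype.card X * a := fun a => by
    change (aug G X).f ((∑ x : X, (Finsupp.singleAddHom x : ℤ →+ (X →₀ ℤ))) a) = _
    rw [AddMonoidHom.finsetSum_apply, map_sum]
    exact (Finset.sum_congr rfl fun x _ => aug_single (G := G) x a).trans (by simp)
  rw [injective_iff_map_eq_zero]
  intro y hy
  obtain ⟨a, rfl⟩ := (c0_bijective (G := G)).2 y
  have h1 := Hom.map_comp (norm G X) (aug G X) F (fun _ => rfl) (fun _ => rfl) 0 (c0 G a)
  rw [hy, map_zero, map_c0, (injective_iff_map_eq_zero' _).1 c0_bijective.1, hF] at h1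
  have : a = 0 := by
    rcases mul_eq_zero.1 h1 with h | h
    · simp at h
    · exact h
  rw [this, map_zero]

end Aug

/-! ### Characters -/

section Character

variable {G B : Type} [Group G] [AddCommGroup B]

/-- The functional on one-letter chains given by a homomorphism to an abelian group. -/
noncomputable def h1fun (χ : G →* Multiplicative B) : ((triv G).iter 1).V →+ B :=
  lift (M := triv G) (n := 0) fun g => (zmultiplesHom B (χ g).toAdd : ℤ →+ B)

lemma h1fun_cons (χ : G →* Multiplicative B) (g : G) : h1fun χ (cons g (one0 G)) = (χ g).toAdd :=
  (lift_cons _ _ _).trans (one_zsmul _)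

lemma h1fun_d (χ : G →* Multiplicative B) (y : ((triv G).iter 2).V) :
    h1fun χ ((triv G).bar.d 1 y) = 0 := by
  refine iter_hom_ext (f := (h1fun χ).comp ((triv G).bar.d 1)) (f' := 0) (fun g c => ?_) y
  refine iter_hom_ext (f := ((h1fun χ).comp ((triv G).bar.d 1)).comp (cons g)) (f' := 0)
    (fun k v => ?_) c
  obtain ⟨m, rfl⟩ := eq_zsmul_one0 v
  rw [AddMonoidHom.zero_apply, map_zsmul, map_zsmul]
  convert smul_zero m
  change h1fun χ ((triv G).bar.d 1 (cons g (cons k (one0 G)))) = 0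
  rw [d_cons, R_cons, map_sub, map_sub]
  change h1fun χ (cons k (one0 G)) - (h1fun χ (cons (g * k) (one0 G)) -
    h1fun χ (cons g (one0 G))) = 0
  rw [h1fun_cons, h1fun_cons, h1fun_cons, map_mul, toAdd_mul]
  abel

/-- The functional on degree-one homology given by a homomorphism to an abelian group. -/
noncomputable def h1hom (χ : G →* Multiplicative B) : h G 1 →+ B :=
  QuotientAddGroup.lift _ ((h1fun χ).comp ((triv G).bar.Z 1).subtype) (by
    rintro ⟨x, hx⟩ ⟨y, hy⟩
    have hy' : (triv G).bar.d 1 y = x := hy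
    subst hy'
    exact h1fun_d χ y)

lemma h1hom_c1 (χ : G →* Multiplicative B) (g : G) : h1hom χ (c1 g) = (χ g).toAdd :=
  h1fun_cons χ g

lemma c1_zpow (g : G) (n : ℤ) : c1 (g ^ n) = n • c1 g :=
  congrArg Multiplicative.toAdd (map_zpow (c1Hom G) g n)

lemma c1_one : c1 (1 : G) = 0 :=
  congrArg Multiplicative.toAdd (map_one (c1Hom G))

end Character

/-! ### Cyclic groups -/

section Cyclic

variable (n : ℕ)

/-- The cyclic group of order `n`. -/
abbrev Cyc : Type := Multiplicative (ZMod n)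

/-- The generator of a cyclic group. -/
abbrev gen : Cyc n := Multiplicative.ofAdd 1

lemma cyc_o (g e : Cyc n) : id (g • e) = g • id e := rfl

lemma cyc_t (g e : Cyc n) : (g • e) * gen n = g • (e * gen n) := mul_assoc _ _ _

variable [NeZero n]

lemma gen_pow_val (g : Cyc n) : gen n ^ (g.toAdd.val) = g := by
  apply Multiplicative.toAdd.injective
  simp

lemma cyc_closure : Subgroup.closure {gen n} = ⊤ := by
  refine (Subgroup.eq_top_iff' _).2 fun g => ?_
  have := Subgroup.pow_mem (Subgroup.closure {gen n})
    (Subgroup.subset_closure (Set.mem_singleton _)) g.toAdd.val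
  rwa [gen_pow_val] at this

/-- The degree-one homology of a cyclic group. -/
noncomputable def cycH1 : h (Cyc n) 1 →+ ZMod n := h1hom (MonoidHom.id (Cyc n))

lemma cycH1_bijective : Function.Bijective (cycH1 n) := by
  have key : ∀ y : h (Cyc n) 1, ∃ k : ℤ, k • c1 (gen n) = y := fun y =>
    AddSubgroup.mem_zmultiples_iff.1 (h1_mem_of_closure (AddSubgroup.zmultiples (c1 (gen n)))
      {gen n} (cyc_closure n) (by
        rintro _ rfl; exact AddSubgroup.mem_zmultiples _) y)
  have hg : cycH1 n (c1 (gen n)) = 1 := h1hom_c1 _ _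
  constructor
  · rw [injective_iff_map_eq_zero]
    intro y hy
    obtain ⟨k, rfl⟩ := key y
    rw [map_zsmul, hg, zsmul_one] at hy
    rw [← c1_zpow]
    have : gen n ^ k = 1 := by
      apply Multiplicative.toAdd.injective
      simpa using hy
    rw [this, c1_one]
  · intro a
    refine ⟨(a.val) • c1 (gen n), ?_⟩
    rw [map_nsmul, hg]
    simp

lemma cyc_bd_exact : Function.Exact (bd (G := Cyc n) id (· * gen n) (cyc_o n) (cyc_t n)).f
    (aug (Cyc n) (Cyc n)).f := by
  refine bd_exact _ _ 1 fun v => ?_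
  have := linked_of_closure (E := Cyc n) (o := id) (t := (· * gen n)) {gen n} (cyc_closure n)
    (1 : Cyc n) (cyc_o n) (cyc_t n) (by
      rintro _ rfl
      have := (linked_edge (o := id) (t := (· * gen n)) (1 : Cyc n)).symm
      simpa using this) v
  simpa using this

lemma cyc_norm_exact : Function.Exact (norm (Cyc n) (Cyc n)).f
    (bd (G := Cyc n) id (· * gen n) (cyc_o n) (cyc_t n)).f := by
  have hinj : Function.Injective (· * gen n : Cyc n → Cyc n) := mul_left_injective _
  have key : ∀ x : Cyc n →₀ ℤ, ∀ k, ((bd (G := Cyc n) id (· * gen n) (cyc_o n) (cyc_t n)).f x :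
      Cyc n →₀ ℤ) (k * gen n) = x (k * gen n) - x k := by
    intro x k
    change (Finsupp.mapDomain id x - Finsupp.mapDomain (· * gen n) x) (k * gen n) = _
    rw [Finsupp.sub_apply, Finsupp.mapDomain_id]
    congr 1
    exact Finsupp.mapDomain_apply hinj x k
  intro x
  constructor
  · intro hx
    have h1 : ∀ k, (x : Cyc n →₀ ℤ) (k * gen n) = (x : Cyc n →₀ ℤ) k := fun k => by
      have := key x k
      rw [hx] at this
      exact (sub_eq_zero.1 this.symm)
    have h2 : ∀ m : ℕ, (x : Cyc n →₀ ℤ) (gen n ^ m) = (x : Cyc n →₀ ℤ) 1 := fun m => by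
      induction m with
      | zero => rw [pow_zero]
      | succ m ih => rw [pow_succ, h1, ih]
    refine ⟨(x : Cyc n →₀ ℤ) 1, Finsupp.ext fun k => ?_⟩
    rw [norm_apply, ← gen_pow_val n k, h2]
  · rintro ⟨a, rfl⟩
    refine Finsupp.ext fun k => ?_
    obtain ⟨k, rfl⟩ := (Group.mulRight_bijective (gen n)).2 k
    rw [key, norm_apply, norm_apply, sub_self]
    rfl

lemma norm_injective {G X : Type} [Group G] [MulAction G X] [Fintype X] [Nonempty X] :
    Function.Injective (norm G X).f := fun a b hab => by
  obtain ⟨x⟩ := ‹Nonempty X›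
  have := DFunLike.congr_fun (F := X →₀ ℤ) hab x
  rwa [norm_apply, norm_apply] at this

/-- The syzygy sequence of a cyclic group. -/
noncomputable def cycSes : Cx.SES (triv (Cyc n)).bar (perm (Cyc n) (Cyc n)).bar
    (kerMod (aug (Cyc n) (Cyc n))).bar :=
  kerLiftSes _ _ _ (cyc_bd_exact n) norm_injective (cyc_norm_exact n)

/-- The augmentation sequence of a cyclic group. -/
noncomputable def cycAug : Cx.SES (kerMod (aug (Cyc n) (Cyc n))).bar (perm (Cyc n) (Cyc n)).bar
    (triv (Cyc n)).bar :=
  kerSes _ (aug_surjective 1)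

/-- The periodicity map. -/
noncomputable def cycShift (q : ℕ) : h (Cyc n) (q + 2) →+ h (Cyc n) q :=
  ((cycSes n).δ q).comp ((cycAug n).δ (q + 1))

lemma cycShift_injective (q : ℕ) : Function.Injective (cycShift n q) :=
  ((cycSes n).δ_injective q (H_perm_self q)).comp
    ((cycAug n).δ_injective (q + 1) (H_perm_self (q + 1)))

lemma cycShift_bijective (q : ℕ) : Function.Bijective (cycShift n (q + 1)) :=
  ((cycSes n).δ_bijective (q + 1) (H_perm_self (q + 1)) (H_perm_self q)).comp
    ((cycAug n).δ_bijective (q + 2) (H_perm_self (q + 2)) (H_perm_self (q + 1)))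

lemma cyc_h_two (y : h (Cyc n) 2) : y = 0 := by
  apply cycShift_injective n 0
  rw [map_zero]
  apply norm_zero_injective (G := Cyc n) (X := Cyc n)
  rw [map_zero]
  exact ((cycSes n).exact_left 0 _).2 ⟨_, rfl⟩

lemma cyc_h_even (k : ℕ) (y : h (Cyc n) (2 * k + 2)) : y = 0 := by
  induction k with
  | zero => exact cyc_h_two n y
  | succ k ih =>
    apply (cycShift_bijective n (2 * k + 1)).1
    rw [map_zero]
    exact ih _

lemma cyc_h_odd (k : ℕ) : Nonempty (h (Cyc n) (2 * k + 1) ≃+ ZMod n) := by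
  induction k with
  | zero => exact ⟨AddEquiv.ofBijective _ (cycH1_bijective n)⟩
  | succ k ih =>
    obtain ⟨e⟩ := ih
    exact ⟨(AddEquiv.ofBijective _ (cycShift_bijective n (2 * k))).trans e⟩

end Cyclic

end GMod

/-! ### The alternating group on four letters -/

/-- The field with four elements, `a + b ω` with `ω² = ω + 1`. -/
@[ext] structure F4 where
  /-- The constant coefficient. -/
  a : ZMod 2
  /-- The coefficient of `ω`. -/
  b : ZMod 2
  deriving DecidableEq, Fintype

namespace F4

instance : Zero F4 := ⟨⟨0, 0⟩⟩
instance : One F4 := ⟨⟨1, 0⟩⟩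
instance : Add F4 := ⟨fun x y => ⟨x.a + y.a, x.b + y.b⟩⟩
instance : Neg F4 := ⟨fun x => x⟩
instance : Mul F4 := ⟨fun x y => ⟨x.a * y.a + x.b * y.b, x.a * y.b + x.b * y.a + x.b * y.b⟩⟩

instance : CommRing F4 where
  add_assoc := by decide
  zero_add := by decide
  add_zero := by decide
  nsmul := nsmulRec
  zsmul := zsmulRec
  neg_add_cancel := by decide
  add_comm := by decide
  left_distrib := by decide
  right_distrib := by decide
  zero_mul := by decide
  mul_zero := by decide
  mul_assoc := by decide
  one_mul := by decide
  mul_one := by decide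
  mul_comm := by decide

lemma two_nsmul (x : F4) : 2 • x = 0 := by
  rw [_root_.two_nsmul]; revert x; decide

/-- A cube root of unity. -/
def ω : F4 := ⟨0, 1⟩

/-- The powers of `ω`. -/
def pw (i : ZMod 3) : F4 := ω ^ i.val

lemma pw_add : ∀ i j, pw (i + j) = pw i * pw j := by decide

lemma pw_zero : pw 0 = 1 := by decide

lemma pw_cube (i : ZMod 3) : pw i ^ 3 = 1 := by revert i; decide

lemma add_pow_of (k : ℕ) (hk : k = 1 ∨ k = 2) (x y : F4) : (x + y) ^ k = x ^ k + y ^ k := by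
  revert x y
  rcases hk with rfl | rfl <;> decide

end F4

/-- The alternating group on four letters as the group of maps `y ↦ n + ωⁱ y` of `F4`. -/
@[ext] structure A4 where
  /-- The exponent of the linear part. -/
  i : ZMod 3
  /-- The translation part. -/
  n : F4
  deriving DecidableEq, Fintype

namespace A4

open F4

instance : One A4 := ⟨⟨0, 0⟩⟩
instance : Mul A4 := ⟨fun x y => ⟨x.i + y.i, x.n + pw x.i * y.n⟩⟩
instance : Inv A4 := ⟨fun x => ⟨-x.i, pw (-x.i) * x.n⟩⟩

lemma mul_i (x y : A4) : (x * y).i = x.i + y.i := rfl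
lemma mul_n (x y : A4) : (x * y).n = x.n + pw x.i * y.n := rfl

instance : Group A4 := Group.ofLeftAxioms
  (fun x y z => by
    ext1
    · exact add_assoc _ _ _
    · simp only [mul_n, mul_i, pw_add]; ring)
  (by decide) (by decide)

instance : MulAction A4 F4 where
  smul g y := g.n + pw g.i * y
  one_smul y := by
    change (0 : F4) + pw 0 * y = y
    rw [pw_zero, zero_add, one_mul]
  mul_smul g h y := by
    change (g * h).n + pw (g * h).i * y = g.n + pw g.i * (h.n + pw h.i * y)
    rw [mul_n, mul_i, pw_add]; ring

/-- An element of order two. -/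
def σ : A4 := ⟨0, 1⟩

lemma one_n : (1 : A4).n = 0 := rfl
lemma σ_n : σ.n = 1 := rfl
lemma σ_i : σ.i = 0 := rfl

/-- An element of order three. -/
def ρ : A4 := ⟨1, 0⟩

end A4

namespace GMod

/-- The homomorphism from a cyclic group given by an element. -/
def cycHom (n : ℕ) {G : Type} [Group G] (g : G) (hg : g ^ n = 1) : Cyc n →* G :=
  AddMonoidHom.toMultiplicativeLeft
    (ZMod.lift n ⟨(zmultiplesHom (Additive G) (Additive.ofMul g)), by
      rw [zmultiplesHom_apply, natCast_zsmul]
      exact congrArg Additive.ofMul hg⟩)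

lemma cycHom_gen (n : ℕ) {G : Type} [Group G] (g : G) (hg : g ^ n = 1) :
    cycHom n g hg (gen n) = g := by
  have h := ZMod.lift_coe n ⟨(zmultiplesHom (Additive G) (Additive.ofMul g)), by
      rw [zmultiplesHom_apply, natCast_zsmul]
      exact congrArg Additive.ofMul hg⟩ 1
  rw [Int.cast_one] at h
  exact h.trans (one_zsmul (Additive.ofMul g))

lemma cyc_hom_ext {n : ℕ} [NeZero n] {G : Type} [Group G] {f f' : Cyc n →* G}
    (h : f (gen n) = f' (gen n)) (x : Cyc n) : f x = f' x := by
  rw [← gen_pow_val n x, map_pow, map_pow, h]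

lemma range_cycHom (n : ℕ) [NeZero n] {G : Type} [Group G] (g : G) (hg : g ^ n = 1) (x : G) :
    x ∈ (cycHom n g hg).range ↔ ∃ k < n, g ^ k = x := by
  constructor
  · rintro ⟨y, rfl⟩
    refine ⟨y.toAdd.val, ZMod.val_lt _, ?_⟩
    conv_rhs => rw [← gen_pow_val n y]
    rw [map_pow, cycHom_gen]
  · rintro ⟨k, -, rfl⟩
    exact ⟨gen n ^ k, by rw [map_pow, cycHom_gen]⟩

lemma cycHom_injective (n : ℕ) [NeZero n] {G : Type} [Group G] (g : G) (hg : g ^ n = 1)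
    (h : ∀ k < n, g ^ k = 1 → k = 0) : Function.Injective (cycHom n g hg) := by
  rw [injective_iff_map_eq_one]
  intro y hy
  rw [← gen_pow_val n y, map_pow, cycHom_gen] at hy
  rw [← gen_pow_val n y, h _ (ZMod.val_lt _) hy, pow_zero]

open F4 A4

/-- The subgroup of order two. -/
def iσ : Cyc 2 →* A4 := cycHom 2 σ (by decide)

/-- The subgroup of order three. -/
def iρ : Cyc 3 →* A4 := cycHom 3 ρ (by decide)

lemma iσ_gen : iσ (gen 2) = σ := cycHom_gen _ _ _

lemma iρ_gen : iρ (gen 3) = ρ := cycHom_gen _ _ _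

lemma iσ_injective : Function.Injective iσ := cycHom_injective _ _ _ (by decide)

lemma iρ_injective : Function.Injective iρ := cycHom_injective _ _ _ (by decide)

/-! ### Characteristic-two functionals -/

section Ev

variable (e : ℕ → ℕ)

/-- The partial sums of the exponents. -/
def expSum (n : ℕ) : ℕ := ∑ k ∈ Finset.range n, e k

/-- The product functional attached to a sequence of exponents. -/
noncomputable def ev : ∀ n : ℕ, ((triv A4).iter n).V →+ F4
  | 0 => (zmultiplesHom F4 1 : ℤ →+ F4)
  | n + 1 => lift fun g =>
      (AddMonoidHom.mulLeft (g.n ^ e n * pw g.i ^ expSum e n)).comp (ev n)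

lemma ev_cons (n : ℕ) (g : A4) (c : ((triv A4).iter n).V) :
    ev e (n + 1) (cons g c) = g.n ^ e n * pw g.i ^ expSum e n * ev e n c :=
  lift_cons _ _ _

lemma ev_one0 : ev e 0 (one0 A4) = 1 := one_zsmul _

lemma ev_R (he : ∀ n, e n = 1 ∨ e n = 2) (n : ℕ) (g : A4) (c : ((triv A4).iter n).V) :
    ev e n (((triv A4).iter n).R g c) = pw g.i ^ expSum e n * ev e n c := by
  induction n generalizing g with
  | zero =>
    rw [expSum, Finset.range_zero, Finset.sum_empty, pow_zero, one_mul]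
    rfl
  | succ n ih =>
    refine iter_hom_ext (f := (ev e (n + 1)).comp (((triv A4).iter (n + 1)).R g))
      (f' := (AddMonoidHom.mulLeft (pw g.i ^ expSum e (n + 1))).comp (ev e (n + 1)))
      (fun k v => ?_) c
    rw [AddMonoidHom.comp_apply, AddMonoidHom.comp_apply, R_cons, map_sub, ev_cons, ev_cons, ih,
      AddMonoidHom.coe_mulLeft, ev_cons, mul_n, mul_i, pw_add, add_pow_of _ (he n), expSum,
      expSum, Finset.sum_range_succ]
    ring

lemma ev_d (he : ∀ n, e n = 1 ∨ e n = 2) (n : ℕ) (hn : 3 ∣ expSum e n)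
    (c : ((triv A4).iter (n + 1)).V) : ev e n ((triv A4).bar.d n c) = 0 := by
  refine iter_hom_ext (f := (ev e n).comp ((triv A4).bar.d n)) (f' := 0) (fun g v => ?_) c
  obtain ⟨k, hk⟩ := hn
  change ev e n ((triv A4).bar.d n (cons g v)) = 0
  rw [d_cons, map_sub, ev_R e he, hk, pow_mul, pw_cube, one_pow, one_mul, sub_self]

/-- The functional induced on homology. -/
noncomputable def evH (he : ∀ n, e n = 1 ∨ e n = 2) (n : ℕ) (hn : 3 ∣ expSum e n) :
    h A4 n →+ F4 :=
  QuotientAddGroup.lift _ ((ev e n).comp ((triv A4).bar.Z n).subtype) (by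
    rintro ⟨x, hx⟩ ⟨y, hy⟩
    have hy' : (triv A4).bar.d n y = x := hy
    subst hy'
    exact ev_d e he n hn y)

lemma evH_cls (he : ∀ n, e n = 1 ∨ e n = 2) (n : ℕ) (hn : 3 ∣ expSum e n)
    (z : (triv A4).bar.Z n) : evH e he n hn ((triv A4).bar.cls n z) = ev e n z := rfl

end Ev

/-! ### Generating cycles of the group of order two -/

/-- The tail of the generating cycle of odd degree. -/
noncomputable def tail2 : ∀ k : ℕ, ((triv (Cyc 2)).iter (2 * k)).V
  | 0 => one0 _
  | k + 1 => cons (n := 2 * k + 1) 1 (cons (gen 2) (tail2 k)) +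
      cons (n := 2 * k + 1) (gen 2) (cons (gen 2) (tail2 k))

lemma gen2_mul : gen 2 * gen 2 = 1 := by decide

lemma R_tail2 (k : ℕ) : ((triv (Cyc 2)).iter (2 * k)).R (gen 2) (tail2 k) = tail2 k := by
  induction k with
  | zero => rfl
  | succ k ih =>
    have key : ((triv (Cyc 2)).iter (2 * k + 1)).R 1 (cons (gen 2) (tail2 k)) +
        ((triv (Cyc 2)).iter (2 * k + 1)).R (gen 2) (cons (gen 2) (tail2 k)) = 0 := by
      rw [R_cons, R_cons, ih, one_mul, gen2_mul]
      abel
    change ((triv (Cyc 2)).iter (2 * k + 1 + 1)).R (gen 2) (cons 1 (cons (gen 2) (tail2 k)) +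
      cons (gen 2) (cons (gen 2) (tail2 k))) = cons 1 (cons (gen 2) (tail2 k)) +
      cons (gen 2) (cons (gen 2) (tail2 k))
    rw [map_add, R_cons _ _ (cons (gen 2) (tail2 k)), R_cons _ _ (cons (gen 2) (tail2 k)),
      mul_one, gen2_mul, eq_neg_of_add_eq_zero_left key, map_neg]
    abel

/-- The generating cycle of odd degree. -/
noncomputable def gen2 (k : ℕ) : h (Cyc 2) (2 * k + 1) :=
  (triv (Cyc 2)).bar.cls (2 * k + 1) ⟨cons (gen 2) (tail2 k), by
    rw [Cx.mem_Z_succ, d_cons, R_tail2, sub_self]⟩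

lemma ev_tail2 (e : ℕ → ℕ) (he : ∀ n, e n = 1 ∨ e n = 2) (k : ℕ) :
    ev e (2 * k) (((trivHom iσ).iter (2 * k)).f (tail2 k)) = 1 := by
  induction k with
  | zero => exact ev_one0 e
  | succ k ih =>
    have h0 : (0 : F4) ^ e (2 * k + 1) = 0 := by
      rcases he (2 * k + 1) with h | h <;> rw [h] <;> decide
    have hz : ev e (2 * k + 1) (cons σ (((trivHom iσ).iter (2 * k)).f (tail2 k))) = 1 := by
      rw [ev_cons, ih, σ_n, σ_i, pw_zero]
      simp
    change ev e (2 * k + 1 + 1) (((trivHom iσ).iter (2 * k + 1 + 1)).f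
      (cons 1 (cons (gen 2) (tail2 k)) + cons (gen 2) (cons (gen 2) (tail2 k)))) = 1
    rw [map_add, map_add, Hom.iter_cons _ _ _ (cons (gen 2) (tail2 k)),
      Hom.iter_cons _ _ _ (cons (gen 2) (tail2 k)), Hom.iter_cons, ev_cons, ev_cons,
      iσ_gen, ev_cons e (2 * k + 1), hz, map_one, one_n, σ_n, σ_i, h0, pw_zero]
    simp

lemma evH_gen2 (e : ℕ → ℕ) (he : ∀ n, e n = 1 ∨ e n = 2) (k : ℕ)
    (hn : 3 ∣ expSum e (2 * k + 1)) : evH e he _ hn (hmap iσ (2 * k + 1) (gen2 k)) = 1 := by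
  change ev e (2 * k + 1) (((trivHom iσ).iter (2 * k + 1)).f (cons (gen 2) (tail2 k))) = 1
  rw [Hom.iter_cons, ev_cons, ev_tail2 e he, iσ_gen, σ_n, σ_i, pw_zero]
  simp

/-- Exponents giving functionals in all odd degrees at least three. -/
def oddExp (n : ℕ) : ℕ := if n < 3 then 1 else if n % 2 = 0 then 1 else 2

lemma oddExp_or (n : ℕ) : oddExp n = 1 ∨ oddExp n = 2 := by
  unfold oddExp; split_ifs <;> simp

lemma oddExp_sum (k : ℕ) : 3 ∣ expSum oddExp (2 * (k + 1) + 1) := by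
  induction k with
  | zero => decide
  | succ k ih =>
    rw [show 2 * (k + 1 + 1) + 1 = 2 * (k + 1) + 1 + 1 + 1 by ring, expSum,
      Finset.sum_range_succ, Finset.sum_range_succ, add_assoc]
    refine dvd_add ih ?_
    have h1 : oddExp (2 * (k + 1) + 1) = 2 := by
      unfold oddExp; rw [if_neg (by omega), if_neg (by omega)]
    have h2 : oddExp (2 * (k + 1) + 1 + 1) = 1 := by
      unfold oddExp; rw [if_neg (by omega), if_pos (by omega)]
    rw [h1, h2]

/-- The functional detecting the subgroup of order two in odd degrees. -/
noncomputable def evOdd (k : ℕ) : h A4 (2 * (k + 1) + 1) →+ F4 :=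
  evH oddExp oddExp_or _ (oddExp_sum k)

lemma evOdd_σ (k : ℕ) (a : h (Cyc 2) (2 * (k + 1) + 1))
    (ha : evOdd k (hmap iσ _ a) = 0) : a = 0 := by
  obtain ⟨f⟩ := cyc_h_odd 2 (k + 1)
  have h1 : evOdd k (hmap iσ _ (gen2 (k + 1))) = 1 := evH_gen2 _ _ _ _
  have hg : f (gen2 (k + 1)) = 1 := by
    have : f (gen2 (k + 1)) ≠ 0 := fun h0 => by
      rw [(map_eq_zero_iff f f.injective).1 h0, map_zero, map_zero] at h1
      exact absurd h1 (by decide)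
    revert this
    generalize f (gen2 (k + 1)) = t
    revert t
    decide
  have h2 : f a = 0 ∨ f a = 1 := by generalize f a = t; revert t; decide
  rcases h2 with h2 | h2
  · exact (map_eq_zero_iff f f.injective).1 h2
  · rw [f.injective (h2.trans hg.symm), h1] at ha
    exact absurd ha (by decide)

end GMod

/-! ### The tetrahedral resolution -/

namespace GMod

open F4 A4

/-- The vertices of the subdivided tetrahedron. -/
abbrev TV : Type := (A4 ⧸ iσ.range) ⊕ (A4 ⧸ iρ.range)

/-- One end of a half-edge. -/
def tσ (g : A4) : TV := Sum.inl (g : A4 ⧸ iσ.range)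

/-- The other end of a half-edge. -/
def tρ (g : A4) : TV := Sum.inr (g : A4 ⧸ iρ.range)

lemma tσ_smul (g e : A4) : tσ (g • e) = g • tσ e := rfl

lemma tρ_smul (g e : A4) : tρ (g • e) = g • tρ e := rfl

/-- The boundary of half-edges. -/
noncomputable abbrev tbd : Hom (MonoidHom.id A4) (perm A4 A4) (perm A4 TV) := bd tσ tρ tσ_smul tρ_smul

lemma tσ_eq (g k : A4) : tσ g = tσ k ↔ g = k ∨ g = k * σ := by
  rw [tσ, tσ, Sum.inl.injEq, eq_comm, QuotientGroup.eq, iσ, range_cycHom]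
  revert g k; decide

lemma tρ_eq (g k : A4) : tρ g = tρ k ↔ g = k ∨ g = k * ρ ∨ g = k * ρ ^ 2 := by
  rw [tρ, tρ, Sum.inr.injEq, eq_comm, QuotientGroup.eq, iρ, range_cycHom]
  revert g k; decide

lemma tbd_tσ (x : A4 →₀ ℤ) (k : A4) : (tbd.f x : TV →₀ ℤ) (tσ k) = x k + x (k * σ) := by
  classical
  induction x using Finsupp.induction_linear with
  | zero => rw [map_zero]; rfl
  | add a b ha hb =>
    rw [map_add]
    change (tbd.f a : TV →₀ ℤ) (tσ k) + (tbd.f b : TV →₀ ℤ) (tσ k) = _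
    rw [ha, hb, Finsupp.add_apply, Finsupp.add_apply]
    abel
  | single g a =>
    rw [bd_single]
    change (Finsupp.single (tσ g) a : TV →₀ ℤ) (tσ k) - (Finsupp.single (tρ g) a : TV →₀ ℤ) (tσ k) = _
    have hne : k ≠ k * σ := by revert k; decide
    rw [Finsupp.single_apply, Finsupp.single_apply, Finsupp.single_apply, Finsupp.single_apply,
      if_neg (show tρ g ≠ tσ k from Sum.inr_ne_inl), sub_zero]
    by_cases h1 : g = k
    · subst h1
      rw [if_pos rfl, if_pos rfl, if_neg hne, add_zero]
    · rw [if_neg h1, zero_add]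
      refine if_congr ?_ rfl rfl
      rw [tσ_eq]
      exact or_iff_right h1

lemma tbd_tρ (x : A4 →₀ ℤ) (k : A4) :
    (tbd.f x : TV →₀ ℤ) (tρ k) = -(x k + x (k * ρ) + x (k * ρ ^ 2)) := by
  classical
  induction x using Finsupp.induction_linear with
  | zero => rw [map_zero]; rfl
  | add a b ha hb =>
    rw [map_add]
    change (tbd.f a : TV →₀ ℤ) (tρ k) + (tbd.f b : TV →₀ ℤ) (tρ k) = _
    rw [ha, hb, Finsupp.add_apply, Finsupp.add_apply, Finsupp.add_apply]
    abel
  | single g a =>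
    rw [bd_single]
    change (Finsupp.single (tσ g) a : TV →₀ ℤ) (tρ k) - (Finsupp.single (tρ g) a : TV →₀ ℤ) (tρ k) = _
    have hne : k ≠ k * ρ := by revert k; decide
    have hne2 : k ≠ k * ρ ^ 2 := by revert k; decide
    have hne3 : k * ρ ≠ k * ρ ^ 2 := by revert k; decide
    rw [Finsupp.single_apply, Finsupp.single_apply, Finsupp.single_apply, Finsupp.single_apply,
      Finsupp.single_apply, if_neg (show tσ g ≠ tρ k from Sum.inl_ne_inr), zero_sub, neg_inj]
    by_cases h1 : g = k
    · subst h1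
      rw [if_pos rfl, if_pos rfl, if_neg hne, if_neg hne2, add_zero, add_zero]
    · rw [if_neg h1, zero_add]
      by_cases h2 : g = k * ρ
      · rw [if_pos h2, if_pos ((tρ_eq _ _).2 (Or.inr (Or.inl h2))), h2, if_neg hne3, add_zero]
      · rw [if_neg h2, zero_add]
        refine if_congr ?_ rfl rfl
        rw [tρ_eq, or_iff_right h1, or_iff_right h2]

lemma tbd_eq_zero (x : A4 →₀ ℤ) : tbd.f x = 0 ↔ (∀ k, x k + x (k * σ) = 0) ∧
    ∀ k, x k + x (k * ρ) + x (k * ρ ^ 2) = 0 := by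
  constructor
  · intro hx
    refine ⟨fun k => ?_, fun k => ?_⟩
    · rw [← tbd_tσ, hx]; rfl
    · rw [← neg_eq_zero, ← tbd_tρ, hx]; rfl
  · rintro ⟨h1, h2⟩
    refine Finsupp.ext fun v => ?_
    rcases v with v | v <;> induction v using QuotientGroup.induction_on with
    | H k => first | exact (tbd_tσ x k).trans (h1 k)
                   | exact (tbd_tρ x k).trans (neg_eq_zero.2 (h2 k))

lemma tbd_exact : Function.Exact tbd.f (aug A4 TV).f := by
  refine bd_exact _ _ (tσ 1) fun v => ?_
  have key : ∀ g : A4, Linked tσ tρ (g • tσ 1) (tσ 1) := by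
    refine linked_of_closure {σ, ρ} ?_ _ tσ_smul tρ_smul ?_
    · refine (Subgroup.eq_top_iff' _).2 fun g => ?_
      have h1 : σ ∈ Subgroup.closure {σ, ρ} := Subgroup.subset_closure (by simp)
      have h2 : ρ ∈ Subgroup.closure {σ, ρ} := Subgroup.subset_closure (by simp)
      have h3 : ∃ a b c d : Fin 3, g = σ ^ a.val * ρ ^ b.val * σ ^ c.val * ρ ^ d.val := by
        revert g; decide
      obtain ⟨a, b, c, d, rfl⟩ := h3
      exact mul_mem (mul_mem (mul_mem (pow_mem h1 _) (pow_mem h2 _)) (pow_mem h1 _)) (pow_mem h2 _)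
    · rintro g (rfl | rfl)
      · rw [show σ • tσ 1 = tσ 1 from (tσ_eq _ _).2 (by decide)]
        exact Linked.refl _
      · have h1 := linked_edge (o := tσ) (t := tρ) ρ
        rw [show tρ ρ = tρ 1 from (tρ_eq _ _).2 (by decide)] at h1
        exact h1.trans (linked_edge (o := tσ) (t := tρ) 1).symm
  rcases v with v | v <;> induction v using QuotientGroup.induction_on with
  | H k =>
    have h1 : Linked tσ tρ (tσ k) (tσ 1) := by simpa [← tσ_smul] using key k
    first | exact h1
          | exact (linked_edge (o := tσ) (t := tρ) k).symm.trans h1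

/-- The boundary of faces. -/
noncomputable def face : Hom (MonoidHom.id A4) (perm A4 F4) (perm A4 A4) where
  f := {
    toFun := fun c => (Finsupp.equivFunOnFinite.symm fun g : A4 =>
      (c : F4 →₀ ℤ) (g • ω) - (c : F4 →₀ ℤ) ((g * σ) • ω) : A4 →₀ ℤ)
    map_zero' := by ext g; rfl
    map_add' := fun c c' => by
      ext g
      change (c + c' : F4 →₀ ℤ) _ - (c + c' : F4 →₀ ℤ) _ =
        ((c : F4 →₀ ℤ) _ - (c : F4 →₀ ℤ) _) + ((c' : F4 →₀ ℤ) _ - (c' : F4 →₀ ℤ) _)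
      rw [Finsupp.add_apply, Finsupp.add_apply]
      abel }
  comm k c := by
    ext g
    have h1 : ∀ y : F4, (Finsupp.mapDomain (k • ·) c : F4 →₀ ℤ) y = (c : F4 →₀ ℤ) (k⁻¹ • y) := by
      intro y
      have := Finsupp.mapDomain_apply (MulAction.injective k) c (k⁻¹ • y)
      rwa [smul_inv_smul] at this
    change (Finsupp.mapDomain (k • ·) c : F4 →₀ ℤ) (g • ω) -
      (Finsupp.mapDomain (k • ·) c : F4 →₀ ℤ) ((g * σ) • ω) =
      (Finsupp.mapDomain (k • ·) (Finsupp.equivFunOnFinite.symm _) : A4 →₀ ℤ) g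
    obtain ⟨g, rfl⟩ : ∃ g', g = k • g' := ⟨k⁻¹ • g, by rw [smul_inv_smul]⟩
    rw [h1, h1, Finsupp.mapDomain_apply (MulAction.injective k), smul_eq_mul, mul_assoc,
      mul_smul, mul_smul k, inv_smul_smul, inv_smul_smul]
    rfl

lemma face_apply (c : F4 →₀ ℤ) (g : A4) :
    (face.f c : A4 →₀ ℤ) g = c (g • ω) - c ((g * σ) • ω) := rfl

lemma face_exact : Function.Exact face.f tbd.f := by
  intro x
  rw [tbd_eq_zero]
  constructor
  · rintro ⟨h1, h2⟩
    let p : F4 → A4 := fun y => ⟨if y = 1 then 0 else if y = ω then 1 else 2, y * (ω + 1)⟩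
    refine ⟨(Finsupp.equivFunOnFinite.symm fun y : F4 =>
      if y = 0 then 0 else (x : A4 →₀ ℤ) (p y) : F4 →₀ ℤ), Finsupp.ext fun g => ?_⟩
    rw [face_apply]
    change (if g • ω = 0 then 0 else (x : A4 →₀ ℤ) (p (g • ω))) -
      (if (g * σ) • ω = 0 then 0 else (x : A4 →₀ ℤ) (p ((g * σ) • ω))) = (x : A4 →₀ ℤ) g
    have hd : (g • ω ≠ 0 ∧ (g * σ) • ω = 0 ∧ p (g • ω) = g) ∨
        (g • ω = 0 ∧ (g * σ) • ω ≠ 0 ∧ p ((g * σ) • ω) = g * σ) ∨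
        (g • ω ≠ 0 ∧ (g * σ) • ω ≠ 0 ∧ p ((g * σ) • ω) = g * ρ ∧ p (g • ω) = g * ρ ^ 2 * σ) ∨
        (g • ω ≠ 0 ∧ (g * σ) • ω ≠ 0 ∧ p (g • ω) = g * σ * ρ ∧
          p ((g * σ) • ω) = g * σ * ρ ^ 2 * σ) := by
      revert g; decide
    have e1 := h1 g
    have e2 := h2 g
    have e3 := h2 (g * σ)
    have e4 := h1 (g * ρ ^ 2)
    have e5 := h1 (g * σ * ρ ^ 2)
    rcases hd with ⟨a, b, c⟩ | ⟨a, b, c⟩ | ⟨a, b, c, d⟩ | ⟨a, b, c, d⟩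
    · rw [if_neg a, if_pos b, c, sub_zero]
    · rw [if_pos a, if_neg b, c, zero_sub]; omega
    · rw [if_neg a, if_neg b, c, d]; omega
    · rw [if_neg a, if_neg b, c, d]; omega
  · rintro ⟨c, rfl⟩
    refine ⟨fun k => ?_, fun k => ?_⟩
    · rw [face_apply, face_apply, show k * σ * σ = k by revert k; decide]
      abel
    · rw [face_apply, face_apply, face_apply,
        show (k * ρ) • ω = (k * σ) • ω by revert k; decide,
        show (k * ρ ^ 2) • ω = (k * ρ * σ) • ω by revert k; decide,
        show (k * ρ ^ 2 * σ) • ω = k • ω by revert k; decide]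
      abel

lemma norm_face_exact : Function.Exact (norm A4 F4).f face.f := by
  intro c
  constructor
  · intro hc
    have h1 : ∀ g : A4, (c : F4 →₀ ℤ) (g • ω) = (c : F4 →₀ ℤ) ((g * σ) • ω) := fun g => by
      rw [← sub_eq_zero, ← face_apply, hc]; rfl
    refine ⟨(c : F4 →₀ ℤ) 0, Finsupp.ext fun y => ?_⟩
    rw [norm_apply]
    have h2 : y = 0 ∨ ∃ g : A4, g • ω = y ∧ (g * σ) • ω = 0 := by revert y; decide
    rcases h2 with rfl | ⟨g, rfl, hg⟩
    · rfl
    · rw [h1, hg]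
  · rintro ⟨a, rfl⟩
    refine Finsupp.ext fun g => ?_
    rw [face_apply, norm_apply, norm_apply, sub_self]
    rfl

/-- The augmentation sequence. -/
noncomputable def tSes₁ : Cx.SES (kerMod (aug A4 TV)).bar (perm A4 TV).bar (triv A4).bar :=
  kerSes _ (aug_surjective (tσ 1))

/-- The sequence of half-edges. -/
noncomputable def tSes₂ : Cx.SES (kerMod tbd).bar (perm A4 A4).bar (kerMod (aug A4 TV)).bar :=
  kerLiftSes _ _ (kerIncl tbd) tbd_exact Subtype.val_injective (fun x => by
    constructor
    · intro hx; exact ⟨⟨x, hx⟩, rfl⟩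
    · rintro ⟨y, rfl⟩; exact y.2)

/-- The sequence of faces. -/
noncomputable def tSes₃ : Cx.SES (triv A4).bar (perm A4 F4).bar (kerMod tbd).bar :=
  kerLiftSes _ _ _ face_exact norm_injective norm_face_exact

end GMod

/-! ### The homology of the alternating group `A4` -/

namespace GMod

open F4 A4

lemma cyc_smul (n : ℕ) [NeZero n] (q : ℕ) (y : h (Cyc n) (q + 1)) : n • y = 0 := by
  obtain ⟨k, rfl | rfl⟩ := Nat.even_or_odd' q
  · obtain ⟨e⟩ := cyc_h_odd n k
    apply e.injective
    rw [map_nsmul, map_zero]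
    exact ZModModule.char_nsmul_eq_zero n _
  · rw [cyc_h_even n k y, smul_zero]

/-- The stabilizer of the origin. -/
noncomputable def ptρ : Hom iρ (triv (Cyc 3)) (perm A4 F4) := pt iρ 0 (by decide)

lemma ptρ_bijective (n : ℕ) : Function.Bijective (ptρ.map n) :=
  pt_map_bijective _ _ iρ_injective _ (by decide) (by decide) n

lemma norm_iρ (q : ℕ) (y : h (Cyc 3) (q + 1)) :
    (norm A4 F4).map (q + 1) (hmap iρ (q + 1) y) = ptρ.map (q + 1) y := by
  have hf : ∀ (g : Cyc 3) (x : Cyc 3), iρ (g • x) • (1 : F4) = iρ g • iρ x • (1 : F4) := by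
    intro g x
    rw [smul_eq_mul, map_mul, mul_smul]
  let P : Hom iρ (perm (Cyc 3) (Cyc 3)) (perm A4 F4) := permHom iρ (fun c => iρ c • (1 : F4)) hf
  let K : Hom iρ (triv (Cyc 3)) (perm A4 F4) := ⟨(norm A4 F4).f, fun g v => (norm A4 F4).comm (iρ g) v⟩
  let Q : Hom iρ (triv (Cyc 3)) (perm A4 F4) := ⟨P.f.comp (norm (Cyc 3) (Cyc 3)).f, fun g v => by
    exact (congrArg P.f ((norm (Cyc 3) (Cyc 3)).comm g v)).trans
      (P.comm g ((norm (Cyc 3) (Cyc 3)).f v))⟩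
  have h1 : K.map (q + 1) y = (norm A4 F4).map (q + 1) (hmap iρ (q + 1) y) :=
    Hom.map_comp _ _ _ (fun _ => rfl) (fun _ => rfl) _ _
  have h2 : Q.map (q + 1) y = 0 := by
    rw [Hom.map_comp (norm (Cyc 3) (Cyc 3)) P Q (fun _ => rfl) (fun _ => rfl),
      H_perm_self q ((norm (Cyc 3) (Cyc 3)).map (q + 1) y), map_zero]
  rw [← h1, Hom.map_add ptρ Q K (fun v => ?_), h2, add_zero]
  have h3 : (Finset.univ : Finset F4) =
      {0, iρ 1 • 1, iρ (gen 3) • 1, iρ (gen 3 * gen 3) • 1} := by decide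
  have h4 : (Finset.univ : Finset (Cyc 3)) = {1, gen 3, gen 3 * gen 3} := by decide
  change (∑ x : F4, (Finsupp.singleAddHom x : ℤ →+ (F4 →₀ ℤ))) v = Finsupp.single 0 v +
    Finsupp.mapDomain (fun c => iρ c • (1 : F4))
      ((∑ x : Cyc 3, (Finsupp.singleAddHom x : ℤ →+ (Cyc 3 →₀ ℤ))) v)
  rw [h3, h4, Finset.sum_insert (by decide), Finset.sum_insert (by decide),
    Finset.sum_insert (by decide), Finset.sum_singleton, Finset.sum_insert (by decide),
    Finset.sum_insert (by decide), Finset.sum_singleton]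
  simp only [AddMonoidHom.add_apply, Finsupp.singleAddHom_apply, Finsupp.mapDomain_add,
    Finsupp.mapDomain_single]

lemma norm_surjective (q : ℕ) : Function.Surjective ((norm A4 F4).map (q + 1)) := fun x => by
  obtain ⟨y, rfl⟩ := (ptρ_bijective (q + 1)).2 x
  exact ⟨_, norm_iρ q y⟩

lemma hmap_iρ_injective (q : ℕ) : Function.Injective (hmap iρ (q + 1)) := by
  intro a b hab
  apply (ptρ_bijective (q + 1)).1
  rw [← norm_iρ, hab, norm_iρ]

/-- The sum of the inclusions of the two cyclic subgroups. -/
noncomputable def cycSum (q : ℕ) : h (Cyc 2) q × h (Cyc 3) q →+ h A4 q :=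
  AddMonoidHom.coprod (hmap iσ q) (hmap iρ q)

lemma cycSum_apply (q : ℕ) (a : h (Cyc 2) q) (b : h (Cyc 3) q) :
    cycSum q (a, b) = hmap iσ q a + hmap iρ q b := rfl

lemma evOdd_iρ (k : ℕ) (b : h (Cyc 3) (2 * (k + 1) + 1)) : evOdd k (hmap iρ _ b) = 0 := by
  have h1 : 3 • evOdd k (hmap iρ _ b) = 0 := by
    rw [← map_nsmul, ← map_nsmul, cyc_smul 3 _ b, map_zero, map_zero]
  rwa [succ_nsmul, F4.two_nsmul, zero_add] at h1

lemma cycSum_injective (q : ℕ) : Function.Injective (cycSum (q + 2)) := by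
  rw [injective_iff_map_eq_zero]
  rintro ⟨a, b⟩ hab
  rw [cycSum_apply] at hab
  obtain ⟨k, rfl | rfl⟩ := Nat.even_or_odd' q
  · rw [Prod.mk_eq_zero]
    exact ⟨cyc_h_even 2 k a, cyc_h_even 3 k b⟩
  · have ha : a = 0 := evOdd_σ k a (by
      have h1 := congrArg (evOdd k) hab
      rw [map_add] at h1
      erw [evOdd_iρ k b] at h1
      rw [add_zero, map_zero] at h1
      exact h1)
    subst ha
    rw [map_zero, zero_add] at hab
    rw [Prod.mk_eq_zero]
    exact ⟨rfl, (injective_iff_map_eq_zero _).1 (hmap_iρ_injective (2 * k + 1 + 1)) b hab⟩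

/-- The homology of the vertices. -/
noncomputable def vert (q : ℕ) : h (Cyc 2) q × h (Cyc 3) q →+ (perm A4 TV).H q :=
  AddMonoidHom.coprod (((permInl A4 _ _).map q).comp ((pt iσ _ (range_smul_mk_one iσ)).map q))
    (((permInr A4 _ _).map q).comp ((pt iρ _ (range_smul_mk_one iρ)).map q))

lemma vert_bijective (q : ℕ) : Function.Bijective (vert q) :=
  coprod_bijective q _ _ (pt_quot_bijective iσ iσ_injective q) (pt_quot_bijective iρ iρ_injective q)

lemma aug_vert (q : ℕ) (x : h (Cyc 2) q × h (Cyc 3) q) : tSes₁.p.map q (vert q x) = cycSum q x := by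
  obtain ⟨a, b⟩ := x
  change (aug A4 TV).map q (_ + _) = _
  rw [map_add, cycSum_apply]
  congr 1
  · change (aug A4 TV).map q ((permInl A4 _ _).map q ((pt iσ _ (range_smul_mk_one iσ)).map q a)) = _
    rw [← Hom.map_comp (pt iσ _ (range_smul_mk_one iσ)) (permInl A4 _ _)
      (pt iσ (tσ 1) fun a => congrArg Sum.inl (range_smul_mk_one iσ a)) (fun _ => rfl)
      (fun v => by simp [permInl, permHom, pt, tσ])]
    exact (hmap_eq_aug_pt _ _ _ _ _).symm
  · change (aug A4 TV).map q ((permInr A4 _ _).map q ((pt iρ _ (range_smul_mk_one iρ)).map q b)) = _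
    rw [← Hom.map_comp (pt iρ _ (range_smul_mk_one iρ)) (permInr A4 _ _)
      (pt iρ (tρ 1) fun a => congrArg Sum.inr (range_smul_mk_one iρ a)) (fun _ => rfl)
      (fun v => by simp [permInr, permHom, pt, tρ])]
    exact (hmap_eq_aug_pt _ _ _ _ _).symm

lemma tδ₁_eq_zero (q : ℕ) (x : h A4 (q + 1)) : tSes₁.δ q x = 0 ↔ ∃ y, cycSum (q + 1) y = x := by
  rw [tSes₁.exact_right q x]
  constructor
  · rintro ⟨y, rfl⟩
    obtain ⟨z, rfl⟩ := (vert_bijective _).2 y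
    exact ⟨z, (aug_vert _ z).symm⟩
  · rintro ⟨y, rfl⟩
    exact ⟨_, aug_vert _ y⟩

lemma tδ₁_surjective (q : ℕ) : Function.Surjective (tSes₁.δ (q + 2)) := fun x => by
  refine (tSes₁.exact_left (q + 2) x).1 ?_
  obtain ⟨y, hy⟩ := (vert_bijective _).2 (tSes₁.i.map (q + 2) x)
  have h1 : cycSum (q + 2) y = 0 := by
    rw [← aug_vert, hy]
    exact (tSes₁.exact_mid (q + 2)).apply_apply_eq_zero x
  rw [← hy, (injective_iff_map_eq_zero _).1 (cycSum_injective q) y h1, map_zero]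

lemma tδ₂_injective (q : ℕ) : Function.Injective (tSes₂.δ q) :=
  tSes₂.δ_injective q (H_perm_self q)

lemma tδ₂_bijective (q : ℕ) : Function.Bijective (tSes₂.δ (q + 1)) :=
  tSes₂.δ_bijective _ (H_perm_self _) (H_perm_self _)

lemma tδ₃_injective (q : ℕ) : Function.Injective (tSes₃.δ q) := by
  rw [injective_iff_map_eq_zero]
  intro x hx
  obtain ⟨y, rfl⟩ := (tSes₃.exact_right q x).1 hx
  obtain ⟨z, rfl⟩ := norm_surjective q y
  exact (tSes₃.exact_mid (q + 1)).apply_apply_eq_zero z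

/-- The shift of degree three. -/
noncomputable def shift (q : ℕ) : h A4 (q + 3) →+ h A4 q :=
  (tSes₃.δ q).comp ((tSes₂.δ (q + 1)).comp (tSes₁.δ (q + 2)))

lemma shift_eq_zero (q : ℕ) (x : h A4 (q + 3)) : shift q x = 0 ↔ ∃ y, cycSum (q + 3) y = x := by
  rw [← tδ₁_eq_zero]
  change tSes₃.δ q (tSes₂.δ (q + 1) (tSes₁.δ (q + 2) x)) = 0 ↔ _
  rw [map_eq_zero_iff _ (tδ₃_injective q), map_eq_zero_iff _ (tδ₂_injective (q + 1))]

lemma norm_eq_zero (q : ℕ) (x : h A4 q) : (norm A4 F4).map q x = 0 ↔ ∃ y, shift q y = x := by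
  refine (tSes₃.exact_left q x).trans ?_
  constructor
  · rintro ⟨y, rfl⟩
    obtain ⟨y, rfl⟩ := (tδ₂_bijective q).2 y
    obtain ⟨y, rfl⟩ := tδ₁_surjective q y
    exact ⟨y, rfl⟩
  · rintro ⟨y, rfl⟩
    exact ⟨_, rfl⟩

lemma six_nsmul_shift (q : ℕ) (x : h A4 (q + 3)) (hx : shift q (6 • x) = 0) : 6 • x = 0 := by
  obtain ⟨⟨a, b⟩, hab⟩ := (shift_eq_zero q _).1 hx
  rw [cycSum_apply] at hab
  have ha : a = 0 := by
    obtain ⟨k, rfl | rfl⟩ := Nat.even_or_odd' q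
    · refine evOdd_σ k a ?_
      have h1 := congrArg (evOdd k) hab
      rw [map_add, map_nsmul, show 6 = 3 * 2 from rfl, mul_nsmul, F4.two_nsmul] at h1
      erw [evOdd_iρ k b] at h1
      rwa [add_zero] at h1
    · exact cyc_h_even 2 (k + 1) a
  rw [ha, map_zero, zero_add] at hab
  have hb : ptρ.map (q + 3) b = 0 := by
    rw [← norm_iρ (q + 2), hab, map_nsmul]
    obtain ⟨z, hz⟩ := (ptρ_bijective (q + 3)).2 ((norm A4 F4).map (q + 3) x)
    erw [← hz]
    rw [← map_nsmul, show 6 = 3 * 2 from rfl, mul_nsmul', cyc_smul 3 (q + 2), map_zero]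
  rw [← hab, (injective_iff_map_eq_zero _).1 (ptρ_bijective (q + 3)).1 b hb, map_zero]

end GMod

/-! ### Orders of the homology groups of `A4` -/

namespace GMod

open F4 A4

lemma closure_σρ : Subgroup.closure {σ, ρ} = ⊤ := by
  refine (Subgroup.eq_top_iff' _).2 fun g => ?_
  have h1 : σ ∈ Subgroup.closure {σ, ρ} := Subgroup.subset_closure (by simp)
  have h2 : ρ ∈ Subgroup.closure {σ, ρ} := Subgroup.subset_closure (by simp)
  have h3 : ∃ a b c d : Fin 3, g = σ ^ a.val * ρ ^ b.val * σ ^ c.val * ρ ^ d.val := by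
    revert g; decide
  obtain ⟨a, b, c, d, rfl⟩ := h3
  exact mul_mem (mul_mem (mul_mem (pow_mem h1 _) (pow_mem h2 _)) (pow_mem h1 _)) (pow_mem h2 _)

lemma c1_σ : c1 σ = 0 := by
  have h1 : c1 (ρ * σ * ρ⁻¹) = c1 σ := by
    rw [c1_mul, c1_mul, add_right_comm, ← c1_mul, mul_inv_cancel, c1_one, zero_add]
  have h2 : c1 (ρ * (ρ * σ * ρ⁻¹) * ρ⁻¹) = c1 σ := by
    rw [c1_mul, c1_mul, add_right_comm, ← c1_mul, mul_inv_cancel, c1_one, zero_add, h1]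
  rw [show ρ * (ρ * σ * ρ⁻¹) * ρ⁻¹ = σ * (ρ * σ * ρ⁻¹) by decide, c1_mul, h1] at h2
  exact left_eq_add.1 h2.symm

lemma hmap_iσ_one (y : h (Cyc 2) 1) : hmap iσ 1 y = 0 := by
  refine h1_mem_of_closure (hmap iσ 1).ker {gen 2} (cyc_closure 2) ?_ y
  rintro g rfl
  rw [AddMonoidHom.mem_ker, hmap_c1, iσ_gen, c1_σ]

lemma hmap_iρ_one_bijective : Function.Bijective (hmap iρ 1) := by
  refine ⟨hmap_iρ_injective 0, fun y => ?_⟩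
  refine h1_mem_of_closure (hmap iρ 1).range {σ, ρ} closure_σρ ?_ y
  rintro g (rfl | rfl)
  · rw [c1_σ]; exact zero_mem _
  · exact ⟨c1 (gen 3), by rw [hmap_c1, iρ_gen]⟩

lemma card_cyc_odd (n : ℕ) [NeZero n] (k : ℕ) : Nat.card (h (Cyc n) (2 * k + 1)) = n := by
  obtain ⟨e⟩ := cyc_h_odd n k
  rw [Nat.card_congr e.toEquiv, Nat.card_zmod]

lemma card_cyc_even (n : ℕ) [NeZero n] (k : ℕ) : Nat.card (h (Cyc n) (2 * k + 2)) = 1 :=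
  Nat.card_eq_one_iff_unique.2
    ⟨⟨fun a b => by rw [cyc_h_even n k a, cyc_h_even n k b]⟩, ⟨0⟩⟩

lemma card_h_one : Nat.card (h A4 1) = 3 := by
  rw [← Nat.card_congr (Equiv.ofBijective _ hmap_iρ_one_bijective)]
  exact card_cyc_odd 3 0

lemma aug_norm (a : ℤ) : (aug A4 F4).map 0 ((norm A4 F4).map 0 (c0 A4 a)) = c0 A4 (4 * a) := by
  have h1 : ((aug A4 F4).comp (norm A4 F4)).map 0 (c0 A4 a) = _ := Hom.comp_map _ _ _ _
  rw [← h1, map_c0]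
  congr 1
  change (aug A4 F4).f ((∑ x : F4, (Finsupp.singleAddHom x : ℤ →+ (F4 →₀ ℤ))) a) = _
  rw [AddMonoidHom.finsetSum_apply, map_sum]
  refine (Finset.sum_congr rfl fun x _ => aug_single x a).trans ?_
  rw [Finset.sum_const, show (Finset.univ : Finset F4).card = 4 by decide, nsmul_eq_mul]
  rfl

lemma aug_zero_bijective : Function.Bijective ((aug A4 F4).map 0) := by
  refine ⟨aug_zero_injective_of_pt iρ 0 _ (ptρ_bijective 0).2, fun x => ?_⟩
  obtain ⟨a, rfl⟩ := c0_bijective.2 x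
  exact ⟨_, aug_pt_zero iρ (0 : F4) (by decide) a⟩

/-- The coinvariants of the module of closed chains of half-edges. -/
noncomputable def faceHom : ℤ →+ (kerMod tbd).H 0 :=
  (tSes₃.p.map 0).comp ((ptρ.map 0).comp (c0 (Cyc 3)))

lemma faceHom_surjective : Function.Surjective faceHom :=
  tSes₃.map_zero_surjective.comp ((ptρ_bijective 0).2.comp c0_bijective.2)

lemma faceHom_eq_zero (a : ℤ) : faceHom a = 0 ↔ 4 ∣ a := by
  refine (tSes₃.exact_mid 0 (ptρ.map 0 (c0 (Cyc 3) a))).trans ?_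
  have h1 : ∀ b, tSes₃.i.map 0 (c0 A4 b) = ptρ.map 0 (c0 (Cyc 3) a) ↔ 4 * b = a := fun b => by
    rw [← aug_zero_bijective.1.eq_iff, ← (c0_bijective (G := A4)).1.eq_iff (a := 4 * b) (b := a)]
    exact Iff.of_eq (congrArg₂ Eq (aug_norm b) (aug_pt_zero iρ (0 : F4) (by decide) a))
  constructor
  · rintro ⟨y, hy⟩
    obtain ⟨b, rfl⟩ := c0_bijective.2 y
    exact ⟨b, ((h1 b).1 hy).symm⟩
  · rintro ⟨b, rfl⟩
    exact ⟨_, (h1 b).2 rfl⟩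

lemma card_face : Nat.card ((kerMod tbd).H 0) = 4 := by
  have h1 : faceHom.ker = AddSubgroup.zmultiples (4 : ℤ) := by
    ext a
    rw [AddMonoidHom.mem_ker, faceHom_eq_zero, Int.mem_zmultiples_iff]
  rw [← Nat.card_congr (QuotientAddGroup.quotientKerEquivOfSurjective _ faceHom_surjective).toEquiv,
    h1, Nat.card_congr (Int.quotientZMultiplesEquivZMod 4).toEquiv, Nat.card_zmod]
  rfl

lemma four_nsmul_face (x : (kerMod tbd).H 0) : 4 • x = 0 := by
  obtain ⟨a, rfl⟩ := faceHom_surjective x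
  rw [← map_nsmul, faceHom_eq_zero, nsmul_eq_mul]
  exact Dvd.intro _ rfl

lemma tδ₂_zero_bijective : Function.Bijective (tSes₂.δ 0) := by
  refine ⟨tδ₂_injective 0, fun x => (tSes₂.exact_left 0 x).1 ?_⟩
  apply aug_perm_self_zero_injective (G := A4)
  rw [map_zero]
  obtain ⟨a, ha⟩ := c0_bijective.2 ((aug A4 A4).map 0 (tSes₂.i.map 0 x))
  have h1 : c0 A4 (4 • a) = 0 := by
    rw [map_nsmul, ha, ← map_nsmul, ← map_nsmul, four_nsmul_face, map_zero, map_zero]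
  have h2 := (injective_iff_map_eq_zero _).1 c0_bijective.1 _ h1
  have h3 : a = 0 := by simpa using h2
  rw [← ha, h3, map_zero]

lemma card_h_two : Nat.card (h A4 2) = 2 := by
  have hi : Function.Injective (tSes₁.δ 1) := by
    rw [injective_iff_map_eq_zero]
    intro x hx
    obtain ⟨⟨a, b⟩, rfl⟩ := (tδ₁_eq_zero 1 x).1 hx
    rw [cycSum_apply, cyc_h_even 2 0 a, cyc_h_even 3 0 b, map_zero, map_zero, add_zero]
  let V : h (Cyc 2) 1 × h (Cyc 3) 1 ≃+ (perm A4 TV).H 1 := AddEquiv.ofBijective _ (vert_bijective 1)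
  let p : (kerMod (aug A4 TV)).H 1 →+ h (Cyc 2) 1 :=
    (AddMonoidHom.fst _ _).comp (V.symm.toAddMonoidHom.comp (tSes₁.i.map 1))
  have h1 : ∀ x, tSes₁.i.map 1 x = vert 1 (p x, 0) := fun x => by
    have h2 : V (V.symm (tSes₁.i.map 1 x)) = _ := V.apply_symm_apply _
    have h3 : tSes₁.p.map 1 (V (V.symm (tSes₁.i.map 1 x))) = 0 := by
      rw [h2]; exact (tSes₁.exact_mid 1).apply_apply_eq_zero x
    rw [← h2]
    generalize hu : V.symm (tSes₁.i.map 1 x) = u at h3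
    have h4 : p x = u.1 := congrArg Prod.fst hu
    rw [h4]
    obtain ⟨a, b⟩ := u
    change tSes₁.p.map 1 (vert 1 (a, b)) = 0 at h3
    rw [aug_vert, cycSum_apply, hmap_iσ_one, zero_add] at h3
    rw [(injective_iff_map_eq_zero _).1 hmap_iρ_one_bijective.1 b h3]
    rfl
  have he : Function.Exact (tSes₁.δ 1) p := by
    intro x
    refine Iff.trans ?_ (tSes₁.exact_left 1 x)
    rw [h1, map_eq_zero_iff _ (vert_bijective 1).1, Prod.mk_eq_zero]
    exact (and_iff_left rfl).symm
  have hs : Function.Surjective p := by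
    intro a
    obtain ⟨x, hx⟩ := (tSes₁.exact_mid 1 (vert 1 (a, 0))).1 (by
      rw [aug_vert, cycSum_apply, hmap_iσ_one, map_zero, zero_add])
    refine ⟨x, ?_⟩
    rw [h1] at hx
    exact congrArg Prod.fst ((vert_bijective 1).1 hx)
  have h5 := card_eq_mul_of_exact _ p hi hs he
  rw [Nat.card_congr (Equiv.ofBijective _ tδ₂_zero_bijective), card_face, card_cyc_odd 2 0] at h5
  change 4 = Nat.card (h A4 2) * 2 at h5
  omega

lemma six_nsmul_h (q : ℕ) : ∀ x : h A4 (q + 1), 6 • x = 0 := by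
  induction q using Nat.strongRecOn with
  | ind q ih =>
    match q with
    | 0 =>
      intro x
      obtain ⟨y, rfl⟩ := hmap_iρ_one_bijective.2 x
      rw [← map_nsmul, show 6 = 3 * 2 from rfl, mul_nsmul', cyc_smul 3 0, map_zero]
    | 1 =>
      intro x
      have h1 : Nat.card (h A4 2) • x = 0 := card_nsmul_eq_zero'
      rw [card_h_two] at h1
      rw [show 6 = 2 * 3 from rfl, mul_nsmul, h1, nsmul_zero]
    | 2 =>
      intro x
      refine six_nsmul_shift 0 x ?_
      exact (injective_iff_map_eq_zero _).1 norm_zero_injective _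
        ((norm_eq_zero 0 _).2 ⟨_, rfl⟩)
    | q + 3 =>
      intro x
      refine six_nsmul_shift (q + 1) x ?_
      rw [map_nsmul]
      exact ih q (by omega) _

lemma card_h_shift (q : ℕ) : Nat.card (h A4 (q + 4)) * Nat.card (h (Cyc 3) (q + 1)) =
    Nat.card (h (Cyc 2) (q + 4)) * Nat.card (h (Cyc 3) (q + 4)) * Nat.card (h A4 (q + 1)) := by
  let r : h A4 (q + 4) →+ ((norm A4 F4).map (q + 1)).ker :=
    AddMonoidHom.codRestrict (shift (q + 1)) _ fun x => (norm_eq_zero (q + 1) _).2 ⟨x, rfl⟩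
  have h1 : Nat.card (h A4 (q + 4)) = _ := card_eq_mul_of_exact (cycSum (q + 4)) r
    (cycSum_injective (q + 2)) (fun x => by
      obtain ⟨y, hy⟩ := (norm_eq_zero (q + 1) _).1 x.2
      exact ⟨y, Subtype.ext hy⟩) (fun x => by
      refine Iff.trans ?_ (shift_eq_zero (q + 1) x)
      exact ⟨fun h => congrArg Subtype.val h, fun h => Subtype.ext h⟩)
  have h2 : Nat.card (h A4 (q + 1)) = _ := card_eq_mul_of_exact
    (((norm A4 F4).map (q + 1)).ker.subtype) ((norm A4 F4).map (q + 1)) Subtype.val_injective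
    (norm_surjective q) (fun x => ⟨fun h => ⟨⟨x, h⟩, rfl⟩, by rintro ⟨y, rfl⟩; exact y.2⟩)
  rw [← Nat.card_congr (Equiv.ofBijective _ (ptρ_bijective (q + 1)))] at h2
  rw [h1, h2, Nat.card_prod]
  ring

lemma card_h_three : Nat.card (h A4 3) = 6 := by
  have h1 : Function.Bijective (cycSum 3) := by
    refine ⟨cycSum_injective 1, fun x => (shift_eq_zero 0 x).1 ?_⟩
    exact (injective_iff_map_eq_zero _).1 norm_zero_injective _ ((norm_eq_zero 0 _).2 ⟨_, rfl⟩)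
  rw [← Nat.card_congr (Equiv.ofBijective _ h1), Nat.card_prod, card_cyc_odd 2 1, card_cyc_odd 3 1]

lemma card_h_even (m : ℕ) : Nat.card (h A4 (2 * m + 5)) = 6 * Nat.card (h A4 (2 * m + 2)) := by
  have h1 := card_h_shift (2 * m + 1)
  have h2 : Nat.card (h (Cyc 3) (2 * m + 1 + 1)) = 1 := card_cyc_even 3 m
  have h3 : Nat.card (h (Cyc 3) (2 * m + 1 + 4)) = 3 := card_cyc_odd 3 (m + 2)
  have h4 : Nat.card (h (Cyc 2) (2 * m + 1 + 4)) = 2 := card_cyc_odd 2 (m + 2)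
  rw [h2, h3, h4, mul_one] at h1
  exact h1

lemma card_h_odd (m : ℕ) : Nat.card (h A4 (2 * m + 4)) * 3 = Nat.card (h A4 (2 * m + 1)) := by
  have h1 := card_h_shift (2 * m)
  have h2 : Nat.card (h (Cyc 3) (2 * m + 1)) = 3 := card_cyc_odd 3 m
  have h3 : Nat.card (h (Cyc 3) (2 * m + 4)) = 1 := card_cyc_even 3 (m + 1)
  have h4 : Nat.card (h (Cyc 2) (2 * m + 4)) = 1 := card_cyc_even 2 (m + 1)
  rw [h2, h3, h4, one_mul, one_mul] at h1
  exact h1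

lemma card_h_all (k : ℕ) : Nat.card (h A4 (6 * k + 1)) = 3 * 2 ^ k ∧
    Nat.card (h A4 (6 * k + 2)) = 2 ^ (k + 1) ∧ Nat.card (h A4 (6 * k + 3)) = 3 * 2 ^ (k + 1) ∧
    Nat.card (h A4 (6 * k + 4)) = 2 ^ k ∧ Nat.card (h A4 (6 * k + 5)) = 3 * 2 ^ (k + 2) ∧
    Nat.card (h A4 (6 * k + 6)) = 2 ^ (k + 1) := by
  have step : ∀ k : ℕ, Nat.card (h A4 (6 * k + 1)) = 3 * 2 ^ k →
      Nat.card (h A4 (6 * k + 2)) = 2 ^ (k + 1) → Nat.card (h A4 (6 * k + 3)) = 3 * 2 ^ (k + 1) →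
      Nat.card (h A4 (6 * k + 4)) = 2 ^ k ∧ Nat.card (h A4 (6 * k + 5)) = 3 * 2 ^ (k + 2) ∧
      Nat.card (h A4 (6 * k + 6)) = 2 ^ (k + 1) := by
    intro k h1 h2 h3
    have e1 := card_h_odd (3 * k)
    have e2 := card_h_even (3 * k)
    have e3 := card_h_odd (3 * k + 1)
    simp only [show 2 * (3 * k) = 6 * k by ring, show 2 * (3 * k + 1) = 6 * k + 2 by ring,
      add_assoc, Nat.reduceAdd] at e1 e2 e3
    refine ⟨by omega, by rw [e2, h2]; ring, by omega⟩
  induction k with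
  | zero =>
    have h1 := card_h_one
    have h2 := card_h_two
    have h3 := card_h_three
    exact ⟨h1, h2, h3, step 0 h1 h2 h3⟩
  | succ k ih =>
    obtain ⟨-, -, -, h4, h5, h6⟩ := ih
    have e1 := card_h_even (3 * k + 1)
    have e2 := card_h_odd (3 * k + 2)
    have e3 := card_h_even (3 * k + 2)
    simp only [show 2 * (3 * k + 1) = 6 * k + 2 by ring, show 2 * (3 * k + 2) = 6 * k + 4 by ring,
      add_assoc, Nat.reduceAdd] at e1 e2 e3
    have g1 : Nat.card (h A4 (6 * (k + 1) + 1)) = 3 * 2 ^ (k + 1) := by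
      rw [show 6 * (k + 1) + 1 = 6 * k + 7 by ring, e1, h4]; ring
    have g2 : Nat.card (h A4 (6 * (k + 1) + 2)) = 2 ^ (k + 1 + 1) := by
      rw [show 6 * (k + 1) + 2 = 6 * k + 8 by ring]
      rw [h5] at e2
      exact Nat.eq_of_mul_eq_mul_right (by norm_num : 0 < 3) (e2.trans (mul_comm _ _))
    have g3 : Nat.card (h A4 (6 * (k + 1) + 3)) = 3 * 2 ^ (k + 1 + 1) := by
      rw [show 6 * (k + 1) + 3 = 6 * k + 9 by ring, e3, h6]; ring
    exact ⟨g1, g2, g3, step (k + 1) g1 g2 g3⟩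

end GMod

/-! ### The class of order four in degree two -/

namespace GMod

open F4 A4

/-- A chain bounding twice an involution. -/
noncomputable def sqChain {G : Type} [Group G] (g : G) : ((triv G).iter 2).V :=
  cons g (cons g (one0 G)) + cons 1 (cons 1 (one0 G))

lemma d_sqChain {G : Type} [Group G] (g : G) (hg : g * g = 1) :
    (triv G).bar.d 1 (sqChain g) = 2 • cons g (one0 G) := by
  rw [sqChain, map_add, d_cons, d_cons, R_cons, R_cons, hg, mul_one]
  change cons g (one0 G) - (cons 1 (one0 G) - cons g (one0 G)) +
    (cons 1 (one0 G) - (cons 1 (one0 G) - cons 1 (one0 G))) = _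
  rw [two_smul]
  abel

lemma iter_sqChain {G G' : Type} [Group G] [Group G'] (φ : G →* G') (g : G) :
    (trivHom φ).bar.f 2 (sqChain g) = sqChain (φ g) := by
  change ((trivHom φ).iter 2).f (sqChain g) = _
  rw [sqChain, map_add, Hom.iter_cons, Hom.iter_cons, Hom.iter_cons, Hom.iter_cons, map_one]
  rfl

/-- Exponents giving a functional in degree two. -/
def twoExp (n : ℕ) : ℕ := if n = 0 then 1 else 2

lemma twoExp_or (n : ℕ) : twoExp n = 1 ∨ twoExp n = 2 := by
  unfold twoExp; split_ifs <;> simp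

lemma twoExp_sum : 3 ∣ expSum twoExp 2 := by
  rw [expSum, Finset.sum_range_succ, Finset.sum_range_one]; decide

lemma exists_chain_σ : ∃ c : ((triv A4).iter 2).V,
    (triv A4).bar.d 1 c = cons σ (one0 A4) ∧
    ∃ hz : 2 • c - sqChain σ ∈ (triv A4).bar.Z 2, (triv A4).bar.cls 2 ⟨_, hz⟩ ≠ 0 := by
  obtain ⟨c, hc⟩ := Cx.cls_eq_zero.1 c1_σ
  have hc' : (triv A4).bar.d 1 c = cons σ (one0 A4) := hc
  have hz : 2 • c - sqChain σ ∈ (triv A4).bar.Z 2 := by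
    rw [Cx.mem_Z_succ, map_sub, map_nsmul, hc', d_sqChain _ (by decide), sub_self]
  refine ⟨c, hc', hz, fun h0 => ?_⟩
  have h1 := evH_cls twoExp twoExp_or 2 twoExp_sum ⟨_, hz⟩
  rw [h0, map_zero] at h1
  change 0 = ev twoExp 2 (2 • c - sqChain σ) at h1
  rw [map_sub, map_nsmul, F4.two_nsmul, sqChain, map_add, ev_cons, ev_cons, ev_cons, ev_cons,
    ev_one0, one_n, σ_n, σ_i, pw_zero] at h1
  simp only [expSum, Finset.sum_range_one, Finset.range_zero, Finset.sum_empty] at h1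
  revert h1
  decide

namespace TreeAction

variable {G C E₁ E₂ E₃ : Type} [Group G] [Group C] [Group E₁] [Group E₂] [Group E₃]
  (T : TreeAction G C E₁ E₂ E₃)

lemma exists_order_four (i : A4 →* C) (s : E₁) (his : T.φ₁ s = i σ) :
    ∃ (y : h A4 2) (ξ : h G 2), y ≠ 0 ∧ T.D 1 ξ = (c1 s, 0, 0) ∧
      2 • ξ = T.b 2 (hmap i 2 y, - hmap i 2 y) := by
  obtain ⟨c, hc, hz, hy⟩ := exists_chain_σ
  have hcs : (triv C).bar.d 1 ((trivHom i).bar.f 2 c) =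
      (trivHom T.φ₁).bar.f 1 (cons s (one0 E₁)) := by
    rw [← Cx.Hom.comm, hc]
    change ((trivHom i).iter 1).f (cons σ (one0 A4)) = ((trivHom T.φ₁).iter 1).f _
    rw [Hom.iter_cons, Hom.iter_cons, his]
    rfl
  obtain ⟨hw, hD⟩ := T.D_of_chain 1 ⟨cons s (one0 E₁), by
    rw [Cx.mem_Z_succ, d_cons]; exact sub_self _⟩ _ hcs
  refine ⟨_, _, hy, hD, ?_⟩
  have hsj : (trivHom T.j).bar.f 2 ((trivHom i).bar.f 2 (sqChain σ)) =
      (trivHom T.j').bar.f 2 ((trivHom i).bar.f 2 (sqChain σ)) := by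
    rw [iter_sqChain, iter_sqChain, iter_sqChain, ← his, T.conj₁]
  have hcls : ∀ {A B : Type} [Group A] [Group B] (ψ : A →* B) (z : (triv A).bar.Z 2),
      hmap ψ 2 ((triv A).bar.cls 2 z) = (triv B).bar.cls 2 ((trivHom ψ).bar.mapZ 2 z) :=
    fun _ _ => rfl
  rw [b, AddMonoidHom.coprod_apply, ← map_nsmul, map_neg, hcls, hcls, hcls, ← map_neg, ← map_add]
  congr 1
  refine Subtype.ext ?_
  rw [AddSubgroup.coe_nsmul, AddSubgroup.coe_add, AddSubgroup.coe_neg, Cx.Hom.mapZ_coe,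
    Cx.Hom.mapZ_coe, Cx.Hom.mapZ_coe, Cx.Hom.mapZ_coe]
  simp only [map_sub, map_nsmul, hsj, smul_sub]
  abel

end TreeAction

end GMod

/-! ### The action on Hermitian forms -/

namespace Bianchi

open Matrix

/-- The ring of integers of `ℚ(√-6)`. -/
abbrev R : Type := ℤ√(-6)

/-- The group `SL₂`. -/
abbrev SL : Type := SpecialLinearGroup (Fin 2) R

/-- The group `PSL₂`. -/
abbrev G : Type := ProjectiveSpecialLinearGroup (Fin 2) R

/-- The projection. -/
def mk : SL →* G := QuotientGroup.mk' _

/-- The matrix with given integral coordinates. -/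
def sl (p₁ p₂ q₁ q₂ r₁ r₂ s₁ s₂ : ℤ)
    (h₁ : p₁ * s₁ - 6 * (p₂ * s₂) - (q₁ * r₁ - 6 * (q₂ * r₂)) = 1)
    (h₂ : p₁ * s₂ + p₂ * s₁ - (q₁ * r₂ + q₂ * r₁) = 0) : SL :=
  ⟨!![⟨p₁, p₂⟩, ⟨q₁, q₂⟩; ⟨r₁, r₂⟩, ⟨s₁, s₂⟩], by
    rw [det_fin_two_of]
    refine Zsqrtd.ext ?_ ?_
    · simp only [Zsqrtd.re_sub, Zsqrtd.re_mul, Zsqrtd.re_one]; linarith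
    · simp only [Zsqrtd.im_sub, Zsqrtd.im_mul, Zsqrtd.im_one]; linarith⟩

lemma exists_sl (g : SL) : ∃ p₁ p₂ q₁ q₂ r₁ r₂ s₁ s₂ h₁ h₂,
    g = sl p₁ p₂ q₁ q₂ r₁ r₂ s₁ s₂ h₁ h₂ := by
  have hd := g.2
  rw [det_fin_two] at hd
  have h1 := congrArg Zsqrtd.re hd
  have h2 := congrArg Zsqrtd.im hd
  simp only [Zsqrtd.re_sub, Zsqrtd.re_mul, Zsqrtd.re_one, Zsqrtd.im_sub, Zsqrtd.im_mul,
    Zsqrtd.im_one] at h1 h2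
  refine ⟨(g.1 0 0).re, (g.1 0 0).im, (g.1 0 1).re, (g.1 0 1).im, (g.1 1 0).re, (g.1 1 0).im,
    (g.1 1 1).re, (g.1 1 1).im, by linarith, by linarith, ?_⟩
  refine Subtype.ext ?_
  exact eta_fin_two g.1

lemma sl_inj {p₁ p₂ q₁ q₂ r₁ r₂ s₁ s₂ h₁ h₂ p₁' p₂' q₁' q₂' r₁' r₂' s₁' s₂' h₁' h₂'} :
    sl p₁ p₂ q₁ q₂ r₁ r₂ s₁ s₂ h₁ h₂ = sl p₁' p₂' q₁' q₂' r₁' r₂' s₁' s₂' h₁' h₂' ↔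
    (p₁ = p₁' ∧ p₂ = p₂') ∧ (q₁ = q₁' ∧ q₂ = q₂') ∧ (r₁ = r₁' ∧ r₂ = r₂') ∧
      (s₁ = s₁' ∧ s₂ = s₂') := by
  have h : sl p₁ p₂ q₁ q₂ r₁ r₂ s₁ s₂ h₁ h₂ = sl p₁' p₂' q₁' q₂' r₁' r₂' s₁' s₂' h₁' h₂' ↔
      (!![⟨p₁, p₂⟩, ⟨q₁, q₂⟩; ⟨r₁, r₂⟩, ⟨s₁, s₂⟩] : Matrix (Fin 2) (Fin 2) R) =
        !![⟨p₁', p₂'⟩, ⟨q₁', q₂'⟩; ⟨r₁', r₂'⟩, ⟨s₁', s₂'⟩] := Subtype.ext_iff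
  rw [h]
  simp [Zsqrtd.ext_iff, and_assoc]

lemma sl_congr {p₁ p₂ q₁ q₂ r₁ r₂ s₁ s₂ h₁ h₂ p₁' p₂' q₁' q₂' r₁' r₂' s₁' s₂' h₁' h₂'}
    (e₁ : p₁ = p₁') (e₂ : p₂ = p₂') (e₃ : q₁ = q₁') (e₄ : q₂ = q₂') (e₅ : r₁ = r₁')
    (e₆ : r₂ = r₂') (e₇ : s₁ = s₁') (e₈ : s₂ = s₂') :
    sl p₁ p₂ q₁ q₂ r₁ r₂ s₁ s₂ h₁ h₂ = sl p₁' p₂' q₁' q₂' r₁' r₂' s₁' s₂' h₁' h₂' :=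
  sl_inj.2 ⟨⟨e₁, e₂⟩, ⟨e₃, e₄⟩, ⟨e₅, e₆⟩, e₇, e₈⟩

lemma one_eq : (1 : SL) = sl 1 0 0 0 0 0 1 0 rfl rfl :=
  Subtype.ext Matrix.one_fin_two

lemma neg_eq (p₁ p₂ q₁ q₂ r₁ r₂ s₁ s₂ h₁ h₂) : -(sl p₁ p₂ q₁ q₂ r₁ r₂ s₁ s₂ h₁ h₂) =
    sl (-p₁) (-p₂) (-q₁) (-q₂) (-r₁) (-r₂) (-s₁) (-s₂) (by linarith) (by linarith) := by
  refine Subtype.ext ?_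
  rw [SpecialLinearGroup.coe_neg]
  change -!![_, _; _, _] = !![_, _; _, _]
  simp [Zsqrtd.ext_iff]

lemma mul_eq (p₁ p₂ q₁ q₂ r₁ r₂ s₁ s₂ h₁ h₂ p₁' p₂' q₁' q₂' r₁' r₂' s₁' s₂' h₁' h₂') :
    sl p₁ p₂ q₁ q₂ r₁ r₂ s₁ s₂ h₁ h₂ * sl p₁' p₂' q₁' q₂' r₁' r₂' s₁' s₂' h₁' h₂' =
    sl (p₁ * p₁' - 6 * (p₂ * p₂') + (q₁ * r₁' - 6 * (q₂ * r₂')))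
      (p₁ * p₂' + p₂ * p₁' + (q₁ * r₂' + q₂ * r₁'))
      (p₁ * q₁' - 6 * (p₂ * q₂') + (q₁ * s₁' - 6 * (q₂ * s₂')))
      (p₁ * q₂' + p₂ * q₁' + (q₁ * s₂' + q₂ * s₁'))
      (r₁ * p₁' - 6 * (r₂ * p₂') + (s₁ * r₁' - 6 * (s₂ * r₂')))
      (r₁ * p₂' + r₂ * p₁' + (s₁ * r₂' + s₂ * r₁'))
      (r₁ * q₁' - 6 * (r₂ * q₂') + (s₁ * s₁' - 6 * (s₂ * s₂')))
      (r₁ * q₂' + r₂ * q₁' + (s₁ * s₂' + s₂ * s₁'))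
      (by linear_combination (p₁' * s₁' - 6 * (p₂' * s₂') - (q₁' * r₁' - 6 * (q₂' * r₂'))) * h₁ -
            6 * (p₁' * s₂' + p₂' * s₁' - (q₁' * r₂' + q₂' * r₁')) * h₂ + h₁')
      (by linear_combination (p₁' * s₁' - 6 * (p₂' * s₂') - (q₁' * r₁' - 6 * (q₂' * r₂'))) * h₂ +
            (p₁' * s₂' + p₂' * s₁' - (q₁' * r₂' + q₂' * r₁')) * h₁ + h₂') := by
  refine Subtype.ext ?_
  change !![_, _; _, _] * !![_, _; _, _] = !![_, _; _, _]
  rw [Matrix.mul_fin_two]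
  have hc : ∀ {a b c d a' b' c' d' : R}, a = a' → b = b' → c = c' → d = d' →
      !![a, b; c, d] = !![a', b'; c', d'] := by rintro a b c d _ _ _ _ rfl rfl rfl rfl; rfl
  refine hc ?_ ?_ ?_ ?_ <;> refine Zsqrtd.ext ?_ ?_ <;>
    simp only [Zsqrtd.re_add, Zsqrtd.im_add, Zsqrtd.re_mul, Zsqrtd.im_mul] <;> ring

lemma inv_eq (p₁ p₂ q₁ q₂ r₁ r₂ s₁ s₂ h₁ h₂) : (sl p₁ p₂ q₁ q₂ r₁ r₂ s₁ s₂ h₁ h₂)⁻¹ =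
    sl s₁ s₂ (-q₁) (-q₂) (-r₁) (-r₂) p₁ p₂ (by linarith) (by linarith) := by
  rw [inv_eq_iff_mul_eq_one, mul_eq, one_eq]
  apply sl_congr <;> linarith

lemma sq_eq_one {r : R} (h : r ^ 2 = 1) : r = 1 ∨ r = -1 := by
  have h1 := congrArg Zsqrtd.re h
  have h2 := congrArg Zsqrtd.im h
  simp only [pow_two, Zsqrtd.re_mul, Zsqrtd.im_mul, Zsqrtd.re_one, Zsqrtd.im_one] at h1 h2
  have h3 : r.re * r.im = 0 := by linarith
  rcases mul_eq_zero.1 h3 with h4 | h4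
  · rw [h4] at h1
    nlinarith [mul_self_nonneg r.im]
  · rw [h4] at h1
    have h5 : r.re ^ 2 = 1 := by linarith
    rcases Int.eq_one_or_neg_one_of_mul_eq_one (pow_two r.re ▸ h5) with h6 | h6
    · exact Or.inl (Zsqrtd.ext h6 h4)
    · exact Or.inr (Zsqrtd.ext h6 h4)

lemma mem_center (g : SL) : g ∈ Subgroup.center SL ↔ g = 1 ∨ g = -1 := by
  have hs : scalar (Fin 2) (-1 : R) = -1 := by rw [map_neg, map_one]
  rw [Matrix.SpecialLinearGroup.mem_center_iff]
  constructor
  · rintro ⟨r, hr, hg⟩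
    rw [Fintype.card_fin] at hr
    rcases sq_eq_one hr with rfl | rfl
    · left; exact Subtype.ext (by rw [← hg, map_one]; rfl)
    · right; exact Subtype.ext (by
        rw [← hg, hs, SpecialLinearGroup.coe_neg]; rfl)
  · rintro (rfl | rfl)
    · exact ⟨1, one_pow _, by rw [map_one]; rfl⟩
    · exact ⟨-1, by simp, by rw [hs, SpecialLinearGroup.coe_neg]; rfl⟩

lemma mk_eq_mk {g g' : SL} : mk g = mk g' ↔ g = g' ∨ g = -g' := by
  have h : mk g = mk g' ↔ g⁻¹ * g' ∈ Subgroup.center SL := QuotientGroup.eq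
  rw [h, mem_center, inv_mul_eq_one, inv_mul_eq_iff_eq_mul]
  refine or_congr Iff.rfl ⟨?_, ?_⟩
  · rintro rfl; simp
  · rintro rfl; simp

lemma mk_surjective (w : G) : ∃ g, mk g = w := QuotientGroup.mk'_surjective _ w

lemma exists_mk_sl (w : G) : ∃ p₁ p₂ q₁ q₂ r₁ r₂ s₁ s₂ h₁ h₂,
    w = mk (sl p₁ p₂ q₁ q₂ r₁ r₂ s₁ s₂ h₁ h₂) := by
  obtain ⟨g, rfl⟩ := mk_surjective w
  obtain ⟨p₁, p₂, q₁, q₂, r₁, r₂, s₁, s₂, h₁, h₂, rfl⟩ := exists_sl g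
  exact ⟨p₁, p₂, q₁, q₂, r₁, r₂, s₁, s₂, h₁, h₂, rfl⟩

/-- A binary Hermitian form. -/
@[ext] structure Vec where
  /-- The lower right entry. -/
  A : ℤ
  /-- The real part of the upper right entry. -/
  X : ℤ
  /-- The imaginary part of the upper right entry. -/
  Y : ℤ
  /-- The upper left entry. -/
  C : ℤ
  deriving DecidableEq

/-- The polarised determinant. -/
def pair (h k : Vec) : ℤ := h.A * k.C + h.C * k.A - 2 * (h.X * k.X) - 12 * (h.Y * k.Y)

/-- The action of a matrix on a form, in coordinates. -/
def act (p₁ p₂ q₁ q₂ r₁ r₂ s₁ s₂ : ℤ) (h : Vec) : Vec where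
  A := (r₁ ^ 2 + 6 * r₂ ^ 2) * h.C + (s₁ ^ 2 + 6 * s₂ ^ 2) * h.A +
    2 * (r₁ * s₁ + 6 * (r₂ * s₂)) * h.X + 12 * (r₁ * s₂ - r₂ * s₁) * h.Y
  C := (p₁ ^ 2 + 6 * p₂ ^ 2) * h.C + (q₁ ^ 2 + 6 * q₂ ^ 2) * h.A +
    2 * (p₁ * q₁ + 6 * (p₂ * q₂)) * h.X + 12 * (p₁ * q₂ - p₂ * q₁) * h.Y
  X := (p₁ * r₁ + 6 * (p₂ * r₂)) * h.C + (q₁ * s₁ + 6 * (q₂ * s₂)) * h.A +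
    (p₁ * s₁ + 6 * (p₂ * s₂) + q₁ * r₁ + 6 * (q₂ * r₂)) * h.X +
    6 * (p₁ * s₂ - p₂ * s₁ + q₂ * r₁ - q₁ * r₂) * h.Y
  Y := (p₂ * r₁ - p₁ * r₂) * h.C + (q₂ * s₁ - q₁ * s₂) * h.A +
    (p₂ * s₁ - p₁ * s₂ + q₂ * r₁ - q₁ * r₂) * h.X +
    (p₁ * s₁ + 6 * (p₂ * s₂) - q₁ * r₁ - 6 * (q₂ * r₂)) * h.Y

/-- The action of `SL₂` on forms. -/
def actSL (g : SL) (h : Vec) : Vec :=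
  act (g.1 0 0).re (g.1 0 0).im (g.1 0 1).re (g.1 0 1).im (g.1 1 0).re (g.1 1 0).im
    (g.1 1 1).re (g.1 1 1).im h

lemma actSL_sl (p₁ p₂ q₁ q₂ r₁ r₂ s₁ s₂ h₁ h₂ h) :
    actSL (sl p₁ p₂ q₁ q₂ r₁ r₂ s₁ s₂ h₁ h₂) h = act p₁ p₂ q₁ q₂ r₁ r₂ s₁ s₂ h := rfl

lemma actSL_mul (g g' : SL) (h : Vec) : actSL (g * g') h = actSL g (actSL g' h) := by
  obtain ⟨p₁, p₂, q₁, q₂, r₁, r₂, s₁, s₂, h₁, h₂, rfl⟩ := exists_sl g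
  obtain ⟨p₁', p₂', q₁', q₂', r₁', r₂', s₁', s₂', h₁', h₂', rfl⟩ := exists_sl g'
  rw [mul_eq, actSL_sl, actSL_sl, actSL_sl]
  apply Vec.ext <;> simp only [act] <;> ring

lemma actSL_neg (g : SL) (h : Vec) : actSL (-g) h = actSL g h := by
  obtain ⟨p₁, p₂, q₁, q₂, r₁, r₂, s₁, s₂, h₁, h₂, rfl⟩ := exists_sl g
  rw [neg_eq, actSL_sl, actSL_sl]
  apply Vec.ext <;> simp only [act] <;> ring

lemma actSL_one (h : Vec) : actSL 1 h = h := by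
  rw [one_eq, actSL_sl]
  apply Vec.ext <;> simp only [act] <;> ring

lemma pair_actSL (g : SL) (h k : Vec) : pair (actSL g h) (actSL g k) = pair h k := by
  obtain ⟨p₁, p₂, q₁, q₂, r₁, r₂, s₁, s₂, h₁, h₂, rfl⟩ := exists_sl g
  rw [actSL_sl, actSL_sl]
  have key : pair (act p₁ p₂ q₁ q₂ r₁ r₂ s₁ s₂ h) (act p₁ p₂ q₁ q₂ r₁ r₂ s₁ s₂ k) =
      ((p₁ * s₁ - 6 * (p₂ * s₂) - (q₁ * r₁ - 6 * (q₂ * r₂))) ^ 2 +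
        6 * (p₁ * s₂ + p₂ * s₁ - (q₁ * r₂ + q₂ * r₁)) ^ 2) * pair h k := by
    simp only [act, pair]
    ring
  rw [key, h₁, h₂]
  ring

instance : MulAction G Vec where
  smul w h := Quotient.liftOn' w (fun g => actSL g h) (fun g g' hg => by
    rcases mk_eq_mk.1 (Quotient.sound' hg : mk g = mk g') with rfl | rfl
    · rfl
    · exact actSL_neg _ _)
  one_smul h := actSL_one h
  mul_smul w w' h := by
    obtain ⟨g, rfl⟩ := mk_surjective w
    obtain ⟨g', rfl⟩ := mk_surjective w'
    exact actSL_mul g g' h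

lemma mk_sl_smul (p₁ p₂ q₁ q₂ r₁ r₂ s₁ s₂ h₁ h₂ h) :
    mk (sl p₁ p₂ q₁ q₂ r₁ r₂ s₁ s₂ h₁ h₂) • h = act p₁ p₂ q₁ q₂ r₁ r₂ s₁ s₂ h := rfl

lemma pair_smul (w : G) (h k : Vec) : pair (w • h) (w • k) = pair h k := by
  obtain ⟨g, rfl⟩ := mk_surjective w
  exact pair_actSL g h k

lemma pair_smul_right (w : G) (h k : Vec) : pair h (w • k) = pair (w⁻¹ • h) k := by
  rw [← pair_smul w (w⁻¹ • h), smul_inv_smul]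

end Bianchi

/-! ### Generators, reflections and the automorphisms they induce -/

namespace Bianchi

open Matrix

/-- An involution of order two. -/
def τ : G := mk (sl 0 0 (-1) 0 1 0 0 0 rfl rfl)
/-- The translation by `1`. -/
def t : G := mk (sl 1 0 1 0 0 0 1 0 rfl rfl)
/-- The translation by `√-6`. -/
def u : G := mk (sl 1 0 0 1 0 0 1 0 rfl rfl)
/-- An involution fixing the two walls at the base vertex. -/
def σ : G := mk (sl 1 1 2 (-1) 2 0 (-1) (-1) rfl rfl)
/-- The second stable element. -/
def v : G := mk (sl 7 0 0 (-3) 0 (-2) (-5) 0 rfl rfl)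

lemma det_re (g : SL) : (g.1 0 0).re * (g.1 1 1).re - 6 * ((g.1 0 0).im * (g.1 1 1).im) -
    ((g.1 0 1).re * (g.1 1 0).re - 6 * ((g.1 0 1).im * (g.1 1 0).im)) = 1 := by
  obtain ⟨p₁, p₂, q₁, q₂, r₁, r₂, s₁, s₂, h₁, h₂, rfl⟩ := exists_sl g
  exact h₁

lemma det_im (g : SL) : (g.1 0 0).re * (g.1 1 1).im + (g.1 0 0).im * (g.1 1 1).re -
    ((g.1 0 1).re * (g.1 1 0).im + (g.1 0 1).im * (g.1 1 0).re) = 0 := by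
  obtain ⟨p₁, p₂, q₁, q₂, r₁, r₂, s₁, s₂, h₁, h₂, rfl⟩ := exists_sl g
  exact h₂

/-- The reflection `X ↦ A - X`. -/
def r₂ (h : Vec) : Vec := ⟨h.A, h.A - h.X, h.Y, h.C + h.A - 2 * h.X⟩
/-- The reflection `Y ↦ -Y`. -/
def r₃ (h : Vec) : Vec := ⟨h.A, h.X, -h.Y, h.C⟩
/-- The reflection `Y ↦ A - Y`. -/
def r₄ (h : Vec) : Vec := ⟨h.A, h.X, h.A - h.Y, h.C + 6 * h.A - 12 * h.Y⟩
/-- The reflection in the sixth wall. -/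
def r₆ (h : Vec) : Vec := ⟨h.A + 2 * (h.A + h.C - 6 * h.Y), h.X, h.Y + (h.A + h.C - 6 * h.Y),
  h.C + 2 * (h.A + h.C - 6 * h.Y)⟩

lemma pair_r₄ (h k : Vec) : pair (r₄ h) (r₄ k) = pair h k := by simp only [pair, r₄]; ring
lemma pair_r₆ (h k : Vec) : pair (r₆ h) (r₆ k) = pair h k := by simp only [pair, r₆]; ring
lemma r₂_r₂ (h : Vec) : r₂ (r₂ h) = h := by apply Vec.ext <;> simp only [r₂] <;> ring
lemma r₄_r₄ (h : Vec) : r₄ (r₄ h) = h := by apply Vec.ext <;> simp only [r₄] <;> ring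
lemma r₆_r₆ (h : Vec) : r₆ (r₆ h) = h := by apply Vec.ext <;> simp only [r₆] <;> ring

/-- Conjugation by the reflection `r₂`. -/
def κ₂Fun (g : SL) : SL := sl ((g.1 0 0).re - (g.1 1 0).re) (-(g.1 0 0).im + (g.1 1 0).im)
    (-(g.1 0 0).re + (g.1 1 0).re - (g.1 0 1).re + (g.1 1 1).re)
    ((g.1 0 0).im - (g.1 1 0).im + (g.1 0 1).im - (g.1 1 1).im)
    (-(g.1 1 0).re) ((g.1 1 0).im) ((g.1 1 0).re + (g.1 1 1).re)
    (-(g.1 1 0).im - (g.1 1 1).im)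
    (by linear_combination det_re g) (by linear_combination -det_im g)

lemma κ₂Fun_sl (p₁ p₂ q₁ q₂ r₁ r₂ s₁ s₂ : ℤ) (h₁ h₂) :
    κ₂Fun (sl p₁ p₂ q₁ q₂ r₁ r₂ s₁ s₂ h₁ h₂) =
    sl (p₁ - r₁) (-p₂ + r₂) (-p₁ + r₁ - q₁ + s₁) (p₂ - r₂ + q₂ - s₂) (-r₁) r₂ (r₁ + s₁)
      (-r₂ - s₂) (by linear_combination h₁) (by linear_combination -h₂) := rfl

lemma κ₂Fun_mul (p₁ p₂ q₁ q₂ r₁ r₂ s₁ s₂ : ℤ) (h₁ h₂) (p₁' p₂' q₁' q₂' r₁' r₂' s₁' s₂' : ℤ)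
    (h₁' h₂') :
    κ₂Fun (sl p₁ p₂ q₁ q₂ r₁ r₂ s₁ s₂ h₁ h₂ * sl p₁' p₂' q₁' q₂' r₁' r₂' s₁' s₂' h₁' h₂') =
    κ₂Fun (sl p₁ p₂ q₁ q₂ r₁ r₂ s₁ s₂ h₁ h₂) *
      κ₂Fun (sl p₁' p₂' q₁' q₂' r₁' r₂' s₁' s₂' h₁' h₂') := by
  rw [mul_eq, κ₂Fun_sl]
  rw [κ₂Fun_sl p₁ p₂ q₁ q₂ r₁ r₂ s₁ s₂ h₁ h₂]
  rw [κ₂Fun_sl p₁' p₂' q₁' q₂' r₁' r₂' s₁' s₂' h₁' h₂']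
  refine Eq.trans ?_ (mul_eq ..).symm
  apply sl_congr <;> ring

/-- Conjugation by the reflection, as a homomorphism. -/
def κ₂SL : SL →* SL where
  toFun := κ₂Fun
  map_one' := by rw [one_eq]; rfl
  map_mul' g g' := by
    obtain ⟨p₁, p₂, q₁, q₂, r₁, r₂, s₁, s₂, h₁, h₂, rfl⟩ := exists_sl g
    obtain ⟨p₁', p₂', q₁', q₂', r₁', r₂', s₁', s₂', h₁', h₂', rfl⟩ := exists_sl g'
    exact κ₂Fun_mul ..

/-- Conjugation by the reflection `r₄`. -/
def κ₄Fun (g : SL) : SL := sl ((g.1 0 0).re + 6 * (g.1 1 0).im) (-(g.1 0 0).im + (g.1 1 0).re)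
    (-6 * (g.1 0 0).im + 6 * (g.1 1 0).re + (g.1 0 1).re + 6 * (g.1 1 1).im)
    (-(g.1 0 0).re - 6 * (g.1 1 0).im - (g.1 0 1).im + (g.1 1 1).re)
    (g.1 1 0).re (-(g.1 1 0).im) ((g.1 1 1).re - 6 * (g.1 1 0).im)
    (-(g.1 1 1).im - (g.1 1 0).re)
    (by linear_combination det_re g) (by linear_combination -det_im g)

lemma κ₄Fun_sl (p₁ p₂ q₁ q₂ r₁ r₂ s₁ s₂ : ℤ) (h₁ h₂) :
    κ₄Fun (sl p₁ p₂ q₁ q₂ r₁ r₂ s₁ s₂ h₁ h₂) =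
    sl (p₁ + 6 * r₂) (-p₂ + r₁) (-6 * p₂ + 6 * r₁ + q₁ + 6 * s₂) (-p₁ - 6 * r₂ - q₂ + s₁)
      r₁ (-r₂) (s₁ - 6 * r₂) (-s₂ - r₁) (by linear_combination h₁)
      (by linear_combination -h₂) := rfl

lemma κ₄Fun_mul (p₁ p₂ q₁ q₂ r₁ r₂ s₁ s₂ : ℤ) (h₁ h₂) (p₁' p₂' q₁' q₂' r₁' r₂' s₁' s₂' : ℤ)
    (h₁' h₂') :
    κ₄Fun (sl p₁ p₂ q₁ q₂ r₁ r₂ s₁ s₂ h₁ h₂ * sl p₁' p₂' q₁' q₂' r₁' r₂' s₁' s₂' h₁' h₂') =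
    κ₄Fun (sl p₁ p₂ q₁ q₂ r₁ r₂ s₁ s₂ h₁ h₂) *
      κ₄Fun (sl p₁' p₂' q₁' q₂' r₁' r₂' s₁' s₂' h₁' h₂') := by
  rw [mul_eq, κ₄Fun_sl]
  rw [κ₄Fun_sl p₁ p₂ q₁ q₂ r₁ r₂ s₁ s₂ h₁ h₂]
  rw [κ₄Fun_sl p₁' p₂' q₁' q₂' r₁' r₂' s₁' s₂' h₁' h₂']
  refine Eq.trans ?_ (mul_eq ..).symm
  apply sl_congr <;> ring

/-- Conjugation by the reflection, as a homomorphism. -/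
def κ₄SL : SL →* SL where
  toFun := κ₄Fun
  map_one' := by rw [one_eq]; rfl
  map_mul' g g' := by
    obtain ⟨p₁, p₂, q₁, q₂, r₁, r₂, s₁, s₂, h₁, h₂, rfl⟩ := exists_sl g
    obtain ⟨p₁', p₂', q₁', q₂', r₁', r₂', s₁', s₂', h₁', h₂', rfl⟩ := exists_sl g'
    exact κ₄Fun_mul ..

/-- Conjugation by the reflection `r₆`. -/
def κ₆Fun (g : SL) : SL := sl
    (3 * (g.1 0 0).re - 2 * (g.1 1 1).re + 6 * (g.1 0 1).im + 6 * (g.1 1 0).im)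
    (-3 * (g.1 0 0).im + 2 * (g.1 1 1).im + (g.1 0 1).re + (g.1 1 0).re)
    (3 * (g.1 0 1).re + 2 * (g.1 1 0).re + 6 * (g.1 1 1).im - 6 * (g.1 0 0).im)
    (-3 * (g.1 0 1).im - 2 * (g.1 1 0).im + (g.1 1 1).re - (g.1 0 0).re)
    (2 * (g.1 0 1).re + 3 * (g.1 1 0).re + 6 * (g.1 1 1).im - 6 * (g.1 0 0).im)
    (-2 * (g.1 0 1).im - 3 * (g.1 1 0).im + (g.1 1 1).re - (g.1 0 0).re)
    (3 * (g.1 1 1).re - 2 * (g.1 0 0).re - 6 * (g.1 0 1).im - 6 * (g.1 1 0).im)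
    (-3 * (g.1 1 1).im + 2 * (g.1 0 0).im - (g.1 0 1).re - (g.1 1 0).re)
    (by linear_combination det_re g) (by linear_combination -det_im g)

lemma κ₆Fun_sl (p₁ p₂ q₁ q₂ r₁ r₂ s₁ s₂ : ℤ) (h₁ h₂) :
    κ₆Fun (sl p₁ p₂ q₁ q₂ r₁ r₂ s₁ s₂ h₁ h₂) =
    sl (3 * p₁ - 2 * s₁ + 6 * q₂ + 6 * r₂) (-3 * p₂ + 2 * s₂ + q₁ + r₁)
      (3 * q₁ + 2 * r₁ + 6 * s₂ - 6 * p₂) (-3 * q₂ - 2 * r₂ + s₁ - p₁)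
      (2 * q₁ + 3 * r₁ + 6 * s₂ - 6 * p₂) (-2 * q₂ - 3 * r₂ + s₁ - p₁)
      (3 * s₁ - 2 * p₁ - 6 * q₂ - 6 * r₂) (-3 * s₂ + 2 * p₂ - q₁ - r₁)
      (by linear_combination h₁) (by linear_combination -h₂) := rfl

lemma κ₆Fun_mul (p₁ p₂ q₁ q₂ r₁ r₂ s₁ s₂ : ℤ) (h₁ h₂) (p₁' p₂' q₁' q₂' r₁' r₂' s₁' s₂' : ℤ)
    (h₁' h₂') :
    κ₆Fun (sl p₁ p₂ q₁ q₂ r₁ r₂ s₁ s₂ h₁ h₂ * sl p₁' p₂' q₁' q₂' r₁' r₂' s₁' s₂' h₁' h₂') =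
    κ₆Fun (sl p₁ p₂ q₁ q₂ r₁ r₂ s₁ s₂ h₁ h₂) *
      κ₆Fun (sl p₁' p₂' q₁' q₂' r₁' r₂' s₁' s₂' h₁' h₂') := by
  rw [mul_eq, κ₆Fun_sl]
  rw [κ₆Fun_sl p₁ p₂ q₁ q₂ r₁ r₂ s₁ s₂ h₁ h₂]
  rw [κ₆Fun_sl p₁' p₂' q₁' q₂' r₁' r₂' s₁' s₂' h₁' h₂']
  refine Eq.trans ?_ (mul_eq ..).symm
  apply sl_congr <;> ring

/-- Conjugation by the reflection, as a homomorphism. -/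
def κ₆SL : SL →* SL where
  toFun := κ₆Fun
  map_one' := by rw [one_eq]; rfl
  map_mul' g g' := by
    obtain ⟨p₁, p₂, q₁, q₂, r₁, r₂, s₁, s₂, h₁, h₂, rfl⟩ := exists_sl g
    obtain ⟨p₁', p₂', q₁', q₂', r₁', r₂', s₁', s₂', h₁', h₂', rfl⟩ := exists_sl g'
    exact κ₆Fun_mul ..

/-- The endomorphism of `PSL₂` induced by one of `SL₂`. -/
def descend (f : SL →* SL) (hf : f (-1) = -1) : G →* G :=
  QuotientGroup.map _ _ f (by
    intro g hg
    rw [Subgroup.mem_comap]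
    rcases (mem_center g).1 hg with rfl | rfl
    · rw [map_one]; exact one_mem _
    · rw [hf]; exact (mem_center _).2 (Or.inr rfl))

lemma neg_one_eq : (-1 : SL) = sl (-1) 0 0 0 0 0 (-1) 0 rfl rfl := by rw [one_eq, neg_eq]; rfl

/-- The automorphism induced by `r₂`. -/
def κ₂ : G →* G := descend κ₂SL (by rw [neg_one_eq]; rfl)
/-- The automorphism induced by `r₄`. -/
def κ₄ : G →* G := descend κ₄SL (by rw [neg_one_eq]; rfl)
/-- The automorphism induced by `r₆`. -/
def κ₆ : G →* G := descend κ₆SL (by rw [neg_one_eq]; rfl)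

lemma κ₂_mk (p₁ p₂ q₁ q₂ r₁ r₂ s₁ s₂ : ℤ) (h₁ h₂) : κ₂ (mk (sl p₁ p₂ q₁ q₂ r₁ r₂ s₁ s₂ h₁ h₂)) =
    mk (sl (p₁ - r₁) (-p₂ + r₂) (-p₁ + r₁ - q₁ + s₁) (p₂ - r₂ + q₂ - s₂) (-r₁) r₂ (r₁ + s₁)
      (-r₂ - s₂) (by linear_combination h₁) (by linear_combination -h₂)) := rfl

lemma κ₄_mk (p₁ p₂ q₁ q₂ r₁ r₂ s₁ s₂ : ℤ) (h₁ h₂) : κ₄ (mk (sl p₁ p₂ q₁ q₂ r₁ r₂ s₁ s₂ h₁ h₂)) =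
    mk (sl (p₁ + 6 * r₂) (-p₂ + r₁) (-6 * p₂ + 6 * r₁ + q₁ + 6 * s₂) (-p₁ - 6 * r₂ - q₂ + s₁)
      r₁ (-r₂) (s₁ - 6 * r₂) (-s₂ - r₁) (by linear_combination h₁)
      (by linear_combination -h₂)) := rfl

lemma κ₆_mk (p₁ p₂ q₁ q₂ r₁ r₂ s₁ s₂ : ℤ) (h₁ h₂) : κ₆ (mk (sl p₁ p₂ q₁ q₂ r₁ r₂ s₁ s₂ h₁ h₂)) =
    mk (sl (3 * p₁ - 2 * s₁ + 6 * q₂ + 6 * r₂) (-3 * p₂ + 2 * s₂ + q₁ + r₁)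
      (3 * q₁ + 2 * r₁ + 6 * s₂ - 6 * p₂) (-3 * q₂ - 2 * r₂ + s₁ - p₁)
      (2 * q₁ + 3 * r₁ + 6 * s₂ - 6 * p₂) (-2 * q₂ - 3 * r₂ + s₁ - p₁)
      (3 * s₁ - 2 * p₁ - 6 * q₂ - 6 * r₂) (-3 * s₂ + 2 * p₂ - q₁ - r₁)
      (by linear_combination h₁) (by linear_combination -h₂)) := rfl

lemma κ₂_smul (w : G) (h : Vec) : κ₂ w • r₂ h = r₂ (w • h) := by
  obtain ⟨p₁, p₂, q₁, q₂, a₁, a₂, s₁, s₂, h₁, h₂, rfl⟩ := exists_mk_sl w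
  rw [κ₂_mk, mk_sl_smul, mk_sl_smul]
  apply Vec.ext <;> simp only [act, r₂] <;> ring

lemma κ₄_smul (w : G) (h : Vec) : κ₄ w • r₄ h = r₄ (w • h) := by
  obtain ⟨p₁, p₂, q₁, q₂, a₁, a₂, s₁, s₂, h₁, h₂, rfl⟩ := exists_mk_sl w
  rw [κ₄_mk, mk_sl_smul, mk_sl_smul]
  apply Vec.ext <;> simp only [act, r₄] <;> ring

lemma κ₆_smul (w : G) (h : Vec) : κ₆ w • r₆ h = r₆ (w • h) := by
  obtain ⟨p₁, p₂, q₁, q₂, a₁, a₂, s₁, s₂, h₁, h₂, rfl⟩ := exists_mk_sl w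
  rw [κ₆_mk, mk_sl_smul, mk_sl_smul]
  apply Vec.ext <;> simp only [act, r₆] <;> ring

lemma κ₄_κ₄ (w : G) : κ₄ (κ₄ w) = w := by
  obtain ⟨p₁, p₂, q₁, q₂, a₁, a₂, s₁, s₂, h₁, h₂, rfl⟩ := exists_mk_sl w
  rw [κ₄_mk, κ₄_mk]
  congr 1
  apply sl_congr <;> ring

lemma κ₆_κ₆ (w : G) : κ₆ (κ₆ w) = w := by
  obtain ⟨p₁, p₂, q₁, q₂, a₁, a₂, s₁, s₂, h₁, h₂, rfl⟩ := exists_mk_sl w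
  rw [κ₆_mk, κ₆_mk]
  congr 1
  apply sl_congr <;> ring

instance : DecidableEq SL := fun g g' => decidable_of_iff (g.1 = g'.1) Subtype.ext_iff.symm

/-- A decidable form of equality in the quotient. -/
lemma mk_eq_of {g g' : SL} (h : g = g' ∨ g = -g') : mk g = mk g' := mk_eq_mk.2 h

lemma κ₂_t : κ₂ t = t⁻¹ := by rw [t, ← map_inv, κ₂_mk, inv_eq]; rfl
lemma κ₂_σ : κ₂ σ = σ := by
  rw [σ, κ₂_mk]; refine mk_eq_of (Or.inr ?_); rw [neg_eq]; rfl

end Bianchi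

/-! ### Relations between the generators -/

namespace Bianchi

open Matrix

/-- An element of order three. -/
def ρ : G := mk (sl 1 0 (-1) 0 1 0 0 0 rfl rfl)

/-- A lift of the tetrahedral group. -/
def liftA4 (x : A4) : SL :=
  (if x.n.a = 1 then sl 1 1 2 (-1) 2 0 (-1) (-1) rfl rfl else 1) *
    (if x.n.b = 1 then sl (-3) 0 2 1 (-2) 1 3 0 rfl rfl else 1) *
    (if x.i = 1 then sl 1 0 (-1) 0 1 0 0 0 rfl rfl else
      if x.i = 2 then sl 0 0 (-1) 0 1 0 (-1) 0 rfl rfl else 1)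

set_option maxRecDepth 100000 in
lemma liftA4_mul : ∀ x y : A4, liftA4 (x * y) = liftA4 x * liftA4 y ∨
    liftA4 (x * y) = -(liftA4 x * liftA4 y) := by decide +kernel

lemma liftA4_eq : ∀ x : A4, liftA4 x = 1 ∨ liftA4 x = -1 → x = 1 := by decide +kernel

/-- The tetrahedral subgroup. -/
def iA : A4 →* G := MonoidHom.mk' (fun x => mk (liftA4 x)) fun x y => by
  rw [← map_mul]; exact mk_eq_of (liftA4_mul x y)

lemma iA_injective : Function.Injective iA := by
  rw [injective_iff_map_eq_one]
  intro x hx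
  exact liftA4_eq x (mk_eq_mk.1 (hx.trans (map_one mk).symm))

lemma iA_σ : iA A4.σ = σ := mk_eq_of (by decide +kernel)
lemma iA_ρ : iA A4.ρ = ρ := mk_eq_of (by decide +kernel)

lemma τ_mul_τ : τ * τ = 1 := by
  change mk (_ * _) = mk 1; exact mk_eq_of (by decide +kernel)
lemma t_mul_τ : t * τ = ρ := by
  change mk (_ * _) = mk _; exact mk_eq_of (by decide +kernel)
lemma σ_mul_σ : σ * σ = 1 := by
  change mk (_ * _) = mk 1; exact mk_eq_of (by decide +kernel)

lemma κ₂_u : κ₂ u = u := by rw [u, κ₂_mk]; exact mk_eq_of (by decide +kernel)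
lemma κ₂_τ : κ₂ τ * t = t * τ := by
  rw [τ, κ₂_mk]; change mk (_ * _) = mk (_ * _); exact mk_eq_of (by decide +kernel)
lemma κ₂_v : κ₂ v = σ * v * σ := by
  rw [v, κ₂_mk]; change mk _ = mk (_ * _ * _); exact mk_eq_of (by decide +kernel)
lemma κ₄_u : κ₄ u * u = 1 := by
  rw [u, κ₄_mk]; change mk (_ * _) = mk 1; exact mk_eq_of (by decide +kernel)
lemma κ₄_v : κ₄ v * v = 1 := by
  rw [v, κ₄_mk]; change mk (_ * _) = mk 1; exact mk_eq_of (by decide +kernel)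
lemma κ₄_σ : κ₄ σ = σ := by rw [σ, κ₄_mk]; exact mk_eq_of (by decide +kernel)
lemma κ₄_t : κ₄ t = t := by rw [t, κ₄_mk]; exact mk_eq_of (by decide +kernel)
lemma κ₄_τ_mul_u : κ₄ τ * u = u * τ := by
  rw [τ, κ₄_mk]; change mk (_ * _) = mk (_ * _); exact mk_eq_of (by decide +kernel)
lemma κ₄_t_mul_u : κ₄ t * u = u * t := by
  rw [t, κ₄_mk]; change mk (_ * _) = mk (_ * _); exact mk_eq_of (by decide +kernel)
lemma κ₆_τ : κ₆ τ = τ := by rw [τ, κ₆_mk]; exact mk_eq_of (by decide +kernel)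
lemma κ₆_σ : κ₆ σ = σ := by rw [σ, κ₆_mk]; exact mk_eq_of (by decide +kernel)
lemma κ₆_t : κ₆ t = σ * t := by
  rw [t, κ₆_mk]; change mk _ = mk (_ * _); exact mk_eq_of (by decide +kernel)
lemma κ₆_u : κ₆ u = v := by rw [u, κ₆_mk]; exact mk_eq_of (by decide +kernel)
lemma κ₆_v : κ₆ v = u := by rw [← κ₆_u, κ₆_κ₆]
lemma κ₄_τ_mul_v : κ₄ τ * v = v * τ := by
  rw [τ, κ₄_mk]; change mk (_ * _) = mk (_ * _); exact mk_eq_of (by decide +kernel)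
lemma κ₆_ρ : κ₆ ρ = σ * ρ := by
  rw [← t_mul_τ, map_mul, κ₆_t, κ₆_τ, mul_assoc]
lemma κ₄_κ₆_t_mul_v : κ₄ (κ₆ t) * v = v * κ₆ t := by
  rw [κ₆_t, t, σ, map_mul, κ₄_mk, κ₄_mk]
  change mk (_ * _ * _) = mk (_ * (_ * _)); exact mk_eq_of (by decide +kernel)

end Bianchi

/-! ### Walls which do not separate points -/

namespace Bianchi

lemma mem_Icc_of_sq_lt {x b : ℤ} (hb : 0 ≤ b) (h : x ^ 2 < (b + 1) ^ 2) :
    x ∈ Finset.Icc (-b) b := by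
  have := abs_lt_of_sq_lt_sq' h (by omega)
  rw [Finset.mem_Icc]
  omega

lemma solve_tau {a b c d : ℤ} (h : c ^ 2 + 6 * b ^ 2 - 6 * (a * d) = 1)
    (hs : (6 * a - 6 * b - 4 * c + 6 * d) * (6 * a + 6 * b - 4 * c + 6 * d) ≤ 0) :
    False := by
  have ha : a ∈ Finset.Icc (-1 : ℤ) 1 := mem_Icc_of_sq_lt (by norm_num) (by
    nlinarith only [h, hs, sq_nonneg b,
      sq_nonneg (-16 * a + 15 * c - 16 * d), sq_nonneg (-7 * a + 8 * d)])
  have hb : b ∈ Finset.Icc (-1 : ℤ) 1 := mem_Icc_of_sq_lt (by norm_num) (by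
    nlinarith only [h, hs, sq_nonneg (24 * a - 16 * c + 11 * d),
      sq_nonneg (c - 2 * d), sq_nonneg d])
  have hc : c ∈ Finset.Icc (-3 : ℤ) 3 := mem_Icc_of_sq_lt (by norm_num) (by
    nlinarith only [h, hs, sq_nonneg (24 * a - 16 * c + 11 * d),
      sq_nonneg b, sq_nonneg (-16 * c + 35 * d)])
  have hd : d ∈ Finset.Icc (-1 : ℤ) 1 := mem_Icc_of_sq_lt (by norm_num) (by
    nlinarith only [h, hs, sq_nonneg (24 * a - 16 * c + 11 * d),
      sq_nonneg b, sq_nonneg (c - 2 * d)])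
  have key : ∀ a ∈ Finset.Icc (-1 : ℤ) 1, ∀ b ∈ Finset.Icc (-1 : ℤ) 1,
      ∀ c ∈ Finset.Icc (-3 : ℤ) 3, ∀ d ∈ Finset.Icc (-1 : ℤ) 1,
      c ^ 2 + 6 * b ^ 2 - 6 * (a * d) = 1 →
      (6 * a - 6 * b - 4 * c + 6 * d) * (6 * a + 6 * b - 4 * c + 6 * d) ≤ 0 →
      False := by decide +kernel
  exact key a ha b hb c hc d hd h hs

lemma solve_r_three {a b c d : ℤ} (h : c ^ 2 + 6 * b ^ 2 - 6 * (a * d) = 1)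
    (hs : (6 * a - 6 * b - 4 * c + 6 * d) * (6 * a - 6 * b + 4 * c + 6 * d) ≤ 0) :
    b = 0 ∧ a = 0 ∧ d = 0 ∧ (c = 1 ∨ c = -1) := by
  have ha : a ∈ Finset.Icc (-1 : ℤ) 1 := mem_Icc_of_sq_lt (by norm_num) (by
    nlinarith only [h, hs, sq_nonneg (-4 * a + 15 * b - 4 * d),
      sq_nonneg c, sq_nonneg (-7 * a + 8 * d)])
  have hb : b ∈ Finset.Icc (0 : ℤ) 0 := mem_Icc_of_sq_lt (by norm_num) (by
    nlinarith only [h, hs, sq_nonneg (8 * a - 8 * b - 3 * d),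
      sq_nonneg c, sq_nonneg (-8 * b + 5 * d)])
  have hc : c ∈ Finset.Icc (-5 : ℤ) 5 := mem_Icc_of_sq_lt (by norm_num) (by
    nlinarith only [h, hs, sq_nonneg (8 * a - 8 * b - 3 * d),
      sq_nonneg (2 * b - d), sq_nonneg d])
  have hd : d ∈ Finset.Icc (-1 : ℤ) 1 := mem_Icc_of_sq_lt (by norm_num) (by
    nlinarith only [h, hs, sq_nonneg (8 * a - 8 * b - 3 * d),
      sq_nonneg (2 * b - d), sq_nonneg c])
  have key : ∀ a ∈ Finset.Icc (-1 : ℤ) 1, ∀ b ∈ Finset.Icc (0 : ℤ) 0,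
      ∀ c ∈ Finset.Icc (-5 : ℤ) 5, ∀ d ∈ Finset.Icc (-1 : ℤ) 1,
      c ^ 2 + 6 * b ^ 2 - 6 * (a * d) = 1 →
      (6 * a - 6 * b - 4 * c + 6 * d) * (6 * a - 6 * b + 4 * c + 6 * d) ≤ 0 →
      b = 0 ∧ a = 0 ∧ d = 0 ∧ (c = 1 ∨ c = -1) := by decide +kernel
  exact key a ha b hb c hc d hd h hs

lemma solve_r_four {a b c d : ℤ} (h : c ^ 2 + 6 * b ^ 2 - 6 * (a * d) = 1)
    (hs : (6 * a - 6 * b - 4 * c + 6 * d) * (18 * a - 6 * b - 8 * c + 6 * d) ≤ 0) :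
    b = 0 ∧ a = 0 ∧ d = c ∧ (c = 1 ∨ c = -1) := by
  have ha : a ∈ Finset.Icc (-1 : ℤ) 1 := mem_Icc_of_sq_lt (by norm_num) (by
    nlinarith only [h, hs, sq_nonneg (-8 * a + 7 * b + 4 * c - 4 * d),
      sq_nonneg (-264 * a + 223 * c - 216 * d), sq_nonneg (-15 * a + 8 * d)])
  have hb : b ∈ Finset.Icc (0 : ℤ) 0 := mem_Icc_of_sq_lt (by norm_num) (by
    nlinarith only [h, hs, sq_nonneg (72 * a - 48 * b - 40 * c + 39 * d),
      sq_nonneg (-24 * b + 19 * c - 21 * d), sq_nonneg (-16 * b + 5 * d)])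
  have hc : c ∈ Finset.Icc (-5 : ℤ) 5 := mem_Icc_of_sq_lt (by norm_num) (by
    nlinarith only [h, hs, sq_nonneg (72 * a - 48 * b - 40 * c + 39 * d),
      sq_nonneg (15 * b - 4 * c + 3 * d), sq_nonneg (-8 * c + 11 * d)])
  have hd : d ∈ Finset.Icc (-4 : ℤ) 4 := mem_Icc_of_sq_lt (by norm_num) (by
    nlinarith only [h, hs, sq_nonneg (72 * a - 48 * b - 40 * c + 39 * d),
      sq_nonneg (15 * b - 4 * c + 3 * d), sq_nonneg (7 * c - 9 * d)])
  have key : ∀ a ∈ Finset.Icc (-1 : ℤ) 1, ∀ b ∈ Finset.Icc (0 : ℤ) 0,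
      ∀ c ∈ Finset.Icc (-5 : ℤ) 5, ∀ d ∈ Finset.Icc (-4 : ℤ) 4,
      c ^ 2 + 6 * b ^ 2 - 6 * (a * d) = 1 →
      (6 * a - 6 * b - 4 * c + 6 * d) * (18 * a - 6 * b - 8 * c + 6 * d) ≤ 0 →
      b = 0 ∧ a = 0 ∧ d = c ∧ (c = 1 ∨ c = -1) := by decide +kernel
  exact key a ha b hb c hc d hd h hs

lemma solve_base {a b c d : ℤ} (h : c ^ 2 + 6 * b ^ 2 - 6 * (a * d) = 1)
    (hs : (6 * a - 6 * b - 4 * c + 6 * d) * (3 * a - 2 * c + 3 * d) ≤ 0) :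
    False := by
  have ha : a ∈ Finset.Icc (-1 : ℤ) 1 := mem_Icc_of_sq_lt (by norm_num) (by
    nlinarith only [h, hs, sq_nonneg (-3 * a + 4 * b + 2 * c - 3 * d),
      sq_nonneg (-15 * a + 14 * c - 15 * d), sq_nonneg (-13 * a + 15 * d)])
  have hb : b ∈ Finset.Icc (0 : ℤ) 0 := mem_Icc_of_sq_lt (by norm_num) (by
    nlinarith only [h, hs, sq_nonneg (6 * a - 3 * b - 4 * c + 4 * d),
      sq_nonneg (c - 2 * d), sq_nonneg (-3 * b + 2 * d)])
  have hc : c ∈ Finset.Icc (-3 : ℤ) 3 := mem_Icc_of_sq_lt (by norm_num) (by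
    nlinarith only [h, hs, sq_nonneg (6 * a - 3 * b - 4 * c + 4 * d),
      sq_nonneg (5 * b - 2 * d), sq_nonneg (-5 * c + 11 * d)])
  have hd : d ∈ Finset.Icc (-1 : ℤ) 1 := mem_Icc_of_sq_lt (by norm_num) (by
    nlinarith only [h, hs, sq_nonneg (6 * a - 3 * b - 4 * c + 4 * d),
      sq_nonneg (5 * b - 2 * d), sq_nonneg (c - 2 * d)])
  have key : ∀ a ∈ Finset.Icc (-1 : ℤ) 1, ∀ b ∈ Finset.Icc (0 : ℤ) 0,
      ∀ c ∈ Finset.Icc (-3 : ℤ) 3, ∀ d ∈ Finset.Icc (-1 : ℤ) 1,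
      c ^ 2 + 6 * b ^ 2 - 6 * (a * d) = 1 →
      (6 * a - 6 * b - 4 * c + 6 * d) * (3 * a - 2 * c + 3 * d) ≤ 0 →
      False := by decide +kernel
  exact key a ha b hb c hc d hd h hs

lemma solve_mirror {a b c d : ℤ} (h : b ^ 2 + 6 * c ^ 2 - 4 * (a * d) = 1)
    (hs : (6 * a - 3 * b - 12 * c + 6 * d) * (3 * a - 6 * c + 3 * d) ≤ 0) :
    a = 0 ∧ d = 0 ∧ c = 0 ∧ (b = 1 ∨ b = -1) := by
  have ha : a ∈ Finset.Icc (-1 : ℤ) 1 := mem_Icc_of_sq_lt (by norm_num) (by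
    nlinarith only [h, hs, sq_nonneg (-9 * a + 4 * b + 18 * c - 9 * d),
      sq_nonneg (-21 * a + 58 * c - 21 * d), sq_nonneg (-53 * a + 63 * d)])
  have hb : b ∈ Finset.Icc (-2 : ℤ) 2 := mem_Icc_of_sq_lt (by norm_num) (by
    nlinarith only [h, hs, sq_nonneg (36 * a - 9 * b - 72 * c + 28 * d),
      sq_nonneg (3 * c - 2 * d), sq_nonneg (-9 * b + 16 * d)])
  have hc : c ∈ Finset.Icc (-1 : ℤ) 1 := mem_Icc_of_sq_lt (by norm_num) (by
    nlinarith only [h, hs, sq_nonneg (36 * a - 9 * b - 72 * c + 28 * d),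
      sq_nonneg (7 * b - 8 * d), sq_nonneg (-63 * c + 47 * d)])
  have hd : d ∈ Finset.Icc (-1 : ℤ) 1 := mem_Icc_of_sq_lt (by norm_num) (by
    nlinarith only [h, hs, sq_nonneg (36 * a - 9 * b - 72 * c + 28 * d),
      sq_nonneg (7 * b - 8 * d), sq_nonneg (3 * c - 2 * d)])
  have key : ∀ a ∈ Finset.Icc (-1 : ℤ) 1, ∀ b ∈ Finset.Icc (-2 : ℤ) 2,
      ∀ c ∈ Finset.Icc (-1 : ℤ) 1, ∀ d ∈ Finset.Icc (-1 : ℤ) 1,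
      b ^ 2 + 6 * c ^ 2 - 4 * (a * d) = 1 →
      (6 * a - 3 * b - 12 * c + 6 * d) * (3 * a - 6 * c + 3 * d) ≤ 0 →
      a = 0 ∧ d = 0 ∧ c = 0 ∧ (b = 1 ∨ b = -1) := by decide +kernel
  exact key a ha b hb c hc d hd h hs

/-- The point fixed by the tetrahedral subgroup. -/
def pA : Vec := ⟨6, 3, 2, 6⟩
/-- A point fixed by `τ`. -/
def pτ : Vec := ⟨3, 0, 1, 3⟩

/-- A congruence condition on vectors. -/
def Typ (m : ℤ) (n : Vec) : Prop := 2 * m ∣ n.A ∧ 2 * m ∣ n.C ∧ m ∣ n.X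

/-- The vectors defining the walls. -/
def IsWall (n : Vec) : Prop := Typ 3 n ∧ pair n n = -12

instance : Neg Vec := ⟨fun h => ⟨-h.A, -h.X, -h.Y, -h.C⟩⟩

lemma neg_def (h : Vec) : -h = ⟨-h.A, -h.X, -h.Y, -h.C⟩ := rfl

lemma Typ.smul {m : ℤ} (hm : m ∣ 6) {n : Vec} (hn : Typ m n) (w : G) : Typ m (w • n) := by
  obtain ⟨p₁, p₂, q₁, q₂, a₁, a₂, s₁, s₂, h₁, h₂, rfl⟩ := exists_mk_sl w
  obtain ⟨hA, hC, hX⟩ := hn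
  have h12 : 2 * m ∣ 12 := mul_dvd_mul_left 2 hm
  have hX' : 2 * m ∣ 2 * n.X := mul_dvd_mul_left 2 hX
  have hmA : m ∣ n.A := (Dvd.intro_left 2 rfl).trans hA
  have hmC : m ∣ n.C := (Dvd.intro_left 2 rfl).trans hC
  rw [mk_sl_smul]
  refine ⟨?_, ?_, ?_⟩ <;> simp only [act]
  · refine dvd_add (dvd_add (dvd_add (hC.mul_left _) (hA.mul_left _)) ?_) ?_
    · rw [mul_right_comm]; exact hX'.mul_right _
    · rw [mul_assoc]; exact h12.mul_right _
  · refine dvd_add (dvd_add (dvd_add (hC.mul_left _) (hA.mul_left _)) ?_) ?_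
    · rw [mul_right_comm]; exact hX'.mul_right _
    · rw [mul_assoc]; exact h12.mul_right _
  · refine dvd_add (dvd_add (dvd_add (hmC.mul_left _) (hmA.mul_left _)) (hX.mul_left _)) ?_
    rw [mul_assoc]; exact hm.mul_right _

lemma IsWall.smul {n : Vec} (hn : IsWall n) (w : G) : IsWall (w • n) :=
  ⟨hn.1.smul (by decide) w, by rw [pair_smul]; exact hn.2⟩

lemma IsWall.r₄ {n : Vec} (hn : IsWall n) : IsWall (r₄ n) := by
  obtain ⟨⟨hA, hC, hX⟩, hq⟩ := hn
  refine ⟨⟨hA, ?_, hX⟩, by rw [pair_r₄, hq]⟩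
  simp only [Bianchi.r₄]; omega

lemma Typ.r₆ {n : Vec} (hn : Typ 6 n) : Typ 6 (r₆ n) := by
  obtain ⟨hA, hC, hX⟩ := hn
  refine ⟨?_, ?_, hX⟩ <;> simp only [Bianchi.r₆] <;> omega

lemma IsWall.r₆ {n : Vec} (hn : IsWall n) : IsWall (r₆ n) := by
  obtain ⟨⟨hA, hC, hX⟩, hq⟩ := hn
  refine ⟨⟨?_, ?_, hX⟩, by rw [pair_r₆, hq]⟩ <;> simp only [Bianchi.r₆] <;> omega

lemma IsWall.exists_coords {n : Vec} (hn : IsWall n) : ∃ a b c d : ℤ, n = ⟨6 * a, 6 * b, c, 6 * d⟩ ∧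
    c ^ 2 + 6 * b ^ 2 - 6 * (a * d) = 1 := by
  obtain ⟨n₁, n₂, n₃, n₄⟩ := n
  obtain ⟨⟨⟨a, ha⟩, ⟨d, hd⟩, ⟨b, hb⟩⟩, hq⟩ := hn
  simp only [pair] at ha hb hd hq
  subst ha hb hd
  obtain ⟨b, rfl⟩ : (2 : ℤ) ∣ b := by
    rw [← Int.prime_two.dvd_pow_iff_dvd two_ne_zero]
    ring_nf at hq ⊢
    omega
  refine ⟨a, b, n₃, d, ?_, by linarith⟩
  ext <;> simp only <;> ring

/-- The wall `Y = 0`. -/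
def e₃ : Vec := ⟨0, 0, -1, 0⟩
/-- The wall `A = 2 Y`. -/
def e₄ : Vec := ⟨0, 0, 1, 6⟩
/-- The mirror `X = 0`. -/
def e₁ : Vec := ⟨0, -1, 0, 0⟩

lemma IsWall.pair_τ_pos {n : Vec} (hn : IsWall n) : 0 < pair n pA * pair n (τ • pA) := by
  obtain ⟨a, b, c, d, rfl, h⟩ := hn.exists_coords
  by_contra! hs
  have e : τ • pA = ⟨6, -3, 2, 6⟩ := by decide
  rw [e] at hs
  simp only [pair, pA] at hs
  exact solve_tau h (by linarith)

lemma IsWall.pair_pτ_pos {n : Vec} (hn : IsWall n) : 0 < pair n pA * pair n pτ := by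
  obtain ⟨a, b, c, d, rfl, h⟩ := hn.exists_coords
  by_contra! hs
  simp only [pair, pA, pτ] at hs
  exact solve_base h (by linarith)

lemma IsWall.eq_e₃ {n : Vec} (hn : IsWall n) (hs : pair n pA * pair n (Bianchi.r₃ pA) ≤ 0) :
    n = e₃ ∨ n = -e₃ := by
  obtain ⟨a, b, c, d, rfl, h⟩ := hn.exists_coords
  simp only [pair, pA, Bianchi.r₃] at hs
  obtain ⟨rfl, rfl, rfl, rfl | rfl⟩ := solve_r_three h (by linarith)
  · exact Or.inr rfl
  · exact Or.inl rfl

lemma IsWall.eq_e₄ {n : Vec} (hn : IsWall n) (hs : pair n pA * pair n (Bianchi.r₄ pA) ≤ 0) :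
    n = e₄ ∨ n = -e₄ := by
  obtain ⟨a, b, c, d, rfl, h⟩ := hn.exists_coords
  simp only [pair, pA, Bianchi.r₄] at hs
  obtain ⟨rfl, rfl, rfl, rfl | rfl⟩ := solve_r_four h (by linarith)
  · exact Or.inl rfl
  · exact Or.inr rfl

lemma eq_e₁ {n : Vec} (hn : Typ 1 n) (hq : pair n n = -2) (hs : pair n pA * pair n pτ ≤ 0) :
    n = e₁ ∨ n = -e₁ := by
  obtain ⟨n₁, n₂, n₃, n₄⟩ := n
  obtain ⟨⟨a, ha⟩, ⟨d, hd⟩, -⟩ := hn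
  simp only [pair, pA, pτ] at ha hd hq hs
  subst ha hd
  obtain ⟨rfl, rfl, rfl, rfl | rfl⟩ :=
    solve_mirror (a := a) (b := n₂) (c := n₃) (d := d) (by linarith) (by linarith)
  · exact Or.inr rfl
  · exact Or.inl rfl

end Bianchi

/-! ### Stabilisers of walls -/

namespace Bianchi

open Matrix

lemma vec_ext_iff (h k : Vec) : h = k ↔ h.A = k.A ∧ h.X = k.X ∧ h.Y = k.Y ∧ h.C = k.C :=
  Vec.ext_iff

lemma eq_one_of_smul {w : G} (hw : ∀ h : Vec, w • h = h) : w = 1 := by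
  obtain ⟨p₁, p₂, q₁, q₂, a₁, a₂, s₁, s₂, h₁, h₂, rfl⟩ := exists_mk_sl w
  have e := (vec_ext_iff _ _).1 (hw ⟨0, 0, 0, 1⟩)
  have e' := (vec_ext_iff _ _).1 (hw ⟨1, 0, 0, 0⟩)
  simp only [mk_sl_smul, act] at e e'
  obtain ⟨eA, -, -, eC⟩ := e
  obtain ⟨eA', -, -, eC'⟩ := e'
  have ha₁ : a₁ = 0 := by nlinarith
  have ha₂ : a₂ = 0 := by nlinarith
  have hq₁ : q₁ = 0 := by nlinarith
  have hq₂ : q₂ = 0 := by nlinarith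
  have hp₂ : p₂ = 0 := by nlinarith
  have hs₂ : s₂ = 0 := by nlinarith
  subst ha₁ ha₂ hq₁ hq₂ hp₂ hs₂
  have h1 : p₁ * s₁ = 1 := by linarith
  rw [← map_one mk, mk_eq_mk, one_eq, neg_eq, sl_inj, sl_inj]
  rcases Int.eq_one_or_neg_one_of_mul_eq_one h1 with rfl | rfl
  · left; simp; linarith
  · right; simp; linarith

lemma eq_of_smul {w w' : G} (hw : ∀ h : Vec, w • h = w' • h) : w = w' := by
  rw [← inv_mul_eq_one]
  refine (eq_one_of_smul fun h => ?_)
  rw [mul_smul, ← hw h, inv_smul_smul]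

/-- The stabiliser of the wall `Y = 0`. -/
def E : Subgroup G := Subgroup.closure {τ, t}

/-- The map from the modular group. -/
def ofInt : SpecialLinearGroup (Fin 2) ℤ →* G :=
  mk.comp (SpecialLinearGroup.map (Int.castRingHom R))

lemma ofInt_mem (g : SpecialLinearGroup (Fin 2) ℤ) : ofInt g ∈ E := by
  have hg : g ∈ Subgroup.closure {ModularGroup.S, ModularGroup.T} := by
    rw [SpecialLinearGroup.SL2Z_generators]; trivial
  induction hg using Subgroup.closure_induction with
  | mem x hx =>
    refine Subgroup.subset_closure ?_
    rcases hx with rfl | rfl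
    · exact Or.inl (mk_eq_of (by decide +kernel))
    · exact Or.inr (mk_eq_of (by decide +kernel))
  | one => rw [map_one]; exact one_mem _
  | mul x y _ _ hx hy => rw [map_mul]; exact mul_mem hx hy
  | inv x _ hx => rw [map_inv]; exact inv_mem hx

lemma mem_E {w : G} (hw : w • e₃ = e₃) : w ∈ E := by
  obtain ⟨p₁, p₂, q₁, q₂, a₁, a₂, s₁, s₂, h₁, h₂, rfl⟩ := exists_mk_sl w
  have e := (vec_ext_iff _ _).1 hw
  simp only [mk_sl_smul, act, e₃] at e
  obtain ⟨eA, eX, eY, eC⟩ := e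
  have k₁ : p₁ * s₁ - q₁ * a₁ = 1 := by linarith
  have k₂ : a₁ * s₂ = a₂ * s₁ := by linarith
  have k₃ : p₁ * q₂ = p₂ * q₁ := by linarith
  have k₄ : p₁ * s₂ = q₁ * a₂ := by linarith
  have k₅ : p₂ * s₁ = q₂ * a₁ := by linarith
  obtain rfl : p₂ = 0 := by linear_combination -p₂ * k₁ + p₁ * k₅ + a₁ * k₃
  obtain rfl : q₂ = 0 := by linear_combination -q₂ * k₁ + s₁ * k₃ + q₁ * k₅
  obtain rfl : a₂ = 0 := by linear_combination -a₂ * k₁ - p₁ * k₂ + a₁ * k₄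
  obtain rfl : s₂ = 0 := by linear_combination -s₂ * k₁ + s₁ * k₄ - q₁ * k₂
  have := ofInt_mem ⟨!![p₁, q₁; a₁, s₁], by rw [det_fin_two_of]; linarith⟩
  convert this using 1
  refine congrArg mk (Subtype.ext ?_)
  change !![_, _; _, _] = _
  ext i j
  all_goals fin_cases i <;> fin_cases j <;> rfl

lemma smul_e₃_ne_neg (w : G) : w • e₃ ≠ -e₃ := by
  intro hw
  obtain ⟨p₁, p₂, q₁, q₂, a₁, a₂, s₁, s₂, h₁, h₂, rfl⟩ := exists_mk_sl w
  have e := (vec_ext_iff _ _).1 hw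
  simp only [mk_sl_smul, act, e₃, neg_def] at e
  omega

lemma smul_e₃_ne (w : G) : w • e₃ ≠ r₆ e₃ ∧ w • e₃ ≠ - r₆ e₃ := by
  obtain ⟨p₁, p₂, q₁, q₂, a₁, a₂, s₁, s₂, h₁, h₂, rfl⟩ := exists_mk_sl w
  constructor <;> intro hw <;> have e := (vec_ext_iff _ _).1 hw <;>
    simp only [mk_sl_smul, act, e₃, neg_def, r₆] at e <;> omega

lemma eq_one_of_smul_e₁ {w : G} (h1 : w • e₁ = e₁) (h2 : w • pτ = pτ) : w = 1 := by
  obtain ⟨p₁, p₂, q₁, q₂, a₁, a₂, s₁, s₂, h₁, h₂, rfl⟩ := exists_mk_sl w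
  have e := (vec_ext_iff _ _).1 h1
  have e' := (vec_ext_iff _ _).1 h2
  simp only [mk_sl_smul, act, e₁, pτ] at e e'
  obtain ⟨eA, eX, eY, eC⟩ := e
  obtain ⟨eA', -, -, eC'⟩ := e'
  have k₁ : p₁ * s₁ + 6 * (q₂ * a₂) = 1 := by linarith
  have k₂ : a₁ * s₁ = -6 * (a₂ * s₂) := by linarith
  have k₃ : p₁ * q₁ = -6 * (p₂ * q₂) := by linarith
  have k₄ : p₂ * s₁ = q₁ * a₂ := by linarith
  have k₅ : p₁ * s₂ = q₂ * a₁ := by linarith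
  obtain rfl : p₂ = 0 := by linear_combination -p₂ * k₁ + p₁ * k₄ + a₂ * k₃
  obtain rfl : q₁ = 0 := by linear_combination -q₁ * k₁ + s₁ * k₃ - 6 * q₂ * k₄
  obtain rfl : a₁ = 0 := by linear_combination -a₁ * k₁ + p₁ * k₂ - 6 * a₂ * k₅
  obtain rfl : s₂ = 0 := by linear_combination -s₂ * k₁ + s₁ * k₅ + q₂ * k₂
  obtain rfl : q₂ = 0 := by nlinarith [sq_nonneg (p₁ + 2 * q₂)]
  obtain rfl : a₂ = 0 := by nlinarith [sq_nonneg (s₁ - 2 * a₂)]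
  have h1 : p₁ * s₁ = 1 := by linarith
  rw [← map_one mk, mk_eq_mk, one_eq, neg_eq, sl_inj, sl_inj]
  rcases Int.eq_one_or_neg_one_of_mul_eq_one h1 with rfl | rfl
  · left; simp; linarith
  · right; simp; linarith

lemma r₄_eq (h : Vec) : 6 * (r₄ h).A = 6 * h.A + pair h e₄ * e₄.A ∧
    6 * (r₄ h).X = 6 * h.X + pair h e₄ * e₄.X ∧ 6 * (r₄ h).Y = 6 * h.Y + pair h e₄ * e₄.Y ∧
    6 * (r₄ h).C = 6 * h.C + pair h e₄ * e₄.C := by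
  simp only [r₄, pair, e₄]
  refine ⟨?_, ?_, ?_, ?_⟩ <;> ring

lemma smul_r₄_eq (w : G) (h : Vec) :
    6 * (w • r₄ h).A = 6 * (w • h).A + pair h e₄ * (w • e₄).A ∧
    6 * (w • r₄ h).X = 6 * (w • h).X + pair h e₄ * (w • e₄).X ∧
    6 * (w • r₄ h).Y = 6 * (w • h).Y + pair h e₄ * (w • e₄).Y ∧
    6 * (w • r₄ h).C = 6 * (w • h).C + pair h e₄ * (w • e₄).C := by
  obtain ⟨p₁, p₂, q₁, q₂, x₁, x₂, s₁, s₂, h₁, h₂, rfl⟩ := exists_mk_sl w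
  simp only [mk_sl_smul, act, r₄, pair, e₄]
  refine ⟨?_, ?_, ?_, ?_⟩ <;> ring

lemma pair_neg (h k : Vec) : pair h (-k) = -pair h k := by
  simp only [pair, neg_def]; ring

/-- The stabiliser of a wall is fixed by the reflection. -/
lemma κ₄_eq {w : G} (hw : w • e₄ = e₄ ∨ w • e₄ = -e₄) : κ₄ w = w := by
  refine eq_of_smul fun h => ?_
  rw [← r₄_r₄ h, κ₄_smul]
  generalize r₄ h = k
  obtain ⟨a₁, a₂, a₃, a₄⟩ := r₄_eq (w • k)
  obtain ⟨b₁, b₂, b₃, b₄⟩ := smul_r₄_eq w k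
  have hp := pair_smul w k e₄
  rcases hw with hw | hw
  · rw [hw] at b₁ b₂ b₃ b₄ hp
    rw [hp] at a₁ a₂ a₃ a₄
    apply Vec.ext <;> linarith
  · rw [hw] at b₁ b₂ b₃ b₄ hp
    rw [pair_neg] at hp
    rw [← hp, neg_def] at b₁ b₂ b₃ b₄
    apply Vec.ext <;> linarith

/-- The elements of the stabiliser of the wall `A = 2 Y`. -/
def elF (a b c d e : ℤ) (h : a * d - 2 * (b * c) = 1) (he : d = a + 2 * e) : G :=
  mk (sl a c (b + 3 * c) e (2 * c) 0 d (-c) (by linear_combination h)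
    (by linear_combination c * he))

lemma exists_elF {w : G} (hw : κ₄ w = w) : ∃ a b c d e h he, w = elF a b c d e h he := by
  obtain ⟨p₁, p₂, q₁, q₂, x₁, x₂, s₁, s₂, h₁, h₂, rfl⟩ := exists_mk_sl w
  rw [κ₄_mk, mk_eq_mk, neg_eq, sl_inj, sl_inj] at hw
  rcases hw with ⟨⟨e₁, e₂⟩, ⟨e₃, e₄⟩, ⟨e₅, e₆⟩, e₇, e₈⟩ | ⟨⟨e₁, e₂⟩, ⟨e₃, e₄⟩, ⟨e₅, e₆⟩, e₇, e₈⟩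
  · obtain rfl : x₂ = 0 := by omega
    obtain rfl : x₁ = 2 * p₂ := by omega
    obtain rfl : s₂ = -p₂ := by omega
    refine ⟨p₁, q₁ - 3 * p₂, p₂, s₁, q₂, by linear_combination h₁, by omega, ?_⟩
    refine congrArg mk (sl_congr ?_ ?_ ?_ ?_ ?_ ?_ ?_ ?_) <;> ring
  · exfalso
    obtain rfl : p₁ = -3 * x₂ := by omega
    obtain rfl : x₁ = 0 := by omega
    obtain rfl : s₁ = 3 * x₂ := by omega
    have : 3 * (-3 * (x₂ * x₂) - 2 * (p₂ * s₂) + 2 * (q₂ * x₂)) = 1 := by linear_combination h₁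
    omega

lemma smul_e₄_ne_neg (w : G) : w • e₄ ≠ -e₄ := by
  intro hw
  obtain ⟨a, b, c, d, e, h, he, rfl⟩ := exists_elF (κ₄_eq (Or.inr hw))
  have e := (vec_ext_iff _ _).1 hw
  simp only [elF, mk_sl_smul, act, e₄, neg_def] at e
  obtain ⟨-, -, eY, -⟩ := e
  have : a * d - 2 * (b * c) = -1 := by linear_combination eY
  omega

end Bianchi

/-! ### The stabiliser of the wall `A = 2 Y` -/

namespace Bianchi

open Matrix GMod

/-- The stabiliser of the wall `A = 2 Y`. -/
def F : Subgroup G := Subgroup.closure {σ, t}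

lemma σ_mem_F : σ ∈ F := Subgroup.subset_closure (Or.inl rfl)
lemma t_mem_F : t ∈ F := Subgroup.subset_closure (Or.inr rfl)

lemma t_zpow (k : ℤ) : t ^ k = mk (sl 1 0 k 0 0 0 1 0 (by ring) (by ring)) := by
  have hs : ∀ k : ℤ, t * mk (sl 1 0 k 0 0 0 1 0 (by ring) (by ring)) =
      mk (sl 1 0 (k + 1) 0 0 0 1 0 (by ring) (by ring)) := fun k => by
    rw [t, ← map_mul, mul_eq]
    refine congrArg mk (sl_congr ?_ ?_ ?_ ?_ ?_ ?_ ?_ ?_) <;> ring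
  induction k with
  | zero => rw [zpow_zero, ← map_one mk, one_eq]
  | succ n ih =>
    rw [add_comm, _root_.zpow_add, zpow_one, ih, hs]
    refine congrArg mk (sl_congr rfl rfl ?_ rfl rfl rfl rfl rfl); ring
  | pred n ih =>
    rw [← mul_right_inj t, hs, ← _root_.zpow_one_add, add_sub_cancel, ih]
    refine congrArg mk (sl_congr rfl rfl ?_ rfl rfl rfl rfl rfl); ring

lemma t_zpow_mul_elF (k a b c d e : ℤ) (h he) : t ^ k * elF a b c d e h he =
    elF (a + 2 * (k * c)) (b + k * d) c d (e - k * c) (by linear_combination h)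
      (by linear_combination he) := by
  rw [t_zpow, elF, elF, ← map_mul, mul_eq]
  refine congrArg mk (sl_congr ?_ ?_ ?_ ?_ ?_ ?_ ?_ ?_) <;> ring

lemma σ_mul_elF (a b c d e : ℤ) (h he) : σ * elF a b c d e h he =
    elF (a - 2 * c) (b - d) (a - c) (2 * b - d) (b - d + c + e) (by linear_combination h)
      (by linear_combination he) := by
  rw [σ, elF, elF, ← map_mul, mul_eq]
  refine congrArg mk (sl_congr ?_ ?_ ?_ ?_ ?_ ?_ ?_ ?_) <;> linarith

lemma elF_neg (a b c d e : ℤ) (h he) : elF a b c d e h he =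
    elF (-a) (-b) (-c) (-d) (-e) (by linear_combination h) (by linear_combination -he) := by
  rw [elF, elF, mk_eq_mk, neg_eq]
  right
  apply sl_congr <;> ring

lemma exists_shift (a c : ℤ) (hc : c ≠ 0) (ha : ¬ 2 ∣ a) : ∃ k : ℤ, |a + 2 * (k * c) - c| < |c| := by
  have h := Int.emod_add_mul_ediv a (2 * |c|)
  have hp : 0 < |c| := abs_pos.2 hc
  have h0 := Int.emod_nonneg a (show 2 * |c| ≠ 0 by omega)
  have h1 := Int.emod_lt_of_pos a (show 0 < 2 * |c| by omega)
  have hn : a % (2 * |c|) ≠ 0 := fun h' => ha (by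
    rw [h', zero_add] at h; exact ⟨|c| * (a / (2 * |c|)), by rw [← mul_assoc]; exact h.symm⟩)
  generalize a % (2 * |c|) = m at h h0 h1 hn
  generalize a / (2 * |c|) = q at h
  rcases abs_cases c with ⟨h2, h3⟩ | ⟨h2, h3⟩
  · rw [h2] at h h1 ⊢
    refine ⟨-q, ?_⟩
    have : a + 2 * (-q * c) - c = m - c := by linear_combination -h
    rw [this, abs_lt]; constructor <;> omega
  · rw [h2] at h h1 ⊢
    refine ⟨q + 1, ?_⟩
    have : a + 2 * ((q + 1) * c) - c = m + c := by linear_combination -h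
    rw [this, abs_lt]; constructor <;> omega

lemma elF_mem (n : ℕ) : ∀ (a b c d e : ℤ) (h he), c.natAbs ≤ n → elF a b c d e h he ∈ F := by
  induction n with
  | zero =>
    intro a b c d e h he hc
    obtain rfl : c = 0 := by omega
    have h1 : a * d = 1 := by linarith
    have key : ∀ b h he, elF 1 b 0 1 0 h he ∈ F := fun b h he => by
      have : elF 1 b 0 1 0 h he = t ^ b := by
        rw [t_zpow]; refine congrArg mk (sl_congr ?_ ?_ ?_ ?_ ?_ ?_ ?_ ?_) <;> ring
      rw [this]; exact zpow_mem t_mem_F b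
    rcases Int.eq_one_or_neg_one_of_mul_eq_one h1 with rfl | rfl
    · obtain rfl : d = 1 := by linarith
      obtain rfl : e = 0 := by linarith
      exact key _ _ _
    · obtain rfl : d = -1 := by linarith
      obtain rfl : e = 0 := by linarith
      rw [elF_neg]
      exact key _ _ _
  | succ n ih =>
    intro a b c d e h he hn
    rcases eq_or_ne c 0 with rfl | hc
    · exact ih _ _ _ _ _ _ _ (by simp)
    have ha : ¬ 2 ∣ a := by
      rintro ⟨a', rfl⟩
      have : 2 * (a' * d - b * c) = 1 := by linear_combination h
      omega
    obtain ⟨k, hk⟩ := exists_shift a c hc ha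
    rw [Int.abs_eq_natAbs, Int.abs_eq_natAbs] at hk
    have hm := ih (a + 2 * (k * c) - 2 * c) (b + k * d - d) (a + 2 * (k * c) - c)
      (2 * (b + k * d) - d) (b + k * d - d + c + (e - k * c)) (by linear_combination h)
      (by linear_combination he) (by omega)
    rw [← σ_mul_elF _ _ _ _ _ (by linear_combination h) (by linear_combination he),
      ← t_zpow_mul_elF _ _ _ _ _ _ h he] at hm
    exact (mul_mem_cancel_left (zpow_mem t_mem_F k)).1 ((mul_mem_cancel_left σ_mem_F).1 hm)

lemma mem_F {w : G} (hw : κ₄ w = w) : w ∈ F := by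
  obtain ⟨a, b, c, d, e, h, he, rfl⟩ := exists_elF hw
  exact elF_mem _ _ _ _ _ _ _ _ le_rfl

lemma κ₄_of_mem_F {w : G} (hw : w ∈ F) : κ₄ w = w := by
  induction hw using Subgroup.closure_induction with
  | mem x hx =>
    rcases hx with rfl | rfl
    · exact κ₄_σ
    · exact κ₄_t
  | one => exact map_one _
  | mul x y _ _ hx hy => rw [map_mul, hx, hy]
  | inv x _ hx => rw [map_inv, hx]

/-- A base point for the action of `F`. -/
def kF : Vec := ⟨2, 1, 1, 4⟩

lemma elF_smul_kF (a b c d e : ℤ) (h he) :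
    (elF a b c d e h he • kF).X = 2 * (a * c + 2 * (b * c) + b * d) + 1 := by
  obtain rfl : d = a + 2 * e := he
  simp only [elF, mk_sl_smul, act, kF]
  linear_combination h

lemma elF_mul_t_inv (a b c d e : ℤ) (h he) : elF a b c d e h he * t⁻¹ =
    elF a (b - a) c (d - 2 * c) (e - c) (by linear_combination h) (by linear_combination he) := by
  rw [mul_inv_eq_iff_eq_mul, t, elF, elF, ← map_mul, mul_eq]
  refine congrArg mk (sl_congr ?_ ?_ ?_ ?_ ?_ ?_ ?_ ?_) <;> linarith

lemma elF_X_mul_t_inv (a b c d e : ℤ) (h he) : ((elF a b c d e h he * t⁻¹) • kF).X =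
    2 * (a * c + b * d - 2 * (b * c) - 1) + 1 := by
  rw [elF_mul_t_inv, elF_smul_kF]; linear_combination -2 * h

lemma σ_smul_kF : σ • kF = kF := by decide +kernel

/-- The involution in `F`. -/
def σF : F := ⟨σ, σ_mem_F⟩

lemma σF_pow : σF ^ 2 = 1 := by rw [pow_two]; exact Subtype.ext σ_mul_σ

/-- The cyclic subgroup of `F`. -/
def cF : Cyc 2 →* F := cycHom 2 σF σF_pow

lemma σ_ne_one : σ ≠ 1 := by rw [← iA_σ, ← map_one iA]; exact fun h => by cases iA_injective h

lemma cF_injective : Function.Injective cF := 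
  cycHom_injective 2 _ _ fun k hk h => by
    interval_cases k
    · rfl
    · rw [pow_one] at h; exact absurd (congrArg Subtype.val h) σ_ne_one

lemma closure_eq_top_of {K : Type} [Group K] {k : Set K} {s : Set (Subgroup.closure k)}
    (h : ∀ x (hx : x ∈ k), (⟨x, Subgroup.subset_closure hx⟩ : Subgroup.closure k) ∈
      Subgroup.closure s) : Subgroup.closure s = ⊤ := by
  rw [eq_top_iff, ← Subgroup.closure_closure_coe_preimage, Subgroup.closure_le]
  exact fun x hx => h x.1 hx

lemma closure_F : Subgroup.closure (Set.range cF ∪ {(⟨t, t_mem_F⟩ : F)⁻¹}) = ⊤ := by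
  refine closure_eq_top_of ?_
  rintro x (rfl | rfl)
  · exact Subgroup.subset_closure (Or.inl ⟨gen 2, cycHom_gen _ _ _⟩)
  · rw [← inv_mem_iff]; exact Subgroup.subset_closure (Or.inr rfl)

lemma cF_smul_kF (x : Cyc 2) : (cF x : G) • kF = kF := by
  obtain ⟨k, -, hk⟩ := (range_cycHom 2 σF σF_pow (cF x)).1 ⟨x, rfl⟩
  rw [← hk]
  change σ ^ k • kF = kF
  induction k generalizing x with
  | zero => rw [pow_zero, one_smul]
  | succ n ih => rw [pow_succ, mul_smul, σ_smul_kF]; exact ih (gen 2 ^ n) (by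
      rw [map_pow]; exact congrArg (· ^ n) (cycHom_gen _ _ _).symm)

lemma elF_position {a b c d e : ℤ} {h he} :
    (0 ≤ a * c + 2 * (b * c) + b * d ↔ 0 ≤ a * c + b * d - 2 * (b * c) - 1) ∨
      elF a b c d e h he = 1 := by
  have hpq : (a * c) * (b * d) = 2 * (b * c) ^ 2 + b * c := by linear_combination (b * c) * h
  have hsq : 4 * (2 * (b * c) ^ 2 + b * c) ≤ (a * c + b * d) ^ 2 := by
    nlinarith [sq_nonneg (a * c - b * d)]
  by_cases h0 : b = 0 ∧ c = 0
  · right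
    obtain ⟨rfl, rfl⟩ := h0
    have h1 : a * d = 1 := by linarith
    rcases Int.eq_one_or_neg_one_of_mul_eq_one h1 with rfl | rfl
    · obtain rfl : d = 1 := by linarith
      obtain rfl : e = 0 := by linarith
      rw [← map_one mk, one_eq]; rfl
    · obtain rfl : d = -1 := by linarith
      obtain rfl : e = 0 := by linarith
      rw [elF_neg, ← map_one mk, one_eq]; rfl
  left
  constructor
  · intro h1
    by_contra! h2
    have hp : (a * c + b * d) ^ 2 ≤ (2 * (b * c)) ^ 2 := sq_le_sq' (by linarith) (by linarith)
    have hq0 : b * c = 0 := by nlinarith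
    have hp0 : a * c + b * d = 0 := by linarith
    have had : a * d = 1 := by linarith
    have ha : a ≠ 0 := by rintro rfl; simp at had
    have hd : d ≠ 0 := by rintro rfl; simp at had
    rcases mul_eq_zero.1 hq0 with rfl | rfl
    · exact h0 ⟨rfl, by simpa [ha] using hp0⟩
    · exact h0 ⟨by simpa [hd] using hp0, rfl⟩
  · intro h1
    by_contra! h2
    have hp : (a * c + b * d) ^ 2 ≤ (-2 * (b * c) - 1) ^ 2 := sq_le_sq' (by linarith) (by linarith)
    have hq0 : b * c ≤ -1 := by omega
    nlinarith

/-- The homology of `F`. -/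
theorem F_homology : (∀ n, Function.Bijective (hmap cF (n + 2))) ∧
    Function.Injective (hmap cF 1) ∧
      ∃ δ : h F 1 →+ ℤ, Function.Surjective δ ∧ Function.Exact (hmap cF 1) δ := by
  refine hnn_homology cF _ cF_injective closure_F
    (fun w => if 1 ≤ ((w : G) • kF).X then 1 else 0) (fun w x => ?_) (by decide +kernel) ?_
  · rw [Subgroup.coe_mul, mul_smul, cF_smul_kF]
  · rintro ⟨w, hw⟩ hne
    obtain ⟨a, b, c, d, e, h, he, rfl⟩ := exists_elF (κ₄_of_mem_F hw)
    change (if 1 ≤ (elF a b c d e h he • kF).X then (1 : ℤ) else 0) =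
      if 1 ≤ ((elF a b c d e h he * t⁻¹) • kF).X then 1 else 0
    rw [elF_smul_kF, elF_X_mul_t_inv]
    rcases elF_position (h := h) (he := he) with h1 | h1
    · exact if_congr (by omega) rfl rfl
    · exact absurd (Subtype.ext h1) hne

end Bianchi

/-! ### The vertex group and its free product decomposition -/

namespace Bianchi

open Matrix GMod

/-- The stabiliser of a vertex of the tree. -/
def Γ : Subgroup G := Subgroup.closure (Set.range iA ∪ {τ})

lemma iA_mem_Γ (x : A4) : iA x ∈ Γ := Subgroup.subset_closure (Or.inl ⟨x, rfl⟩)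
lemma τ_mem_Γ : τ ∈ Γ := Subgroup.subset_closure (Or.inr rfl)
lemma σ_mem_Γ : σ ∈ Γ := iA_σ ▸ iA_mem_Γ _
lemma ρ_mem_Γ : ρ ∈ Γ := iA_ρ ▸ iA_mem_Γ _
lemma t_eq : t = ρ * τ := by rw [← t_mul_τ, mul_assoc, τ_mul_τ, mul_one]
lemma t_mem_Γ : t ∈ Γ := t_eq ▸ mul_mem ρ_mem_Γ τ_mem_Γ

lemma iA_smul_pA : ∀ x : A4, iA x • pA = pA := by decide +kernel
lemma τ_smul_pτ : τ • pτ = pτ := by decide +kernel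
lemma τ_ne_one : τ ≠ 1 := fun h => by
  have : τ • pA = pA := by rw [h, one_smul]
  revert this; decide +kernel

lemma mul_pos_trans {a b c : ℤ} (h₁ : 0 < a * b) (h₂ : 0 < b * c) : 0 < a * c := by
  rcases pos_and_pos_or_neg_and_neg_of_mul_pos h₁ with ⟨ha, hb⟩ | ⟨ha, hb⟩ <;>
    rcases pos_and_pos_or_neg_and_neg_of_mul_pos h₂ with ⟨hb', hc⟩ | ⟨hb', hc⟩ <;> nlinarith

/-- The orbit of the base point under the vertex group is not separated by walls. -/
lemma IsWall.sign {n : Vec} (hn : IsWall n) {x : G} (hx : x ∈ Γ) :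
    0 < pair n pA * pair n (x • pA) := by
  have hself : ∀ {n : Vec}, IsWall n → 0 < pair n pA * pair n pA := fun hn =>
    mul_pos_trans hn.pair_τ_pos (mul_comm (pair _ pA) _ ▸ hn.pair_τ_pos)
  induction hx using Subgroup.closure_induction generalizing n with
  | mem x hx =>
    rcases hx with ⟨y, rfl⟩ | rfl
    · rw [iA_smul_pA]; exact hself hn
    · exact hn.pair_τ_pos
  | one => rw [one_smul]; exact hself hn
  | mul x y _ _ hx hy =>
    refine mul_pos_trans (hx hn) ?_
    rw [mul_smul, pair_smul_right x, pair_smul_right x]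
    exact hy (hn.smul _)
  | inv x _ hx =>
    have := hx (hn.smul x)
    rwa [pair_smul, ← inv_inv x, ← pair_smul_right, mul_comm] at this

lemma IsWall.sign_pτ {n : Vec} (hn : IsWall n) {x : G} (hx : x ∈ Γ) :
    0 < pair n pA * pair n (x • pτ) := by
  refine mul_pos_trans (hn.sign hx) ?_
  rw [pair_smul_right x, pair_smul_right x]
  exact (hn.smul _).pair_pτ_pos

lemma isWall_e₃ : IsWall e₃ := by simp [IsWall, Typ, e₃, pair]
lemma isWall_e₄ : IsWall e₄ := by simp [IsWall, Typ, e₄, pair]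
lemma isWall_e₅ : IsWall ⟨6, 0, 1, 0⟩ := by simp [IsWall, Typ, pair]

lemma eq_one_of_mem_Γ {w : G} (hw : w ∈ Γ) (h1 : w • e₁ = e₁) : w = 1 := by
  refine eq_one_of_smul_e₁ h1 ?_
  have k₀ := pair_smul w e₁ pτ
  have k₁ := pair_smul w pτ pτ
  have k₂ := isWall_e₃.sign_pτ hw
  have k₃ := isWall_e₄.sign_pτ hw
  have k₄ := isWall_e₅.sign_pτ hw
  have k₅ := isWall_e₃.r₆.sign_pτ hw
  rw [h1] at k₀
  generalize w • pτ = p at k₀ k₁ k₂ k₃ k₄ k₅ ⊢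
  obtain ⟨A, X, Y, C⟩ := p
  simp only [pair, e₁, pτ, pA, e₃, e₄, r₆] at k₀ k₁ k₂ k₃ k₄ k₅
  obtain rfl : X = 0 := by linarith
  have m₁ : A * C - 6 * Y ^ 2 = 3 := by linarith
  have m₂ : 1 ≤ Y := by linarith
  obtain ⟨a, rfl⟩ : ∃ a, A = a + 2 * Y := ⟨A - 2 * Y, by ring⟩
  obtain ⟨c, rfl⟩ : ∃ c, C = c + 2 * Y := ⟨C - 2 * Y, by ring⟩
  have m₃ : 1 ≤ a := by linarith
  have m₄ : 1 ≤ c := by linarith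
  have m₅ : Y + 1 ≤ a + c := by linarith
  have m₆ : a * c ≤ 3 - 2 * Y := by nlinarith
  have m₇ : 1 ≤ a * c := by nlinarith
  obtain rfl : Y = 1 := by linarith
  obtain rfl : a = 1 := by nlinarith
  obtain rfl : c = 1 := by nlinarith
  rfl

lemma typ_e₁ : Typ 1 e₁ := by simp [Typ, e₁]

/-- Subgroups of the vertex group generated by stabilisers of the two base points are free
products. -/
lemma freeProduct_of {K P Q : Type} [Group K] [Group P] [Group Q] (i : K →* G)
    (hi : Function.Injective i) (hK : ∀ x, i x ∈ Γ) (a : P →* K) (b : Q →* K)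
    (ha : Function.Injective a) (hb : Function.Injective b)
    (hgen : Subgroup.closure (Set.range a ∪ Set.range b) = ⊤)
    (hpa : ∀ x, i (a x) • pA = pA) (hpb : ∀ x, i (b x) • pτ = pτ) (n : ℕ) :
    Function.Bijective (AddMonoidHom.coprod (hmap a (n + 1)) (hmap b (n + 1))) := by
  refine freeProduct_bijective a b ha hb hgen
    (fun w => if 0 < pair e₁ (i w • pA) then 1 else 0)
    (fun w => if 0 < pair e₁ (i w • pτ) then 1 else 0) (fun w x => ?_) (fun w x => ?_) ?_ ?_ n
  · rw [map_mul, mul_smul, hpa]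
  · rw [map_mul, mul_smul, hpb]
  · rw [map_one, one_smul, one_smul]; decide
  · intro w hw
    refine if_congr ?_ rfl rfl
    rw [pair_smul_right, pair_smul_right]
    by_cases hs : pair ((i w)⁻¹ • e₁) pA * pair ((i w)⁻¹ • e₁) pτ ≤ 0
    · rcases eq_e₁ (typ_e₁.smul (by norm_num) _) ((pair_smul _ _ _).trans (by decide)) hs with h | h
      · refine absurd (hi ?_) hw
        rw [map_one, ← inv_eq_one]
        exact eq_one_of_mem_Γ (inv_mem (hK w)) h
      · rw [h]; decide
    · rcases pos_and_pos_or_neg_and_neg_of_mul_pos (not_le.1 hs) with ⟨h, h'⟩ | ⟨h, h'⟩ <;>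
        constructor <;> intros <;> linarith

/-- The inclusion of the tetrahedral group. -/
def aΓ : A4 →* Γ := iA.codRestrict Γ iA_mem_Γ

lemma aΓ_injective : Function.Injective aΓ := fun _ _ h => iA_injective (congrArg Subtype.val h)

lemma τ_pow {K : Subgroup G} (h : τ ∈ K) : (⟨τ, h⟩ : K) ^ 2 = 1 := by
  rw [pow_two]; exact Subtype.ext τ_mul_τ

/-- The group of order two generated by `τ`. -/
def cτ {K : Subgroup G} (h : τ ∈ K) : Cyc 2 →* K := cycHom 2 ⟨τ, h⟩ (τ_pow h)

lemma cτ_gen {K : Subgroup G} (h : τ ∈ K) : cτ h (gen 2) = ⟨τ, h⟩ := cycHom_gen _ _ _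

lemma cτ_injective {K : Subgroup G} (h : τ ∈ K) : Function.Injective (cτ h) :=
  cycHom_injective 2 _ _ fun k hk h => by
    interval_cases k
    · rfl
    · rw [pow_one] at h; exact absurd (congrArg Subtype.val h) τ_ne_one

lemma cτ_smul_pτ {K : Subgroup G} (h : τ ∈ K) (x : Cyc 2) : (cτ h x : G) • pτ = pτ := by
  rw [← gen_pow_val 2 x, map_pow, cτ_gen, Subgroup.coe_pow]
  generalize x.toAdd.val = k
  induction k with
  | zero => rw [pow_zero, one_smul]
  | succ n ih => rw [pow_succ, mul_smul, τ_smul_pτ, ih]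

lemma closure_Γ : Subgroup.closure (Set.range aΓ ∪ Set.range (cτ τ_mem_Γ)) = ⊤ := by
  refine closure_eq_top_of ?_
  rintro x (⟨y, rfl⟩ | rfl)
  · exact Subgroup.subset_closure (Or.inl ⟨y, rfl⟩)
  · exact Subgroup.subset_closure (Or.inr ⟨gen 2, cτ_gen _⟩)

/-- The homology of the vertex group. -/
theorem Γ_homology (n : ℕ) : Function.Bijective
    (AddMonoidHom.coprod (hmap aΓ (n + 1)) (hmap (cτ τ_mem_Γ) (n + 1))) :=
  freeProduct_of Γ.subtype Γ.subtype_injective (fun x => x.2) aΓ (cτ τ_mem_Γ) aΓ_injective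
    (cτ_injective _) closure_Γ (fun x => iA_smul_pA x) (cτ_smul_pτ _) n

/-- The group generated by `τ` and an element of the tetrahedral group. -/
def Es (y : A4) : Subgroup G := Subgroup.closure {iA y, τ}

lemma τ_mem_Es (y : A4) : τ ∈ Es y := Subgroup.subset_closure (Or.inr rfl)
lemma iA_mem_Es (y : A4) : iA y ∈ Es y := Subgroup.subset_closure (Or.inl rfl)

lemma Es_le (y : A4) : Es y ≤ Γ := by
  rw [Es, Subgroup.closure_le]
  rintro x (rfl | rfl)
  · exact iA_mem_Γ y
  · exact τ_mem_Γ

lemma F_le : F ≤ Γ := by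
  rw [F, Subgroup.closure_le]
  rintro x (rfl | rfl)
  · exact σ_mem_Γ
  · exact t_mem_Γ

/-- The cyclic subgroup generated by an element of order three. -/
def c3 {y : A4} (hy : y ^ 3 = 1) : Cyc 3 →* Es y := cycHom 3 ⟨iA y, iA_mem_Es y⟩ (by
  refine Subtype.ext ?_
  rw [Subgroup.coe_pow, ← map_pow, hy, map_one]; rfl)

lemma c3_gen {y : A4} (hy : y ^ 3 = 1) : c3 hy (gen 3) = ⟨iA y, iA_mem_Es y⟩ := cycHom_gen _ _ _

lemma c3_coe {y : A4} (hy : y ^ 3 = 1) (x : Cyc 3) : (c3 hy x : G) = iA (cycHom 3 y hy x) := by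
  rw [← gen_pow_val 3 x, map_pow, c3_gen, map_pow, cycHom_gen, map_pow]; rfl

lemma c3_injective {y : A4} (hy : y ^ 3 = 1) (h : ∀ k < 3, y ^ k = 1 → k = 0) :
    Function.Injective (c3 hy) := fun x x' hx => by
  refine cycHom_injective 3 y hy h (iA_injective ?_)
  rw [← c3_coe, ← c3_coe, hx]

lemma closure_Es {y : A4} (hy : y ^ 3 = 1) :
    Subgroup.closure (Set.range (c3 hy) ∪ Set.range (cτ (τ_mem_Es y))) = ⊤ := by
  refine closure_eq_top_of ?_
  rintro x (rfl | rfl)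
  · exact Subgroup.subset_closure (Or.inl ⟨gen 3, c3_gen _⟩)
  · exact Subgroup.subset_closure (Or.inr ⟨gen 2, cτ_gen _⟩)

/-- The homology of the second and third edge groups. -/
theorem Es_homology {y : A4} (hy : y ^ 3 = 1) (h : ∀ k < 3, y ^ k = 1 → k = 0) (n : ℕ) :
    Function.Bijective
      (AddMonoidHom.coprod (hmap (c3 hy) (n + 1)) (hmap (cτ (τ_mem_Es y)) (n + 1))) :=
  freeProduct_of (Es y).subtype (Es y).subtype_injective (fun x => Es_le y x.2) (c3 hy)
    (cτ (τ_mem_Es y)) (c3_injective hy h) (cτ_injective _) (closure_Es hy)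
    (fun x => by rw [Subgroup.subtype_apply, c3_coe, iA_smul_pA]) (cτ_smul_pτ _) n

lemma mem_Es_ρ {w : G} (hw : w • e₃ = e₃) : w ∈ Es A4.ρ := by
  have h : E ≤ Es A4.ρ := by
    rw [E, Subgroup.closure_le]
    rintro x (rfl | rfl)
    · exact τ_mem_Es _
    · rw [t_eq, ← iA_ρ]; exact mul_mem (iA_mem_Es _) (τ_mem_Es _)
  exact h (mem_E hw)

lemma iA_σρ : iA (A4.σ * A4.ρ) = κ₆ ρ := by rw [map_mul, iA_σ, iA_ρ, κ₆_ρ]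

lemma κ₆_mem {w : G} (hw : w ∈ Es A4.ρ) : κ₆ w ∈ Es (A4.σ * A4.ρ) := by
  have h : Es A4.ρ ≤ (Es (A4.σ * A4.ρ)).comap κ₆ := by
    rw [Es, Subgroup.closure_le]
    rintro x (rfl | rfl)
    · rw [iA_ρ, SetLike.mem_coe, Subgroup.mem_comap, ← iA_σρ]; exact iA_mem_Es _
    · rw [SetLike.mem_coe, Subgroup.mem_comap, κ₆_τ]; exact τ_mem_Es _
  exact h hw

lemma mem_Es_σρ {w : G} (hw : w • r₆ e₃ = r₆ e₃) : w ∈ Es (A4.σ * A4.ρ) := by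
  rw [← κ₆_κ₆ w]
  refine κ₆_mem (mem_Es_ρ ?_)
  have := κ₆_smul w (r₆ e₃)
  rwa [hw, r₆_r₆] at this

end Bianchi

/-! ### Generators -/

namespace Bianchi

open Matrix GMod

/-- The subgroup generated by the distinguished elements. -/
def Hs : Subgroup G := Subgroup.closure {τ, t, σ, u, v}

lemma τ_mem_Hs : τ ∈ Hs := Subgroup.subset_closure (by simp)
lemma t_mem_Hs : t ∈ Hs := Subgroup.subset_closure (by simp)
lemma σ_mem_Hs : σ ∈ Hs := Subgroup.subset_closure (by simp)
lemma u_mem_Hs : u ∈ Hs := Subgroup.subset_closure (by simp)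
lemma v_mem_Hs : v ∈ Hs := Subgroup.subset_closure (by simp)

lemma map_mem_Hs (κ : G →* G) (h₁ : κ τ ∈ Hs) (h₂ : κ t ∈ Hs) (h₃ : κ σ ∈ Hs) (h₄ : κ u ∈ Hs)
    (h₅ : κ v ∈ Hs) {w : G} (hw : w ∈ Hs) : κ w ∈ Hs := by
  have h : Hs ≤ Hs.comap κ := by
    conv_lhs => rw [Hs]
    rw [Subgroup.closure_le]
    rintro x (rfl | rfl | rfl | rfl | rfl) <;> assumption
  exact h hw

lemma κ₂_mem_Hs {w : G} (hw : w ∈ Hs) : κ₂ w ∈ Hs := by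
  refine map_mem_Hs κ₂ ?_ ?_ ?_ ?_ ?_ hw
  · rw [← mul_mem_cancel_right t_mem_Hs, κ₂_τ]; exact mul_mem t_mem_Hs τ_mem_Hs
  · rw [κ₂_t]; exact inv_mem t_mem_Hs
  · rw [κ₂_σ]; exact σ_mem_Hs
  · rw [κ₂_u]; exact u_mem_Hs
  · rw [κ₂_v]; exact mul_mem (mul_mem σ_mem_Hs v_mem_Hs) σ_mem_Hs

lemma κ₄_mem_Hs {w : G} (hw : w ∈ Hs) : κ₄ w ∈ Hs := by
  refine map_mem_Hs κ₄ ?_ ?_ ?_ ?_ ?_ hw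
  · rw [← mul_mem_cancel_right u_mem_Hs, κ₄_τ_mul_u]; exact mul_mem u_mem_Hs τ_mem_Hs
  · rw [κ₄_t]; exact t_mem_Hs
  · rw [κ₄_σ]; exact σ_mem_Hs
  · rw [← mul_mem_cancel_right u_mem_Hs, κ₄_u]; exact one_mem _
  · rw [← mul_mem_cancel_right v_mem_Hs, κ₄_v]; exact one_mem _

lemma κ₆_mem_Hs {w : G} (hw : w ∈ Hs) : κ₆ w ∈ Hs := by
  refine map_mem_Hs κ₆ ?_ ?_ ?_ ?_ ?_ hw
  · rw [κ₆_τ]; exact τ_mem_Hs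
  · rw [κ₆_t]; exact mul_mem σ_mem_Hs t_mem_Hs
  · rw [κ₆_σ]; exact σ_mem_Hs
  · rw [κ₆_u]; exact v_mem_Hs
  · rw [κ₆_v]; exact u_mem_Hs

/-- The translations. -/
def tr (a b : ℤ) : G := mk (sl 1 0 a b 0 0 1 0 (by ring) (by ring))

lemma tr_add (a b a' b' : ℤ) : tr (a + a') (b + b') = tr a b * tr a' b' := by
  rw [tr, tr, tr, ← map_mul, mul_eq]
  refine congrArg mk (sl_congr ?_ ?_ ?_ ?_ ?_ ?_ ?_ ?_) <;> ring

/-- The translations by multiples of `√-6`. -/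
def trHom : Multiplicative ℤ →* G where
  toFun b := tr 0 b.toAdd
  map_one' := by rw [← map_one mk, one_eq]; rfl
  map_mul' b b' := (tr_add 0 b.toAdd 0 b'.toAdd)

lemma tr_mem_Hs (a b : ℤ) : tr a b ∈ Hs := by
  have h₁ : tr a 0 = t ^ a := (t_zpow a).symm
  have h₂ : tr 0 b = u ^ b := by
    have h := map_zpow trHom (Multiplicative.ofAdd 1) b
    rw [← ofAdd_zsmul, smul_eq_mul, mul_one] at h
    exact h
  have h := tr_add a 0 0 b
  rw [add_zero, zero_add, h₁, h₂] at h
  rw [h]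
  exact mul_mem (zpow_mem t_mem_Hs a) (zpow_mem u_mem_Hs b)

lemma tr_smul (a b : ℤ) (x : Vec) : tr a b • x = ⟨x.A, x.X + a * x.A, x.Y + b * x.A,
    x.C + (a ^ 2 + 6 * b ^ 2) * x.A + 2 * a * x.X + 12 * b * x.Y⟩ := by
  rw [tr, mk_sl_smul]
  apply Vec.ext <;> simp only [act] <;> ring

/-- The isotropic vectors in the orbits of the two cusps. -/
def Cusp (x : Vec) : Prop := ∃ n : ℤ, 1 ≤ n ∧ ∃ h ∈ Hs,
  x = h • (⟨0, 0, 0, n⟩ : Vec) ∨ x = h • (⟨2 * n, 0, n, 3 * n⟩ : Vec)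

lemma Cusp.smul {x : Vec} (hx : Cusp x) {w : G} (hw : w ∈ Hs) : Cusp (w • x) := by
  obtain ⟨n, hn, h, hh, rfl | rfl⟩ := hx
  · exact ⟨n, hn, w * h, mul_mem hw hh, Or.inl (mul_smul _ _ _).symm⟩
  · exact ⟨n, hn, w * h, mul_mem hw hh, Or.inr (mul_smul _ _ _).symm⟩

lemma Cusp.of_smul {x : Vec} {w : G} (hx : Cusp (w • x)) (hw : w ∈ Hs) : Cusp x := by
  rw [← inv_smul_smul w x]; exact hx.smul (inv_mem hw)

lemma σ_smul_cusp (n : ℤ) : σ • (⟨2 * n, 0, n, 3 * n⟩ : Vec) = r₂ ⟨2 * n, 0, n, 3 * n⟩ := by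
  rw [σ, mk_sl_smul]; apply Vec.ext <;> simp only [act, r₂] <;> ring

lemma v_smul_cusp (n : ℤ) : v • (⟨2 * n, 0, n, 3 * n⟩ : Vec) = r₄ ⟨2 * n, 0, n, 3 * n⟩ := by
  rw [v, mk_sl_smul]; apply Vec.ext <;> simp only [act, r₄] <;> ring

lemma Cusp.r₂ {x : Vec} (hx : Cusp x) : Cusp (r₂ x) := by
  obtain ⟨n, hn, h, hh, rfl | rfl⟩ := hx
  · refine ⟨n, hn, κ₂ h, κ₂_mem_Hs hh, Or.inl ?_⟩
    rw [← κ₂_smul]; congr 1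
    apply Vec.ext <;> simp only [Bianchi.r₂] <;> ring
  · refine ⟨n, hn, κ₂ h * σ, mul_mem (κ₂_mem_Hs hh) σ_mem_Hs, Or.inr ?_⟩
    rw [← κ₂_smul, mul_smul, σ_smul_cusp]

lemma Cusp.r₄ {x : Vec} (hx : Cusp x) : Cusp (r₄ x) := by
  obtain ⟨n, hn, h, hh, rfl | rfl⟩ := hx
  · refine ⟨n, hn, κ₄ h, κ₄_mem_Hs hh, Or.inl ?_⟩
    rw [← κ₄_smul]; congr 1
    apply Vec.ext <;> simp only [Bianchi.r₄] <;> ring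
  · refine ⟨n, hn, κ₄ h * v, mul_mem (κ₄_mem_Hs hh) v_mem_Hs, Or.inr ?_⟩
    rw [← κ₄_smul, mul_smul, v_smul_cusp]

lemma Cusp.r₆ {x : Vec} (hx : Cusp x) : Cusp (r₆ x) := by
  obtain ⟨n, hn, h, hh, rfl | rfl⟩ := hx
  · refine ⟨n, hn, κ₆ h, κ₆_mem_Hs hh, Or.inr ?_⟩
    rw [← κ₆_smul]; congr 1
    apply Vec.ext <;> simp only [Bianchi.r₆] <;> ring
  · refine ⟨n, hn, κ₆ h, κ₆_mem_Hs hh, Or.inl ?_⟩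
    rw [← κ₆_smul]; congr 1
    apply Vec.ext <;> simp only [Bianchi.r₆] <;> ring

lemma τ_smul (x : Vec) : τ • x = ⟨x.C, -x.X, x.Y, x.A⟩ := by
  rw [τ, mk_sl_smul]; apply Vec.ext <;> simp only [act] <;> ring

lemma t_smul_neg (A X Y C : ℤ) : t • (⟨A, -X, Y, C⟩ : Vec) = Bianchi.r₂ ⟨A, X, Y, C⟩ := by
  rw [t, mk_sl_smul]; apply Vec.ext <;> simp only [act, r₂] <;> ring

lemma Cusp.swap {A X Y C : ℤ} (hx : Cusp ⟨A, X, Y, C⟩) : Cusp ⟨C, X, Y, A⟩ := by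
  have h : Cusp ⟨A, -X, Y, C⟩ := Cusp.of_smul (by rw [t_smul_neg]; exact hx.r₂) t_mem_Hs
  have := h.smul τ_mem_Hs
  rwa [τ_smul, neg_neg] at this

lemma exists_reduced (X A : ℤ) (hA : 0 < A) :
    ∃ k m : ℤ, 0 ≤ 2 * m ∧ 2 * m ≤ A ∧ (X + k * A = m ∨ X + k * A = A - m) := by
  have h0 := Int.emod_nonneg X hA.ne'
  have h1 := Int.emod_lt_of_pos X hA
  have h := Int.emod_add_mul_ediv X A
  by_cases h2 : 2 * (X % A) ≤ A
  · exact ⟨-(X / A), X % A, by omega, h2, Or.inl (by linarith)⟩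
  · exact ⟨-(X / A), A - X % A, by omega, by omega, Or.inr (by linarith)⟩

lemma not_reduced {A X Y C : ℤ} (hA : 0 < A) (hX : 0 ≤ 2 * X) (hX' : 2 * X ≤ A) (hY : 0 ≤ 2 * Y)
    (hY' : 2 * Y ≤ A) (h : A * C = X ^ 2 + 6 * Y ^ 2) (h1 : A ≤ C) (h2 : 6 * Y ≤ A + C) : False := by
  have k1 : 4 * X ^ 2 ≤ A ^ 2 := by nlinarith
  rcases le_total (3 * Y) A with k2 | k2
  · have k3 : 9 * Y ^ 2 ≤ A ^ 2 := by nlinarith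
    nlinarith
  · have k3 : A * (6 * Y - A) ≤ A * C := mul_le_mul_of_nonneg_left (by linarith) hA.le
    nlinarith [mul_nonneg (sub_nonneg.2 k2) (sub_nonneg.2 hY')]

lemma cusp_of_isotropic (N : ℕ) : ∀ A X Y C : ℤ, A ≤ N → 0 ≤ A → 0 ≤ C → 0 < A + C →
    A * C = X ^ 2 + 6 * Y ^ 2 → Cusp ⟨A, X, Y, C⟩ := by
  induction N using Nat.strong_induction_on with
  | _ N ih =>
    intro A X Y C hN hA hC hAC h
    rcases hA.eq_or_lt with rfl | hA
    · obtain rfl : X = 0 := by nlinarith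
      obtain rfl : Y = 0 := by nlinarith
      exact ⟨C, by linarith, 1, one_mem _, Or.inl (one_smul _ _).symm⟩
    have ih' : ∀ A' X Y C : ℤ, A' < A → 0 ≤ A' → 0 ≤ C → 0 < A' + C →
        A' * C = X ^ 2 + 6 * Y ^ 2 → Cusp ⟨A', X, Y, C⟩ := fun A' X Y C h₁ h₂ =>
      ih A'.toNat (by omega) A' X Y C (by omega) h₂
    have key : ∀ X Y C : ℤ, 0 ≤ 2 * X → 2 * X ≤ A → 0 ≤ 2 * Y → 2 * Y ≤ A →
        A * C = X ^ 2 + 6 * Y ^ 2 → Cusp ⟨A, X, Y, C⟩ := by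
      intro X Y C hX hX' hY hY' h
      have hC : 0 ≤ C := by
        by_contra! h'
        nlinarith [sq_nonneg X, sq_nonneg Y]
      by_cases h1 : C < A
      · exact (ih' C X Y A h1 hC hA.le (by linarith) (by linarith)).swap
      by_cases h2 : A + C < 6 * Y
      · rw [← r₆_r₆ ⟨A, X, Y, C⟩]
        have k1 : A * (A + 2 * (A + C - 6 * Y)) = 3 * (A - 2 * Y) ^ 2 + 2 * X ^ 2 := by
          linear_combination 2 * h
        have k2 : A * (C + 2 * (A + C - 6 * Y)) = 3 * X ^ 2 + 2 * (A - 3 * Y) ^ 2 := by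
          linear_combination 3 * h
        have k3 : 0 ≤ A + 2 * (A + C - 6 * Y) := by
          refine nonneg_of_mul_nonneg_right (a := A) ?_ hA; rw [k1]; positivity
        have k4 : 0 ≤ C + 2 * (A + C - 6 * Y) := by
          refine nonneg_of_mul_nonneg_right (a := A) ?_ hA; rw [k2]; positivity
        refine (ih' _ _ _ _ (by linarith) k3 k4 ?_ (by linear_combination h)).r₆
        by_contra! h3
        have k5 : A + 2 * (A + C - 6 * Y) = 0 := by linarith
        have k6 : C + 2 * (A + C - 6 * Y) = 0 := by linarith
        rw [k5] at k1
        rw [k6] at k2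
        have k7 : A - 2 * Y = 0 := by nlinarith
        have k8 : A - 3 * Y = 0 := by nlinarith
        linarith
      · exact (not_reduced hA hX hX' hY hY' h (by linarith) (by linarith)).elim
    obtain ⟨k, m, hm, hm', hk⟩ := exists_reduced X A hA
    obtain ⟨l, m', hl, hl', hk'⟩ := exists_reduced Y A hA
    refine Cusp.of_smul ?_ (tr_mem_Hs k l)
    rw [tr_smul]
    simp only
    obtain ⟨C', hC'⟩ : ∃ C', C' = C + (k ^ 2 + 6 * l ^ 2) * A + 2 * k * X + 12 * l * Y := ⟨_, rfl⟩
    rw [← hC']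
    have h' : A * C' = (X + k * A) ^ 2 + 6 * (Y + l * A) ^ 2 := by
      rw [hC']; linear_combination h
    generalize X + k * A = X' at *
    generalize Y + l * A = Y' at *
    have keyX : ∀ Y C : ℤ, 0 ≤ 2 * Y → 2 * Y ≤ A → A * C = X' ^ 2 + 6 * Y ^ 2 →
        Cusp ⟨A, X', Y, C⟩ := by
      intro Y C hY hY' h
      rcases hk with rfl | rfl
      · exact key _ _ _ hm hm' hY hY' h
      · rw [← r₂_r₂ ⟨A, A - m, Y, C⟩]
        exact (key _ _ _ (by simp only; linarith) (by simp only; linarith) hY hY'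
          (by linear_combination h)).r₂
    rcases hk' with rfl | rfl
    · exact keyX _ _ hl hl' h'
    · rw [← r₄_r₄ ⟨A, X', A - m', C'⟩]
      exact (keyX _ _ (by simp only; linarith) (by simp only; linarith)
        (by linear_combination h')).r₄

lemma mem_Hs_of_smul {w : G} {n : ℤ} (h : w • (⟨0, 0, 0, 1⟩ : Vec) = ⟨0, 0, 0, n⟩) : w ∈ Hs := by
  obtain ⟨p₁, p₂, q₁, q₂, a₁, a₂, s₁, s₂, h₁, h₂, rfl⟩ := exists_mk_sl w
  have e := (vec_ext_iff _ _).1 h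
  simp only [mk_sl_smul, act] at e
  obtain ⟨eA, -, -, -⟩ := e
  obtain rfl : a₁ = 0 := by nlinarith
  obtain rfl : a₂ = 0 := by nlinarith
  have k : (p₁ ^ 2 + 6 * p₂ ^ 2) * (s₁ ^ 2 + 6 * s₂ ^ 2) = 1 := by
    linear_combination (p₁ * s₁ - 6 * (p₂ * s₂) + 1) * h₁ + 6 * (p₁ * s₂ + p₂ * s₁) * h₂
  have kp : p₁ ^ 2 + 6 * p₂ ^ 2 = 1 :=
    Int.eq_one_of_mul_eq_one_right (by positivity) k
  have ks : s₁ ^ 2 + 6 * s₂ ^ 2 = 1 :=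
    Int.eq_one_of_mul_eq_one_left (by positivity) k
  obtain rfl : p₂ = 0 := by nlinarith
  obtain rfl : s₂ = 0 := by nlinarith
  have h3 : p₁ * s₁ = 1 := by linarith
  rcases Int.eq_one_or_neg_one_of_mul_eq_one h3 with rfl | rfl
  · obtain rfl : s₁ = 1 := by linarith
    exact tr_mem_Hs q₁ q₂
  · obtain rfl : s₁ = -1 := by linarith
    have := tr_mem_Hs (-q₁) (-q₂)
    convert this using 1
    rw [tr, mk_eq_mk, neg_eq]
    right
    apply sl_congr <;> ring

lemma smul_ne_cusp (w : G) {n : ℤ} (hn : 1 ≤ n) :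
    w • (⟨0, 0, 0, 1⟩ : Vec) ≠ ⟨2 * n, 0, n, 3 * n⟩ := by
  intro h
  have h' : w⁻¹ • (⟨2 * n, 0, n, 3 * n⟩ : Vec) = ⟨0, 0, 0, 1⟩ := by rw [← h, inv_smul_smul]
  generalize w⁻¹ = w' at h'
  obtain ⟨p₁, p₂, q₁, q₂, a₁, a₂, s₁, s₂, h₁, h₂, rfl⟩ := exists_mk_sl w'
  have e := (vec_ext_iff _ _).1 h'
  simp only [mk_sl_smul, act] at e
  obtain ⟨-, -, -, eC⟩ := e
  have hd : n ∣ 1 := ⟨(p₁ ^ 2 + 6 * p₂ ^ 2) * 3 + (q₁ ^ 2 + 6 * q₂ ^ 2) * 2 +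
    12 * (p₁ * q₂ - p₂ * q₁), by linear_combination -eC⟩
  obtain rfl : n = 1 := Int.eq_one_of_dvd_one (by linarith) hd
  obtain ⟨p₁, p₂, q₁, q₂, a₁, a₂, s₁, s₂, h₁, h₂, rfl⟩ := exists_mk_sl w
  have e := (vec_ext_iff _ _).1 h
  simp only [mk_sl_smul, act] at e
  obtain ⟨-, -, -, eC⟩ := e
  obtain rfl : p₂ = 0 := by nlinarith
  have : p₁ ^ 2 = 3 := by linarith
  have h1 : p₁ < 2 := by nlinarith
  have h2 : -2 < p₁ := by nlinarith
  interval_cases p₁ <;> omega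

lemma Hs_eq_top : Hs = ⊤ := by
  rw [eq_top_iff]
  rintro w -
  have hc : Cusp (w • ⟨0, 0, 0, 1⟩) := by
    have h0 := pair_smul w ⟨0, 0, 0, 1⟩ ⟨0, 0, 0, 1⟩
    obtain ⟨p₁, p₂, q₁, q₂, a₁, a₂, s₁, s₂, h₁, h₂, rfl⟩ := exists_mk_sl w
    rw [mk_sl_smul] at h0 ⊢
    simp only [act, mul_zero, mul_one, add_zero] at h0 ⊢
    refine cusp_of_isotropic (a₁ ^ 2 + 6 * a₂ ^ 2).toNat _ _ _ _ (by omega) (by positivity)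
      (by positivity) ?_ ?_
    · by_contra! h
      obtain rfl : p₁ = 0 := by nlinarith
      obtain rfl : p₂ = 0 := by nlinarith
      obtain rfl : a₁ = 0 := by nlinarith
      obtain rfl : a₂ = 0 := by nlinarith
      omega
    · simp only [pair] at h0; linarith
  obtain ⟨n, hn, h, hh, e | e⟩ := hc
  · rw [← mul_mem_cancel_left (inv_mem hh)]
    refine mem_Hs_of_smul (n := n) ?_
    rw [mul_smul, e, inv_smul_smul]
  · refine absurd ?_ (smul_ne_cusp (h⁻¹ * w) hn)
    rw [mul_smul, e, inv_smul_smul]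

end Bianchi

/-! ### The action on the tree -/

namespace Bianchi

open Matrix GMod

lemma sign_iff {a b : ℤ} (h : 0 < a * b) : 0 < a ↔ 0 < b := by
  rcases pos_and_pos_or_neg_and_neg_of_mul_pos h with ⟨h, h'⟩ | ⟨h, h'⟩ <;>
    constructor <;> intros <;> linarith

/-- The point `q` is separated from the base point by the single wall `e`. -/
def Adjacent (q e : Vec) : Prop :=
  ∀ ⦃n : Vec⦄, IsWall n → pair n pA * pair n q ≤ 0 → n = e ∨ n = -e

lemma adjacent_e₃ : Adjacent (r₃ pA) e₃ := fun _ hn hs => hn.eq_e₃ hs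
lemma adjacent_e₄ : Adjacent (r₄ pA) e₄ := fun _ hn hs => hn.eq_e₄ hs

lemma vec_neg_neg (h : Vec) : - -h = h := by
  apply Vec.ext <;> simp only [neg_def] <;> ring

lemma r₆_neg (h : Vec) : r₆ (-h) = -r₆ h := by
  apply Vec.ext <;> simp only [r₆, neg_def] <;> ring

lemma r₆_pA : r₆ pA = pA := by decide

lemma adjacent_r₆ : Adjacent (r₆ (r₃ pA)) (r₆ e₃) := fun n hn hs => by
  rw [← r₆_r₆ n, ← r₆_neg]
  rw [← r₆_r₆ n, pair_r₆] at hs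
  nth_rw 1 [← r₆_pA] at hs
  rw [pair_r₆] at hs
  rcases hn.r₆.eq_e₃ hs with h | h
  · exact Or.inl (congrArg r₆ h)
  · exact Or.inr (congrArg r₆ h)

lemma Adjacent.iff {q e n : Vec} (hq : Adjacent q e) (hn : IsWall n) {w : G}
    (h1 : w⁻¹ • n ≠ e) (h2 : w⁻¹ • n ≠ -e) : 0 < pair n (w • pA) ↔ 0 < pair n (w • q) := by
  rw [pair_smul_right, pair_smul_right]
  refine sign_iff (not_le.1 fun hs => ?_)
  exact (hq (hn.smul _) hs).elim h1 h2

/-- The side of the wall on which the first vertex lies. -/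
def side (n : Vec) (w : G) : ℤ := if 0 < pair n (w • pA) then 1 else 0

/-- The side of the wall on which the second vertex lies. -/
def side' (n : Vec) (w : G) : ℤ := if 0 < pair n (w • r₄ pA) then 1 else 0

lemma side_mul {n : Vec} (hn : IsWall n) (w : G) (x : Γ) :
    side n (w * Γ.subtype x) = side n w := by
  refine if_congr ?_ rfl rfl
  rw [mul_smul, pair_smul_right w, pair_smul_right w]
  exact (sign_iff ((hn.smul w⁻¹).sign x.2)).symm

lemma side'_mul {n : Vec} (hn : IsWall n) (w : G) (x : Γ) :
    side' n (w * κ₄.comp Γ.subtype x) = side' n w := by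
  refine if_congr ?_ rfl rfl
  have h : κ₄.comp Γ.subtype x • r₄ pA = r₄ ((x : G) • pA) := κ₄_smul _ _
  rw [mul_smul, pair_smul_right w, pair_smul_right w, h, ← r₄_r₄ (w⁻¹ • n), pair_r₄, pair_r₄]
  exact (sign_iff ((hn.smul w⁻¹).r₄.sign x.2)).symm

lemma u_inv_smul : u⁻¹ • r₄ pA = r₃ pA := by decide +kernel
lemma v_inv_smul : v⁻¹ • r₄ pA = r₆ (r₃ pA) := by decide +kernel

lemma side_eq {n : Vec} (hn : IsWall n) {w : G} (h1 : w⁻¹ • n ≠ e₄) (h2 : w⁻¹ • n ≠ -e₄) :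
    side n w = side' n w := if_congr (adjacent_e₄.iff hn h1 h2) rfl rfl

lemma side_eq_u {n : Vec} (hn : IsWall n) {w : G} (h1 : w⁻¹ • n ≠ e₃) (h2 : w⁻¹ • n ≠ -e₃) :
    side n w = side' n (w * u⁻¹) := by
  rw [side, side', mul_smul, u_inv_smul]
  exact if_congr (adjacent_e₃.iff hn h1 h2) rfl rfl

lemma side_eq_v {n : Vec} (hn : IsWall n) {w : G} (h1 : w⁻¹ • n ≠ r₆ e₃)
    (h2 : w⁻¹ • n ≠ -r₆ e₃) : side n w = side' n (w * v⁻¹) := by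
  rw [side, side', mul_smul, v_inv_smul]
  exact if_congr (adjacent_r₆.iff hn h1 h2) rfl rfl

lemma typ_e₃ : Typ 6 e₃ := by simp [Typ, e₃]
lemma typ_r₆ : Typ 6 (r₆ e₃) := typ_e₃.r₆
lemma Typ.neg {n : Vec} (hn : Typ 6 n) : Typ 6 (-n) := by
  rw [neg_def]; simpa [Typ] using hn
lemma not_typ_e₄ : ¬ Typ 6 e₄ := by simp [Typ, e₄]
lemma not_typ_neg_e₄ : ¬ Typ 6 (-e₄) := fun h => not_typ_e₄ (by simpa only [vec_neg_neg] using h.neg)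

lemma smul_e₄_ne {n : Vec} (hn : Typ 6 n) (w : G) : w • e₄ ≠ n := fun h => by
  refine not_typ_e₄ ?_
  rw [← inv_smul_smul w e₄, h]; exact hn.smul (by norm_num) _

lemma smul_ne_e₄ {n : Vec} (hn : Typ 6 n) (w : G) : w • n ≠ e₄ ∧ w • n ≠ -e₄ :=
  ⟨fun h => not_typ_e₄ (h ▸ hn.smul (by norm_num) w),
    fun h => not_typ_neg_e₄ (h ▸ hn.smul (by norm_num) w)⟩

lemma smul_neg (w : G) (h : Vec) : w • (-h) = -(w • h) := by
  obtain ⟨p₁, p₂, q₁, q₂, a₁, a₂, s₁, s₂, h₁, h₂, rfl⟩ := exists_mk_sl w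
  rw [mk_sl_smul, mk_sl_smul]
  apply Vec.ext <;> simp only [act, neg_def] <;> ring

lemma smul_r₆_ne (w : G) : w • r₆ e₃ ≠ e₃ ∧ w • r₆ e₃ ≠ -e₃ := by
  refine ⟨fun h => (smul_e₃_ne w⁻¹).1 (smul_eq_iff_eq_inv_smul _ |>.1 h).symm,
    fun h => (smul_e₃_ne w⁻¹).2 ?_⟩
  rw [smul_eq_iff_eq_inv_smul, smul_neg] at h
  rw [h, vec_neg_neg]

lemma smul_r₆_ne_neg (w : G) : w • r₆ e₃ ≠ -r₆ e₃ := fun h => by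
  have := κ₆_smul w (r₆ e₃)
  rw [h, r₆_neg, r₆_r₆] at this
  exact smul_e₃_ne_neg _ this

lemma conj_of_mem {k : Set G} {g : G} (h : ∀ x ∈ k, κ₄ x * g = g * x) {x : G}
    (hx : x ∈ Subgroup.closure k) : κ₄ x * g = g * x := by
  induction hx using Subgroup.closure_induction with
  | mem x hx => exact h x hx
  | one => rw [map_one, one_mul, mul_one]
  | mul x y _ _ hx hy => rw [map_mul, mul_assoc, hy, ← mul_assoc, hx, mul_assoc]
  | inv x _ hx => rw [map_inv, inv_mul_eq_iff_eq_mul, ← mul_assoc, hx, mul_inv_cancel_right]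

lemma κ₄_mul_u {x : G} (hx : x ∈ Es A4.ρ) : κ₄ x * u = u * x := by
  refine conj_of_mem ?_ hx
  rintro x (rfl | rfl)
  · rw [iA_ρ, ← t_mul_τ, map_mul, mul_assoc, κ₄_τ_mul_u, ← mul_assoc, κ₄_t_mul_u, mul_assoc]
  · exact κ₄_τ_mul_u

lemma κ₄_mul_v {x : G} (hx : x ∈ Es (A4.σ * A4.ρ)) : κ₄ x * v = v * x := by
  refine conj_of_mem ?_ hx
  rintro x (rfl | rfl)
  · rw [iA_σρ, ← t_mul_τ, map_mul, κ₆_τ, map_mul, mul_assoc, κ₄_τ_mul_v, ← mul_assoc,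
      κ₄_κ₆_t_mul_v, mul_assoc]
  · exact κ₄_τ_mul_v

/-- The tree on which the group acts. -/
def tree : TreeAction G Γ F (Es A4.ρ) (Es (A4.σ * A4.ρ)) where
  j := Γ.subtype
  j' := κ₄.comp Γ.subtype
  φ₁ := Subgroup.inclusion F_le
  φ₂ := Subgroup.inclusion (Es_le _)
  φ₃ := Subgroup.inclusion (Es_le _)
  g₂ := u
  g₃ := v
  j_inj := Γ.subtype_injective
  j'_inj := fun x y h => Γ.subtype_injective (by
    rw [← κ₄_κ₄ (Γ.subtype x), ← κ₄_κ₄ (Γ.subtype y)]; exact congrArg κ₄ h)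
  φ₁_inj := Subgroup.inclusion_injective _
  φ₂_inj := Subgroup.inclusion_injective _
  φ₃_inj := Subgroup.inclusion_injective _
  conj₁ x := κ₄_of_mem_F x.2
  conj₂ x := κ₄_mul_u x.2
  conj₃ x := κ₄_mul_v x.2
  gen := by
    rw [eq_top_iff, ← Hs_eq_top, Hs, Subgroup.closure_le]
    have h : ∀ x ∈ Γ, x ∈ Subgroup.closure
        ((Set.range Γ.subtype ∪ Set.range (κ₄.comp Γ.subtype)) ∪ {u, v}) := fun x hx =>
      Subgroup.subset_closure (Or.inl (Or.inl ⟨⟨x, hx⟩, rfl⟩))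
    rintro x (rfl | rfl | rfl | rfl | rfl)
    · exact h _ τ_mem_Γ
    · exact h _ t_mem_Γ
    · exact h _ σ_mem_Γ
    · exact Subgroup.subset_closure (Or.inr (Or.inl rfl))
    · exact Subgroup.subset_closure (Or.inr (Or.inr rfl))
  sep₁ := by
    refine ⟨side e₄, side' e₄, side_mul isWall_e₄, side'_mul isWall_e₄, by decide +kernel,
      fun w hw => ?_, fun w => ?_, fun w => ?_⟩
    · refine side_eq isWall_e₄ (fun h => ?_) (smul_e₄_ne_neg _)
      exact hw ⟨w, by simpa using mem_F (κ₄_eq (Or.inl h))⟩ rfl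
    · exact side_eq_u isWall_e₄ (smul_e₄_ne typ_e₃ _) (smul_e₄_ne typ_e₃.neg _)
    · exact side_eq_v isWall_e₄ (smul_e₄_ne typ_r₆ _) (smul_e₄_ne typ_r₆.neg _)
  sep₂ := by
    refine ⟨side e₃, side' e₃, side_mul isWall_e₃, side'_mul isWall_e₃, by decide +kernel,
      fun w hw => ?_, fun w => ?_, fun w => ?_⟩
    · refine side_eq_u isWall_e₃ (fun h => ?_) (smul_e₃_ne_neg _)
      exact hw ⟨w, by simpa using mem_Es_ρ h⟩ rfl
    · exact side_eq isWall_e₃ (smul_ne_e₄ typ_e₃ _).1 (smul_ne_e₄ typ_e₃ _).2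
    · exact side_eq_v isWall_e₃ (smul_e₃_ne _).1 (smul_e₃_ne _).2
  sep₃ := by
    refine ⟨side (r₆ e₃), side' (r₆ e₃), side_mul isWall_e₃.r₆, side'_mul isWall_e₃.r₆,
      by decide +kernel, fun w hw => ?_, fun w => ?_, fun w => ?_⟩
    · refine side_eq_v isWall_e₃.r₆ (fun h => ?_) (smul_r₆_ne_neg _)
      exact hw ⟨w, by simpa using mem_Es_σρ h⟩ rfl
    · exact side_eq isWall_e₃.r₆ (smul_ne_e₄ typ_r₆ _).1 (smul_ne_e₄ typ_r₆ _).2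
    · exact side_eq_u isWall_e₃.r₆ (smul_r₆_ne _).1 (smul_r₆_ne _).2

end Bianchi

namespace AbelianExtension

lemma exists_equiv_of_free {A M P : Type} [AddCommGroup A] [AddCommGroup M] [AddCommGroup P]
    [Module.Free ℤ P] (i : A →+ M) (p : M →+ P) (hi : Function.Injective i)
    (hp : Function.Surjective p) (he : Function.Exact i p) :
    ∃ e : M ≃+ P × A, ∀ a, e (i a) = (0, a) := by
  obtain ⟨s, hs⟩ := Module.projective_lifting_property p.toIntLinearMap LinearMap.id hp
  have hs' : ∀ x, p (s x) = x := fun x => LinearMap.congr_fun hs x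
  refine ⟨(AddEquiv.ofBijective (AddMonoidHom.coprod (s : P →+ M) i) ⟨?_, fun m => ?_⟩).symm,
    fun a => ?_⟩
  · rw [injective_iff_map_eq_zero]
    rintro ⟨x, a⟩ h
    change s x + i a = 0 at h
    have hx : x = 0 := by
      have h1 := congrArg p h
      rwa [map_add, hs', he.apply_apply_eq_zero, add_zero, map_zero] at h1
    rw [hx, map_zero, zero_add] at h
    rw [hx, hi (h.trans (map_zero i).symm), Prod.mk_zero_zero]
  · obtain ⟨a, ha⟩ := (he (m - s (p m))).1 (by rw [map_sub, hs', sub_self])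
    refine ⟨(p m, a), ?_⟩
    change s (p m) + i a = m
    rw [ha, add_sub_cancel]
  · rw [AddEquiv.symm_apply_eq]
    change i a = s 0 + i a
    rw [map_zero, zero_add]

/-- The elements killed by `n`. -/
def tors (M : Type) [AddCommGroup M] (n : ℕ) : AddSubgroup M := (nsmulAddMonoidHom n : M →+ M).ker

lemma mem_tors {M : Type} [AddCommGroup M] {n : ℕ} {x : M} : x ∈ tors M n ↔ n • x = 0 := Iff.rfl

lemma exists_equiv_pow_of_module {M : Type} [AddCommGroup M] [Finite M] (p : ℕ) [Fact p.Prime]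
    [Module (ZMod p) M] : ∃ n, Nat.card M = p ^ n ∧ Nonempty (M ≃+ (Fin n → ZMod p)) := by
  have e := (Module.finBasis (ZMod p) M).equivFun
  exact ⟨_, by rw [Nat.card_congr e.toEquiv, Nat.card_fun, Nat.card_zmod, Nat.card_fin],
    ⟨e.toAddEquiv⟩⟩

lemma exists_equiv_pow {M : Type} [AddCommGroup M] [Finite M] (p : ℕ) [Fact p.Prime]
    (h : ∀ x : M, p • x = 0) : ∃ n, Nat.card M = p ^ n ∧ Nonempty (M ≃+ (Fin n → ZMod p)) := by
  let m : Module (ZMod p) M := AddCommGroup.zmodModule h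
  exact exists_equiv_pow_of_module p

/-- A group killed by `6` is the product of its elements killed by `3` and by `2`. -/
noncomputable def torsEquiv {M : Type} [AddCommGroup M] (h : ∀ x : M, 6 • x = 0) :
    M ≃+ tors M 3 × tors M 2 where
  toFun x := (⟨4 • x, by rw [mem_tors, smul_smul, show 3 * 4 = 2 * 6 from rfl, mul_smul, h,
    smul_zero]⟩, ⟨3 • x, by rw [mem_tors, smul_smul]; exact h x⟩)
  invFun y := y.1 + y.2
  left_inv x := by
    change 4 • x + 3 • x = x
    rw [← add_smul, show 4 + 3 = 6 + 1 from rfl, add_smul, h, zero_add, one_smul]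
  right_inv := by
    rintro ⟨⟨y, hy⟩, z, hz⟩
    rw [mem_tors] at hy hz
    refine Prod.ext (Subtype.ext ?_) (Subtype.ext ?_)
    · change 4 • (y + z) = y
      rw [smul_add, show 4 • z = (2 * 2) • z from rfl, mul_smul, hz, smul_zero, add_zero,
        show 4 • y = (3 + 1) • y from rfl, add_smul, hy, zero_add, one_smul]
    · change 3 • (y + z) = z
      rw [smul_add, hy, zero_add, show 3 • z = (2 + 1) • z from rfl, add_smul, hz, zero_add,
        one_smul]
  map_add' x y := Prod.ext (Subtype.ext (smul_add _ _ _)) (Subtype.ext (smul_add _ _ _))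

lemma exists_equiv_of_six {M : Type} [AddCommGroup M] (h : ∀ x : M, 6 • x = 0) (n : ℕ)
    (hM : Nat.card M = 3 * 2 ^ n) : Nonempty (M ≃+ (ZMod 3 × (Fin n → ZMod 2))) := by
  have : Finite M := Nat.finite_of_card_ne_zero (by rw [hM]; positivity)
  obtain ⟨a, ha, ⟨e⟩⟩ := exists_equiv_pow (M := tors M 3) 3 fun x => Subtype.ext x.2
  obtain ⟨b, hb, ⟨f⟩⟩ := exists_equiv_pow (M := tors M 2) 2 fun x => Subtype.ext x.2
  have hc := Nat.card_congr (torsEquiv h).toEquiv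
  rw [Nat.card_prod, ha, hb, hM] at hc
  have h3 : a = 1 := by
    have := congrArg (padicValNat 3) hc
    rw [padicValNat.mul (by norm_num) (by positivity), padicValNat.mul (by positivity)
      (by positivity), padicValNat.self (by norm_num), padicValNat.prime_pow,
      padicValNat_prime_prime_pow _ (by norm_num), padicValNat_prime_prime_pow _ (by norm_num)] at this
    lia
  subst h3
  have h2 : b = n := by
    rw [pow_one] at hc
    exact (Nat.pow_right_injective le_rfl (Nat.eq_of_mul_eq_mul_left (by norm_num) hc)).symm
  subst h2
  exact ⟨(torsEquiv h).trans (AddEquiv.prodCongr (e.trans (AddEquiv.piUnique _)) f)⟩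

/-- The homomorphism from a cyclic group given by an element killed by its order. -/
def zlift {M : Type} [AddCommGroup M] (n : ℕ) (x : M) (hx : n • x = 0) : ZMod n →+ M :=
  ZMod.lift n ⟨zmultiplesHom M x, by rw [zmultiplesHom_apply, natCast_zsmul, hx]⟩

lemma zlift_intCast {M : Type} [AddCommGroup M] (n : ℕ) (x : M) (hx : n • x = 0) (a : ℤ) :
    zlift n x hx a = a • x := by
  rw [zlift, ZMod.lift_coe, zmultiplesHom_apply]

/-- Recognition of an extension of `ℤ × ℤ/2 × ℤ/3 × ℤ/2` by `(ℤ/2)²`. -/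
lemma exists_equiv_of_order_four {M : Type} [AddCommGroup M] (i : ZMod 2 × ZMod 2 →+ M)
    (p : M →+ ℤ × ZMod 2 × ZMod 3 × ZMod 2) (hi : Function.Injective i)
    (hp : Function.Surjective p) (he : Function.Exact i p) (x z : M) (hx : p x = (0, 1, 0, 0))
    (hx2 : 2 • x = i (1, 1)) (hz : p z = (0, 0, 0, 1)) (hz2 : 2 • z = 0) :
    Nonempty (M ≃+ (ℤ × ZMod 4 × ZMod 3 × (Fin 2 → ZMod 2))) := by
  have hi2 : ∀ y, 2 • i y = 0 := fun y => by
    rw [← map_nsmul, show ∀ y : ZMod 2 × ZMod 2, 2 • y = 0 by decide, map_zero]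
  obtain ⟨e, he1⟩ := hp (1, 0, 0, 0)
  obtain ⟨w, hw⟩ := hp (0, 0, 1, 0)
  have hw6 : 6 • w = 0 := by
    obtain ⟨y, hy⟩ := (he (3 • w)).1 (by rw [map_nsmul, hw]; decide)
    rw [show 6 = 2 * 3 from rfl, mul_smul, ← hy, hi2]
  have hw12 : 3 • (4 • w) = 0 := by
    rw [smul_smul, show 3 * 4 = 2 * 6 from rfl, mul_smul, hw6, smul_zero]
  have hx4 : 4 • x = 0 := by rw [show 4 = 2 * 2 from rfl, mul_smul, hx2, hi2]
  let Ψ : ℤ × ZMod 4 × ZMod 3 × (ZMod 2 × ZMod 2) →+ M :=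
    (zmultiplesHom M e).coprod ((zlift 4 x hx4).coprod ((zlift 3 _ hw12).coprod
      ((zlift 2 z hz2).coprod (zlift 2 _ (hi2 (1, 0))))))
  have hΨ : ∀ n a b c d : ℤ, Ψ (n, (a : ZMod 4), (b : ZMod 3), (c : ZMod 2), (d : ZMod 2)) =
      n • e + (a • x + (b • 4 • w + (c • z + d • i (1, 0)))) := fun n a b c d => by
    simp only [Ψ, AddMonoidHom.coprod_apply, zlift_intCast, zmultiplesHom_apply]
  have hpΨ : ∀ n a b c d : ℤ, p (n • e + (a • x + (b • 4 • w + (c • z + d • i (1, 0))))) =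
      (n, (a : ZMod 2), (b : ZMod 3), (c : ZMod 2)) := fun n a b c d => by
    rw [map_add, map_add, map_add, map_add, map_zsmul, map_zsmul, map_zsmul, map_zsmul, map_zsmul,
      map_nsmul, he1, hx, hw, hz, he.apply_apply_eq_zero]
    have h4 : (4 : ZMod 3) = 1 := by decide
    ext <;> simp [h4]
  have hbij : Function.Bijective Ψ := by
    constructor
    · rw [injective_iff_map_eq_zero]
      rintro ⟨n, a, b, c, d⟩ h
      obtain ⟨a, rfl⟩ := ZMod.intCast_surjective a
      obtain ⟨b, rfl⟩ := ZMod.intCast_surjective b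
      obtain ⟨c, rfl⟩ := ZMod.intCast_surjective c
      obtain ⟨d, rfl⟩ := ZMod.intCast_surjective d
      rw [hΨ] at h
      have h1 := congrArg p h
      rw [hpΨ, map_zero, Prod.mk_eq_zero, Prod.mk_eq_zero, Prod.mk_eq_zero] at h1
      obtain ⟨rfl, ha, hb, hc⟩ := h1
      rw [ZMod.intCast_zmod_eq_zero_iff_dvd] at ha hb hc
      obtain ⟨a, rfl⟩ := ha
      obtain ⟨b, rfl⟩ := hb
      obtain ⟨c, rfl⟩ := hc
      have h2 : i ((a : ZMod 2) + d, (a : ZMod 2)) = 0 := by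
        have h3 : i ((a : ZMod 2) + d, (a : ZMod 2)) = a • i (1, 1) + d • i (1, 0) := by
          rw [← map_zsmul, ← map_zsmul, ← map_add]
          congr 1
          ext <;> simp
        rw [h3, ← h, ← hx2, mul_comm, mul_comm (_ : ℤ) b, mul_comm (_ : ℤ) c, mul_smul, mul_smul,
          mul_smul]
        simp only [Nat.cast_ofNat, ofNat_zsmul]
        rw [hz2, hw12]
        simp
      have h3 := (injective_iff_map_eq_zero i).1 hi _ h2
      rw [Prod.mk_eq_zero] at h3
      obtain ⟨h3, h4⟩ := h3
      rw [h4, zero_add] at h3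
      rw [ZMod.intCast_zmod_eq_zero_iff_dvd] at h4
      obtain ⟨a, rfl⟩ := h4
      rw [h3]
      refine Prod.ext rfl (Prod.ext ?_ (Prod.ext ?_ (Prod.ext ?_ rfl)))
      · exact (ZMod.intCast_zmod_eq_zero_iff_dvd _ 4).2 ⟨a, by push_cast; ring⟩
      · exact (ZMod.intCast_zmod_eq_zero_iff_dvd _ 3).2 ⟨b, rfl⟩
      · exact (ZMod.intCast_zmod_eq_zero_iff_dvd _ 2).2 ⟨c, rfl⟩
    · intro m
      rcases hm : p m with ⟨n, a, b, c⟩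
      obtain ⟨a, rfl⟩ := ZMod.intCast_surjective a
      obtain ⟨b, rfl⟩ := ZMod.intCast_surjective b
      obtain ⟨c, rfl⟩ := ZMod.intCast_surjective c
      obtain ⟨⟨f, g⟩, hy⟩ := (he (m - (n • e + (a • x + (b • 4 • w + (c • z + (0 : ℤ) • i (1, 0))))))).1
        (by rw [map_sub, hpΨ, hm, sub_self])
      obtain ⟨f, rfl⟩ := ZMod.intCast_surjective f
      obtain ⟨g, rfl⟩ := ZMod.intCast_surjective g
      refine ⟨(n, ((a + 2 * g : ℤ) : ZMod 4), (b : ZMod 3), (c : ZMod 2), ((f - g : ℤ) : ZMod 2)), ?_⟩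
      have h3 : i ((f : ZMod 2), (g : ZMod 2)) = g • i (1, 1) + (f - g) • i (1, 0) := by
        rw [← map_zsmul, ← map_zsmul, ← map_add]
        congr 1
        ext <;> simp
      rw [hΨ, eq_comm, ← sub_eq_zero, ← sub_eq_zero.2 hy.symm, h3, ← hx2]
      module
  exact ⟨(AddEquiv.ofBijective Ψ hbij).symm.trans (AddEquiv.prodCongr (AddEquiv.refl _)
    (AddEquiv.prodCongr (AddEquiv.refl _) (AddEquiv.prodCongr (AddEquiv.refl _)
      (RingEquiv.piFinTwo (fun _ => ZMod 2)).symm.toAddEquiv)))⟩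

end AbelianExtension

namespace Bianchi

open GMod

lemma ρ_pow : A4.ρ ^ 3 = 1 := by decide

lemma σρ_pow : (A4.σ * A4.ρ) ^ 3 = 1 := by decide

/-- The homology of an edge group in terms of its finite subgroups. -/
noncomputable def esMap {y : A4} (hy : y ^ 3 = 1) (n : ℕ) :
    h (Cyc 3) n × h (Cyc 2) n →+ h (Es y) n :=
  AddMonoidHom.coprod (hmap (c3 hy) n) (hmap (cτ (τ_mem_Es y)) n)

lemma esMap_ρ_bijective (n : ℕ) : Function.Bijective (esMap ρ_pow (n + 1)) :=
  Es_homology ρ_pow (by decide) n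

lemma esMap_σρ_bijective (n : ℕ) : Function.Bijective (esMap σρ_pow (n + 1)) :=
  Es_homology σρ_pow (by decide) n

/-- The homology of the vertex group in terms of its finite subgroups. -/
noncomputable def ΓMap (n : ℕ) : h A4 n × h (Cyc 2) n →+ h Γ n :=
  AddMonoidHom.coprod (hmap aΓ n) (hmap (cτ τ_mem_Γ) n)

lemma ΓMap_bijective (n : ℕ) : Function.Bijective (ΓMap (n + 1)) := Γ_homology n

lemma hmap_φ₁ (n : ℕ) (a : h (Cyc 2) n) :
    hmap tree.φ₁ n (hmap cF n a) = ΓMap n (hmap iσ n a, 0) := by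
  change _ = hmap aΓ n _ + hmap (cτ τ_mem_Γ) n 0
  rw [map_zero, add_zero, ← hmap_comp tree.φ₁ cF (tree.φ₁.comp cF) (fun _ => rfl)]
  refine hmap_comp _ _ _ (cyc_hom_ext (f' := aΓ.comp iσ) ?_) n a
  refine Subtype.ext ?_
  change ((cF (gen 2) : F) : G) = iA (iσ (gen 2))
  rw [iσ_gen, iA_σ, cF, cycHom_gen]
  rfl

lemma hmap_inclusion {y : A4} (hy : y ^ 3 = 1) (x : A4) (hx : y * x = x * A4.ρ) (n : ℕ)
    (e : h (Cyc 3) n × h (Cyc 2) n) :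
    hmap (Subgroup.inclusion (Es_le y)) n (esMap hy n e) = ΓMap n (hmap iρ n e.1, e.2) := by
  obtain ⟨a, c⟩ := e
  change hmap _ n (hmap (c3 hy) n a + hmap (cτ _) n c) = hmap aΓ n _ + hmap (cτ τ_mem_Γ) n c
  rw [map_add]
  congr 1
  · have h1 : hmap iρ n a = hmap (cycHom 3 y hy) n a := by
      refine hmap_conj iρ (cycHom 3 y hy) x (fun z => ?_) n a
      refine mul_eq_of_eq_mul_inv (?_ : _ = x * iρ z * x⁻¹)
      refine cyc_hom_ext (f' := (MulAut.conj x).toMonoidHom.comp iρ) ?_ z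
      change _ = x * iρ (gen 3) * x⁻¹
      rw [cycHom_gen, iρ_gen, ← hx, mul_inv_cancel_right]
    rw [h1, ← hmap_comp _ (c3 hy) ((Subgroup.inclusion (Es_le y)).comp (c3 hy)) (fun _ => rfl)]
    exact hmap_comp _ _ _ (fun z => Subtype.ext (c3_coe hy z)) n a
  · refine (hmap_comp _ _ _ (fun z => ?_) n c).symm
    refine cyc_hom_ext (f' := (Subgroup.inclusion (Es_le y)).comp (cτ (τ_mem_Es y))) ?_ z
    refine Subtype.ext ?_
    change _ = ((cτ (τ_mem_Es y) (gen 2) : Es y) : G)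
    rw [cτ_gen, cτ_gen]

lemma hmap_φ₂ (n : ℕ) (e : h (Cyc 3) n × h (Cyc 2) n) :
    hmap tree.φ₂ n (esMap ρ_pow n e) = ΓMap n (hmap iρ n e.1, e.2) :=
  hmap_inclusion ρ_pow 1 (by decide) n e

lemma exists_conj : ∃ x, A4.σ * A4.ρ * x = x * A4.ρ := by decide

lemma hmap_φ₃ (n : ℕ) (e : h (Cyc 3) n × h (Cyc 2) n) :
    hmap tree.φ₃ n (esMap σρ_pow n e) = ΓMap n (hmap iρ n e.1, e.2) :=
  let ⟨x, hx⟩ := exists_conj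
  hmap_inclusion σρ_pow x hx n e

lemma tree_φ (n : ℕ) (e : h F n × h (Es A4.ρ) n × h (Es (A4.σ * A4.ρ)) n) :
    tree.φ n e = hmap tree.φ₁ n e.1 + (hmap tree.φ₂ n e.2.1 + hmap tree.φ₃ n e.2.2) := rfl

/-- The kernel of the boundary map from edges to vertices. -/
noncomputable def kerMap (n : ℕ) : h (Cyc 3) n × h (Cyc 2) n →+
    h F n × h (Es A4.ρ) n × h (Es (A4.σ * A4.ρ)) n :=
  AddMonoidHom.prod 0 (AddMonoidHom.prod (esMap ρ_pow n) (-esMap σρ_pow n))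

lemma kerMap_apply (n : ℕ) (e : h (Cyc 3) n × h (Cyc 2) n) :
    kerMap n e = (0, esMap ρ_pow n e, -esMap σρ_pow n e) := rfl

lemma kerMap_injective (n : ℕ) : Function.Injective (kerMap (n + 1)) := fun _ _ hab =>
  (esMap_ρ_bijective n).1 (congrArg (fun x => x.2.1) hab)

lemma kerMap_exact (n : ℕ) : Function.Exact (kerMap (n + 2)) (tree.φ (n + 2)) := by
  rintro ⟨a, b, c⟩
  obtain ⟨a, rfl⟩ := (F_homology.1 n).2 a
  obtain ⟨b, rfl⟩ := (esMap_ρ_bijective (n + 1)).2 b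
  obtain ⟨c, rfl⟩ := (esMap_σρ_bijective (n + 1)).2 c
  rw [tree_φ, hmap_φ₁, hmap_φ₂, hmap_φ₃, ← map_add, ← map_add]
  constructor
  · intro h0
    have h1 := (injective_iff_map_eq_zero _).1 (ΓMap_bijective (n + 1)).1 _ h0
    have h2 : hmap iσ (n + 2) a + (hmap iρ (n + 2) b.1 + hmap iρ (n + 2) c.1) = 0 :=
      congrArg Prod.fst h1
    have h3 : 0 + (b.2 + c.2) = 0 := congrArg Prod.snd h1
    rw [← map_add, ← cycSum_apply] at h2
    have h4 := (injective_iff_map_eq_zero _).1 (cycSum_injective n) _ h2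
    rw [Prod.mk_eq_zero] at h4
    have h5 : c = -b := by
      refine eq_neg_of_add_eq_zero_right (Prod.ext h4.2 ?_)
      rwa [zero_add] at h3
    exact ⟨b, by rw [kerMap_apply, h4.1, h5, map_zero, map_neg]⟩
  · rintro ⟨e, he⟩
    rw [kerMap_apply] at he
    have ha : a = 0 := by
      apply (F_homology.1 n).1
      rw [map_zero]
      exact (congrArg Prod.fst he).symm
    have hb : e = b := (esMap_ρ_bijective (n + 1)).1 (congrArg (fun x => x.2.1) he)
    have hc : -e = c := (esMap_σρ_bijective (n + 1)).1 (by
      rw [map_neg]; exact congrArg (fun x => x.2.2) he)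
    rw [ha, ← hb, ← hc, map_zero, ← map_zero (ΓMap (n + 2))]
    congr 1
    refine Prod.ext ?_ ?_
    · change 0 + (hmap iρ _ e.1 + hmap iρ _ (-e.1)) = 0
      rw [map_neg, zero_add, add_neg_cancel]
    · change 0 + (e.2 + -e.2) = 0
      rw [zero_add, add_neg_cancel]

end Bianchi

namespace Bianchi

open GMod

lemma card_Γ (n : ℕ) :
    Nat.card (h Γ (n + 1)) = Nat.card (h A4 (n + 1)) * Nat.card (h (Cyc 2) (n + 1)) := by
  rw [← Nat.card_congr (Equiv.ofBijective _ (ΓMap_bijective n)), Nat.card_prod]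

lemma six_nsmul_Γ (n : ℕ) (x : h Γ (n + 1)) : 6 • x = 0 := by
  obtain ⟨⟨a, c⟩, rfl⟩ := (ΓMap_bijective n).2 x
  rw [← map_nsmul, Prod.smul_mk, six_nsmul_h, show 6 • c = (3 * 2) • c from rfl, mul_smul,
    cyc_smul, smul_zero, Prod.mk_zero_zero, map_zero]

lemma card_edges_even (m : ℕ) :
    Nat.card (h F (2 * m + 2) × h (Es A4.ρ) (2 * m + 2) × h (Es (A4.σ * A4.ρ)) (2 * m + 2)) = 1 := by
  rw [Nat.card_prod, Nat.card_prod, ← Nat.card_congr (Equiv.ofBijective _ (F_homology.1 (2 * m))),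
    ← Nat.card_congr (Equiv.ofBijective _ (esMap_ρ_bijective (2 * m + 1))),
    ← Nat.card_congr (Equiv.ofBijective _ (esMap_σρ_bijective (2 * m + 1))), Nat.card_prod,
    card_cyc_even, card_cyc_even]

lemma card_edges_odd (m : ℕ) :
    Nat.card (h F (2 * m + 3) × h (Es A4.ρ) (2 * m + 3) × h (Es (A4.σ * A4.ρ)) (2 * m + 3)) = 72 := by
  have h2 := card_cyc_odd 2 (m + 1)
  have h3 := card_cyc_odd 3 (m + 1)
  rw [Nat.card_prod, Nat.card_prod,
    ← Nat.card_congr (Equiv.ofBijective _ (F_homology.1 (2 * m + 1))),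
    ← Nat.card_congr (Equiv.ofBijective _ (esMap_ρ_bijective (2 * m + 2))),
    ← Nat.card_congr (Equiv.ofBijective _ (esMap_σρ_bijective (2 * m + 2))), Nat.card_prod]
  change Nat.card (h (Cyc 2) (2 * m + 3)) = 2 at h2
  change Nat.card (h (Cyc 3) (2 * m + 3)) = 3 at h3
  rw [h2, h3]

lemma edges_even (m : ℕ)
    (e : h F (2 * m + 2) × h (Es A4.ρ) (2 * m + 2) × h (Es (A4.σ * A4.ρ)) (2 * m + 2)) : e = 0 :=
  (Nat.card_eq_one_iff_unique.1 (card_edges_even m)).1.elim _ _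

lemma card_range_φ (m : ℕ) : Nat.card (tree.φ (2 * m + 3)).range = 12 := by
  have h1 := card_eq_mul_of_exact (kerMap (2 * m + 3)) (tree.φ (2 * m + 3)).rangeRestrict
    (kerMap_injective _) (AddMonoidHom.rangeRestrict_surjective _) fun e => by
      rw [← kerMap_exact (2 * m + 1) e, Subtype.ext_iff]; rfl
  have h2 : Nat.card (h (Cyc 2) (2 * m + 3)) = 2 := card_cyc_odd 2 (m + 1)
  have h3 : Nat.card (h (Cyc 3) (2 * m + 3)) = 3 := card_cyc_odd 3 (m + 1)
  rw [card_edges_odd, Nat.card_prod, h2, h3] at h1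
  lia

lemma card_range_b (n : ℕ) : Nat.card (h Γ n) * Nat.card (h Γ n) =
    Nat.card (tree.φ n).range * Nat.card (tree.b n).range := by
  rw [← Nat.card_prod]
  refine card_eq_mul_of_exact (AddMonoidHom.prod (tree.φ n).range.subtype
    (-(tree.φ n).range.subtype)) (tree.b n).rangeRestrict (fun a b hab => ?_)
    (AddMonoidHom.rangeRestrict_surjective _) fun y => ?_
  · exact Subtype.ext (congrArg Prod.fst hab)
  · rw [Subtype.ext_iff]
    refine (tree.b_eq_zero n y).trans ⟨?_, ?_⟩
    · rintro ⟨e, rfl⟩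
      exact ⟨⟨_, e, rfl⟩, rfl⟩
    · rintro ⟨⟨_, e, rfl⟩, rfl⟩
      exact ⟨e, rfl⟩

lemma card_H (n : ℕ) : Nat.card (h G (n + 1)) =
    Nat.card (tree.b (n + 1)).range * Nat.card (tree.D n).range :=
  card_eq_mul_of_exact (tree.b (n + 1)).range.subtype (tree.D n).rangeRestrict
    Subtype.val_injective (AddMonoidHom.rangeRestrict_surjective _) fun y => by
    rw [Subtype.ext_iff]
    refine (tree.D_eq_zero n y).trans ⟨?_, ?_⟩
    · rintro ⟨x, rfl⟩
      exact ⟨⟨_, x, rfl⟩, rfl⟩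
    · rintro ⟨⟨_, x, rfl⟩, rfl⟩
      exact ⟨x, rfl⟩

lemma b_surjective (m : ℕ) (y : h G (2 * m + 3)) : ∃ x, tree.b (2 * m + 3) x = y :=
  (tree.D_eq_zero _ y).1 (edges_even m _)

lemma six_nsmul_odd (m : ℕ) (y : h G (2 * m + 3)) : 6 • y = 0 := by
  obtain ⟨⟨a, b⟩, rfl⟩ := b_surjective m y
  rw [← map_nsmul, Prod.smul_mk, six_nsmul_Γ, six_nsmul_Γ, Prod.mk_zero_zero, map_zero]

lemma card_odd (m n : ℕ) (hn : Nat.card (h A4 (2 * m + 3)) = 3 * 2 ^ n) :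
    Nat.card (h G (2 * m + 3)) = 3 * 2 ^ (2 * n) := by
  have h1 := card_range_b (2 * m + 3)
  have h2 : Nat.card (h (Cyc 2) (2 * m + 3)) = 2 := card_cyc_odd 2 (m + 1)
  rw [card_range_φ, card_Γ, hn, h2] at h1
  have h3 : Nat.card (tree.D (2 * m + 2)).range = 1 := Nat.card_eq_one_iff_unique.2
    ⟨⟨fun a b => Subtype.ext ((edges_even m a).trans (edges_even m b).symm)⟩, ⟨0⟩⟩
  rw [card_H, h3, mul_one, pow_mul', pow_two]
  lia

lemma exists_equiv_odd (m n : ℕ) (hn : Nat.card (h A4 (2 * m + 3)) = 3 * 2 ^ n) :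
    Nonempty (h G (2 * m + 3) ≃+ (ZMod 3 × (Fin (2 * n) → ZMod 2))) :=
  AbelianExtension.exists_equiv_of_six (six_nsmul_odd m) _ (card_odd m n hn)

lemma card_range_D (m : ℕ) : Nat.card (tree.D (2 * m + 3)).range = 6 := by
  have h2 : Nat.card (h (Cyc 2) (2 * m + 3)) = 2 := card_cyc_odd 2 (m + 1)
  have h3 : Nat.card (h (Cyc 3) (2 * m + 3)) = 3 := card_cyc_odd 3 (m + 1)
  have h4 : (tree.D (2 * m + 3)).range = (kerMap (2 * m + 3)).range := by
    ext e
    exact (tree.φ_eq_zero _ e).symm.trans (kerMap_exact (2 * m + 1) e)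
  rw [h4, ← Nat.card_congr (AddMonoidHom.ofInjective (kerMap_injective (2 * m + 2))).toEquiv,
    Nat.card_prod, h2, h3]

lemma card_even (m n : ℕ) (hn : Nat.card (h A4 (2 * m + 4)) = 2 ^ n) :
    Nat.card (h G (2 * m + 4)) = 3 * 2 ^ (2 * n + 1) := by
  have h1 := card_range_b (2 * m + 4)
  have h2 : Nat.card (h (Cyc 2) (2 * m + 4)) = 1 := card_cyc_even 2 (m + 1)
  rw [card_Γ, hn, h2, Nat.card_eq_one_iff_unique.2 ⟨⟨?_⟩, ⟨0⟩⟩, one_mul, mul_one] at h1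
  · rw [card_H, card_range_D, ← h1, pow_succ, pow_mul', pow_two]
    lia
  · rintro ⟨_, a, rfl⟩ ⟨_, b, rfl⟩
    have hab : a = b := (edges_even (m + 1) a).trans (edges_even (m + 1) b).symm
    rw [hab]

/-- The inclusion of the group generated by `τ`. -/
def iτ : Cyc 2 →* G := Γ.subtype.comp (cτ τ_mem_Γ)

lemma iτ_comm (x : Cyc 2) : iτ x * (u⁻¹ * v) = u⁻¹ * v * iτ x := by
  refine mul_eq_of_eq_mul_inv ?_
  refine cyc_hom_ext (f' := (MulAut.conj (u⁻¹ * v)).toMonoidHom.comp iτ) ?_ x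
  change iτ (gen 2) = u⁻¹ * v * iτ (gen 2) * (u⁻¹ * v)⁻¹
  have h1 : iτ (gen 2) = τ := congrArg Subtype.val (cτ_gen τ_mem_Γ)
  rw [h1, eq_mul_inv_iff_mul_eq]
  exact mk_eq_of (by decide +kernel)

/-- The classes coming from the commuting pair `τ`, `u⁻¹ * v`. -/
noncomputable def crossτ (n : ℕ) : h (Cyc 2) n →+ h G (n + 1) := cross iτ iτ_comm n

lemma D_crossτ (n : ℕ) (y : h (Cyc 2) n) : tree.D n (crossτ n y) = kerMap n (0, y) := by
  have h1 : ∀ (z : A4) (x : Cyc 2), (cτ τ_mem_Γ x : Γ) =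
      Subgroup.inclusion (Es_le z) (cτ (τ_mem_Es z) x) := fun z x => by
    refine cyc_hom_ext (f' := (Subgroup.inclusion (Es_le z)).comp (cτ (τ_mem_Es z))) ?_ x
    refine Subtype.ext ?_
    change _ = ((cτ (τ_mem_Es z) (gen 2) : Es z) : G)
    rw [cτ_gen, cτ_gen]
  refine (tree.D_cross (cτ (τ_mem_Es _)) (cτ (τ_mem_Es _))
    (fun x => (h1 _ x).symm.trans (h1 _ x)) iτ (fun x => congrArg Subtype.val (h1 _ x))
    iτ_comm n y).trans ?_
  rw [kerMap_apply]
  change _ = (0, hmap _ n 0 + _, -(hmap _ n 0 + _))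
  rw [map_zero, map_zero, zero_add, zero_add]
  rfl

lemma two_nsmul_crossτ (n : ℕ) (y : h (Cyc 2) (n + 1)) : 2 • crossτ (n + 1) y = 0 := by
  rw [← map_nsmul, cyc_smul, map_zero]

lemma two_nsmul_of_card {M : Type} [AddCommGroup M] (n : ℕ) (hM : Nat.card M = 2 ^ n) (x : M)
    (hx : 6 • x = 0) : 2 • x = 0 := by
  have : Finite M := Nat.finite_of_card_ne_zero (by rw [hM]; positivity)
  have h1 : addOrderOf x ∣ 2 ^ n := hM ▸ addOrderOf_dvd_natCard x
  have h2 : addOrderOf x ∣ 2 * 3 := addOrderOf_dvd_of_nsmul_eq_zero hx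
  exact addOrderOf_dvd_iff_nsmul_eq_zero.1
    ((((by norm_num : Nat.Coprime 2 3).pow_left n).coprime_dvd_left h1).dvd_of_dvd_mul_right h2)

lemma two_nsmul_Γ (m n : ℕ) (hn : Nat.card (h A4 (2 * m + 2)) = 2 ^ n) (x : h Γ (2 * m + 2)) :
    2 • x = 0 := by
  refine two_nsmul_of_card n ?_ x (six_nsmul_Γ _ x)
  rw [card_Γ, hn, card_cyc_even 2 m, mul_one]

lemma six_nsmul_even (m n : ℕ) (hn : Nat.card (h A4 (2 * m + 4)) = 2 ^ n) (y : h G (2 * m + 4)) :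
    6 • y = 0 := by
  obtain ⟨⟨a, c⟩, hac⟩ := (kerMap_exact (2 * m + 1) _).1 ((tree.φ_eq_zero _ _).2 ⟨y, rfl⟩)
  obtain ⟨x, hx⟩ := (tree.D_eq_zero (2 * m + 3) (3 • (y - crossτ (2 * m + 3) c))).1 (by
    rw [map_nsmul, map_sub, D_crossτ, ← hac, ← map_sub, ← map_nsmul]
    change kerMap (2 * m + 3) (3 • (a - 0), 3 • (c - c)) = 0
    rw [cyc_smul, sub_self, smul_zero, Prod.mk_zero_zero, map_zero])
  have h1 : 6 • (y - crossτ (2 * m + 3) c) = 0 := by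
    rw [show 6 = 2 * 3 from rfl, mul_smul, ← hx, ← map_nsmul, ← Prod.mk.eta (p := x), Prod.smul_mk,
      two_nsmul_Γ (m + 1) n hn, two_nsmul_Γ (m + 1) n hn, Prod.mk_zero_zero, map_zero]
  rwa [smul_sub, show 6 • crossτ (2 * m + 3) c = (3 * 2) • crossτ (2 * m + 3) c from rfl, mul_smul,
    two_nsmul_crossτ, smul_zero, sub_zero] at h1

lemma exists_equiv_even (m n : ℕ) (hn : Nat.card (h A4 (2 * m + 4)) = 2 ^ n) :
    Nonempty (h G (2 * m + 4) ≃+ (ZMod 3 × (Fin (2 * n + 1) → ZMod 2))) :=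
  AbelianExtension.exists_equiv_of_six (six_nsmul_even m n hn) _ (card_even m n hn)

end Bianchi

namespace Bianchi

open GMod AbelianExtension

/-- The connecting map, without the last edge group. -/
noncomputable def D' (n : ℕ) : h G (n + 1) →+ h F n × h (Es A4.ρ) n :=
  (AddMonoidHom.prod (AddMonoidHom.fst _ _)
    ((AddMonoidHom.fst _ _).comp (AddMonoidHom.snd _ _))).comp (tree.D n)

lemma D'_apply (n : ℕ) (y : h G (n + 1)) : D' n y = ((tree.D n y).1, (tree.D n y).2.1) := rfl

lemma D'_surjective (n : ℕ) (hφ : Function.Bijective (hmap tree.φ₃ n)) :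
    Function.Surjective (D' n) := by
  rintro ⟨a, b⟩
  obtain ⟨c, hc⟩ := hφ.2 (-(hmap tree.φ₁ n a + hmap tree.φ₂ n b))
  obtain ⟨y, hy⟩ := (tree.φ_eq_zero n (a, b, c)).1 (by
    rw [tree_φ, ← add_assoc, hc, add_neg_cancel])
  exact ⟨y, by rw [D'_apply, hy]⟩

lemma D'_eq_zero (n : ℕ) (hφ : Function.Bijective (hmap tree.φ₃ n)) (y : h G (n + 1)) :
    D' n y = 0 ↔ ∃ x, tree.b (n + 1) x = y := by
  rw [← tree.D_eq_zero]
  refine ⟨fun h0 => ?_, fun h0 => by rw [D'_apply, h0]; rfl⟩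
  have h1 := (tree.φ_eq_zero n _).2 ⟨y, rfl⟩
  rw [D'_apply, Prod.mk_eq_zero] at h0
  rw [tree_φ, h0.1, h0.2, map_zero, map_zero, zero_add, zero_add] at h1
  exact Prod.ext h0.1 (Prod.ext h0.2 ((injective_iff_map_eq_zero _).1 hφ.1 _ h1))

lemma hmap_φ₃_one_bijective : Function.Bijective (hmap tree.φ₃ 1) := by
  rw [← Function.Bijective.of_comp_iff _ (esMap_σρ_bijective 0)]
  have h1 : hmap tree.φ₃ 1 ∘ esMap σρ_pow 1 = ΓMap 1 ∘ Prod.map (hmap iρ 1) id :=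
    funext fun e => hmap_φ₃ 1 e
  rw [h1]
  exact (ΓMap_bijective 0).comp (hmap_iρ_one_bijective.prodMap Function.bijective_id)

/-- The first homology of a cyclic group. -/
noncomputable def cycE (n : ℕ) [NeZero n] : h (Cyc n) 1 ≃+ ZMod n :=
  AddEquiv.ofBijective _ (cycH1_bijective n)

lemma cycE_gen (n : ℕ) [NeZero n] : cycE n (c1 (gen n)) = 1 := h1hom_c1 _ _

theorem exists_equiv_one : Nonempty (h G 1 ≃+ ((Fin 2 → ℤ) × ZMod 3 × ZMod 2)) := by
  let e0 : (h F 0 × h (Es A4.ρ) 0) ≃+ (Fin 2 → ℤ) :=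
    (AddEquiv.prodCongr (AddEquiv.ofBijective _ (c0_bijective (G := F))).symm
      (AddEquiv.ofBijective _ (c0_bijective (G := Es A4.ρ))).symm).trans
      (RingEquiv.piFinTwo (fun _ => ℤ)).symm.toAddEquiv
  let eΓ : h Γ 1 ≃+ ZMod 3 × ZMod 2 :=
    (AddEquiv.ofBijective _ (ΓMap_bijective 0)).symm.trans (AddEquiv.prodCongr
      ((AddEquiv.ofBijective _ hmap_iρ_one_bijective).symm.trans (cycE 3)) (cycE 2))
  have hφ : Function.Bijective (hmap tree.φ₃ 0) := hmap_zero_bijective _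
  have hinj : Function.Injective ((tree.b 1).comp (AddMonoidHom.inl (h Γ 1) (h Γ 1))) := by
    rw [injective_iff_map_eq_zero]
    intro x hx
    obtain ⟨e, he⟩ := (tree.b_eq_zero 1 (x, 0)).1 hx
    exact (congrArg Prod.fst he).trans (neg_eq_zero.1 (congrArg Prod.snd he).symm)
  obtain ⟨e, -⟩ := exists_equiv_of_free _ (e0.toAddMonoidHom.comp (D' 0)) hinj
    (e0.surjective.comp (D'_surjective 0 hφ)) fun y => by
    refine ((map_eq_zero_iff e0 e0.injective).trans (D'_eq_zero 0 hφ y)).trans ⟨?_, ?_⟩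
    · rintro ⟨⟨a, c⟩, rfl⟩
      obtain ⟨d, rfl⟩ := hmap_φ₃_one_bijective.2 c
      refine ⟨a + hmap tree.φ₃ 1 d, sub_eq_zero.1 ?_⟩
      rw [AddMonoidHom.comp_apply, ← map_sub]
      refine (tree.b_eq_zero 1 _).2 ⟨(0, 0, d), ?_⟩
      have h1 : tree.φ 1 (0, 0, d) = hmap tree.φ₃ 1 d := by
        change hmap tree.φ₁ 1 0 + (hmap tree.φ₂ 1 0 + hmap tree.φ₃ 1 d) = _
        rw [map_zero, map_zero]
        exact (zero_add _).trans (zero_add _)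
      rw [h1]
      exact Prod.ext (add_sub_cancel_left a _) (zero_sub _)
    · rintro ⟨x, rfl⟩
      exact ⟨_, rfl⟩
  exact ⟨e.trans (AddEquiv.prodCongr (AddEquiv.refl _) eΓ)⟩

lemma σF_map : tree.φ₁ σF = aΓ A4.σ := Subtype.ext iA_σ.symm

lemma exists_equiv_card_two {M : Type} [AddCommGroup M] (hM : Nat.card M = 2) (y : M) (hy : y ≠ 0) :
    ∃ e : ZMod 2 ≃+ M, e 1 = y := by
  have hy2 : 2 • y = 0 := by rw [← hM]; exact card_nsmul_eq_zero'
  refine ⟨AddEquiv.ofBijective (zlift 2 y hy2) ?_, ?_⟩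
  · have : Finite M := Nat.finite_of_card_ne_zero (by rw [hM]; norm_num)
    refine (Nat.bijective_iff_injective_and_card _).2 ⟨?_, by rw [hM, Nat.card_zmod]⟩
    rw [injective_iff_map_eq_zero]
    intro a ha
    obtain rfl | rfl : a = 0 ∨ a = 1 := by clear ha; revert a; decide
    · rfl
    · have h1 := zlift_intCast 2 y hy2 1
      rw [Int.cast_one, ha, one_smul] at h1
      exact absurd h1.symm hy
  · have h1 := zlift_intCast 2 y hy2 1
    rwa [Int.cast_one, one_smul] at h1

theorem exists_equiv_two : Nonempty (h G 2 ≃+ (ℤ × ZMod 4 × ZMod 3 × (Fin 2 → ZMod 2))) := by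
  obtain ⟨y, ξ, hy, hξ, hξ2⟩ := tree.exists_order_four aΓ σF σF_map
  obtain ⟨ey, hey⟩ := exists_equiv_card_two card_h_two y hy
  obtain ⟨-, hF, δ, hδ, hδe⟩ := F_homology
  obtain ⟨eF, heF⟩ := exists_equiv_of_free (hmap cF 1) δ hF hδ hδe
  let eE : h (Cyc 3) 1 × h (Cyc 2) 1 ≃+ h (Es A4.ρ) 1 := AddEquiv.ofBijective _ (esMap_ρ_bijective 0)
  let e1 : (h F 1 × h (Es A4.ρ) 1) ≃+ ℤ × ZMod 2 × ZMod 3 × ZMod 2 :=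
    (AddEquiv.prodCongr (eF.trans (AddEquiv.prodCongr (AddEquiv.refl ℤ) (cycE 2)))
      (eE.symm.trans (AddEquiv.prodCongr (cycE 3) (cycE 2)))).trans AddEquiv.prodAssoc
  have hc2 : ∀ c : h (Cyc 2) 2, c = 0 := cyc_h_even 2 0
  have hΓ : ∀ x : h Γ 2, ∃ z : ZMod 2, hmap aΓ 2 (ey z) = x := fun x => by
    obtain ⟨⟨a, c⟩, rfl⟩ := (ΓMap_bijective 1).2 x
    refine ⟨ey.symm a, ?_⟩
    change _ = hmap aΓ 2 a + hmap (cτ τ_mem_Γ) 2 c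
    rw [hc2 c, map_zero, add_zero, AddEquiv.apply_symm_apply]
  have hΓi : ∀ z : ZMod 2, hmap aΓ 2 (ey z) = 0 → z = 0 := fun z hz => by
    have h1 : ΓMap 2 (ey z, 0) = 0 := by
      change hmap aΓ 2 (ey z) + hmap (cτ τ_mem_Γ) 2 0 = 0
      rw [map_zero, add_zero, hz]
    have h2 := congrArg Prod.fst ((injective_iff_map_eq_zero _).1 (ΓMap_bijective 1).1 _ h1)
    exact (map_eq_zero_iff ey ey.injective).1 h2
  have hφ := hmap_φ₃_one_bijective
  refine exists_equiv_of_order_four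
    ((tree.b 2).comp (AddMonoidHom.prodMap ((hmap aΓ 2).comp ey.toAddMonoidHom)
      ((hmap aΓ 2).comp ey.toAddMonoidHom))) (e1.toAddMonoidHom.comp (D' 1)) ?_
    (e1.surjective.comp (D'_surjective 1 hφ)) (fun m => ?_) ξ (crossτ 1 (c1 (gen 2))) ?_ ?_ ?_
    (two_nsmul_crossτ 0 _)
  · rw [injective_iff_map_eq_zero]
    rintro ⟨z, w⟩ hzw
    obtain ⟨e, he⟩ := (tree.b_eq_zero 2 (hmap aΓ 2 (ey z), hmap aΓ 2 (ey w))).1 hzw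
    rw [edges_even 0 e, map_zero, neg_zero, Prod.mk_zero_zero, Prod.mk_eq_zero] at he
    rw [hΓi z he.1, hΓi w he.2, Prod.mk_zero_zero]
  · refine ((map_eq_zero_iff e1 e1.injective).trans (D'_eq_zero 1 hφ m)).trans ⟨?_, ?_⟩
    · rintro ⟨⟨a, c⟩, rfl⟩
      obtain ⟨z, rfl⟩ := hΓ a
      obtain ⟨w, rfl⟩ := hΓ c
      exact ⟨(z, w), rfl⟩
    · rintro ⟨x, rfl⟩
      exact ⟨_, rfl⟩
  · have h1 : hmap cF 1 (c1 (gen 2)) = c1 σF := by rw [hmap_c1, cF, cycHom_gen]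
    have h2 : D' 1 ξ = (hmap cF 1 (c1 (gen 2)), eE 0) := by rw [D'_apply, hξ, h1, map_zero]
    change e1 (D' 1 ξ) = _
    rw [h2]
    change ((eF (hmap cF 1 (c1 (gen 2)))).1, cycE 2 (eF (hmap cF 1 (c1 (gen 2)))).2,
      cycE 3 (eE.symm (eE 0)).1, cycE 2 (eE.symm (eE 0)).2) = _
    rw [heF, AddEquiv.symm_apply_apply, cycE_gen, Prod.fst_zero, Prod.snd_zero, map_zero, map_zero]
  · rw [hξ2]
    change _ = tree.b 2 (hmap aΓ 2 (ey 1), hmap aΓ 2 (ey 1))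
    rw [hey]
    congr 2
    rw [← hey, ← map_neg, ← map_neg]
    rfl
  · have h2 : D' 1 (crossτ 1 (c1 (gen 2))) = (hmap cF 1 0, eE (0, c1 (gen 2))) := by
      rw [D'_apply, D_crossτ, map_zero]
      rfl
    change e1 (D' 1 _) = _
    rw [h2]
    change ((eF (hmap cF 1 0)).1, cycE 2 (eF (hmap cF 1 0)).2,
      cycE 3 (eE.symm (eE (0, c1 (gen 2)))).1, cycE 2 (eE.symm (eE (0, c1 (gen 2)))).2) = _
    rw [heF, AddEquiv.symm_apply_apply, cycE_gen, map_zero, map_zero]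

end Bianchi

/-! ## The ring of integers -/

namespace Bianchi

section RingOfIntegers

variable {K : Type} [Field K] [NumberField K]

lemma exists_rat_coords (hdeg : Module.finrank ℚ K = 2) {α : K} (hα : α ^ 2 = -6) (x : K) :
    ∃ a b : ℚ, x = a + b * α := by
  have hli : LinearIndependent ℚ ![1, α] := by
    rw [LinearIndependent.pair_iff]
    intro s t hst
    have ht : t = 0 := by
      by_contra ht
      have h1 : α = ((-s / t : ℚ) : K) := by
        have : (t : K) ≠ 0 := by exact_mod_cast ht
        push_cast
        rw [eq_div_iff this]
        simp only [Algebra.smul_def, eq_ratCast, mul_one] at hst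
        linear_combination hst
      rw [h1] at hα
      have : (-s / t) ^ 2 = -6 := by exact_mod_cast hα
      nlinarith [sq_nonneg (-s / t)]
    subst ht
    simpa using hst
  have htop := hli.span_eq_top_of_card_eq_finrank' (by simp [hdeg])
  have hx : x ∈ Submodule.span ℚ (Set.range ![1, α]) := htop ▸ Submodule.mem_top
  rw [Matrix.range_cons, Matrix.range_cons, Matrix.range_empty, Set.union_empty,
    Set.singleton_union, Submodule.mem_span_pair] at hx
  obtain ⟨a, b, h⟩ := hx
  exact ⟨a, b, by rw [← h]; simp [Algebra.smul_def]⟩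

lemma exists_int_of_isIntegral_complex {q : ℚ} (h : IsIntegral ℤ (q : ℂ)) : ∃ n : ℤ, (n : ℚ) = q := by
  have : IsIntegral ℤ q :=
    (isIntegral_algebraMap_iff (R := ℤ) (A := ℚ) (B := ℂ) (algebraMap ℚ ℂ).injective).1 (by simpa using h)
  simpa using IsIntegrallyClosed.isIntegral_iff.1 this

lemma exists_int_coords (hdeg : Module.finrank ℚ K = 2) {α : K} (hα : α ^ 2 = -6) {x : K}
    (hx : IsIntegral ℤ x) : ∃ a b : ℤ, x = a + b * α := by
  obtain ⟨a, b, rfl⟩ := exists_rat_coords hdeg hα x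
  let φ : K →+* ℂ := Classical.arbitrary _
  let σ : ℂ →+* ℂ := starRingEnd ℂ
  set β := φ α with hβ
  have hβ2 : β ^ 2 = -6 := by rw [hβ, ← map_pow, hα, map_neg, map_ofNat]
  have hσβ : σ β = -β := by
    have him : β.im ≠ 0 := fun h => by
      have h2 := congrArg Complex.re hβ2
      simp [pow_two, h] at h2
      nlinarith [mul_self_nonneg β.re]
    have hre : β.re = 0 := by
      have h2 := congrArg Complex.im hβ2
      simp [pow_two] at h2
      rcases mul_eq_zero.1 (show β.re * β.im = 0 by linarith) with h | h
      · exact h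
      · exact absurd h him
    apply Complex.ext <;> simp [σ, hre]
  have hφ : IsIntegral ℤ ((a : ℂ) + b * β) := by
    have := hx.map φ.toIntAlgHom
    simpa using this
  have hσ : IsIntegral ℤ ((a : ℂ) - b * β) := by
    have := hφ.map σ.toIntAlgHom
    simpa [hσβ, ← sub_eq_add_neg] using this
  have hβi : IsIntegral ℤ β :=
    IsIntegral.of_pow (n := 2) (by norm_num) (by
      rw [hβ2]; exact_mod_cast isIntegral_algebraMap (R := ℤ) (A := ℂ) (x := -6))
  obtain ⟨m, hm⟩ := exists_int_of_isIntegral_complex (q := 2 * a) (by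
    have := hφ.add hσ
    rwa [show (a + b * β + (a - b * β) : ℂ) = ((2 * a : ℚ) : ℂ) by push_cast; ring] at this)
  obtain ⟨k, hk⟩ := exists_int_of_isIntegral_complex (q := -12 * b) (by
    have := (hφ.sub hσ).mul hβi
    rwa [show ((a + b * β - (a - b * β)) * β : ℂ) = ((-12 * b : ℚ) : ℂ) by
      push_cast; linear_combination (2 * b : ℂ) * hβ2] at this)
  obtain ⟨n, hn⟩ := exists_int_of_isIntegral_complex (q := a ^ 2 + 6 * b ^ 2) (by
    have := hφ.mul hσ
    rwa [show ((a + b * β) * (a - b * β) : ℂ) = ((a ^ 2 + 6 * b ^ 2 : ℚ) : ℂ) by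
      push_cast; linear_combination (-b ^ 2 : ℂ) * hβ2] at this)
  have h24 : 24 * n = 6 * m ^ 2 + k ^ 2 := by
    have : (24 * n : ℚ) = 6 * m ^ 2 + k ^ 2 := by rw [hm, hk, hn]; ring
    exact_mod_cast this
  have hk6 : (6 : ℤ) ∣ k := by
    have h2 : (2 : ℤ) ∣ k := Int.prime_two.dvd_of_dvd_pow (n := 2) ⟨12 * n - 3 * m ^ 2, by linarith⟩
    have h3 : (3 : ℤ) ∣ k := Int.prime_three.dvd_of_dvd_pow (n := 2) ⟨8 * n - 2 * m ^ 2, by linarith⟩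
    omega
  obtain ⟨k', rfl⟩ := hk6
  have h4 : 4 * n = m ^ 2 + 6 * k' ^ 2 := by linarith
  have hm2 : (2 : ℤ) ∣ m := Int.prime_two.dvd_of_dvd_pow (n := 2) ⟨2 * n - 3 * k' ^ 2, by linarith⟩
  obtain ⟨m', rfl⟩ := hm2
  have hk2 : (2 : ℤ) ∣ k' := by
    refine Int.prime_two.dvd_of_dvd_pow (n := 2) ?_
    have : 2 * n = 2 * m' ^ 2 + 3 * k' ^ 2 := by linarith
    omega
  obtain ⟨b', rfl⟩ := hk2
  refine ⟨m', -b', ?_⟩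
  have ha : a = m' := by push_cast at hm; linarith
  have hb : b = -b' := by push_cast at hk; linarith
  rw [ha, hb]; push_cast; rfl

open NumberField in
lemma exists_ringEquiv (hdeg : Module.finrank ℚ K = 2) (hK : ∃ α : K, α ^ 2 = -6) :
    Nonempty (R ≃+* 𝓞 K) := by
  obtain ⟨α, hα⟩ := hK
  have hαi : IsIntegral ℤ α :=
    IsIntegral.of_pow (n := 2) (by norm_num) (by
      rw [hα]; exact_mod_cast isIntegral_algebraMap (R := ℤ) (A := K) (x := -6))
  let α' : 𝓞 K := ⟨α, hαi⟩
  have hα' : α' * α' = ((-6 : ℤ) : 𝓞 K) := by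
    apply RingOfIntegers.ext
    change α * α = algebraMap (𝓞 K) K ((-6 : ℤ) : 𝓞 K)
    rw [← pow_two, hα, map_intCast]; norm_num
  let f : R →+* 𝓞 K := Zsqrtd.lift ⟨α', hα'⟩
  refine ⟨RingEquiv.ofBijective f ⟨?_, fun x => ?_⟩⟩
  · exact Zsqrtd.lift_injective _ fun n => by nlinarith [mul_self_nonneg n]
  · obtain ⟨a, b, h⟩ := exists_int_coords hdeg hα x.isIntegral_coe
    refine ⟨⟨a, b⟩, RingOfIntegers.ext ?_⟩
    refine Eq.trans ?_ h.symm
    change algebraMap (𝓞 K) K ((a : 𝓞 K) + (b : 𝓞 K) * α') = _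
    rw [map_add, map_mul, map_intCast, map_intCast]
    rfl

end RingOfIntegers

lemma map_center_eq {A B : Type} [Group A] [Group B] (e : A ≃* B) :
    (Subgroup.center A).map (e : A →* B) = Subgroup.center B := by
  ext x
  change x ∈ (Subgroup.center A).map e.toMonoidHom ↔ _
  rw [Subgroup.mem_map_equiv, Subgroup.mem_center_iff, Subgroup.mem_center_iff]
  refine ⟨fun h g => ?_, fun h g => ?_⟩
  · apply e.symm.injective; simpa using h (e.symm g)
  · apply e.injective; simpa using h (e g)

/-- The isomorphism of special linear groups induced by an isomorphism of rings. -/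
noncomputable def slCongr {A B : Type} [CommRing A] [CommRing B] (e : A ≃+* B) :
    Matrix.SpecialLinearGroup (Fin 2) A ≃* Matrix.SpecialLinearGroup (Fin 2) B :=
  MulEquiv.ofBijective (Matrix.SpecialLinearGroup.map (e : A →+* B))
    ⟨fun x y h => by
      ext i j
      have := congrArg (fun z : Matrix.SpecialLinearGroup (Fin 2) B => z i j) h
      simpa using this,
    fun y => ⟨Matrix.SpecialLinearGroup.map (e.symm : B →+* A) y, by ext i j; simp⟩⟩

lemma exists_mulEquiv {A : Type} [CommRing A] (e : R ≃+* A) :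
    Nonempty (G ≃* Matrix.ProjectiveSpecialLinearGroup (Fin 2) A) :=
  ⟨QuotientGroup.congr _ _ (slCongr e) (map_center_eq _)⟩

end Bianchi

/-! ## Comparison with the inhomogeneous bar complex -/

namespace GMod

variable {G : Type} [Group G]

/-- The basis element of the bar complex given by a tuple. -/
noncomputable def tuple : ∀ n : ℕ, (Fin n → G) → ((triv G).iter n).V
  | 0, _ => (1 : ℤ)
  | n + 1, g => cons (g 0) (tuple n (Fin.tail g))

lemma tuple_succ (n : ℕ) (g : Fin (n + 1) → G) :
    tuple (n + 1) g = cons (g 0) (tuple n (Fin.tail g)) := rfl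

lemma contractNth_zero (n : ℕ) (g : Fin (n + 2) → G) :
    Fin.contractNth 0 (· * ·) g = Fin.cons (g 0 * g 1) (Fin.tail (Fin.tail g)) := by
  funext i
  refine Fin.cases ?_ (fun i => ?_) i
  · rw [Fin.contractNth_apply_of_eq _ _ _ _ rfl]; rfl
  · rw [Fin.contractNth_apply_of_gt _ _ _ _ (by simp)]; rfl

lemma contractNth_succ (n : ℕ) (j : Fin (n + 1)) (g : Fin (n + 2) → G) :
    Fin.contractNth j.succ (· * ·) g = Fin.cons (g 0) (Fin.contractNth j (· * ·) (Fin.tail g)) := by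
  funext i
  refine Fin.cases ?_ (fun i => ?_) i
  · rw [Fin.contractNth_apply_of_lt _ _ _ _ (by simp)]; rfl
  · rw [Fin.cons_succ]
    rcases lt_trichotomy (i : ℕ) (j : ℕ) with h | h | h
    · rw [Fin.contractNth_apply_of_lt _ _ _ _ h, Fin.contractNth_apply_of_lt _ _ _ _ (by simpa)]
      rfl
    · rw [Fin.contractNth_apply_of_eq _ _ _ _ h, Fin.contractNth_apply_of_eq _ _ _ _ (by simpa)]
      rfl
    · rw [Fin.contractNth_apply_of_gt _ _ _ _ h, Fin.contractNth_apply_of_gt _ _ _ _ (by simpa)]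
      rfl

lemma R_tuple (n : ℕ) (g : Fin (n + 1) → G) :
    ((triv G).iter n).R (g 0) (tuple n (Fin.tail g)) =
      ∑ j : Fin (n + 1), (-1 : ℤ) ^ (j : ℕ) • tuple n (Fin.contractNth j (· * ·) g) := by
  induction n with
  | zero =>
    rw [Fin.sum_univ_one, Fin.val_zero, pow_zero, one_zsmul]
    rfl
  | succ n ih =>
    rw [Fin.sum_univ_succ, contractNth_zero, tuple_succ, R_cons, Fin.val_zero, pow_zero, one_zsmul,
      sub_eq_add_neg]
    have := ih (Fin.tail g)
    congr 1
    change - cons (g 0) (((triv G).iter n).R (Fin.tail g 0) (tuple n (Fin.tail (Fin.tail g)))) = _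
    rw [this, map_sum, ← Finset.sum_neg_distrib]
    refine Finset.sum_congr rfl fun j _ => ?_
    rw [contractNth_succ, tuple_succ, Fin.cons_zero, Fin.tail_cons, Fin.val_succ, map_zsmul,
      pow_succ, mul_neg_one, neg_zsmul]

/-- The map from the inhomogeneous bar complex. -/
noncomputable def ofChains (G : Type) [Group G] (n : ℕ) :
    BarHomology.chains G ℤ n →+ ((triv G).iter n).V :=
  Finsupp.liftAddHom fun g => (zmultiplesHom _ (tuple n g))

@[simp] lemma ofChains_single (n : ℕ) (g : Fin n → G) (z : ℤ) :
    ofChains G n (Finsupp.single g z) = z • tuple n g := by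
  simp [ofChains]

/-- The map to the inhomogeneous bar complex. -/
noncomputable def toChains (G : Type) [Group G] : ∀ n : ℕ,
    ((triv G).iter n).V →+ BarHomology.chains G ℤ n
  | 0 => Finsupp.singleAddHom (M := ℤ) (default : Fin 0 → G)
  | n + 1 => lift fun g =>
      (Finsupp.mapDomain.addMonoidHom (fun f : Fin n → G => (Fin.cons g f : Fin (n + 1) → G))).comp
        (toChains G n)

lemma toChains_cons (n : ℕ) (g : G) (v : ((triv G).iter n).V) :
    toChains G (n + 1) (cons g v) =
      Finsupp.mapDomain (fun f : Fin n → G => (Fin.cons g f : Fin (n + 1) → G)) (toChains G n v) :=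
  lift_cons _ _ _

lemma toChains_tuple (n : ℕ) (g : Fin n → G) : toChains G n (tuple n g) = Finsupp.single g 1 := by
  induction n with
  | zero => rw [Subsingleton.elim g default]; rfl
  | succ n ih =>
    rw [tuple_succ, toChains_cons, ih, Finsupp.mapDomain_single, Fin.cons_self_tail]

lemma toChains_ofChains (n : ℕ) (x : BarHomology.chains G ℤ n) :
    toChains G n (ofChains G n x) = x := by
  refine DFunLike.congr_fun (f := (toChains G n).comp (ofChains G n)) (g := AddMonoidHom.id _) ?_ x
  refine Finsupp.addHom_ext fun g z => ?_
  simp [toChains_tuple]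

lemma ofChains_mapDomain_cons (n : ℕ) (g : G) (x : BarHomology.chains G ℤ n) :
    ofChains G (n + 1) (Finsupp.mapDomain (fun f : Fin n → G => (Fin.cons g f : Fin (n + 1) → G)) x) =
      cons g (ofChains G n x) := by
  refine DFunLike.congr_fun (f := (ofChains G (n + 1)).comp (Finsupp.mapDomain.addMonoidHom
    (fun f : Fin n → G => (Fin.cons g f : Fin (n + 1) → G))))
    (g := (cons g).comp (ofChains G n)) ?_ x
  refine Finsupp.addHom_ext fun f z => ?_
  simp [tuple_succ]

lemma ofChains_toChains (n : ℕ) (v : ((triv G).iter n).V) :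
    ofChains G n (toChains G n v) = v := by
  induction n with
  | zero =>
    change ofChains G 0 (Finsupp.single default (show ℤ from v)) = v
    rw [ofChains_single]
    exact mul_one (show ℤ from v)
  | succ n ih =>
    refine iter_hom_ext (f := (ofChains G (n + 1)).comp (toChains G (n + 1)))
      (f' := AddMonoidHom.id _) (fun g v => ?_) v
    rw [AddMonoidHom.comp_apply, toChains_cons, ofChains_mapDomain_cons, ih]
    rfl

lemma ofChains_d (n : ℕ) (x : BarHomology.chains G ℤ (n + 1)) :
    ofChains G n (BarHomology.d ℤ G ℤ n x) = (triv G).bar.d n (ofChains G (n + 1) x) := by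
  refine DFunLike.congr_fun (f := (ofChains G n).comp (BarHomology.d ℤ G ℤ n).toAddMonoidHom)
    (g := ((triv G).bar.d n).comp (ofChains G (n + 1))) ?_ x
  refine Finsupp.addHom_ext fun g z => ?_
  have hd : (triv G).bar.d n (z • tuple (n + 1) g) = z • (triv G).bar.d n (tuple (n + 1) g) :=
    map_zsmul _ _ _
  rw [AddMonoidHom.comp_apply, AddMonoidHom.comp_apply, ofChains_single]
  refine Eq.trans ?_ hd.symm
  simp only [LinearMap.toAddMonoidHom_coe, BarHomology.d,
    Finsupp.lsum_single, LinearMap.add_apply, LinearMap.sum_apply, LinearMap.smul_apply,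
    Finsupp.lsingle_apply, map_add, map_sum, map_zsmul, ofChains_single]
  rw [tuple_succ, d_cons, R_tuple, sub_eq_add_neg, smul_add, ← Finset.sum_neg_distrib,
    Finset.smul_sum]
  congr 1
  refine Finset.sum_congr rfl fun j _ => ?_
  rw [pow_succ, mul_neg_one, neg_zsmul, smul_comm, smul_neg]

lemma ofChains_mem_Z {n : ℕ} (x : BarHomology.chains G ℤ n) :
    ofChains G n x ∈ (triv G).bar.Z n ↔ x ∈ BarHomology.cycles ℤ G ℤ n := by
  cases n with
  | zero => exact iff_of_true trivial trivial
  | succ n =>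
    rw [Cx.mem_Z_succ, ← ofChains_d]
    change _ ↔ BarHomology.d ℤ G ℤ n x = 0
    rw [map_eq_zero_iff _ (Function.LeftInverse.injective (toChains_ofChains n))]

/-- The map from cycles of the inhomogeneous bar complex to homology. -/
noncomputable def clsOfChains (G : Type) [Group G] (n : ℕ) :
    BarHomology.cycles ℤ G ℤ n →+ h G n :=
  ((triv G).bar.cls n).comp (((ofChains G n).comp
    (BarHomology.cycles ℤ G ℤ n).subtype.toAddMonoidHom).codRestrict _
      fun x => (ofChains_mem_Z _).2 x.2)

lemma exists_equiv_groupHomology (G : Type) [Group G] (n : ℕ) :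
    Nonempty (BarHomology.GroupHomology ℤ G ℤ n ≃+ h G n) := by
  have hsurj : Function.Surjective (clsOfChains G n).toIntLinearMap := fun y => by
    obtain ⟨z, rfl⟩ := (triv G).bar.cls_surj y
    refine ⟨⟨toChains G n z, (ofChains_mem_Z _).1 ?_⟩, ?_⟩
    · rw [ofChains_toChains]; exact z.2
    · exact congrArg ((triv G).bar.cls n) (Subtype.ext (ofChains_toChains n z.1))
  have hker : BarHomology.boundariesIn ℤ G ℤ n = LinearMap.ker (clsOfChains G n).toIntLinearMap := by
    ext x
    refine Iff.trans ?_ Cx.cls_eq_zero.symm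
    change (∃ y, BarHomology.d ℤ G ℤ n y = x) ↔ ∃ y, (triv G).bar.d n y = ofChains G n x
    constructor
    · rintro ⟨y, hy⟩
      exact ⟨ofChains G (n + 1) y, by rw [← ofChains_d, hy]⟩
    · rintro ⟨y, hy⟩
      refine ⟨toChains G (n + 1) y, (Function.LeftInverse.injective (toChains_ofChains n)) ?_⟩
      rw [ofChains_d, ofChains_toChains]
      exact hy
  exact ⟨((Submodule.quotEquivOfEq _ _ hker).trans
    (LinearMap.quotKerEquivOfSurjective _ hsurj)).toAddEquiv⟩

end GMod

/-- The integral homology of `PSL₂(𝒪₋₆)`, where `𝒪₋₆` is the ring of integers of `ℚ(√-6)`. -/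
theorem homology_PSL2_O6 (K : Type) [Field K] [NumberField K]
    (hdeg : Module.finrank ℚ K = 2) (hK : ∃ α : K, α ^ 2 = -6)
    (q : ℕ) (hq : 1 ≤ q) :
    (q = 1 → Nonempty (GroupHomology ℤ (PSL2 (NumberField.RingOfIntegers K)) ℤ q ≃+
      ((Fin 2 → ℤ) × ZMod 3 × ZMod 2))) ∧
    (q = 2 → Nonempty (GroupHomology ℤ (PSL2 (NumberField.RingOfIntegers K)) ℤ q ≃+
      (ℤ × ZMod 4 × ZMod 3 × (Fin 2 → ZMod 2)))) ∧
    (∀ k : ℕ,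
      (q = 6 * k + 3 → Nonempty (GroupHomology ℤ (PSL2 (NumberField.RingOfIntegers K)) ℤ q ≃+
        (ZMod 3 × (Fin (2 * k + 2) → ZMod 2)))) ∧
      (q = 6 * k + 4 → Nonempty (GroupHomology ℤ (PSL2 (NumberField.RingOfIntegers K)) ℤ q ≃+
        (ZMod 3 × (Fin (2 * k + 1) → ZMod 2)))) ∧
      (q = 6 * k + 5 → Nonempty (GroupHomology ℤ (PSL2 (NumberField.RingOfIntegers K)) ℤ q ≃+
        (ZMod 3 × (Fin (2 * k + 4) → ZMod 2)))) ∧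
      (q = 6 * k + 6 → Nonempty (GroupHomology ℤ (PSL2 (NumberField.RingOfIntegers K)) ℤ q ≃+
        (ZMod 3 × (Fin (2 * k + 3) → ZMod 2)))) ∧
      (q = 6 * k + 7 → Nonempty (GroupHomology ℤ (PSL2 (NumberField.RingOfIntegers K)) ℤ q ≃+
        (ZMod 3 × (Fin (2 * k + 2) → ZMod 2)))) ∧
      (q = 6 * k + 8 → Nonempty (GroupHomology ℤ (PSL2 (NumberField.RingOfIntegers K)) ℤ q ≃+
        (ZMod 3 × (Fin (2 * k + 5) → ZMod 2))))) := by
  obtain ⟨e⟩ := Bianchi.exists_ringEquiv hdeg hK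
  obtain ⟨f⟩ := Bianchi.exists_mulEquiv e
  have key : ∀ {n : ℕ} {A : Type} [AddCommGroup A], Nonempty (GMod.h Bianchi.G n ≃+ A) →
      Nonempty (GroupHomology ℤ (PSL2 (NumberField.RingOfIntegers K)) ℤ n ≃+ A) := by
    rintro n A _ ⟨u⟩
    obtain ⟨v⟩ := GMod.exists_equiv_groupHomology (PSL2 (NumberField.RingOfIntegers K)) n
    exact ⟨v.trans ((AddEquiv.ofBijective _ (GMod.hmap_bijective f n)).symm.trans u)⟩
  refine ⟨?_, ?_, fun k => ?_⟩
  · rintro rfl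
    exact key Bianchi.exists_equiv_one
  · rintro rfl
    exact key Bianchi.exists_equiv_two
  obtain ⟨-, -, h3, h4, h5, h6⟩ := GMod.card_h_all k
  obtain ⟨h7, h8, -⟩ := GMod.card_h_all (k + 1)
  have odd : ∀ m n a b : ℕ, a = 2 * m + 3 → b = 2 * n → Nat.card (GMod.h A4 a) = 3 * 2 ^ n →
      Nonempty (GroupHomology ℤ (PSL2 (NumberField.RingOfIntegers K)) ℤ a ≃+
        (ZMod 3 × (Fin b → ZMod 2))) := by
    rintro m n _ _ rfl rfl hn
    exact key (Bianchi.exists_equiv_odd m n hn)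
  have even : ∀ m n a b : ℕ, a = 2 * m + 4 → b = 2 * n + 1 → Nat.card (GMod.h A4 a) = 2 ^ n →
      Nonempty (GroupHomology ℤ (PSL2 (NumberField.RingOfIntegers K)) ℤ a ≃+
        (ZMod 3 × (Fin b → ZMod 2))) := by
    rintro m n _ _ rfl rfl hn
    exact key (Bianchi.exists_equiv_even m n hn)
  refine ⟨?_, ?_, ?_, ?_, ?_, ?_⟩ <;> rintro rfl
  · exact odd (3 * k) (k + 1) _ _ (by ring) (by ring) h3
  · exact even (3 * k) k _ _ (by ring) (by ring) h4
  · exact odd (3 * k + 1) (k + 2) _ _ (by ring) (by ring) h5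
  · exact even (3 * k + 1) (k + 1) _ _ (by ring) (by ring) h6
  · exact odd (3 * k + 2) (k + 1) _ _ (by ring) (by ring) h7
  · exact even (3 * k + 2) (k + 2) _ _ (by ring) (by ring) h8
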